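/- Let $d \ge 1$, $0 < s < 1$, $s_1, s_2 \in [0,s]$ with $s = s_1 + s_2$, and $p, p_1, p_2 \in (1,\infty)$ with $\frac{1}{p} = \frac{1}{p_1} + \frac{1}{p_2}$. There is a constant $C$ (depending on $d, s, s_1, s_2, p, p_1, p_2$) such that for all Schwartz functions $f, g$ on $\mathbb{R}^d$: $\|D^s(fg) - f\,D^s g - g\,D^s f\|_{L^p(\mathbb{R}^d)} \le C\, \|D^{s_1} f\|_{L^{p_1}(\mathbb{R}^d)}\, \|D^{s_2} g\|_{L^{p_2}(\mathbb{R}^d)}$. -/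

import Mathlib

open MeasureTheory Complex
open scoped ENNReal BigOperators RealInnerProductSpace

noncomputable section

abbrev Ed (d : ℕ) := EuclideanSpace ℝ (Fin d)

/-- Fourier transform with convention `(𝓕 f) ξ = ∫ e^{-i x·ξ} f x dx`. -/
def FT {d : ℕ} (f : Ed d → ℂ) (ξ : Ed d) : ℂ :=
  ∫ x : Ed d, Complex.exp (-Complex.I * ((⟪x, ξ⟫ : ℝ) : ℂ)) * f x

/-- Inverse Fourier transform `(2π)^{-d} ∫ e^{i x·ξ} g ξ dξ`. -/
def FTinv {d : ℕ} (g : Ed d → ℂ) (x : Ed d) : ℂ :=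
  (((2 * Real.pi) ^ (-(d : ℝ)) : ℝ) : ℂ) *
    ∫ ξ : Ed d, Complex.exp (Complex.I * ((⟪x, ξ⟫ : ℝ) : ℂ)) * g ξ

/-- Fractional Schrödinger propagator `e^{-it(-Δ)^s}`. -/
def fprop {d : ℕ} (s t : ℝ) (f : Ed d → ℂ) : Ed d → ℂ :=
  FTinv (fun ξ => Complex.exp (-Complex.I * (t : ℂ) * ((‖ξ‖ ^ (2 * s) : ℝ) : ℂ)) * FT f ξ)

/-- Fractional derivative `D^σ = (-Δ)^{σ/2}`, the Fourier multiplier `|ξ|^σ`. -/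
def fracD {d : ℕ} (σ : ℝ) (f : Ed d → ℂ) : Ed d → ℂ :=
  FTinv (fun ξ => ((‖ξ‖ ^ σ : ℝ) : ℂ) * FT f ξ)

/-- `(-Δ)^{β/2} e^{-it(-Δ)^s}`. -/
def fracDProp {d : ℕ} (β s t : ℝ) (f : Ed d → ℂ) : Ed d → ℂ :=
  FTinv (fun ξ => ((‖ξ‖ ^ β : ℝ) : ℂ) *
    Complex.exp (-Complex.I * (t : ℂ) * ((‖ξ‖ ^ (2 * s) : ℝ) : ℂ)) * FT f ξ)

/-- Resolvent `(-Δ + λ)⁻¹`. -/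
def resolv {d : ℕ} (lam : ℝ) (f : Ed d → ℂ) : Ed d → ℂ :=
  FTinv (fun ξ => FT f ξ / ((‖ξ‖ ^ 2 + lam : ℝ) : ℂ))

/-- Resolvent-regularization `u_λ = √(sin(πs)/π) (-Δ+λ)⁻¹ u`. -/
def reg {d : ℕ} (s lam : ℝ) (f : Ed d → ℂ) : Ed d → ℂ :=
  fun x => ((Real.sqrt (Real.sin (Real.pi * s) / Real.pi) : ℝ) : ℂ) * resolv lam f x

/-- A function is radial if its value depends only on `|x|`. -/
def IsRadial {d : ℕ} (f : Ed d → ℂ) : Prop :=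
  ∀ x y : Ed d, ‖x‖ = ‖y‖ → f x = f y

/-- Homogeneous Sobolev norm `‖f‖_{Ḣ^s} = (2π)^{-d/2} ‖ |ξ|^s 𝓕f ‖_{L²}`. -/
def HdotNorm {d : ℕ} (s : ℝ) (f : Ed d → ℂ) : ℝ :=
  (2 * Real.pi) ^ (-(d : ℝ) / 2) *
    (eLpNorm (fun ξ : Ed d => ((‖ξ‖ ^ s : ℝ) : ℂ) * FT f ξ) 2 volume).toReal

/-- Inhomogeneous Sobolev norm `‖f‖_{H^s}² = ‖f‖_{L²}² + ‖f‖_{Ḣ^s}²`. -/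
def HNorm {d : ℕ} (s : ℝ) (f : Ed d → ℂ) : ℝ :=
  Real.sqrt ((eLpNorm f 2 volume).toReal ^ 2 + HdotNorm s f ^ 2)

/-- Mixed space-time norm `L^q_t L^r_x (ℝ × ℝ^d)`. -/
def mixedNorm {d : ℕ} (q r : ℝ≥0∞) (F : ℝ → Ed d → ℂ) : ℝ≥0∞ :=
  eLpNorm (fun t => (eLpNorm (F t) r volume).toReal) q volume

/-- Partial derivative `∂_j` of a complex-valued function. -/
def pd {d : ℕ} (j : Fin d) (f : Ed d → ℂ) (x : Ed d) : ℂ :=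
  fderiv ℝ f x (EuclideanSpace.single j 1)

/-- Partial derivative `∂_j` of a real-valued function. -/
def pdR {d : ℕ} (j : Fin d) (f : Ed d → ℝ) (x : Ed d) : ℝ :=
  fderiv ℝ f x (EuclideanSpace.single j 1)

/-- Laplacian of a real-valued function. -/
def lapR {d : ℕ} (f : Ed d → ℝ) : Ed d → ℝ :=
  fun x => ∑ j : Fin d, pdR j (pdR j f) x

/-- Rescaling `χ_R(x) = χ(x/R)`. -/
def chiR {d : ℕ} (χ : Ed d → ℝ) (R : ℝ) : Ed d → ℝ :=
  fun x => χ (R⁻¹ • x)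


/-- Squared `H^{1/2}` norm `(2π)^{-d} ∫ (1+|ξ|²)^{1/2} |𝓕u(ξ)|² dξ`. -/
def H12sq {d : ℕ} (f : Ed d → ℂ) : ℝ :=
  (2 * Real.pi) ^ (-(d : ℝ)) * ∫ ξ : Ed d, (1 + ‖ξ‖ ^ 2) ^ ((1 : ℝ)/2) * ‖FT f ξ‖ ^ 2

namespace KatoPonce
open Set Filter Topology
variable {d : ℕ}

/-- The scale-invariant measure `dt / t` on `(0, ∞)`. -/
def mu0 : Measure ℝ := (volume.restrict (Ioi 0)).withDensity fun t => ENNReal.ofReal t⁻¹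

instance : SFinite mu0 := by unfold mu0; infer_instance

lemma lintegral_mu0 {f : ℝ → ℝ≥0∞} (hf : Measurable f) :
    ∫⁻ t, f t ∂mu0 = ∫⁻ t in Ioi 0, ENNReal.ofReal t⁻¹ * f t := by
  unfold mu0
  rw [lintegral_withDensity_eq_lintegral_mul _ (by fun_prop) hf]
  rfl

lemma ae_mu0_pos : ∀ᵐ t ∂mu0, 0 < t := by
  have h : ∀ᵐ t ∂(volume.restrict (Ioi (0 : ℝ))), 0 < t := ae_restrict_mem measurableSet_Ioi
  exact (withDensity_absolutelyContinuous _ _) h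

lemma lintegral_mu0_mono {f g : ℝ → ℝ≥0∞} (h : ∀ t, 0 < t → f t ≤ g t) :
    ∫⁻ t, f t ∂mu0 ≤ ∫⁻ t, g t ∂mu0 :=
  lintegral_mono_ae (ae_mu0_pos.mono h)

lemma lintegral_mu0_comp_mul {a : ℝ} (ha : 0 < a) {f : ℝ → ℝ≥0∞} (hf : Measurable f) :
    ∫⁻ t, f (a * t) ∂mu0 = ∫⁻ t, f t ∂mu0 := by
  rw [lintegral_mu0 hf, lintegral_mu0 (f := fun t => f (a * t)) (hf.comp (measurable_const_mul a)),
    ← lintegral_indicator measurableSet_Ioi, ← lintegral_indicator measurableSet_Ioi]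
  set g : ℝ → ℝ≥0∞ := (Ioi (0 : ℝ)).indicator fun t => ENNReal.ofReal t⁻¹ * f t with hg
  have hgm : Measurable g := by
    apply Measurable.indicator _ measurableSet_Ioi
    fun_prop
  have key := Real.map_volume_mul_left ha.ne'
  have h1 : ∫⁻ t, g (a * t) = ENNReal.ofReal |a⁻¹| * ∫⁻ t, g t := by
    rw [← lintegral_map hgm (measurable_const_mul a), key, lintegral_smul_measure]; rfl
  have h2 : ∀ t, (Ioi (0 : ℝ)).indicator (fun t => ENNReal.ofReal t⁻¹ * f (a * t)) t
      = ENNReal.ofReal a * g (a * t) := by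
    intro t
    by_cases ht : 0 < t
    · rw [indicator_of_mem (by exact ht), hg, indicator_of_mem (by simpa using mul_pos ha ht),
        ← mul_assoc, ← ENNReal.ofReal_mul ha.le]
      congr 2
      field_simp
    · rw [indicator_of_notMem (by exact ht), hg, indicator_of_notMem, mul_zero]
      simp only [mem_Ioi, not_lt] at ht ⊢
      exact mul_nonpos_of_nonneg_of_nonpos ha.le ht
  simp_rw [h2]
  rw [lintegral_const_mul (f := fun t => g (a * t)) _ (hgm.comp (measurable_const_mul a)), h1, ← mul_assoc,
    ← ENNReal.ofReal_mul ha.le, abs_of_pos (inv_pos.2 ha), mul_inv_cancel₀ ha.ne']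
  simp

lemma lintegral_Ioc_inv {a b : ℝ} (ha : 0 < a) (hab : a ≤ b) :
    ∫⁻ t in Ioc a b, ENNReal.ofReal t⁻¹ = ENNReal.ofReal (Real.log (b / a)) := by
  rw [← ofReal_integral_eq_lintegral_ofReal]
  · rw [← intervalIntegral.integral_of_le hab, integral_inv_of_pos ha (ha.trans_le hab)]
  · have : IntervalIntegrable (fun t : ℝ => t⁻¹) volume a b := by
      apply intervalIntegral.intervalIntegrable_inv
      · intro x hx
        rw [uIcc_of_le hab] at hx
        exact (ha.trans_le hx.1).ne'
      · fun_prop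
    exact (intervalIntegrable_iff_integrableOn_Ioc_of_le hab).1 this
  · filter_upwards [ae_restrict_mem measurableSet_Ioc] with t ht
    exact inv_nonneg.2 (ha.trans ht.1).le

lemma mu0_Ioc {a b : ℝ} (ha : 0 < a) (hab : a ≤ b) :
    mu0 (Ioc a b) = ENNReal.ofReal (Real.log (b / a)) := by
  unfold mu0
  rw [withDensity_apply _ measurableSet_Ioc, Measure.restrict_restrict measurableSet_Ioc,
    inter_eq_left.2 (fun x hx => mem_Ioi.2 (ha.trans hx.1)), lintegral_Ioc_inv ha hab]

lemma lintegral_mu0_telescope {E G : ℝ → ℝ≥0∞} (hE : Measurable E)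
    {K : ℝ≥0∞} (hK : ∀ t, 0 < t → E t ≤ K) (hGE : ∀ t, 0 < t → G t + E (2 * t) ≤ E t) :
    ∫⁻ t, G t ∂mu0 ≤ K * ENNReal.ofReal (Real.log 2) := by
  have hlog : 0 < Real.log 2 := Real.log_pos one_lt_two
  rcases eq_or_ne K ⊤ with rfl | hKt
  · rw [ENNReal.top_mul (by simpa using hlog)]; exact le_top
  have hcomp : Measurable fun t => E (2 * t) := hE.comp (measurable_const_mul 2)
  have bound : ∀ ε R : ℝ, 0 < ε → 2 * ε ≤ R →
      ∫⁻ t in Ioc ε R, G t ∂mu0 ≤ K * ENNReal.ofReal (Real.log 2) := by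
    intro ε R hε hR
    have hm : MeasurableSet (Ioc ε R) := measurableSet_Ioc
    have h1 : ∫⁻ t in Ioc ε R, G t ∂mu0 + ∫⁻ t in Ioc ε R, E (2 * t) ∂mu0
        ≤ ∫⁻ t in Ioc ε R, E t ∂mu0 := by
      rw [← lintegral_add_right _ hcomp]
      exact setLIntegral_mono hE fun t ht => hGE t (hε.trans ht.1)
    have h2 : ∫⁻ t in Ioc ε R, E (2 * t) ∂mu0 = ∫⁻ t in Ioc (2 * ε) (2 * R), E t ∂mu0 := by
      rw [← lintegral_indicator hm, ← lintegral_indicator measurableSet_Ioc,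
        ← lintegral_mu0_comp_mul two_pos (hE.indicator measurableSet_Ioc)]
      congr 1
      ext t
      simp [indicator, mem_Ioc]
    have h3 : ∫⁻ t in Ioc ε R, E t ∂mu0
        ≤ K * ENNReal.ofReal (Real.log 2) + ∫⁻ t in Ioc (2 * ε) (2 * R), E t ∂mu0 := by
      rw [← Ioc_union_Ioc_eq_Ioc (by linarith : ε ≤ 2 * ε) hR]
      refine (lintegral_union_le _ _ _).trans ?_
      refine add_le_add ?_ ?_
      · calc ∫⁻ t in Ioc ε (2 * ε), E t ∂mu0 ≤ ∫⁻ _ in Ioc ε (2 * ε), K ∂mu0 :=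
              setLIntegral_mono measurable_const fun t ht => hK t (hε.trans ht.1)
          _ = K * ENNReal.ofReal (Real.log 2) := by
              rw [setLIntegral_const, mu0_Ioc hε (by linarith)]
              congr 3
              field_simp
      · exact lintegral_mono_set (Ioc_subset_Ioc_right (by linarith))
    have hfin : ∫⁻ t in Ioc (2 * ε) (2 * R), E t ∂mu0 ≠ ⊤ := by
      refine ne_top_of_le_ne_top (b := K * mu0 (Ioc (2 * ε) (2 * R))) ?_ ?_
      · rw [mu0_Ioc (by linarith) (by linarith)]
        exact ENNReal.mul_ne_top hKt ENNReal.ofReal_ne_top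
      · rw [← setLIntegral_const]
        exact setLIntegral_mono measurable_const fun t ht => hK t (by linarith [ht.1])
    rw [h2] at h1
    exact (ENNReal.add_le_add_iff_right hfin).1 (h1.trans h3)
  have hmono : Monotone fun n : ℕ => Ioc ((2 : ℝ) ^ n)⁻¹ (2 * 2 ^ n) := by
    intro m n hmn
    have : (2 : ℝ) ^ m ≤ 2 ^ n := pow_le_pow_right₀ one_le_two hmn
    apply Ioc_subset_Ioc
    · gcongr
    · gcongr
  have hU : (⋃ n : ℕ, Ioc ((2 : ℝ) ^ n)⁻¹ (2 * 2 ^ n)) = Ioi 0 := by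
    ext t
    simp only [mem_iUnion, mem_Ioc, mem_Ioi]
    constructor
    · rintro ⟨n, h, -⟩
      exact lt_trans (by positivity) h
    · intro ht
      obtain ⟨n, hn⟩ := pow_unbounded_of_one_lt (max t⁻¹ t) one_lt_two
      refine ⟨n, inv_lt_of_inv_lt₀ ht ((le_max_left _ _).trans_lt hn), ?_⟩
      have := (le_max_right t⁻¹ t).trans hn.le
      have h2 : (0 : ℝ) < 2 ^ n := by positivity
      linarith
  have hrestr : mu0.restrict (Ioi 0) = mu0 :=
    Measure.restrict_eq_self_of_ae_mem ae_mu0_pos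
  rw [← hrestr, ← hU, setLIntegral_iUnion_of_directed _ hmono.directed_le]
  refine iSup_le fun n => bound _ _ (by positivity) ?_
  have h1 : (1 : ℝ) ≤ 2 ^ n := one_le_pow₀ one_le_two
  have : ((2 : ℝ) ^ n)⁻¹ ≤ 1 := inv_le_one_of_one_le₀ h1
  linarith

/-- Cauchy–Schwarz for `lintegral`. -/
lemma lintegral_mul_sq_le {α : Type*} [MeasurableSpace α] (μ : Measure α) {f g : α → ℝ≥0∞}
    (hf : AEMeasurable f μ) (hg : AEMeasurable g μ) :
    (∫⁻ a, f a * g a ∂μ) ^ 2 ≤ (∫⁻ a, f a ^ 2 ∂μ) * ∫⁻ a, g a ^ 2 ∂μ := by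
  have h := ENNReal.lintegral_mul_le_Lp_mul_Lq μ Real.HolderConjugate.two_two hf hg
  simp only [Pi.mul_apply, ENNReal.rpow_ofNat] at h
  calc (∫⁻ a, f a * g a ∂μ) ^ 2
      ≤ ((∫⁻ a, f a ^ 2 ∂μ) ^ (1 / 2 : ℝ) * (∫⁻ a, g a ^ 2 ∂μ) ^ (1 / 2 : ℝ)) ^ 2 := by gcongr
    _ = _ := by
      rw [mul_pow, ← ENNReal.rpow_natCast, ← ENNReal.rpow_natCast (_ ^ (1 / 2 : ℝ)),
        ← ENNReal.rpow_mul, ← ENNReal.rpow_mul]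
      norm_num

lemma lintegral_mul_le_sqrt {α : Type*} [MeasurableSpace α] (μ : Measure α) {f g : α → ℝ≥0∞}
    (hf : AEMeasurable f μ) (hg : AEMeasurable g μ) :
    ∫⁻ a, f a * g a ∂μ
      ≤ (∫⁻ a, f a ^ 2 ∂μ) ^ (1 / 2 : ℝ) * (∫⁻ a, g a ^ 2 ∂μ) ^ (1 / 2 : ℝ) := by
  have h := ENNReal.lintegral_mul_le_Lp_mul_Lq μ Real.HolderConjugate.two_two hf hg
  simpa only [Pi.mul_apply, ENNReal.rpow_ofNat] using h

lemma lintegral_schur {α β : Type*} [MeasurableSpace α] [MeasurableSpace β]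
    (μ : Measure α) (ν : Measure β) [SFinite μ] [SFinite ν] {K : α → β → ℝ≥0∞}
    (hK : Measurable (Function.uncurry K)) {A B : ℝ≥0∞}
    (hA : ∀ᵐ x ∂μ, ∫⁻ y, K x y ∂ν ≤ A) (hB : ∀ᵐ y ∂ν, ∫⁻ x, K x y ∂μ ≤ B)
    {a : β → ℝ≥0∞} (ha : Measurable a) :
    ∫⁻ x, (∫⁻ y, K x y * a y ∂ν) ^ 2 ∂μ ≤ A * B * ∫⁻ y, a y ^ 2 ∂ν := by
  have h1 : ∀ x, (∫⁻ y, K x y * a y ∂ν) ^ 2 ≤ (∫⁻ y, K x y ∂ν) * ∫⁻ y, K x y * a y ^ 2 ∂ν := by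
    intro x
    have hKx : Measurable (K x) := hK.of_uncurry_left
    have := lintegral_mul_sq_le ν (f := fun y => K x y ^ (1 / 2 : ℝ))
      (g := fun y => K x y ^ (1 / 2 : ℝ) * a y) (by fun_prop) (by fun_prop)
    have e : ∀ z : ℝ≥0∞, z ^ (1 / 2 : ℝ) * z ^ (1 / 2 : ℝ) = z := by
      intro z
      rw [← ENNReal.rpow_add_of_nonneg _ _ (by norm_num) (by norm_num)]
      norm_num
    simpa only [mul_pow, ← mul_assoc, sq (_ ^ (1 / 2 : ℝ)), e] using this
  have hKa : Measurable (Function.uncurry fun x y => K x y * a y ^ 2) :=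
    hK.mul ((ha.comp measurable_snd).pow_const 2)
  calc ∫⁻ x, (∫⁻ y, K x y * a y ∂ν) ^ 2 ∂μ
      ≤ ∫⁻ x, A * ∫⁻ y, K x y * a y ^ 2 ∂ν ∂μ := by
        refine lintegral_mono_ae ?_
        filter_upwards [hA] with x hx
        exact (h1 x).trans (by gcongr)
    _ = A * ∫⁻ y, ∫⁻ x, K x y * a y ^ 2 ∂μ ∂ν := by
        rw [lintegral_const_mul _ hKa.lintegral_prod_right, lintegral_lintegral_swap]
        exact hKa.aemeasurable
    _ ≤ A * ∫⁻ y, B * a y ^ 2 ∂ν := by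
        gcongr A * ?_
        refine lintegral_mono_ae ?_
        filter_upwards [hB] with y hy
        rw [lintegral_mul_const _ hK.of_uncurry_right]
        gcongr
    _ = A * B * ∫⁻ y, a y ^ 2 ∂ν := by
        rw [lintegral_const_mul _ (by fun_prop), mul_assoc]

/-- The power kernel `(r / w) ^ α` on `r < w`. -/
def pk (α r w : ℝ) : ℝ≥0∞ := if r < w then ENNReal.ofReal ((r / w) ^ α) else 0

lemma measurable_pk (α : ℝ) : Measurable (Function.uncurry (pk α)) := by
  unfold pk Function.uncurry
  refine Measurable.ite (measurableSet_lt measurable_fst measurable_snd) ?_ measurable_const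
  fun_prop

lemma lintegral_Ioi_rpow {α r : ℝ} (hα : 0 < α) (hr : 0 < r) :
    ∫⁻ w in Ioi r, ENNReal.ofReal (w ^ (-α - 1)) = ENNReal.ofReal (r ^ (-α) / α) := by
  rw [← ofReal_integral_eq_lintegral_ofReal]
  · rw [integral_Ioi_rpow_of_lt (by linarith) hr]
    congr 1
    have : -α - 1 + 1 = -α := by ring
    rw [this]; field_simp
  · exact integrableOn_Ioi_rpow_of_lt (by linarith) hr
  · filter_upwards [ae_restrict_mem measurableSet_Ioi] with t ht
    exact Real.rpow_nonneg (hr.trans ht).le _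

lemma lintegral_Ioo_rpow {α r : ℝ} (hα : 0 < α) (hr : 0 < r) :
    ∫⁻ w in Ioo 0 r, ENNReal.ofReal (w ^ (α - 1)) = ENNReal.ofReal (r ^ α / α) := by
  rw [← ofReal_integral_eq_lintegral_ofReal]
  · rw [← integral_Ioc_eq_integral_Ioo, ← intervalIntegral.integral_of_le hr.le,
      integral_rpow (Or.inl (by linarith))]
    congr 1
    have : α - 1 + 1 = α := by ring
    rw [this, Real.zero_rpow hα.ne', sub_zero]
  · have : IntervalIntegrable (fun w : ℝ => w ^ (α - 1)) volume 0 r :=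
      intervalIntegral.intervalIntegrable_rpow' (by linarith)
    exact ((intervalIntegrable_iff_integrableOn_Ioo_of_le hr.le).1 this)
  · filter_upwards [ae_restrict_mem measurableSet_Ioo] with t ht
    exact Real.rpow_nonneg ht.1.le _

lemma lintegral_pk_right {α r : ℝ} (hα : 0 < α) (hr : 0 < r) :
    ∫⁻ w, pk α r w ∂mu0 = ENNReal.ofReal (1 / α) := by
  rw [lintegral_mu0 (measurable_pk α).of_uncurry_left]
  have h1 : ∀ w ∈ Ioi (0 : ℝ), ENNReal.ofReal w⁻¹ * pk α r w
      = (Ioi r).indicator (fun w => ENNReal.ofReal (r ^ α) * ENNReal.ofReal (w ^ (-α - 1))) w := by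
    intro w hw
    have hw : 0 < w := hw
    unfold pk indicator
    simp only [mem_Ioi]
    split_ifs with h
    · rw [← ENNReal.ofReal_mul (by positivity), ← ENNReal.ofReal_mul (by positivity),
        Real.div_rpow hr.le hw.le, Real.rpow_sub hw, Real.rpow_neg hw.le, Real.rpow_one]
      congr 1
      field_simp
    · simp
  rw [setLIntegral_congr_fun measurableSet_Ioi h1, lintegral_indicator measurableSet_Ioi,
    Measure.restrict_restrict measurableSet_Ioi, inter_eq_left.2 (Ioi_subset_Ioi hr.le),
    lintegral_const_mul _ (by fun_prop), lintegral_Ioi_rpow hα hr,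
    ← ENNReal.ofReal_mul (by positivity), Real.rpow_neg hr.le]
  congr 1
  have : r ^ α ≠ 0 := (Real.rpow_pos_of_pos hr α).ne'
  field_simp

/-- Layer cake formula in extended nonnegative reals. -/
lemma lintegral_layer {α : ℝ} (hα : 0 < α) (y : ℝ≥0∞) :
    ∫⁻ t, (if ENNReal.ofReal t < y then ENNReal.ofReal (t ^ α) else 0) ∂mu0
      = ENNReal.ofReal (1 / α) * y ^ α := by
  have hm : Measurable fun t : ℝ => (if ENNReal.ofReal t < y then ENNReal.ofReal (t ^ α) else 0) :=
    Measurable.ite (measurableSet_lt ENNReal.measurable_ofReal measurable_const)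
      (by fun_prop) measurable_const
  have key : ∀ r : ℝ, 0 < r →
      ∫⁻ t, (if t < r then ENNReal.ofReal (t ^ α) else 0) ∂mu0
        = ENNReal.ofReal (1 / α) * (ENNReal.ofReal r) ^ α := by
    intro r hr
    rw [lintegral_mu0 (Measurable.ite measurableSet_Iio (by fun_prop) measurable_const)]
    have h1 : ∀ t ∈ Ioi (0 : ℝ), ENNReal.ofReal t⁻¹ *
        (if t < r then ENNReal.ofReal (t ^ α) else 0)
        = (Iio r).indicator (fun w => ENNReal.ofReal (w ^ (α - 1))) t := by
      intro t ht
      have ht : 0 < t := ht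
      unfold indicator
      simp only [mem_Iio]
      split_ifs with h
      · rw [← ENNReal.ofReal_mul (by positivity), Real.rpow_sub ht, Real.rpow_one]
        congr 1
        field_simp
      · simp
    rw [setLIntegral_congr_fun measurableSet_Ioi h1, lintegral_indicator measurableSet_Iio,
      Measure.restrict_restrict measurableSet_Iio, inter_comm, Ioi_inter_Iio,
      lintegral_Ioo_rpow hα hr, ENNReal.ofReal_rpow_of_pos hr,
      ← ENNReal.ofReal_mul (by positivity)]
    congr 1
    ring
  rcases eq_or_ne y ⊤ with rfl | hy
  · rw [ENNReal.top_rpow_of_pos hα, ENNReal.mul_top (by simpa using hα), eq_top_iff]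
    refine ENNReal.le_of_forall_nnreal_lt fun c _ => ?_
    obtain ⟨r, hr, hrc⟩ : ∃ r : ℝ, 0 < r ∧ (c : ℝ) ≤ 1 / α * r ^ α := by
      refine ⟨(α * c + 1) ^ (1 / α), by positivity, ?_⟩
      rw [← Real.rpow_mul (by positivity), one_div_mul_cancel hα.ne', Real.rpow_one, one_div,
        mul_add, inv_mul_cancel_left₀ hα.ne']
      have : 0 < α⁻¹ * 1 := by positivity
      linarith
    calc (c : ℝ≥0∞) = ENNReal.ofReal c := by simp
      _ ≤ ENNReal.ofReal (1 / α * r ^ α) := ENNReal.ofReal_le_ofReal hrc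
      _ = ∫⁻ t, (if t < r then ENNReal.ofReal (t ^ α) else 0) ∂mu0 := by
        rw [key r hr, ENNReal.ofReal_rpow_of_pos hr, ENNReal.ofReal_mul (by positivity)]
      _ ≤ _ := by
        refine lintegral_mono fun t => ?_
        simp only [ENNReal.ofReal_lt_top, if_true]
        split_ifs <;> simp
  · rcases eq_or_ne y 0 with rfl | h0
    · simp [ENNReal.zero_rpow_of_pos hα]
    have hy0 : 0 < y.toReal := ENNReal.toReal_pos h0 hy
    have := key y.toReal hy0
    rw [ENNReal.ofReal_toReal hy] at this
    rw [← this]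
    refine lintegral_congr_ae ?_
    filter_upwards [ae_mu0_pos] with t ht
    simp only [ENNReal.ofReal_lt_iff_lt_toReal ht.le hy]

lemma lintegral_pk_left {α t : ℝ} (hα : 0 < α) (ht : 0 < t) :
    ∫⁻ r, pk α r t ∂mu0 = ENNReal.ofReal (1 / α) := by
  have h := lintegral_layer hα (ENNReal.ofReal t)
  have e : ∀ᵐ r ∂mu0, pk α r t = ENNReal.ofReal (t ^ (-α)) *
      (if ENNReal.ofReal r < ENNReal.ofReal t then ENNReal.ofReal (r ^ α) else 0) := by
    filter_upwards [ae_mu0_pos] with r hr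
    unfold pk
    simp only [ENNReal.ofReal_lt_ofReal_iff ht]
    split_ifs
    · rw [← ENNReal.ofReal_mul (by positivity), Real.div_rpow hr.le ht.le, Real.rpow_neg ht.le]
      congr 1
      ring
    · simp
  rw [lintegral_congr_ae e, lintegral_const_mul _ (Measurable.ite (measurableSet_lt
    ENNReal.measurable_ofReal measurable_const) (by fun_prop) measurable_const), h,
    ENNReal.ofReal_rpow_of_pos ht, mul_left_comm, ← ENNReal.ofReal_mul (by positivity),
    Real.rpow_neg ht.le, inv_mul_cancel₀ (Real.rpow_pos_of_pos ht α).ne']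
  simp

lemma hardy_up {α : ℝ} (hα : 0 < α) {a : ℝ → ℝ≥0∞} (ha : Measurable a) :
    ∫⁻ r, (∫⁻ w, pk α r w * a w ∂mu0) ^ 2 ∂mu0
      ≤ ENNReal.ofReal (1 / α) ^ 2 * ∫⁻ w, a w ^ 2 ∂mu0 := by
  rw [sq (ENNReal.ofReal _)]
  exact lintegral_schur mu0 mu0 (measurable_pk α)
    (ae_mu0_pos.mono fun r hr => (lintegral_pk_right hα hr).le)
    (ae_mu0_pos.mono fun r hr => (lintegral_pk_left hα hr).le) ha

lemma hardy_down {α : ℝ} (hα : 0 < α) {a : ℝ → ℝ≥0∞} (ha : Measurable a) :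
    ∫⁻ t, (∫⁻ r, pk α r t * a r ∂mu0) ^ 2 ∂mu0
      ≤ ENNReal.ofReal (1 / α) ^ 2 * ∫⁻ w, a w ^ 2 ∂mu0 := by
  rw [sq (ENNReal.ofReal _)]
  exact lintegral_schur mu0 mu0 (K := fun t r => pk α r t) ((measurable_pk α).comp measurable_swap)
    (ae_mu0_pos.mono fun r hr => (lintegral_pk_left hα hr).le)
    (ae_mu0_pos.mono fun r hr => (lintegral_pk_right hα hr).le) ha

section duality
variable {α : Type*} [MeasurableSpace α] {μ : Measure α} [SigmaFinite μ]

/-- Truncations used to test dual inequalities. -/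
def trunc (μ : Measure α) [SigmaFinite μ] (R : α → ℝ≥0∞) (n : ℕ) (x : α) : ℝ≥0∞ :=
  (spanningSets μ n).indicator (fun x => min (R x) n) x

lemma measurable_trunc {R : α → ℝ≥0∞} (hR : Measurable R) (n : ℕ) : Measurable (trunc μ R n) :=
  (hR.min measurable_const).indicator (measurableSet_spanningSets μ n)

lemma trunc_le (R : α → ℝ≥0∞) (n : ℕ) (x : α) : trunc μ R n x ≤ R x := by
  unfold trunc indicator
  split_ifs
  · exact min_le_left _ _
  · exact zero_le

lemma trunc_le_nat (R : α → ℝ≥0∞) (n : ℕ) (x : α) : trunc μ R n x ≤ n := by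
  unfold trunc indicator
  split_ifs
  · exact min_le_right _ _
  · exact zero_le

lemma trunc_mono (R : α → ℝ≥0∞) : Monotone (trunc μ R) := by
  intro m n hmn x
  unfold trunc indicator
  split_ifs with h1 h2
  · exact min_le_min_left _ (by exact_mod_cast hmn)
  · exact absurd (monotone_spanningSets μ hmn h1) h2
  · exact zero_le
  · exact zero_le

lemma iSup_trunc (R : α → ℝ≥0∞) (x : α) : ⨆ n, trunc μ R n x = R x := by
  refine le_antisymm (iSup_le fun n => trunc_le R n x) (le_of_forall_lt fun c hc => ?_)
  obtain ⟨k, hk⟩ := ENNReal.exists_nat_gt (hc.ne_top)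
  obtain ⟨m, hm⟩ := mem_iUnion.1 ((iUnion_spanningSets μ).symm ▸ mem_univ x : x ∈ ⋃ n, _)
  refine lt_of_lt_of_le ?_ (le_iSup _ (max k m))
  unfold trunc
  rw [indicator_of_mem (monotone_spanningSets μ (le_max_right k m) hm)]
  refine lt_min hc (hk.trans_le ?_)
  exact_mod_cast le_max_left k m

lemma lintegral_trunc_rpow_ne_top (R : α → ℝ≥0∞) (n : ℕ) {p : ℝ} (hp : 0 < p) :
    ∫⁻ x, trunc μ R n x ^ p ∂μ ≠ ⊤ := by
  have : ∫⁻ x, trunc μ R n x ^ p ∂μ ≤ ∫⁻ x in spanningSets μ n, (n : ℝ≥0∞) ^ p ∂μ := by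
    rw [← lintegral_indicator (measurableSet_spanningSets μ n)]
    refine lintegral_mono fun x => ?_
    by_cases h : x ∈ spanningSets μ n
    · rw [indicator_of_mem h]
      exact ENNReal.rpow_le_rpow (trunc_le_nat R n x) hp.le
    · rw [indicator_of_notMem h, trunc, indicator_of_notMem h, ENNReal.zero_rpow_of_pos hp]
  refine ne_top_of_le_ne_top ?_ this
  rw [setLIntegral_const]
  exact ENNReal.mul_ne_top (ENNReal.rpow_ne_top_of_nonneg hp.le (by simp))
    (measure_spanningSets_lt_top μ n).ne

lemma lintegral_rpow_eq_iSup_trunc {R : α → ℝ≥0∞} (hR : Measurable R) {p : ℝ} (hp : 0 < p) :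
    ∫⁻ x, R x ^ p ∂μ = ⨆ n, ∫⁻ x, trunc μ R n x ^ p ∂μ := by
  rw [← lintegral_iSup (fun n => (measurable_trunc hR n).pow_const p)
    (fun m n hmn x => ENNReal.rpow_le_rpow (trunc_mono R hmn x) hp.le)]
  refine lintegral_congr fun x => ?_
  rw [← iSup_trunc (μ := μ) R x]
  exact (ENNReal.orderIsoRpow p hp).map_iSup _

/-- Duality for `L^p` norms of nonnegative functions, tested on bounded functions with
support of finite measure. -/
lemma lintegral_rpow_le_of_duality {R : α → ℝ≥0∞} (hR : Measurable R) {p q : ℝ}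
    (hpq : p.HolderConjugate q) {K : ℝ≥0∞}
    (h : ∀ η : α → ℝ≥0∞, Measurable η → (∃ c : ℝ≥0∞, c ≠ ⊤ ∧ ∀ x, η x ≤ c) →
      ∫⁻ x, η x ^ q ∂μ ≠ ⊤ → ∫⁻ x, η x ∂μ ≠ ⊤ →
      ∫⁻ x, R x * η x ∂μ ≤ K * (∫⁻ x, η x ^ q ∂μ) ^ (1 / q)) :
    (∫⁻ x, R x ^ p ∂μ) ^ (1 / p) ≤ K := by
  have hp := hpq.pos
  have hp1 : 0 < p - 1 := by linarith [hpq.lt]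
  have hmain : ∀ n, ∫⁻ x, trunc μ R n x ^ p ∂μ ≤ K ^ p := by
    intro n
    set I := ∫⁻ x, trunc μ R n x ^ p ∂μ with hI
    have hIt : I ≠ ⊤ := lintegral_trunc_rpow_ne_top R n hp
    have hpow : ∀ x, (trunc μ R n x ^ (p - 1)) ^ q = trunc μ R n x ^ p := by
      intro x
      rw [← ENNReal.rpow_mul, hpq.sub_one_mul_conj]
    have h1 := h (fun x => trunc μ R n x ^ (p - 1)) ((measurable_trunc hR n).pow_const _)
      ⟨(n : ℝ≥0∞) ^ (p - 1), ENNReal.rpow_ne_top_of_nonneg hp1.le (by simp),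
        fun x => ENNReal.rpow_le_rpow (trunc_le_nat R n x) hp1.le⟩
      (by simp only [hpow]; exact hIt) (lintegral_trunc_rpow_ne_top R n hp1)
    simp only [hpow] at h1
    have h2 : I ≤ K * I ^ (1 / q) := by
      refine le_trans (lintegral_mono fun x => ?_) h1
      calc trunc μ R n x ^ p = trunc μ R n x * trunc μ R n x ^ (p - 1) := by
            conv_rhs => rw [← ENNReal.rpow_one (trunc μ R n x), ← ENNReal.rpow_mul, one_mul]
            rw [← ENNReal.rpow_add_of_nonneg _ _ zero_le_one hp1.le]
            congr 1; ring
        _ ≤ _ := by gcongr; exact trunc_le R n x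
    rcases eq_or_ne I 0 with h0 | h0
    · rw [h0]; exact zero_le
    have h3 : I ^ (1 / p) ≤ K := by
      have e : I ^ (1 / p) * I ^ (1 / q) = I := by
        rw [← ENNReal.rpow_add _ _ h0 hIt, one_div, one_div, hpq.inv_add_inv_eq_one,
          ENNReal.rpow_one]
      have hq0 : I ^ (1 / q) ≠ 0 := (ENNReal.rpow_pos (pos_iff_ne_zero.2 h0) hIt).ne'
      have hqt : I ^ (1 / q) ≠ ⊤ := ENNReal.rpow_ne_top_of_nonneg
        (one_div_nonneg.2 hpq.symm.nonneg) hIt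
      rw [← ENNReal.mul_le_mul_iff_left hq0 hqt, e]
      exact h2
    calc I = (I ^ (1 / p)) ^ p := by
          rw [← ENNReal.rpow_mul, one_div_mul_cancel hp.ne', ENNReal.rpow_one]
      _ ≤ K ^ p := ENNReal.rpow_le_rpow h3 hp.le
  rw [lintegral_rpow_eq_iSup_trunc hR hp]
  calc (⨆ n, ∫⁻ x, trunc μ R n x ^ p ∂μ) ^ (1 / p) ≤ (K ^ p) ^ (1 / p) :=
        ENNReal.rpow_le_rpow (iSup_le hmain) (one_div_nonneg.2 hp.le)
    _ = K := by rw [← ENNReal.rpow_mul, mul_one_div_cancel hp.ne', ENNReal.rpow_one]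

/-- If `∫ G ψ ≤ C (Φ + ∫ ψ^q)` for all test functions then `∫ G^r` is controlled by `Φ`. -/
lemma lintegral_rpow_le_of_absorb (μ : Measure α) [SigmaFinite μ] {r q : ℝ}
    (hrq : r.HolderConjugate q) {C : ℝ} (hC : 0 < C) :
    ∃ C' : ℝ, 0 < C' ∧ ∀ {G : α → ℝ≥0∞}, Measurable G → ∀ (Φ : ℝ≥0∞),
      (∀ ψ : α → ℝ≥0∞, Measurable ψ →
      ∫⁻ x, G x * ψ x ∂μ ≤ ENNReal.ofReal C * (Φ + ∫⁻ x, ψ x ^ q ∂μ)) →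
      ∫⁻ x, G x ^ r ∂μ ≤ ENNReal.ofReal C' * Φ := by
  have hr := hrq.pos
  have hr1 : 0 < r - 1 := by linarith [hrq.lt]
  have hq1 : 0 < q - 1 := by linarith [hrq.symm.lt]
  set ε : ℝ := (1 / (2 * C)) ^ (1 / (q - 1)) with hε
  have hε0 : 0 < ε := by positivity
  have hεq : C * ε ^ q = ε / 2 := by
    have h1 : ε ^ (q - 1) = 1 / (2 * C) := by
      rw [hε, ← Real.rpow_mul (by positivity), one_div_mul_cancel hq1.ne', Real.rpow_one]
    have h2 : ε ^ q = ε ^ (q - 1) * ε := by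
      rw [← Real.rpow_add_one hε0.ne']; congr 1; ring
    rw [h2, h1]; field_simp
  refine ⟨2 * C / ε, by positivity, fun {G} hG Φ h => ?_⟩
  rw [lintegral_rpow_eq_iSup_trunc hG hr]
  refine iSup_le fun n => ?_
  set I := ∫⁻ x, trunc μ G n x ^ r ∂μ with hI
  have hIt : I ≠ ⊤ := lintegral_trunc_rpow_ne_top G n hr
  have hm := measurable_trunc (μ := μ) hG n
  have h1 := h (fun x => ENNReal.ofReal ε * trunc μ G n x ^ (r - 1)) (by fun_prop)
  have h2 : ∫⁻ x, (ENNReal.ofReal ε * trunc μ G n x ^ (r - 1)) ^ q ∂μ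
      = ENNReal.ofReal (ε ^ q) * I := by
    rw [hI, ← lintegral_const_mul _ (by fun_prop)]
    refine lintegral_congr fun x => ?_
    rw [ENNReal.mul_rpow_of_nonneg _ _ hrq.symm.nonneg, ← ENNReal.rpow_mul, hrq.sub_one_mul_conj,
      ENNReal.ofReal_rpow_of_pos hε0]
  have h3 : ENNReal.ofReal ε * I
      ≤ ∫⁻ x, G x * (ENNReal.ofReal ε * trunc μ G n x ^ (r - 1)) ∂μ := by
    rw [hI, ← lintegral_const_mul _ (by fun_prop)]
    refine lintegral_mono fun x => ?_
    have : trunc μ G n x ^ r = trunc μ G n x * trunc μ G n x ^ (r - 1) := by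
      conv_rhs => rw [← ENNReal.rpow_one (trunc μ G n x), ← ENNReal.rpow_mul, one_mul]
      rw [← ENNReal.rpow_add_of_nonneg _ _ zero_le_one hr1.le]
      congr 1; ring
    rw [this, mul_left_comm]
    gcongr
    exact trunc_le G n x
  rw [h2, mul_add, ← mul_assoc, ← ENNReal.ofReal_mul hC.le, hεq] at h1
  have h4 : ENNReal.ofReal (ε / 2) * I + ENNReal.ofReal (ε / 2) * I
      ≤ ENNReal.ofReal C * Φ + ENNReal.ofReal (ε / 2) * I := by
    rw [← add_mul, ← ENNReal.ofReal_add (by positivity) (by positivity), add_halves]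
    exact h3.trans h1
  have h5 := (ENNReal.add_le_add_iff_right (ENNReal.mul_ne_top ENNReal.ofReal_ne_top hIt)).1 h4
  calc I = ENNReal.ofReal (2 / ε) * (ENNReal.ofReal (ε / 2) * I) := by
        rw [← mul_assoc, ← ENNReal.ofReal_mul (by positivity)]
        have : 2 / ε * (ε / 2) = 1 := by field_simp
        rw [this]; simp
    _ ≤ ENNReal.ofReal (2 / ε) * (ENNReal.ofReal C * Φ) := by gcongr
    _ = ENNReal.ofReal (2 * C / ε) * Φ := by
        rw [← mul_assoc, ← ENNReal.ofReal_mul (by positivity)]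
        congr 2; ring
end duality

/-- The uncentered Hardy–Littlewood maximal function. -/
def maxFun (φ : Ed d → ℝ≥0∞) (x : Ed d) : ℝ≥0∞ :=
  ⨆ (y : Ed d) (r : ℝ) (_ : x ∈ Metric.ball y r),
    (∫⁻ z in Metric.ball y r, φ z) / volume (Metric.ball y r)

lemma lt_maxFun_iff {φ : Ed d → ℝ≥0∞} {x : Ed d} {a : ℝ≥0∞} :
    a < maxFun φ x ↔ ∃ (y : Ed d) (r : ℝ), x ∈ Metric.ball y r ∧
      a < (∫⁻ z in Metric.ball y r, φ z) / volume (Metric.ball y r) := by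
  simp only [maxFun, lt_iSup_iff, exists_prop]

lemma isOpen_lt_maxFun (φ : Ed d → ℝ≥0∞) (a : ℝ≥0∞) : IsOpen {x | a < maxFun φ x} := by
  rw [isOpen_iff_mem_nhds]
  intro x hx
  obtain ⟨y, r, hxy, h⟩ := lt_maxFun_iff.1 hx
  filter_upwards [Metric.isOpen_ball.mem_nhds hxy] with z hz
  exact lt_maxFun_iff.2 ⟨y, r, hz, h⟩

lemma measurable_maxFun (φ : Ed d → ℝ≥0∞) : Measurable (maxFun φ) :=
  measurable_of_Ioi fun a => (isOpen_lt_maxFun φ a).measurableSet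

lemma setLIntegral_ball_le (φ : Ed d → ℝ≥0∞) (x : Ed d) (r : ℝ) :
    ∫⁻ z in Metric.ball x r, φ z ≤ maxFun φ x * volume (Metric.ball x r) := by
  rcases le_or_gt r 0 with hr | hr
  · simp [Metric.ball_eq_empty.2 hr]
  have h0 : volume (Metric.ball x r) ≠ 0 := (Metric.measure_ball_pos volume x hr).ne'
  have ht : volume (Metric.ball x r) ≠ ⊤ := measure_ball_lt_top.ne
  rw [← ENNReal.div_le_iff h0 ht]
  exact le_iSup_of_le x (le_iSup_of_le r (le_iSup_of_le (Metric.mem_ball_self hr) le_rfl))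

lemma measure_lt_maxFun_le (hd : 1 ≤ d) (φ : Ed d → ℝ≥0∞) {a : ℝ≥0∞} (ha : a ≠ 0) (ha' : a ≠ ⊤) :
    volume {x | a < maxFun φ x} ≤ 5 ^ d * (∫⁻ x, φ x) / a := by
  rcases eq_or_ne (∫⁻ x, φ x) ⊤ with hI | hI
  · rw [hI, ENNReal.mul_top (by positivity), ENNReal.top_div_of_ne_top ha']
    exact le_top
  set t : Set (Ed d × ℝ) := {b | 0 < b.2 ∧
    a < (∫⁻ z in Metric.ball b.1 b.2, φ z) / volume (Metric.ball b.1 b.2)} with ht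
  set ω := volume (Metric.ball (0 : Ed d) 1) with hω
  have hω0 : ω ≠ 0 := (Metric.measure_ball_pos volume _ one_pos).ne'
  have hωt : ω ≠ ⊤ := measure_ball_lt_top.ne
  have hvol : ∀ b ∈ t, a * volume (Metric.ball b.1 b.2) ≤ ∫⁻ z in Metric.ball b.1 b.2, φ z := by
    intro b hb
    have h0 : volume (Metric.ball b.1 b.2) ≠ 0 := (Metric.measure_ball_pos volume _ hb.1).ne'
    have ht : volume (Metric.ball b.1 b.2) ≠ ⊤ := measure_ball_lt_top.ne
    exact ((ENNReal.lt_div_iff_mul_lt (Or.inl h0) (Or.inl ht)).1 hb.2).le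
  have hball : ∀ (y : Ed d) (r : ℝ), 0 < r →
      volume (Metric.ball y r) = ENNReal.ofReal (r ^ d) * ω := by
    intro y r hr
    rw [Measure.addHaar_ball_of_pos volume y hr]; simp [hω]
  set c := (∫⁻ x, φ x) / (a * ω) with hc
  have haω : a * ω ≠ 0 := mul_ne_zero ha hω0
  have hct : c ≠ ⊤ := ENNReal.div_ne_top hI haω
  have hR : ∀ b ∈ t, b.2 ≤ max 1 c.toReal := by
    intro b hb
    rcases le_total b.2 1 with h1 | h1
    · exact h1.trans (le_max_left _ _)
    refine le_trans (le_self_pow₀ h1 (by omega : d ≠ 0)) (le_trans ?_ (le_max_right _ _))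
    rw [← ENNReal.ofReal_le_iff_le_toReal hct, hc, ENNReal.le_div_iff_mul_le (Or.inl haω)
      (Or.inl (ENNReal.mul_ne_top ha' hωt))]
    calc _ = a * volume (Metric.ball b.1 b.2) := by rw [hball _ _ hb.1]; ring
      _ ≤ _ := (hvol b hb).trans (setLIntegral_le_lintegral _ _)
  obtain ⟨u, hut, hdisj, hcov⟩ := Vitali.exists_disjoint_subfamily_covering_enlargement_closedBall
    t (fun b => b.1) (fun b => b.2) _ hR 5 (by norm_num)
  have hdisj' : u.PairwiseDisjoint fun b => Metric.ball b.1 b.2 :=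
    hdisj.mono fun b => Metric.ball_subset_closedBall
  have hcount : u.Countable :=
    hdisj'.countable_of_isOpen (fun _ _ => Metric.isOpen_ball)
      (fun b hb => ⟨b.1, Metric.mem_ball_self (hut hb).1⟩)
  have hsub : {x | a < maxFun φ x} ⊆ ⋃ b ∈ u, Metric.closedBall b.1 (5 * b.2) := by
    intro x hx
    obtain ⟨y, r, hxy, h⟩ := lt_maxFun_iff.1 hx
    have hr : 0 < r := dist_nonneg.trans_lt (Metric.mem_ball.1 hxy)
    obtain ⟨b, hb, hsubb⟩ := hcov (y, r) ⟨hr, h⟩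
    exact mem_biUnion hb (hsubb (Metric.ball_subset_closedBall hxy))
  have hcl : ∀ b ∈ u, volume (Metric.closedBall b.1 (5 * b.2))
      ≤ 5 ^ d * ((∫⁻ z in Metric.ball b.1 b.2, φ z) / a) := by
    intro b hb
    have hb0 : 0 < b.2 := (hut hb).1
    rw [Measure.addHaar_closedBall volume _ (by positivity)]
    have h1 : volume (Metric.ball b.1 b.2) ≤ (∫⁻ z in Metric.ball b.1 b.2, φ z) / a := by
      rw [ENNReal.le_div_iff_mul_le (Or.inl ha) (Or.inl ha'), mul_comm]
      exact hvol b (hut hb)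
    calc _ = 5 ^ d * volume (Metric.ball b.1 b.2) := by
          rw [hball _ _ hb0, mul_pow, ENNReal.ofReal_mul (by positivity), ← mul_assoc]
          simp [hω, ENNReal.ofReal_pow]
      _ ≤ _ := by gcongr
  calc volume {x | a < maxFun φ x}
      ≤ volume (⋃ b ∈ u, Metric.closedBall b.1 (5 * b.2)) := measure_mono hsub
    _ ≤ ∑' b : u, volume (Metric.closedBall b.1.1 (5 * b.1.2)) := measure_biUnion_le _ hcount _
    _ ≤ ∑' b : u, 5 ^ d * ((∫⁻ z in Metric.ball b.1.1 b.1.2, φ z) / a) :=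
        ENNReal.tsum_le_tsum fun b => hcl b.1 b.2
    _ = 5 ^ d * ((∑' b : u, ∫⁻ z in Metric.ball b.1.1 b.1.2, φ z) / a) := by
        simp_rw [ENNReal.tsum_mul_left, div_eq_mul_inv, ENNReal.tsum_mul_right]
    _ = 5 ^ d * ((∫⁻ z in ⋃ b ∈ u, Metric.ball b.1 b.2, φ z) / a) := by
        rw [lintegral_biUnion hcount (fun _ _ => Metric.isOpen_ball.measurableSet) hdisj']
    _ ≤ 5 ^ d * ((∫⁻ z, φ z) / a) := by
        gcongr
        exact Measure.restrict_le_self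
    _ = _ := by rw [mul_div_assoc]

lemma maxFun_add_const_le {φ ψ : Ed d → ℝ≥0∞} (hψ : Measurable ψ) {a : ℝ≥0∞}
    (h : ∀ x, φ x ≤ ψ x + a) (x : Ed d) : maxFun φ x ≤ maxFun ψ x + a := by
  refine iSup_le fun y => iSup_le fun r => iSup_le fun hxy => ?_
  have hr : 0 < r := dist_nonneg.trans_lt (Metric.mem_ball.1 hxy)
  have h0 : volume (Metric.ball y r) ≠ 0 := (Metric.measure_ball_pos volume y hr).ne'
  have ht : volume (Metric.ball y r) ≠ ⊤ := measure_ball_lt_top.ne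
  calc (∫⁻ z in Metric.ball y r, φ z) / volume (Metric.ball y r)
      ≤ (∫⁻ z in Metric.ball y r, (ψ z + a)) / volume (Metric.ball y r) := by
        gcongr with z; exact h z
    _ = (∫⁻ z in Metric.ball y r, ψ z) / volume (Metric.ball y r) + a := by
        rw [lintegral_add_left hψ, setLIntegral_const, ENNReal.add_div, mul_div_assoc,
          ENNReal.div_self h0 ht, mul_one]
    _ ≤ _ := by
        gcongr
        exact le_iSup_of_le y (le_iSup_of_le r (le_iSup_of_le hxy le_rfl))

/-- The Hardy–Littlewood maximal theorem. -/
lemma lintegral_maxFun_rpow_le (hd : 1 ≤ d) {q : ℝ} (hq : 1 < q) :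
    ∃ C : ℝ, 0 < C ∧ ∀ φ : Ed d → ℝ≥0∞, Measurable φ →
      ∫⁻ x, maxFun φ x ^ q ≤ ENNReal.ofReal C * ∫⁻ x, φ x ^ q := by
  have hq0 : 0 < q := by linarith
  have hq1 : 0 < q - 1 := by linarith
  refine ⟨q * 2 ^ q * 5 ^ d * (1 / (q - 1)), by positivity, fun φ hφ => ?_⟩
  have hM := measurable_maxFun φ
  have hweak : ∀ t : ℝ, 0 < t → volume {x | ENNReal.ofReal (2 * t) < maxFun φ x}
      ≤ 5 ^ d * (∫⁻ x, if ENNReal.ofReal t < φ x then φ x else 0) / ENNReal.ofReal t := by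
    intro t ht
    have hm : Measurable fun x => if ENNReal.ofReal t < φ x then φ x else 0 :=
      Measurable.ite (measurableSet_lt measurable_const hφ) hφ measurable_const
    refine le_trans (measure_mono ?_) (measure_lt_maxFun_le hd _ (by simpa using ht)
      ENNReal.ofReal_ne_top)
    intro x hx
    have h1 := maxFun_add_const_le (φ := φ) hm (a := ENNReal.ofReal t) (by
      intro x
      split_ifs with h
      · exact le_self_add
      · simpa using h) x
    by_contra hcon
    simp only [mem_ofPred_eq, not_lt] at hcon hx
    have : ENNReal.ofReal (2 * t) = ENNReal.ofReal t + ENNReal.ofReal t := by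
      rw [two_mul, ENNReal.ofReal_add ht.le ht.le]
    rw [this] at hx
    exact absurd (hx.trans_le h1) (not_lt.2 (by gcongr))
  have hset : Measurable fun z : Ed d × ℝ =>
      if ENNReal.ofReal z.2 < maxFun φ z.1 then ENNReal.ofReal (z.2 ^ q) else 0 := by
    refine Measurable.ite (measurableSet_lt (by fun_prop) (by fun_prop)) (by fun_prop)
      measurable_const
  have hset2 : Measurable fun z : ℝ × Ed d =>
      (if ENNReal.ofReal z.1 < φ z.2 then ENNReal.ofReal (z.1 ^ (q - 1)) else 0) * φ z.2 := by
    refine Measurable.mul (Measurable.ite (measurableSet_lt (by fun_prop) (by fun_prop))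
      (by fun_prop) measurable_const) (by fun_prop)
  have hlayer : ∀ x, maxFun φ x ^ q = ENNReal.ofReal q *
      ∫⁻ t, (if ENNReal.ofReal t < maxFun φ x then ENNReal.ofReal (t ^ q) else 0) ∂mu0 := by
    intro x
    rw [lintegral_layer hq0, ← mul_assoc, ← ENNReal.ofReal_mul hq0.le, mul_one_div_cancel hq0.ne']
    simp
  calc ∫⁻ x, maxFun φ x ^ q
      = ENNReal.ofReal q * ∫⁻ t, (∫⁻ x,
          (if ENNReal.ofReal t < maxFun φ x then ENNReal.ofReal (t ^ q) else 0)) ∂mu0 := by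
        simp_rw [hlayer]
        rw [lintegral_const_mul _ hset.lintegral_prod_right', lintegral_lintegral_swap]
        exact hset.aemeasurable
    _ = ENNReal.ofReal q * ∫⁻ t, (∫⁻ x,
          (if ENNReal.ofReal (2 * t) < maxFun φ x then ENNReal.ofReal ((2 * t) ^ q) else 0))
            ∂mu0 := by
        rw [← lintegral_mu0_comp_mul two_pos (f := fun t => ∫⁻ x,
          (if ENNReal.ofReal t < maxFun φ x then ENNReal.ofReal (t ^ q) else 0))]
        exact (hset.comp measurable_swap).lintegral_prod_right'
    _ ≤ ENNReal.ofReal q * ∫⁻ t, ENNReal.ofReal (2 ^ q * 5 ^ d) * (∫⁻ x,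
          (if ENNReal.ofReal t < φ x then ENNReal.ofReal (t ^ (q - 1)) else 0) * φ x) ∂mu0 := by
        gcongr ENNReal.ofReal q * ?_
        refine lintegral_mu0_mono fun t ht => ?_
        have e1 : ∫⁻ x, (if ENNReal.ofReal (2 * t) < maxFun φ x
              then ENNReal.ofReal ((2 * t) ^ q) else 0)
            = ENNReal.ofReal ((2 * t) ^ q) * volume {x | ENNReal.ofReal (2 * t) < maxFun φ x} := by
          rw [← setLIntegral_const, ← lintegral_indicator (isOpen_lt_maxFun φ _).measurableSet]
          refine lintegral_congr fun x => ?_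
          simp [indicator]
        have e2 : ∫⁻ x, (if ENNReal.ofReal t < φ x then ENNReal.ofReal (t ^ (q - 1)) else 0) * φ x
            = ENNReal.ofReal (t ^ (q - 1)) *
              ∫⁻ x, (if ENNReal.ofReal t < φ x then φ x else 0) := by
          rw [← lintegral_const_mul _ (Measurable.ite (measurableSet_lt measurable_const hφ) hφ
            measurable_const)]
          refine lintegral_congr fun x => ?_
          split_ifs <;> simp
        rw [e1, e2]
        refine (mul_le_mul_right (hweak t ht) _).trans (le_of_eq ?_)
        rw [div_eq_mul_inv, ← ENNReal.ofReal_inv_of_pos ht, ← mul_assoc (ENNReal.ofReal (2 ^ q * _)),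
          ← ENNReal.ofReal_mul (by positivity), Real.mul_rpow two_pos.le ht.le,
          Real.rpow_sub_one ht.ne']
        have : (5 : ℝ≥0∞) ^ d = ENNReal.ofReal (5 ^ d) := by
          rw [ENNReal.ofReal_pow (by norm_num)]; norm_num
        rw [this, mul_right_comm (ENNReal.ofReal (5 ^ d)), ← mul_assoc,
          ← ENNReal.ofReal_mul (by positivity), ← ENNReal.ofReal_mul (by positivity)]
        congr 2
        ring
    _ = ENNReal.ofReal q * (ENNReal.ofReal (2 ^ q * 5 ^ d) *
          ∫⁻ x, ENNReal.ofReal (1 / (q - 1)) * φ x ^ q) := by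
        rw [lintegral_const_mul _ hset2.lintegral_prod_right',
          lintegral_lintegral_swap hset2.aemeasurable]
        congr 2
        refine lintegral_congr fun x => ?_
        dsimp only
        rw [lintegral_mul_const _ (Measurable.ite (measurableSet_lt (by fun_prop) (by fun_prop))
          (by fun_prop) measurable_const), lintegral_layer hq1, mul_assoc]
        congr 1
        conv_lhs => rw [← ENNReal.rpow_one (φ x), ← ENNReal.rpow_mul, one_mul]
        rw [← ENNReal.rpow_add_of_nonneg _ _ hq1.le zero_le_one]
        congr 1; ring
    _ = _ := by
        rw [lintegral_const_mul _ (by fun_prop), ← mul_assoc, ← mul_assoc,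
          ← ENNReal.ofReal_mul (by positivity), ← ENNReal.ofReal_mul (by positivity)]
        congr 2
        ring

/-- The heat kernel. -/
def hk (t : ℝ) (x : Ed d) : ℝ :=
  (4 * Real.pi * t) ^ (-(d : ℝ) / 2) * Real.exp (-‖x‖ ^ 2 / (4 * t))

lemma hk_pos {t : ℝ} (ht : 0 < t) (x : Ed d) : 0 < hk t x := by unfold hk; positivity

lemma hk_neg (t : ℝ) (x : Ed d) : hk t (-x) = hk t x := by simp [hk]

lemma hk_sub_comm (t : ℝ) (x y : Ed d) : hk t (x - y) = hk t (y - x) := by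
  rw [← hk_neg, neg_sub]

lemma measurable_hk_uncurry : Measurable fun p : ℝ × Ed d => hk p.1 p.2 := by
  unfold hk; fun_prop

lemma continuous_hk (t : ℝ) : Continuous (hk t : Ed d → ℝ) := by
  unfold hk; fun_prop

@[fun_prop]
lemma measurable_hk_comp {α : Type*} [MeasurableSpace α] {t : α → ℝ} {x : α → Ed d}
    (ht : Measurable t) (hx : Measurable x) : Measurable fun a => hk (t a) (x a) :=
  measurable_hk_uncurry.comp (ht.prodMk hx)

lemma hk_eq (t : ℝ) (x : Ed d) :
    hk t x = (4 * Real.pi * t) ^ (-(d : ℝ) / 2) * Real.exp (-(1 / (4 * t)) * ‖x‖ ^ 2) := by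
  unfold hk; congr 2; ring

lemma integrable_hk {t : ℝ} (ht : 0 < t) : Integrable (hk t : Ed d → ℝ) := by
  have h := GaussianFourier.integrable_cexp_neg_mul_sq_norm_add (V := Ed d)
    (b := ((1 / (4 * t) : ℝ) : ℂ)) (by rw [Complex.ofReal_re]; positivity) 0 0
  have h2 := h.re
  simp_rw [funext (hk_eq (d := d) t)]
  refine Integrable.const_mul ?_ _
  refine h2.congr (ae_of_all _ fun x => ?_)
  have : (-((1 / (4 * t) : ℝ) : ℂ) * (‖x‖ : ℂ) ^ 2 + 0 * ((⟪(0 : Ed d), x⟫ : ℝ) : ℂ))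
      = ((-(1 / (4 * t)) * ‖x‖ ^ 2 : ℝ) : ℂ) := by push_cast; ring
  simp only [this, ← Complex.ofReal_exp]
  exact Complex.ofReal_re _

lemma integral_hk {t : ℝ} (ht : 0 < t) : ∫ x : Ed d, hk t x = 1 := by
  have h := GaussianFourier.integral_rexp_neg_mul_sq_norm (V := Ed d)
    (b := 1 / (4 * t)) (by positivity)
  simp_rw [hk_eq]
  rw [integral_const_mul, h, finrank_euclideanSpace_fin]
  have : Real.pi / (1 / (4 * t)) = 4 * Real.pi * t := by field_simp
  rw [this, ← Real.rpow_add (by positivity)]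
  rw [neg_div, neg_add_cancel, Real.rpow_zero]

/-- The heat kernel as an extended nonnegative real. -/
def hkE (t : ℝ) (x : Ed d) : ℝ≥0∞ := ENNReal.ofReal (hk t x)

@[fun_prop]
lemma measurable_hkE_comp {α : Type*} [MeasurableSpace α] {t : α → ℝ} {x : α → Ed d}
    (ht : Measurable t) (hx : Measurable x) : Measurable fun a => hkE (t a) (x a) :=
  (measurable_hk_comp ht hx).ennreal_ofReal

lemma hkE_sub_comm (t : ℝ) (x y : Ed d) : hkE t (x - y) = hkE t (y - x) := by
  unfold hkE; rw [hk_sub_comm]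

lemma lintegral_hkE {t : ℝ} (ht : 0 < t) : ∫⁻ x : Ed d, hkE t x = 1 := by
  unfold hkE
  rw [← ofReal_integral_eq_lintegral_ofReal (integrable_hk ht)
    (ae_of_all _ fun x => (hk_pos ht x).le), integral_hk ht, ENNReal.ofReal_one]

lemma lintegral_hkE_sub {t : ℝ} (ht : 0 < t) (x : Ed d) : ∫⁻ z, hkE t (x - z) = 1 := by
  rw [lintegral_sub_left_eq_self (fun z => hkE t z) x, lintegral_hkE ht]

lemma hk_mul_hk {s t : ℝ} (hs : 0 < s) (ht : 0 < t) (x y z : Ed d) :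
    hk s (x - z) * hk t (z - y)
      = hk (s + t) (x - y) * hk (s * t / (s + t)) ((s + t)⁻¹ • (t • x + s • y) - z) := by
  have hst : 0 < s + t := by positivity
  unfold hk
  have e1 : -‖x - z‖ ^ 2 / (4 * s) + -‖z - y‖ ^ 2 / (4 * t) = -‖x - y‖ ^ 2 / (4 * (s + t)) +
      -‖(s + t)⁻¹ • (t • x + s • y) - z‖ ^ 2 / (4 * (s * t / (s + t))) := by
    have h1 : (s + t)⁻¹ • (t • x + s • y) - z = (s + t)⁻¹ • (t • (x - z) - s • (z - y)) := by
      have : z = (s + t)⁻¹ • ((s + t) • z) := by rw [smul_smul, inv_mul_cancel₀ hst.ne', one_smul]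
      conv_lhs => rw [this]
      rw [← smul_sub]
      congr 1
      module
    have h2 : x - y = (x - z) + (z - y) := by abel
    rw [h1, h2]
    generalize x - z = u
    generalize z - y = v
    rw [norm_smul, mul_pow, norm_sub_sq_real, norm_add_sq_real, norm_smul, norm_smul,
      inner_smul_left, inner_smul_right, Real.norm_eq_abs, Real.norm_eq_abs, Real.norm_eq_abs,
      abs_of_pos hs, abs_of_pos ht, abs_of_pos (inv_pos.2 hst)]
    simp only [conj_trivial]
    field_simp
    ring
  calc _ = ((4 * Real.pi * s) ^ (-(d : ℝ) / 2) * (4 * Real.pi * t) ^ (-(d : ℝ) / 2)) *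
        Real.exp (-‖x - z‖ ^ 2 / (4 * s) + -‖z - y‖ ^ 2 / (4 * t)) := by
        rw [Real.exp_add]; ring
    _ = ((4 * Real.pi * (s + t)) ^ (-(d : ℝ) / 2) *
          (4 * Real.pi * (s * t / (s + t))) ^ (-(d : ℝ) / 2)) *
        Real.exp (-‖x - z‖ ^ 2 / (4 * s) + -‖z - y‖ ^ 2 / (4 * t)) := by
        rw [← Real.mul_rpow (by positivity) (by positivity),
          ← Real.mul_rpow (by positivity) (by positivity)]
        congr 2
        field_simp
    _ = _ := by rw [e1, Real.exp_add]; ring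

lemma lintegral_hkE_mul_hkE {s t : ℝ} (hs : 0 < s) (ht : 0 < t) (x y : Ed d) :
    ∫⁻ z, hkE s (x - z) * hkE t (z - y) = hkE (s + t) (x - y) := by
  have hst : 0 < s * t / (s + t) := by positivity
  unfold hkE
  simp_rw [← ENNReal.ofReal_mul (hk_pos hs _).le, hk_mul_hk hs ht,
    ENNReal.ofReal_mul (hk_pos (add_pos hs ht) _).le]
  rw [lintegral_const_mul _ (by fun_prop)]
  have := lintegral_hkE_sub hst ((s + t)⁻¹ • (t • x + s • y))
  unfold hkE at this
  rw [this, mul_one]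

/-- The heat semigroup on nonnegative functions. -/
def Pe (t : ℝ) (φ : Ed d → ℝ≥0∞) (x : Ed d) : ℝ≥0∞ := ∫⁻ z, hkE t (x - z) * φ z

lemma measurable_Pe_comp {α : Type*} [MeasurableSpace α] {φ : α → Ed d → ℝ≥0∞}
    (hφ : Measurable (Function.uncurry φ)) {t : α → ℝ} {x : α → Ed d}
    (ht : Measurable t) (hx : Measurable x) : Measurable fun a => Pe (t a) (φ a) (x a) := by
  unfold Pe
  refine Measurable.lintegral_prod_right' (f := fun p : α × Ed d =>
    hkE (t p.1) (x p.1 - p.2) * φ p.1 p.2) ?_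
  exact (measurable_hkE_comp (by fun_prop) (by fun_prop)).mul hφ

lemma measurable_Pe {φ : Ed d → ℝ≥0∞} (hφ : Measurable φ) (t : ℝ) : Measurable (Pe t φ) :=
  measurable_Pe_comp (φ := fun _ => φ) (hφ.comp measurable_snd) measurable_const measurable_id

lemma measurable_Pe_uncurry {φ : Ed d → ℝ≥0∞} (hφ : Measurable φ) :
    Measurable fun p : ℝ × Ed d => Pe p.1 φ p.2 :=
  measurable_Pe_comp (φ := fun _ => φ) (hφ.comp measurable_snd) measurable_fst measurable_snd

lemma Pe_mono {t : ℝ} {φ ψ : Ed d → ℝ≥0∞} (h : ∀ x, φ x ≤ ψ x) (x : Ed d) :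
    Pe t φ x ≤ Pe t ψ x :=
  lintegral_mono fun z => by gcongr; exact h z

lemma Pe_add {t : ℝ} {φ ψ : Ed d → ℝ≥0∞} (hφ : Measurable φ) (x : Ed d) :
    Pe t (fun z => φ z + ψ z) x = Pe t φ x + Pe t ψ x := by
  unfold Pe
  simp_rw [mul_add]
  exact lintegral_add_left (by fun_prop) _

lemma Pe_const_mul {t : ℝ} {φ : Ed d → ℝ≥0∞} (hφ : Measurable φ) (c : ℝ≥0∞) (x : Ed d) :
    Pe t (fun z => c * φ z) x = c * Pe t φ x := by
  unfold Pe
  simp_rw [mul_left_comm _ c]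
  exact lintegral_const_mul _ (by fun_prop)

lemma Pe_const {t : ℝ} (ht : 0 < t) (c : ℝ≥0∞) (x : Ed d) : Pe t (fun _ => c) x = c := by
  unfold Pe
  rw [lintegral_mul_const _ (by fun_prop), lintegral_hkE_sub ht, one_mul]

lemma Pe_Pe {s t : ℝ} (hs : 0 < s) (ht : 0 < t) {φ : Ed d → ℝ≥0∞} (hφ : Measurable φ) (x : Ed d) :
    Pe s (Pe t φ) x = Pe (s + t) φ x := by
  unfold Pe
  simp_rw [← lintegral_hkE_mul_hkE hs ht]
  have h1 : ∀ z, hkE s (x - z) * ∫⁻ y, hkE t (z - y) * φ y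
      = ∫⁻ y, hkE s (x - z) * (hkE t (z - y) * φ y) := fun z =>
    (lintegral_const_mul _ (by fun_prop)).symm
  simp_rw [h1]
  rw [lintegral_lintegral_swap (by fun_prop)]
  refine lintegral_congr fun y => ?_
  rw [← lintegral_mul_const _ (by fun_prop)]
  simp_rw [mul_assoc]

lemma lintegral_Pe_mul {t : ℝ} {φ ψ : Ed d → ℝ≥0∞} (hφ : Measurable φ) (hψ : Measurable ψ) :
    ∫⁻ x, Pe t φ x * ψ x = ∫⁻ x, φ x * Pe t ψ x := by
  unfold Pe
  have h1 : ∀ x, (∫⁻ z, hkE t (x - z) * φ z) * ψ x = ∫⁻ z, hkE t (x - z) * φ z * ψ x := fun x =>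
    (lintegral_mul_const _ (by fun_prop)).symm
  have h2 : ∀ x, φ x * (∫⁻ z, hkE t (x - z) * ψ z) = ∫⁻ z, φ x * (hkE t (x - z) * ψ z) := fun x =>
    (lintegral_const_mul _ (by fun_prop)).symm
  simp_rw [h1, h2]
  rw [lintegral_lintegral_swap (by fun_prop)]
  refine lintegral_congr fun x => lintegral_congr fun z => ?_
  rw [hkE_sub_comm]
  ring

lemma lintegral_Pe {t : ℝ} (ht : 0 < t) {φ : Ed d → ℝ≥0∞} (hφ : Measurable φ) :
    ∫⁻ x, Pe t φ x = ∫⁻ x, φ x := by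
  have := lintegral_Pe_mul (t := t) hφ (measurable_const (a := (1 : ℝ≥0∞)))
  simpa [Pe_const ht] using this

lemma Pe_rpow_le {t : ℝ} (ht : 0 < t) {p : ℝ} (hp : 1 ≤ p) {φ : Ed d → ℝ≥0∞} (hφ : Measurable φ)
    (x : Ed d) : Pe t φ x ^ p ≤ Pe t (fun z => φ z ^ p) x := by
  have hp0 : 0 < p := by linarith
  have hp1 : 0 ≤ 1 - 1 / p := by rw [sub_nonneg, div_le_one hp0]; exact hp
  have h := ENNReal.lintegral_mul_norm_pow_le (μ := volume)
    (f := fun z => hkE t (x - z) * φ z ^ p) (g := fun z => hkE t (x - z))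
    (by fun_prop) (by fun_prop) (p := 1 / p) (q := 1 - 1 / p) (by positivity) hp1 (by ring)
  rw [lintegral_hkE_sub ht, ENNReal.one_rpow, mul_one] at h
  have h2 : Pe t φ x ≤ (Pe t (fun z => φ z ^ p) x) ^ (1 / p) := by
    refine le_trans (le_of_eq (lintegral_congr fun z => ?_)) h
    rw [ENNReal.mul_rpow_of_nonneg _ _ (by positivity), ← ENNReal.rpow_mul,
      mul_one_div_cancel hp0.ne', ENNReal.rpow_one, mul_right_comm,
      ← ENNReal.rpow_add_of_nonneg _ _ (by positivity) hp1, add_sub_cancel, ENNReal.rpow_one]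
  calc Pe t φ x ^ p ≤ ((Pe t (fun z => φ z ^ p) x) ^ (1 / p)) ^ p :=
        ENNReal.rpow_le_rpow h2 hp0.le
    _ = _ := by rw [← ENNReal.rpow_mul, one_div_mul_cancel hp0.ne', ENNReal.rpow_one]

lemma Pe_le_maxFun {t : ℝ} (ht : 0 < t) {φ : Ed d → ℝ≥0∞} (hφ : Measurable φ) (x : Ed d) :
    Pe t φ x ≤ maxFun φ x := by
  have layer : ∀ z : Ed d, hkE t z
      = ∫⁻ a in Ioi (0 : ℝ), (if a < hk t z then 1 else 0 : ℝ≥0∞) := by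
    intro z
    have : (fun a : ℝ => (if a < hk t z then 1 else 0 : ℝ≥0∞)) = (Iio (hk t z)).indicator 1 := by
      ext a; simp [indicator]
    rw [this, lintegral_indicator_one measurableSet_Iio, Measure.restrict_apply measurableSet_Iio,
      inter_comm, Ioi_inter_Iio, Real.volume_Ioo, sub_zero, hkE]
  have hlev : ∀ a : ℝ, 0 < a → ∃ r : ℝ, ∀ z : Ed d, a < hk t z ↔ ‖z‖ < r := by
    intro a ha
    set c := (4 * Real.pi * t) ^ (-(d : ℝ) / 2) with hc
    have hc0 : 0 < c := by positivity
    have e : ∀ z : Ed d, a < hk t z ↔ ‖z‖ ^ 2 < -(4 * t) * Real.log (a / c) := by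
      intro z
      unfold hk
      rw [← hc, ← div_lt_iff₀' hc0, ← Real.log_lt_iff_lt_exp (by positivity),
        lt_div_iff₀ (by positivity)]
      constructor <;> intro h <;> nlinarith
    by_cases h0 : 0 ≤ -(4 * t) * Real.log (a / c)
    · refine ⟨Real.sqrt (-(4 * t) * Real.log (a / c)), fun z => ?_⟩
      rw [e, Real.lt_sqrt (norm_nonneg z)]
    · refine ⟨0, fun z => ?_⟩
      rw [e]
      constructor
      · intro h; nlinarith [sq_nonneg ‖z‖]
      · intro h; exact absurd h (not_lt.2 (norm_nonneg z))
  have hmeas : Measurable fun p : Ed d × ℝ => (if p.2 < hk t (x - p.1) then 1 else 0 : ℝ≥0∞) :=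
    Measurable.ite (measurableSet_lt (by fun_prop) (by fun_prop)) measurable_const measurable_const
  have hind : ∀ (r : ℝ) (ψ : Ed d → ℝ≥0∞), ∫⁻ z, (if ‖x - z‖ < r then 1 else 0 : ℝ≥0∞) * ψ z
      = ∫⁻ z in Metric.ball x r, ψ z := by
    intro r ψ
    rw [← lintegral_indicator Metric.isOpen_ball.measurableSet]
    refine lintegral_congr fun z => ?_
    simp [indicator, dist_eq_norm, norm_sub_rev z x]
  have expand : ∀ ψ : Ed d → ℝ≥0∞, Measurable ψ → ∫⁻ z, hkE t (x - z) * ψ z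
      = ∫⁻ a in Ioi (0 : ℝ), ∫⁻ z, (if a < hk t (x - z) then 1 else 0 : ℝ≥0∞) * ψ z := by
    intro ψ hψ
    simp_rw [layer]
    have h1 : ∀ z, (∫⁻ a in Ioi (0 : ℝ), (if a < hk t (x - z) then 1 else 0 : ℝ≥0∞)) * ψ z
        = ∫⁻ a in Ioi (0 : ℝ), (if a < hk t (x - z) then 1 else 0 : ℝ≥0∞) * ψ z := fun z =>
      (lintegral_mul_const _ (hmeas.comp measurable_prodMk_left)).symm
    simp_rw [h1]
    rw [lintegral_lintegral_swap]
    exact (hmeas.mul (hψ.comp measurable_fst)).aemeasurable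
  have hcon := expand (fun _ => 1) measurable_const
  simp only [mul_one] at hcon
  rw [lintegral_hkE_sub ht] at hcon
  have hmeas2 : Measurable fun a : ℝ => ∫⁻ z, (if a < hk t (x - z) then 1 else 0 : ℝ≥0∞) :=
    (hmeas.comp measurable_swap).lintegral_prod_right'
  unfold Pe
  rw [expand φ hφ]
  calc _ ≤ ∫⁻ a in Ioi (0 : ℝ), maxFun φ x *
        ∫⁻ z, (if a < hk t (x - z) then 1 else 0 : ℝ≥0∞) := by
        refine setLIntegral_mono (hmeas2.const_mul _) fun a ha => ?_
        obtain ⟨r, hr⟩ := hlev a ha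
        simp_rw [hr]
        have h1 := hind r (fun _ => 1)
        simp only [mul_one] at h1
        rw [hind, h1, setLIntegral_one]
        exact setLIntegral_ball_le φ x r
    _ = maxFun φ x := by
        rw [lintegral_const_mul _ hmeas2, ← hcon, mul_one]

lemma hk_le_hk {s t : ℝ} (hs : 0 < s) (hst : s ≤ t) (x : Ed d) :
    hk s x ≤ (t / s) ^ ((d : ℝ) / 2) * hk t x := by
  have ht : 0 < t := hs.trans_le hst
  unfold hk
  have e : (4 * Real.pi * s) ^ (-(d : ℝ) / 2)
      = (t / s) ^ ((d : ℝ) / 2) * (4 * Real.pi * t) ^ (-(d : ℝ) / 2) := by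
    rw [neg_div, Real.rpow_neg (by positivity), Real.rpow_neg (by positivity),
      Real.mul_rpow (by positivity) hs.le, Real.mul_rpow (by positivity) ht.le,
      Real.div_rpow ht.le hs.le]
    have h1 := Real.rpow_pos_of_pos ht ((d : ℝ) / 2)
    field_simp
  rw [e, mul_assoc]
  gcongr _ * (_ * Real.exp ?_)
  rw [neg_div, neg_div, neg_le_neg_iff]
  gcongr

lemma hk_le_of_near {a : ℝ} (ha : 0 < a) {x z : Ed d} (h : ‖z - x‖ ^ 2 ≤ a) (y : Ed d) :
    hk a (x - y) ≤ (2 ^ ((d : ℝ) / 2) * Real.exp (1 / 4)) * hk (2 * a) (z - y) := by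
  have h1 : ‖z - y‖ ^ 2 ≤ 2 * ‖x - y‖ ^ 2 + 2 * a := by
    have : z - y = (z - x) + (x - y) := by abel
    have h2 := norm_add_le (z - x) (x - y)
    rw [← this] at h2
    nlinarith [norm_nonneg (z - y), norm_nonneg (z - x), norm_nonneg (x - y),
      sq_nonneg (‖z - x‖ - ‖x - y‖)]
  unfold hk
  have e : (4 * Real.pi * a) ^ (-(d : ℝ) / 2)
      = 2 ^ ((d : ℝ) / 2) * (4 * Real.pi * (2 * a)) ^ (-(d : ℝ) / 2) := by
    have e2 : 4 * Real.pi * (2 * a) = 2 * (4 * Real.pi * a) := by ring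
    rw [e2, neg_div, Real.rpow_neg (by positivity), Real.rpow_neg (by positivity),
      Real.mul_rpow (two_pos.le) (by positivity)]
    have h1 := Real.rpow_pos_of_pos (two_pos (α := ℝ)) ((d : ℝ) / 2)
    field_simp
  have h3 : Real.exp (-‖x - y‖ ^ 2 / (4 * a))
      ≤ Real.exp (1 / 4) * Real.exp (-‖z - y‖ ^ 2 / (4 * (2 * a))) := by
    rw [← Real.exp_add, Real.exp_le_exp]
    have e2 : 1 / 4 + -‖z - y‖ ^ 2 / (4 * (2 * a)) - -‖x - y‖ ^ 2 / (4 * a)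
        = (2 * a + 2 * ‖x - y‖ ^ 2 - ‖z - y‖ ^ 2) / (8 * a) := by field_simp; ring
    have : 0 ≤ (2 * a + 2 * ‖x - y‖ ^ 2 - ‖z - y‖ ^ 2) / (8 * a) :=
      div_nonneg (by linarith) (by positivity)
    linarith
  calc _ ≤ (2 ^ ((d : ℝ) / 2) * (4 * Real.pi * (2 * a)) ^ (-(d : ℝ) / 2)) *
        (Real.exp (1 / 4) * Real.exp (-‖z - y‖ ^ 2 / (4 * (2 * a)))) := by rw [e]; gcongr
    _ = _ := by ring

lemma Pe_le_of_near {a : ℝ} (ha : 0 < a) {x z : Ed d} (h : ‖z - x‖ ^ 2 ≤ a)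
    {φ : Ed d → ℝ≥0∞} (hφ : Measurable φ) :
    Pe a φ x ≤ ENNReal.ofReal (2 ^ ((d : ℝ) / 2) * Real.exp (1 / 4)) * Pe (2 * a) φ z := by
  unfold Pe
  rw [← lintegral_const_mul _ (by fun_prop)]
  refine lintegral_mono fun y => ?_
  rw [← mul_assoc]
  gcongr
  unfold hkE
  rw [← ENNReal.ofReal_mul (by positivity)]
  exact ENNReal.ofReal_le_ofReal (hk_le_of_near ha h y)

lemma Pe_le_Pe {s t : ℝ} (hs : 0 < s) (hst : s ≤ t) {φ : Ed d → ℝ≥0∞} (hφ : Measurable φ)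
    (x : Ed d) : Pe s φ x ≤ ENNReal.ofReal ((t / s) ^ ((d : ℝ) / 2)) * Pe t φ x := by
  have ht : 0 < t := hs.trans_le hst
  unfold Pe
  rw [← lintegral_const_mul _ (by fun_prop)]
  refine lintegral_mono fun y => ?_
  rw [← mul_assoc]
  gcongr
  unfold hkE
  rw [← ENNReal.ofReal_mul (by positivity)]
  exact ENNReal.ofReal_le_ofReal (hk_le_hk hs hst _)

lemma rpow_gap_unit {p : ℝ} (hp1 : 1 < p) (hp2 : p ≤ 2) {u : ℝ} (hu : 0 ≤ u) :
    p * u + p * (p - 1) / 2 * (max (1 - u) 0) ^ 2 ≤ u ^ p + (p - 1) := by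
  rcases le_total 1 u with h1 | h1
  · rw [max_eq_right (by linarith)]
    have := one_add_mul_self_le_rpow_one_add (s := u - 1) (by linarith) hp1.le
    rw [add_sub_cancel] at this
    nlinarith
  rw [max_eq_left (by linarith)]
  set g : ℝ → ℝ := fun y => y ^ p - p * y - p * (p - 1) / 2 * (1 - y) ^ 2 with hg
  have hanti : AntitoneOn g (Icc 0 1) := by
    have hder : ∀ y ∈ interior (Icc (0 : ℝ) 1),
        HasDerivAt g (p * y ^ (p - 1) - p + p * (p - 1) * (1 - y)) y := by
      intro y hy
      rw [interior_Icc] at hy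
      have h2 := (Real.hasDerivAt_rpow_const (x := y) (p := p) (Or.inl hy.1.ne'))
      have h3 : HasDerivAt (fun y : ℝ => (1 - y) ^ 2) (2 * (1 - y) * (-1)) y := by
        have := ((hasDerivAt_id' y).const_sub 1).fun_pow 2
        exact this.congr_deriv (by norm_num)
      have := (h2.fun_sub ((hasDerivAt_id' y).const_mul p)).fun_sub (h3.const_mul (p * (p - 1) / 2))
      exact this.congr_deriv (by ring)
    refine antitoneOn_of_deriv_nonpos (convex_Icc 0 1) ?_
      (fun y hy => (hder y hy).differentiableAt.differentiableWithinAt) ?_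
    · have : Continuous fun y : ℝ => y ^ p := Real.continuous_rpow_const (by linarith)
      exact Continuous.continuousOn (by fun_prop)
    · intro y hy
      rw [(hder y hy).deriv]
      rw [interior_Icc] at hy
      have := rpow_one_add_le_one_add_mul_self (s := y - 1) (p := p - 1) (by linarith [hy.1])
        (by linarith) (by linarith)
      rw [add_sub_cancel] at this
      nlinarith
  have := hanti ⟨hu, h1⟩ (right_mem_Icc.2 zero_le_one) h1
  simp only [hg, Real.one_rpow] at this
  nlinarith

lemma rpow_gap {p : ℝ} (hp1 : 1 < p) (hp2 : p ≤ 2) {x y : ℝ≥0∞} (hx : x ≠ ⊤) (hy : y ≠ ⊤) :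
    ENNReal.ofReal p * (x * y) + ENNReal.ofReal (p * (p - 1) / 2) * (x - y) ^ 2
      ≤ x ^ (2 - p) * y ^ p + ENNReal.ofReal (p - 1) * x ^ 2 := by
  rcases eq_or_ne x 0 with rfl | hx0
  · simp
  lift x to NNReal using hx
  lift y to NNReal using hy
  have hxpos : (0 : ℝ) < x := by
    have : x ≠ 0 := by simpa using hx0
    exact_mod_cast pos_iff_ne_zero.2 this
  have h := rpow_gap_unit hp1 hp2 (u := (y : ℝ) / x) (by positivity)
  have e1 : (x : ℝ) * max (1 - (y : ℝ) / (x : ℝ)) 0 = ((x - y : NNReal) : ℝ) := by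
    rw [NNReal.coe_sub_def, mul_max_of_nonneg _ _ hxpos.le, mul_zero]
    congr 1
    field_simp
  have h2 := mul_le_mul_of_nonneg_left h (sq_nonneg (x : ℝ))
  have e2 : (x : ℝ) ^ 2 * ((y / x : ℝ) ^ p + (p - 1))
      = (x : ℝ) ^ (2 - p) * (y : ℝ) ^ p + (p - 1) * (x : ℝ) ^ 2 := by
    rw [Real.div_rpow (by positivity) hxpos.le, Real.rpow_sub hxpos, Real.rpow_two]
    have := Real.rpow_pos_of_pos hxpos p
    field_simp
  have e3 : (x : ℝ) ^ 2 * (p * (y / x) + p * (p - 1) / 2 * (max (1 - (y : ℝ) / x) 0) ^ 2)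
      = p * (x * y) + p * (p - 1) / 2 * ((x - y : NNReal) : ℝ) ^ 2 := by
    rw [← e1]
    field_simp
  rw [e2, e3] at h2
  have hp0 : 0 ≤ p - 1 := by linarith
  have hp0' : 0 ≤ p := by linarith
  have h3 := ENNReal.ofReal_le_ofReal h2
  rw [ENNReal.ofReal_add (by positivity) (by positivity),
    ENNReal.ofReal_add (by positivity) (by positivity), ENNReal.ofReal_mul (by positivity),
    ENNReal.ofReal_mul (by positivity), ENNReal.ofReal_mul (by positivity),
    ENNReal.ofReal_mul (by positivity), ENNReal.ofReal_mul (by positivity),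
    ← ENNReal.ofReal_rpow_of_pos hxpos,
    ← ENNReal.ofReal_rpow_of_nonneg (by positivity) hp0', ENNReal.ofReal_pow (by positivity),
    ENNReal.ofReal_pow (by positivity)] at h3
  simpa only [ENNReal.ofReal_coe_nnreal, ENNReal.coe_sub] using h3

/-- One-sided local oscillation of the heat extension. -/
def dlt (φ : Ed d → ℝ≥0∞) (t : ℝ) (x : Ed d) : ℝ≥0∞ :=
  ∫⁻ z, hkE t (x - z) * (Pe (2 * t) φ x - Pe t φ z)

lemma measurable_Pe_pair {φ : Ed d → ℝ≥0∞} (hφ : Measurable φ) {α : Type*} [MeasurableSpace α]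
    {t : α → ℝ} {x : α → Ed d} (ht : Measurable t) (hx : Measurable x) :
    Measurable fun a => Pe (t a) φ (x a) := by
  have h := (measurable_Pe_uncurry hφ).comp (ht.prodMk hx)
  simpa only [Function.comp_def] using h

lemma measurable_dlt_uncurry {φ : Ed d → ℝ≥0∞} (hφ : Measurable φ) :
    Measurable fun p : ℝ × Ed d => dlt φ p.1 p.2 := by
  unfold dlt
  refine Measurable.lintegral_prod_right' (f := fun q : (ℝ × Ed d) × Ed d =>
    hkE q.1.1 (q.1.2 - q.2) * (Pe (2 * q.1.1) φ q.1.2 - Pe q.1.1 φ q.2)) ?_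
  exact (by fun_prop : Measurable fun q : (ℝ × Ed d) × Ed d => hkE q.1.1 (q.1.2 - q.2)).mul
    ((measurable_Pe_pair hφ (by fun_prop) (by fun_prop)).sub
      (measurable_Pe_pair hφ (by fun_prop) (by fun_prop)))

lemma measurable_dlt_pair {φ : Ed d → ℝ≥0∞} (hφ : Measurable φ) {α : Type*} [MeasurableSpace α]
    {t : α → ℝ} {x : α → Ed d} (ht : Measurable t) (hx : Measurable x) :
    Measurable fun a => dlt φ (t a) (x a) := by
  have h := (measurable_dlt_uncurry hφ).comp (ht.prodMk hx)
  simpa only [Function.comp_def] using h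

lemma Pe_le_of_le {t : ℝ} (ht : 0 < t) {φ : Ed d → ℝ≥0∞} {c : ℝ≥0∞} (h : ∀ x, φ x ≤ c) (x : Ed d) :
    Pe t φ x ≤ c := (Pe_mono h x).trans (Pe_const ht c x).le

lemma dlt_sq_le {p : ℝ} (hp1 : 1 < p) (hp2 : p ≤ 2) {φ : Ed d → ℝ≥0∞} (hφ : Measurable φ)
    {c : ℝ≥0∞} (hc : c ≠ ⊤) (hφc : ∀ x, φ x ≤ c) {t : ℝ} (ht : 0 < t) (x : Ed d) :
    ENNReal.ofReal (p * (p - 1) / 2) * dlt φ t x ^ 2 + Pe (2 * t) φ x ^ 2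
      ≤ Pe (2 * t) φ x ^ (2 - p) * Pe t (fun z => Pe t φ z ^ p) x := by
  have hu : ∀ z, Pe t φ z ≠ ⊤ := fun z => ne_top_of_le_ne_top hc (Pe_le_of_le ht hφc z)
  have hX : Pe (2 * t) φ x ≠ ⊤ :=
    ne_top_of_le_ne_top hc (Pe_le_of_le (by positivity) hφc x)
  have hum : Measurable (Pe t φ) := measurable_Pe hφ t
  set X := Pe (2 * t) φ x with hXdef
  have hPP : ∫⁻ z, hkE t (x - z) * Pe t φ z = X := by
    have := Pe_Pe ht ht hφ x
    rw [← two_mul] at this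
    exact this
  have hCS : dlt φ t x ^ 2 ≤ ∫⁻ z, hkE t (x - z) * (X - Pe t φ z) ^ 2 := by
    have h := Pe_rpow_le ht (p := 2) (by norm_num) (φ := fun z => X - Pe t φ z) (by fun_prop) x
    simp only [ENNReal.rpow_ofNat] at h
    exact h
  have key : ∫⁻ z, hkE t (x - z) * (ENNReal.ofReal p * (X * Pe t φ z) +
        ENNReal.ofReal (p * (p - 1) / 2) * (X - Pe t φ z) ^ 2)
      ≤ ∫⁻ z, hkE t (x - z) * (X ^ (2 - p) * Pe t φ z ^ p + ENNReal.ofReal (p - 1) * X ^ 2) :=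
    lintegral_mono fun z => mul_le_mul' le_rfl (rpow_gap hp1 hp2 hX (hu z))
  have eL : ∫⁻ z, hkE t (x - z) * (ENNReal.ofReal p * (X * Pe t φ z) +
        ENNReal.ofReal (p * (p - 1) / 2) * (X - Pe t φ z) ^ 2)
      = ENNReal.ofReal p * (X * X) + ENNReal.ofReal (p * (p - 1) / 2) *
        ∫⁻ z, hkE t (x - z) * (X - Pe t φ z) ^ 2 := by
    simp_rw [mul_add]
    rw [lintegral_add_left (by fun_prop), ← lintegral_const_mul _ (by fun_prop)]
    congr 1
    · calc _ = ∫⁻ z, ENNReal.ofReal p * X * (hkE t (x - z) * Pe t φ z) :=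
            lintegral_congr fun z => by ring
        _ = _ := by rw [lintegral_const_mul _ (by fun_prop), hPP, mul_assoc]
    · refine lintegral_congr fun z => by ring
  have eR : ∫⁻ z, hkE t (x - z) * (X ^ (2 - p) * Pe t φ z ^ p + ENNReal.ofReal (p - 1) * X ^ 2)
      = X ^ (2 - p) * Pe t (fun z => Pe t φ z ^ p) x + ENNReal.ofReal (p - 1) * X ^ 2 := by
    simp_rw [mul_add]
    rw [lintegral_add_left (by fun_prop), lintegral_mul_const _ (by fun_prop),
      lintegral_hkE_sub ht, one_mul]
    congr 1
    unfold Pe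
    change _ = _ * ∫⁻ z, hkE t (x - z) * Pe t φ z ^ p
    rw [← lintegral_const_mul _ (by fun_prop)]
    change ∫⁻ z, hkE t (x - z) * (X ^ (2 - p) * Pe t φ z ^ p) = _
    refine lintegral_congr fun z => by ring
  rw [eL, eR] at key
  have hsplit : ENNReal.ofReal p * (X * X) = X ^ 2 + ENNReal.ofReal (p - 1) * X ^ 2 := by
    have : ENNReal.ofReal p = 1 + ENNReal.ofReal (p - 1) := by
      rw [← ENNReal.ofReal_one, ← ENNReal.ofReal_add (by norm_num) (by linarith)]
      congr 1; ring
    rw [this]; ring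
  have hfin : ENNReal.ofReal (p - 1) * X ^ 2 ≠ ⊤ :=
    ENNReal.mul_ne_top ENNReal.ofReal_ne_top (ENNReal.pow_ne_top hX)
  refine (ENNReal.add_le_add_iff_right hfin).1 (le_trans ?_ key)
  rw [hsplit]
  calc _ ≤ ENNReal.ofReal (p * (p - 1) / 2) * (∫⁻ z, hkE t (x - z) * (X - Pe t φ z) ^ 2)
        + X ^ 2 + ENNReal.ofReal (p - 1) * X ^ 2 := by gcongr
    _ = _ := by ring

lemma measurable_section_left {α β γ : Type*} [MeasurableSpace α] [MeasurableSpace β]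
    [MeasurableSpace γ] {f : α → β → γ} (h : Measurable fun q : α × β => f q.1 q.2) (y : β) :
    Measurable fun a => f a y :=
  h.comp (measurable_id.prodMk measurable_const)

lemma measurable_section_right {α β γ : Type*} [MeasurableSpace α] [MeasurableSpace β]
    [MeasurableSpace γ] {f : α → β → γ} (h : Measurable fun q : α × β => f q.1 q.2) (x : α) :
    Measurable fun b => f x b :=
  h.comp (measurable_const.prodMk measurable_id)

lemma measurable_flip {α β γ : Type*} [MeasurableSpace α] [MeasurableSpace β]
    [MeasurableSpace γ] {f : α → β → γ} (h : Measurable fun q : α × β => f q.1 q.2) :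
    Measurable fun q : β × α => f q.2 q.1 :=
  h.comp measurable_swap

lemma lintegral_Pe_rpow_le {t : ℝ} (ht : 0 < t) {p : ℝ} (hp : 1 ≤ p) {φ : Ed d → ℝ≥0∞}
    (hφ : Measurable φ) : ∫⁻ x, Pe t φ x ^ p ≤ ∫⁻ x, φ x ^ p :=
  (lintegral_mono fun x => Pe_rpow_le ht hp hφ x).trans (lintegral_Pe ht (hφ.pow_const p)).le

set_option maxHeartbeats 1000000 in
/-- Littlewood-Paley estimate for the local oscillations, `1 < p ≤ 2`. -/
lemma lintegral_dlt_sqfun_le (hd : 1 ≤ d) {p : ℝ} (hp1 : 1 < p) (hp2 : p ≤ 2) :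
    ∃ C : ℝ≥0∞, C ≠ ⊤ ∧ ∀ φ : Ed d → ℝ≥0∞, Measurable φ → (∃ c : ℝ≥0∞, c ≠ ⊤ ∧ ∀ x, φ x ≤ c) →
      ∫⁻ x, (∫⁻ τ, dlt φ τ x ^ 2 ∂mu0) ^ (p / 2) ≤ C * ∫⁻ x, φ x ^ p := by
  obtain ⟨CM, hCM, hM⟩ := lintegral_maxFun_rpow_le hd hp1
  set k : ℝ≥0∞ := ENNReal.ofReal (p * (p - 1) / 2) with hk
  have hk0 : k ≠ 0 := by
    rw [hk]; simp only [ne_eq, ENNReal.ofReal_eq_zero, not_le]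
    have : 0 < p - 1 := by linarith
    positivity
  have hkt : k ≠ ⊤ := ENNReal.ofReal_ne_top
  refine ⟨(k⁻¹) ^ (p / 2) * ((ENNReal.ofReal CM) ^ ((2 - p) / 2) *
    (ENNReal.ofReal (Real.log 2)) ^ (p / 2)), ?_, ?_⟩
  · refine ENNReal.mul_ne_top (ENNReal.rpow_ne_top_of_nonneg (by linarith) (ENNReal.inv_ne_top.2 hk0))
      (ENNReal.mul_ne_top (ENNReal.rpow_ne_top_of_nonneg (by linarith) ENNReal.ofReal_ne_top)
      (ENNReal.rpow_ne_top_of_nonneg (by linarith) ENNReal.ofReal_ne_top))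
  rintro φ hφ ⟨c, hc, hφc⟩
  set gap : ℝ → Ed d → ℝ≥0∞ := fun t x =>
    Pe t (fun z => Pe t φ z ^ p) x - Pe (2 * t) φ x ^ p with hgap
  have hgapm : Measurable fun q : ℝ × Ed d => gap q.1 q.2 := by
    refine Measurable.sub (measurable_Pe_comp (φ := fun (q : ℝ × Ed d) z => Pe q.1 φ z ^ p)
      ?_ measurable_fst measurable_snd)
      ((measurable_Pe_pair hφ (by fun_prop) (by fun_prop)).pow_const p)
    exact (measurable_Pe_pair hφ (by fun_prop) (by fun_prop)).pow_const p
  have hXt : ∀ t, 0 < t → ∀ x, Pe t φ x ≠ ⊤ :=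
    fun t ht x => ne_top_of_le_ne_top hc (Pe_le_of_le ht hφc x)
  have hpt : ∀ t, 0 < t → ∀ x, dlt φ t x ^ 2 ≤ k⁻¹ * (maxFun φ x ^ (2 - p) * gap t x) := by
    intro t ht x
    have h := dlt_sq_le hp1 hp2 hφ hc hφc ht x
    have h2t : 0 < 2 * t := by positivity
    set X := Pe (2 * t) φ x with hX
    have hX2 : X ^ 2 = X ^ (2 - p) * X ^ p := by
      rw [← ENNReal.rpow_add_of_nonneg _ _ (by linarith) (by linarith)]
      norm_num
    have h3 : k * dlt φ t x ^ 2 ≤ X ^ (2 - p) * gap t x := by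
      rw [hgap]
      simp only
      rw [ENNReal.mul_sub (fun _ _ => ENNReal.rpow_ne_top_of_nonneg (by linarith) (hXt _ h2t x)),
        ← hX2]
      refine ENNReal.le_sub_of_add_le_right (ENNReal.pow_ne_top (hXt _ h2t x)) h
    rw [mul_comm k⁻¹, ← div_eq_mul_inv, ENNReal.le_div_iff_mul_le (Or.inl hk0) (Or.inl hkt), mul_comm]
    refine h3.trans (mul_le_mul' (ENNReal.rpow_le_rpow (Pe_le_maxFun h2t hφ x) (by linarith)) le_rfl)
  have hgx : ∀ x, Measurable fun t => gap t x := fun x =>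
    measurable_section_left hgapm x
  have hgI : Measurable fun x => ∫⁻ t, gap t x ∂mu0 :=
    Measurable.lintegral_prod_left' (f := fun q : ℝ × Ed d => gap q.1 q.2) hgapm
  have hx : ∀ x, (∫⁻ τ, dlt φ τ x ^ 2 ∂mu0) ^ (p / 2) ≤ (k⁻¹) ^ (p / 2) *
      ((maxFun φ x ^ p) ^ ((2 - p) / 2) * (∫⁻ t, gap t x ∂mu0) ^ (p / 2)) := by
    intro x
    have : ∫⁻ τ, dlt φ τ x ^ 2 ∂mu0 ≤ k⁻¹ * (maxFun φ x ^ (2 - p) * ∫⁻ t, gap t x ∂mu0) := by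
      rw [← lintegral_const_mul _ (hgx x), ← lintegral_const_mul _ ((hgx x).const_mul _)]
      exact lintegral_mu0_mono fun t ht => hpt t ht x
    refine (ENNReal.rpow_le_rpow this (by linarith)).trans_eq ?_
    rw [ENNReal.mul_rpow_of_nonneg _ _ (by linarith), ENNReal.mul_rpow_of_nonneg _ _ (by linarith),
      ← ENNReal.rpow_mul, ← ENNReal.rpow_mul]
    congr 3
    ring
  have htel : ∫⁻ t, (∫⁻ x, gap t x) ∂mu0 ≤ (∫⁻ x, φ x ^ p) * ENNReal.ofReal (Real.log 2) := by
    refine lintegral_mu0_telescope (E := fun t => ∫⁻ x, Pe t φ x ^ p) ?_ ?_ ?_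
    · exact Measurable.lintegral_prod_right' (f := fun q : ℝ × Ed d => Pe q.1 φ q.2 ^ p)
        ((measurable_Pe_uncurry hφ).pow_const p)
    · exact fun t ht => lintegral_Pe_rpow_le ht hp1.le hφ
    · intro t ht
      have hm : Measurable fun z => Pe t φ z ^ p := (measurable_Pe hφ t).pow_const p
      rw [← lintegral_Pe ht hm, ← lintegral_add_right _ ((measurable_Pe hφ _).pow_const p)]
      refine lintegral_mono fun x => ?_
      rw [hgap]
      refine (tsub_add_cancel_of_le ?_).le
      rw [two_mul, ← Pe_Pe ht ht hφ x]
      exact Pe_rpow_le ht hp1.le (measurable_Pe hφ t) x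
  have hswap : ∫⁻ x, ∫⁻ t, gap t x ∂mu0 = ∫⁻ t, (∫⁻ x, gap t x) ∂mu0 :=
    lintegral_lintegral_swap ((measurable_flip hgapm).aemeasurable)
  calc ∫⁻ x, (∫⁻ τ, dlt φ τ x ^ 2 ∂mu0) ^ (p / 2)
      ≤ ∫⁻ x, (k⁻¹) ^ (p / 2) *
      ((maxFun φ x ^ p) ^ ((2 - p) / 2) * (∫⁻ t, gap t x ∂mu0) ^ (p / 2)) := lintegral_mono hx
    _ = (k⁻¹) ^ (p / 2) * ∫⁻ x,
      ((maxFun φ x ^ p) ^ ((2 - p) / 2) * (∫⁻ t, gap t x ∂mu0) ^ (p / 2)) :=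
        lintegral_const_mul _ ((((measurable_maxFun φ).pow_const _).pow_const _).mul (hgI.pow_const _))
    _ ≤ (k⁻¹) ^ (p / 2) * ((∫⁻ x, maxFun φ x ^ p) ^ ((2 - p) / 2) *
        (∫⁻ x, ∫⁻ t, gap t x ∂mu0) ^ (p / 2)) := by
        gcongr
        exact ENNReal.lintegral_mul_norm_pow_le ((measurable_maxFun φ).pow_const _).aemeasurable
          hgI.aemeasurable (by linarith) (by linarith) (by ring)
    _ ≤ (k⁻¹) ^ (p / 2) * ((ENNReal.ofReal CM * ∫⁻ x, φ x ^ p) ^ ((2 - p) / 2) *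
        ((∫⁻ x, φ x ^ p) * ENNReal.ofReal (Real.log 2)) ^ (p / 2)) := by
        have h2 : 0 ≤ (2 - p) / 2 := by linarith
        rw [hswap]
        gcongr
        exact hM φ hφ
    _ = _ := by
        have e : ∀ I : ℝ≥0∞, I = I ^ ((2 - p) / 2) * I ^ (p / 2) := fun I => by
          rw [← ENNReal.rpow_add_of_nonneg _ _ (by linarith) (by linarith)]
          ring_nf; simp
        rw [ENNReal.mul_rpow_of_nonneg _ _ (by linarith), ENNReal.mul_rpow_of_nonneg _ _ (by linarith)]
        conv_rhs => rw [e (∫⁻ x, φ x ^ p)]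
        ring

lemma exists_ball_lower (d : ℕ) : ∃ κ : ℝ≥0∞, κ ≠ 0 ∧ κ ≠ ⊤ ∧ ∀ {a : ℝ}, 0 < a → ∀ (x : Ed d)
    {ω : Ed d → ℝ≥0∞} {m : ℝ≥0∞}, (∀ z, ‖z - x‖ ^ 2 ≤ a → m ≤ ω z) → κ * m ≤ Pe (6 * a) ω x := by
  set V := volume (Metric.ball (0 : Ed d) 1) with hV
  have hV0 : V ≠ 0 := (Metric.measure_ball_pos _ _ one_pos).ne'
  have hVt : V ≠ ⊤ := measure_ball_lt_top.ne
  set c := (24 * Real.pi) ^ (-(d : ℝ) / 2) * Real.exp (-(1 / 24)) with hc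
  have hc0 : 0 < c := by positivity
  refine ⟨ENNReal.ofReal c * V, mul_ne_zero (by simpa using hc0) hV0,
    ENNReal.mul_ne_top ENNReal.ofReal_ne_top hVt, ?_⟩
  intro a ha x ω m h
  have hball : volume (Metric.ball x (√a)) = ENNReal.ofReal (a ^ ((d : ℝ) / 2)) * V := by
    rw [Measure.addHaar_ball_of_pos _ _ (Real.sqrt_pos.2 ha), finrank_euclideanSpace_fin]
    congr 2
    rw [Real.sqrt_eq_rpow, ← Real.rpow_natCast, ← Real.rpow_mul ha.le]
    congr 1; ring
  have hlow : ∀ z ∈ Metric.ball x (√a), ENNReal.ofReal (c * a ^ (-((d : ℝ) / 2))) * m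
      ≤ hkE (6 * a) (x - z) * ω z := by
    intro z hz
    have hz2 : ‖z - x‖ ^ 2 ≤ a := by
      rw [Metric.mem_ball, dist_eq_norm] at hz
      calc ‖z - x‖ ^ 2 ≤ √a ^ 2 := by gcongr
        _ = a := Real.sq_sqrt ha.le
    refine mul_le_mul' (ENNReal.ofReal_le_ofReal ?_) (h z hz2)
    rw [hk_eq, norm_sub_rev, hc, show 4 * Real.pi * (6 * a) = (24 * Real.pi) * a by ring,
      Real.mul_rpow (by positivity) ha.le, neg_div]
    have : -(1 / 24) ≤ -(1 / (4 * (6 * a))) * ‖z - x‖ ^ 2 := by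
      have : 1 / (4 * (6 * a)) * ‖z - x‖ ^ 2 ≤ 1 / (4 * (6 * a)) * a := by gcongr
      have e : 1 / (4 * (6 * a)) * a = 1 / 24 := by field_simp; norm_num
      linarith
    have := Real.exp_le_exp.2 this
    have hpos : 0 ≤ (24 * Real.pi) ^ (-((d : ℝ) / 2)) * a ^ (-((d : ℝ) / 2)) := by positivity
    calc _ = (24 * Real.pi) ^ (-((d : ℝ) / 2)) * a ^ (-((d : ℝ) / 2)) * Real.exp (-(1 / 24)) := by ring
      _ ≤ _ := mul_le_mul_of_nonneg_left this hpos
  calc ENNReal.ofReal c * V * m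
      = ∫⁻ z in Metric.ball x (√a), ENNReal.ofReal (c * a ^ (-((d : ℝ) / 2))) * m := by
        rw [setLIntegral_const, hball, ENNReal.ofReal_mul hc0.le]
        have : ENNReal.ofReal (a ^ (-((d : ℝ) / 2))) * ENNReal.ofReal (a ^ ((d : ℝ) / 2)) = 1 := by
          rw [← ENNReal.ofReal_mul (by positivity), ← Real.rpow_add ha]; simp
        calc _ = ENNReal.ofReal c * V * m *
            (ENNReal.ofReal (a ^ (-((d : ℝ) / 2))) * ENNReal.ofReal (a ^ ((d : ℝ) / 2))) := by
              rw [this, mul_one]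
          _ = _ := by ring
    _ ≤ ∫⁻ z in Metric.ball x (√a), hkE (6 * a) (x - z) * ω z :=
        setLIntegral_mono' measurableSet_ball hlow
    _ ≤ _ := setLIntegral_le_lintegral _ _

lemma rpow_add_mul_le {r : ℝ} (hr : 1 < r) {a b o : ℝ≥0∞} (ho : o ≤ a) :
    o ^ (r - 1) * b + a ^ r ≤ (a + b) ^ r := by
  have e : ∀ y : ℝ≥0∞, y ^ r = y ^ (r - 1) * y := fun y => by
    conv_rhs => rw [← ENNReal.rpow_one y, ← ENNReal.rpow_mul, one_mul,
      ← ENNReal.rpow_add_of_nonneg _ _ (by linarith) (by linarith)]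
    norm_num
  have hr' : 0 ≤ r - 1 := by linarith
  rw [e (a + b), e a, mul_add, add_comm]
  gcongr
  · exact le_self_add
  · exact ho.trans le_self_add

set_option maxHeartbeats 1000000 in
/-- Littlewood-Paley estimate for averaged local oscillations, exponent `2 r > 2`. -/
lemma lintegral_Pe_dlt_sqfun_le (hd : 1 ≤ d) {r : ℝ} (hr : 1 < r) :
    ∃ C : ℝ≥0∞, C ≠ ⊤ ∧ ∀ φ : Ed d → ℝ≥0∞, Measurable φ → (∃ c : ℝ≥0∞, c ≠ ⊤ ∧ ∀ x, φ x ≤ c) →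
      ∫⁻ x, (∫⁻ τ, Pe (τ / 3) (fun z => dlt φ τ z ^ 2) x ∂mu0) ^ r
        ≤ C * ∫⁻ x, φ x ^ (2 * r) := by
  have hr0 : 0 < r - 1 := by linarith
  have hrq : r.HolderConjugate (r.conjExponent) := Real.HolderConjugate.conjExponent hr
  set q := r.conjExponent with hq
  have hqr : q = r / (r - 1) := rfl
  obtain ⟨CM, hCM, hM⟩ := lintegral_maxFun_rpow_le hd hrq.symm.lt
  obtain ⟨κ, hκ0, hκt, hκ⟩ := exists_ball_lower d
  set c1 : ℝ≥0∞ := ENNReal.ofReal (2 ^ ((d : ℝ) / 2) * Real.exp (1 / 4)) with hc1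
  have hc10 : c1 ≠ 0 := by rw [hc1]; simp only [ne_eq, ENNReal.ofReal_eq_zero, not_le]; positivity
  have hc1t : c1 ≠ ⊤ := ENNReal.ofReal_ne_top
  set c2 : ℝ≥0∞ := c1 * (κ⁻¹) ^ (r - 1) with hc2
  have hc2t : c2 ≠ ⊤ := ENNReal.mul_ne_top hc1t
    (ENNReal.rpow_ne_top_of_nonneg hr0.le (ENNReal.inv_ne_top.2 hκ0))
  set C0 : ℝ≥0∞ := c2 * (2 ^ (r - 1) * (1 + ENNReal.ofReal CM) * ENNReal.ofReal (Real.log 2)) with hC0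
  have hC0t : C0 ≠ ⊤ := by
    refine ENNReal.mul_ne_top hc2t (ENNReal.mul_ne_top (ENNReal.mul_ne_top ?_ ?_) ENNReal.ofReal_ne_top)
    · exact ENNReal.rpow_ne_top_of_nonneg hr0.le (by simp)
    · simp
  obtain ⟨C', hC', habs⟩ := lintegral_rpow_le_of_absorb (volume : Measure (Ed d)) hrq
    (C := C0.toReal + 1) (by positivity)
  refine ⟨ENNReal.ofReal C', ENNReal.ofReal_ne_top, ?_⟩
  rintro φ hφ ⟨c, hc, hφc⟩
  have hdm : Measurable fun a : (ℝ × Ed d) × Ed d => dlt φ a.1.1 a.2 ^ 2 :=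
    (measurable_dlt_pair hφ (by fun_prop) (by fun_prop)).pow_const 2
  have hdt : ∀ t, Measurable fun x => dlt φ t x ^ 2 := fun t =>
    (measurable_dlt_pair hφ measurable_const measurable_id).pow_const 2
  have hPm : Measurable fun a : ℝ × Ed d => Pe (a.1 / 3) (fun z => dlt φ a.1 z ^ 2) a.2 :=
    measurable_Pe_comp (φ := fun (a : ℝ × Ed d) z => dlt φ a.1 z ^ 2) hdm (by fun_prop) (by fun_prop)
  refine habs (Measurable.lintegral_prod_left'
    (f := fun a : ℝ × Ed d => Pe (a.1 / 3) (fun z => dlt φ a.1 z ^ 2) a.2) hPm) _ ?_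
  intro ψ hψ
  set ω : Ed d → ℝ≥0∞ := fun x => maxFun ψ x ^ (1 / (r - 1)) with hω
  have hωm : Measurable ω := (measurable_maxFun ψ).pow_const _
  have hcomp : ∀ t, 0 < t → ∀ x, Pe (t / 3) ψ x ≤ c2 * Pe (2 * t) ω x ^ (r - 1) := by
    intro t ht x
    have ha : 0 < t / 3 := by positivity
    set m := (Pe (t / 3) ψ x / c1) ^ (1 / (r - 1)) with hm
    have h1 : ∀ z, ‖z - x‖ ^ 2 ≤ t / 3 → m ≤ ω z := by
      intro z hz
      refine ENNReal.rpow_le_rpow ?_ (by positivity)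
      refine ENNReal.div_le_of_le_mul' ((Pe_le_of_near ha hz hψ).trans ?_)
      exact mul_le_mul' le_rfl (Pe_le_maxFun (by positivity) hψ z)
    have h2 := hκ ha x h1
    rw [show 6 * (t / 3) = 2 * t by ring] at h2
    have h3 : m ≤ κ⁻¹ * Pe (2 * t) ω x := by
      rw [mul_comm, ← div_eq_mul_inv, ENNReal.le_div_iff_mul_le (Or.inl hκ0) (Or.inl hκt), mul_comm]
      exact h2
    have h4 := ENNReal.rpow_le_rpow h3 hr0.le
    rw [hm, ← ENNReal.rpow_mul, one_div, inv_mul_cancel₀ hr0.ne', ENNReal.rpow_one,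
      ENNReal.mul_rpow_of_nonneg _ _ hr0.le,
      ENNReal.div_le_iff_le_mul (Or.inl hc10) (Or.inl hc1t)] at h4
    refine h4.trans_eq ?_
    rw [hc2]; ring
  have hEm : ∀ t, Measurable fun x => Pe t φ x ^ 2 + Pe t ω x := fun t =>
    ((measurable_Pe hφ t).pow_const 2).add (measurable_Pe hωm t)
  have htel : ∫⁻ t, (∫⁻ x, Pe (2 * t) ω x ^ (r - 1) * dlt φ t x ^ 2) ∂mu0
      ≤ (∫⁻ x, (φ x ^ 2 + ω x) ^ r) * ENNReal.ofReal (Real.log 2) := by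
    refine lintegral_mu0_telescope (E := fun t => ∫⁻ x, (Pe t φ x ^ 2 + Pe t ω x) ^ r) ?_ ?_ ?_
    · exact Measurable.lintegral_prod_right'
        (f := fun q : ℝ × Ed d => (Pe q.1 φ q.2 ^ 2 + Pe q.1 ω q.2) ^ r)
        ((((measurable_Pe_uncurry hφ).pow_const 2).add (measurable_Pe_uncurry hωm)).pow_const r)
    · intro t ht
      refine (lintegral_mono fun x => ENNReal.rpow_le_rpow ?_ (by linarith)).trans
        (lintegral_Pe_rpow_le ht hr.le ((hφ.pow_const 2).add hωm))
      rw [Pe_add (hφ.pow_const 2)]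
      gcongr
      simpa only [ENNReal.rpow_ofNat] using Pe_rpow_le ht (p := 2) (by norm_num) hφ x
    · intro t ht
      rw [← lintegral_Pe ht ((hEm t).pow_const r), ← lintegral_add_right _ ((hEm _).pow_const r)]
      refine lintegral_mono fun x => ?_
      have h1 := dlt_sq_le one_lt_two le_rfl hφ hc hφc ht x
      norm_num at h1
      refine le_trans (rpow_add_mul_le hr le_add_self) (le_trans ?_ (Pe_rpow_le ht hr.le (hEm t) x))
      refine ENNReal.rpow_le_rpow ?_ (by linarith)
      rw [Pe_add ((measurable_Pe hφ t).pow_const 2), Pe_Pe ht ht hωm, ← two_mul]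
      calc _ = dlt φ t x ^ 2 + Pe (2 * t) φ x ^ 2 + Pe (2 * t) ω x := by ring
        _ ≤ _ := by gcongr
  have hbound : ∫⁻ x, (φ x ^ 2 + ω x) ^ r ≤
      2 ^ (r - 1) * (1 + ENNReal.ofReal CM) * ((∫⁻ x, φ x ^ (2 * r)) + ∫⁻ x, ψ x ^ q) := by
    have e1 : ∀ x, ω x ^ r = maxFun ψ x ^ q := fun x => by
      rw [hω, ← ENNReal.rpow_mul, hqr]; congr 1; field_simp
    have e2 : ∀ x, (φ x ^ 2) ^ r = φ x ^ (2 * r) := fun x => by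
      rw [ENNReal.rpow_mul, ENNReal.rpow_two]
    calc _ ≤ ∫⁻ x, 2 ^ (r - 1) * (φ x ^ (2 * r) + maxFun ψ x ^ q) := lintegral_mono fun x => by
            refine (ENNReal.rpow_add_le_mul_rpow_add_rpow _ _ hr.le).trans_eq ?_
            rw [e1, e2]
      _ = 2 ^ (r - 1) * ((∫⁻ x, φ x ^ (2 * r)) + ∫⁻ x, maxFun ψ x ^ q) := by
            have hmm := (measurable_maxFun ψ).pow_const q
            have hmp := hφ.pow_const (2 * r)
            rw [lintegral_const_mul _ (by fun_prop),
              lintegral_add_left (hφ.pow_const _)]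
      _ ≤ 2 ^ (r - 1) * ((∫⁻ x, φ x ^ (2 * r)) + ENNReal.ofReal CM * ∫⁻ x, ψ x ^ q) := by
            gcongr; exact hM ψ hψ
      _ ≤ 2 ^ (r - 1) * ((1 + ENNReal.ofReal CM) * ((∫⁻ x, φ x ^ (2 * r)) + ∫⁻ x, ψ x ^ q)) := by
            gcongr
            rw [mul_add]
            exact add_le_add (le_mul_of_one_le_left' le_self_add) (mul_le_mul' le_add_self le_rfl)
      _ = _ := by ring
  calc ∫⁻ x, (∫⁻ τ, Pe (τ / 3) (fun z => dlt φ τ z ^ 2) x ∂mu0) * ψ x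
      = ∫⁻ x, ∫⁻ τ, Pe (τ / 3) (fun z => dlt φ τ z ^ 2) x * ψ x ∂mu0 := by
        refine lintegral_congr fun x => ?_
        rw [lintegral_mul_const]
        exact measurable_section_left (f := fun t x => Pe (t / 3) (fun z => dlt φ t z ^ 2) x) hPm x
    _ = ∫⁻ τ, (∫⁻ x, Pe (τ / 3) (fun z => dlt φ τ z ^ 2) x * ψ x) ∂mu0 := by
        refine lintegral_lintegral_swap (Measurable.aemeasurable ?_)
        exact (measurable_flip (f := fun t x => Pe (t / 3) (fun z => dlt φ t z ^ 2) x) hPm).mul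
          (hψ.comp measurable_fst)
    _ = ∫⁻ τ, (∫⁻ x, dlt φ τ x ^ 2 * Pe (τ / 3) ψ x) ∂mu0 := by
        refine lintegral_congr fun t => lintegral_Pe_mul (hdt t) hψ
    _ ≤ ∫⁻ τ, c2 * (∫⁻ x, Pe (2 * τ) ω x ^ (r - 1) * dlt φ τ x ^ 2) ∂mu0 := by
        refine lintegral_mu0_mono fun t ht => ?_
        have h1 := hdt t
        have h2 := measurable_Pe hωm (2 * t)
        rw [← lintegral_const_mul _ (by fun_prop)]
        refine lintegral_mono fun x => ?_
        calc _ ≤ dlt φ t x ^ 2 * (c2 * Pe (2 * t) ω x ^ (r - 1)) := by gcongr; exact hcomp t ht x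
          _ = _ := by ring
    _ ≤ c2 * ((∫⁻ x, (φ x ^ 2 + ω x) ^ r) * ENNReal.ofReal (Real.log 2)) := by
        rw [lintegral_const_mul' _ _ hc2t]
        gcongr
    _ ≤ c2 * ((2 ^ (r - 1) * (1 + ENNReal.ofReal CM) *
        ((∫⁻ x, φ x ^ (2 * r)) + ∫⁻ x, ψ x ^ q)) * ENNReal.ofReal (Real.log 2)) := by gcongr
    _ = C0 * ((∫⁻ x, φ x ^ (2 * r)) + ∫⁻ x, ψ x ^ q) := by rw [hC0]; ring
    _ ≤ _ := by
        gcongr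
        rw [← ENNReal.ofReal_toReal hC0t]
        exact ENNReal.ofReal_le_ofReal (by simp)

lemma sum_rpow_le {ι : Type*} (S : Finset ι) (a : ι → ℝ≥0∞) {r : ℝ} (hr : 0 < r) :
    (∑ i ∈ S, a i) ^ r ≤ (S.card : ℝ≥0∞) ^ r * ∑ i ∈ S, a i ^ r := by
  rcases S.eq_empty_or_nonempty with rfl | hS
  · simp [hr]
  obtain ⟨i, hi, him⟩ := S.exists_max_image a hS
  calc (∑ i ∈ S, a i) ^ r ≤ ((S.card : ℝ≥0∞) * a i) ^ r := by
        refine ENNReal.rpow_le_rpow ?_ hr.le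
        simpa using Finset.sum_le_card_nsmul S a (a i) him
    _ = (S.card : ℝ≥0∞) ^ r * a i ^ r := ENNReal.mul_rpow_of_nonneg _ _ hr.le
    _ ≤ _ := by
        gcongr
        exact Finset.single_le_sum (f := fun i => a i ^ r) (fun _ _ => zero_le) hi

/-- Convolution of a real kernel with a complex function. -/
def cv (k : Ed d → ℝ) (F : Ed d → ℂ) (x : Ed d) : ℂ := ∫ z, ((k (x - z) : ℝ) : ℂ) * F z

lemma measurable_cv {k : Ed d → ℝ} (hk : Measurable k) {F : Ed d → ℂ} (hF : Measurable F) :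
    Measurable (cv k F) := by
  unfold cv
  refine (StronglyMeasurable.integral_prod_right (f := fun x z => ((k (x - z) : ℝ) : ℂ) * F z)
    (Measurable.stronglyMeasurable ?_)).measurable
  simp only [Function.uncurry_def]
  fun_prop

lemma enorm_cv_le {k : Ed d → ℝ} (F : Ed d → ℂ) {M : ℝ≥0∞} (hM : M ≠ ⊤) {t : ℝ}
    (hkM : ∀ z, ‖k z‖ₑ ≤ M * hkE t z) (x : Ed d) :
    ‖cv k F x‖ₑ ≤ M * Pe t (fun z => ‖F z‖ₑ) x := by
  unfold cv Pe
  rw [← lintegral_const_mul' _ _ hM]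
  refine (enorm_integral_le_lintegral_enorm _).trans (lintegral_mono fun z => ?_)
  rw [enorm_mul, ← mul_assoc]
  gcongr
  rw [← ofReal_norm, Complex.norm_real, ofReal_norm]
  exact hkM _

lemma enorm_hk {t : ℝ} (ht : 0 < t) (z : Ed d) : ‖hk t z‖ₑ = hkE t z := by
  rw [Real.enorm_eq_ofReal (hk_pos ht z).le, hkE]

lemma enorm_cv_hk_le (F : Ed d → ℂ) {t : ℝ} (ht : 0 < t) (x : Ed d) :
    ‖cv (hk t) F x‖ₑ ≤ Pe t (fun z => ‖F z‖ₑ) x := by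
  simpa using enorm_cv_le F (M := 1) (by simp) (t := t) (fun z => by rw [enorm_hk ht]; simp) x

lemma integrable_of_le_hkE {k : Ed d → ℝ} (hk : Measurable k) {M : ℝ≥0∞} (hM : M ≠ ⊤) {t : ℝ}
    (ht : 0 < t) (hkM : ∀ z, ‖k z‖ₑ ≤ M * hkE t z) : Integrable k := by
  refine ⟨hk.aestronglyMeasurable, ?_⟩
  refine (lintegral_mono hkM).trans_lt ?_
  rw [lintegral_const_mul' _ _ hM, lintegral_hkE ht, mul_one]
  exact hM.lt_top

lemma integrable_cv {k : Ed d → ℝ} (hk : Integrable k) {F : Ed d → ℂ} (hF : Measurable F)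
    {c : ℝ} (hFc : ∀ z, ‖F z‖ ≤ c) (x : Ed d) :
    Integrable fun z => ((k (x - z) : ℝ) : ℂ) * F z :=
  ((hk.comp_sub_left x).ofReal).mul_bdd (c := c) hF.aestronglyMeasurable (Eventually.of_forall hFc)

lemma cv_sub_const {k : Ed d → ℝ} (hk : Integrable k) (hk0 : ∫ z, k z = 0) {F : Ed d → ℂ}
    (hF : Measurable F) {c : ℝ} (hFc : ∀ z, ‖F z‖ ≤ c) (b : ℂ) (x : Ed d) :
    cv k (fun z => F z - b) x = cv k F x := by
  unfold cv
  simp_rw [mul_sub]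
  have h1 : Integrable fun z => ((k (x - z) : ℝ) : ℂ) := (hk.comp_sub_left x).ofReal
  rw [integral_sub (integrable_cv hk hF hFc x) (h1.mul_const b), integral_mul_const,
    integral_complex_ofReal, integral_sub_left_eq_self k volume x, hk0]
  simp

lemma norm_cv_hk_le {F : Ed d → ℂ} {c : ℝ} (hFc : ∀ z, ‖F z‖ ≤ c) {t : ℝ} (ht : 0 < t)
    (x : Ed d) : ‖cv (hk t) F x‖ ≤ c := by
  have hc : 0 ≤ c := (norm_nonneg _).trans (hFc 0)
  have h := (enorm_cv_hk_le F ht x).trans (Pe_le_of_le ht (c := ENNReal.ofReal c) (fun z => by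
    rw [← ofReal_norm]; exact ENNReal.ofReal_le_ofReal (hFc z)) x)
  rw [← ofReal_norm] at h
  exact (ENNReal.ofReal_le_ofReal_iff hc).1 h

/-- Positive and negative parts of the real and imaginary parts. -/
def prt (k : Fin 4) (F : Ed d → ℂ) (x : Ed d) : ℝ≥0∞ :=
  ENNReal.ofReal (![(F x).re, -(F x).re, (F x).im, -(F x).im] k)

lemma measurable_prt (k : Fin 4) {F : Ed d → ℂ} (hF : Measurable F) : Measurable (prt k F) := by
  unfold prt
  refine ENNReal.measurable_ofReal.comp ?_
  fin_cases k <;> simp <;> fun_prop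

lemma prt_le (k : Fin 4) (F : Ed d → ℂ) (x : Ed d) : prt k F x ≤ ‖F x‖ₑ := by
  unfold prt
  rw [← ofReal_norm]
  refine ENNReal.ofReal_le_ofReal ?_
  have h1 := abs_le.1 (Complex.abs_re_le_norm (F x))
  have h2 := abs_le.1 (Complex.abs_im_le_norm (F x))
  fin_cases k <;> simp <;> linarith

lemma eq_prt (F : Ed d → ℂ) (x : Ed d) : F x = (((prt 0 F x).toReal - (prt 1 F x).toReal : ℝ) : ℂ)
    + (((prt 2 F x).toReal - (prt 3 F x).toReal : ℝ) : ℂ) * I := by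
  have h : ∀ y : ℝ, (ENNReal.ofReal y).toReal - (ENNReal.ofReal (-y)).toReal = y := fun y => by
    rw [ENNReal.toReal_ofReal', ENNReal.toReal_ofReal']
    rcases le_total y 0 with h | h
    · rw [max_eq_right h, max_eq_left (by linarith)]; ring
    · rw [max_eq_left h, max_eq_right (by linarith)]; ring
  simp [prt, h, Complex.re_add_im]

lemma cv_hk_eq {F : Ed d → ℂ} (hF : Measurable F) {c : ℝ} (hFc : ∀ z, ‖F z‖ ≤ c) {t : ℝ}
    (ht : 0 < t) (x : Ed d) : cv (hk t) F x =
      (((Pe t (prt 0 F) x).toReal - (Pe t (prt 1 F) x).toReal : ℝ) : ℂ)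
    + (((Pe t (prt 2 F) x).toReal - (Pe t (prt 3 F) x).toReal : ℝ) : ℂ) * I := by
  have hc : 0 ≤ c := (norm_nonneg _).trans (hFc 0)
  have hle : ∀ k z, prt k F z ≤ ENNReal.ofReal c := fun k z => (prt_le k F z).trans (by
    rw [← ofReal_norm]; exact ENNReal.ofReal_le_ofReal (hFc z))
  have hInt : ∀ k, Integrable fun z => hk t (x - z) * (prt k F z).toReal := fun k => by
    refine ((integrable_hk ht).comp_sub_left x).mul_bdd (c := c)
      (measurable_prt k hF).ennreal_toReal.aestronglyMeasurable (Eventually.of_forall fun z => ?_)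
    rw [Real.norm_of_nonneg ENNReal.toReal_nonneg]
    exact ENNReal.toReal_le_of_le_ofReal hc (hle k z)
  have hPe : ∀ k, (Pe t (prt k F) x).toReal = ∫ z, hk t (x - z) * (prt k F z).toReal := fun k => by
    rw [integral_eq_lintegral_of_nonneg_ae (Eventually.of_forall fun z =>
      mul_nonneg (hk_pos ht _).le ENNReal.toReal_nonneg) (hInt k).aestronglyMeasurable]
    unfold Pe
    congr 1
    refine lintegral_congr fun z => ?_
    rw [ENNReal.ofReal_mul (hk_pos ht _).le, ENNReal.ofReal_toReal
      (ne_top_of_le_ne_top ENNReal.ofReal_ne_top (hle k z)), hkE]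
  simp_rw [hPe]
  rw [← integral_sub (hInt 0) (hInt 1), ← integral_sub (hInt 2) (hInt 3), ← integral_complex_ofReal,
    ← integral_complex_ofReal, ← integral_mul_const, ← integral_add]
  · unfold cv
    refine integral_congr_ae (Eventually.of_forall fun z => ?_)
    simp only
    conv_lhs => rw [eq_prt F z]
    push_cast
    ring
  · exact ((hInt 0).sub (hInt 1)).ofReal
  · exact (((hInt 2).sub (hInt 3)).ofReal).mul_const I

lemma enorm_sub_toReal_le {a b : ℝ≥0∞} (ha : a ≠ ⊤) (hb : b ≠ ⊤) :
    ‖a.toReal - b.toReal‖ₑ ≤ (a - b) + (b - a) := by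
  rw [Real.enorm_eq_ofReal_abs]
  rcases le_total a b with h | h
  · rw [abs_of_nonpos (by simpa using ENNReal.toReal_mono hb h), neg_sub,
      ← ENNReal.toReal_sub_of_le h hb, ENNReal.ofReal_toReal (by simp [hb])]
    exact le_add_self
  · rw [abs_of_nonneg (by simpa using ENNReal.toReal_mono ha h),
      ← ENNReal.toReal_sub_of_le h ha, ENNReal.ofReal_toReal (by simp [ha])]
    exact le_self_add

lemma lintegral_abs_osc_eq {φ : Ed d → ℝ≥0∞} (hφ : Measurable φ) {c : ℝ≥0∞} (hc : c ≠ ⊤)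
    (hφc : ∀ x, φ x ≤ c) {t : ℝ} (ht : 0 < t) (x : Ed d) :
    ∫⁻ z, hkE t (x - z) * ((Pe t φ z - Pe (2 * t) φ x) + (Pe (2 * t) φ x - Pe t φ z))
      = 2 * dlt φ t x := by
  have hu := measurable_Pe hφ t
  set X := Pe (2 * t) φ x with hX
  have hXt : X ≠ ⊤ := ne_top_of_le_ne_top hc (Pe_le_of_le (by positivity) hφc x)
  have hPP : ∫⁻ z, hkE t (x - z) * Pe t φ z = X := by
    have := Pe_Pe ht ht hφ x
    rw [← two_mul] at this
    exact this
  have e : X + dlt φ t x = X + ∫⁻ z, hkE t (x - z) * (Pe t φ z - X) := by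
    have h1 : ∫⁻ z, hkE t (x - z) * X = X := by
      rw [lintegral_mul_const _ (by fun_prop), lintegral_hkE_sub ht, one_mul]
    calc X + dlt φ t x = ∫⁻ z, hkE t (x - z) * Pe t φ z + hkE t (x - z) * (X - Pe t φ z) := by
          rw [lintegral_add_left (by fun_prop), hPP, dlt]
      _ = ∫⁻ z, hkE t (x - z) * X + hkE t (x - z) * (Pe t φ z - X) := by
          refine lintegral_congr fun z => ?_
          rw [← mul_add, ← mul_add]
          congr 1
          rcases le_total X (Pe t φ z) with h | h
          · rw [tsub_eq_zero_of_le h, add_zero, add_tsub_cancel_of_le h]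
          · rw [tsub_eq_zero_of_le h, add_zero, add_tsub_cancel_of_le h]
      _ = _ := by rw [lintegral_add_left (by fun_prop), h1]
  have e2 := (ENNReal.add_right_inj hXt).1 e
  simp_rw [mul_add]
  rw [lintegral_add_left (by fun_prop), ← e2, two_mul, dlt]

/-- Total local oscillation of the heat extension of a complex function. -/
def dl4 (F : Ed d → ℂ) (t : ℝ) (x : Ed d) : ℝ≥0∞ := ∑ k : Fin 4, dlt (prt k F) t x

lemma measurable_dl4 {F : Ed d → ℂ} (hF : Measurable F) :
    Measurable fun q : ℝ × Ed d => dl4 F q.1 q.2 := by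
  unfold dl4
  exact Finset.measurable_sum _ fun k _ => measurable_dlt_uncurry (measurable_prt k hF)

lemma Pe_osc_le {F : Ed d → ℂ} (hF : Measurable F) {c : ℝ} (hFc : ∀ z, ‖F z‖ ≤ c) {t : ℝ}
    (ht : 0 < t) (x : Ed d) :
    Pe t (fun z => ‖cv (hk t) F z - cv (hk (2 * t)) F x‖ₑ) x ≤ 2 * dl4 F t x := by
  have hle : ∀ k z, prt k F z ≤ ENNReal.ofReal c := fun k z => (prt_le k F z).trans (by
    rw [← ofReal_norm]; exact ENNReal.ofReal_le_ofReal (hFc z))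
  have h2t : 0 < 2 * t := by positivity
  have hfin : ∀ k (s : ℝ), 0 < s → ∀ z, Pe s (prt k F) z ≠ ⊤ := fun k s hs z =>
    ne_top_of_le_ne_top ENNReal.ofReal_ne_top (Pe_le_of_le hs (hle k) z)
  have hpt : ∀ z, ‖cv (hk t) F z - cv (hk (2 * t)) F x‖ₑ ≤ ∑ k : Fin 4,
      ((Pe t (prt k F) z - Pe (2 * t) (prt k F) x) + (Pe (2 * t) (prt k F) x - Pe t (prt k F) z)) := by
    intro z
    rw [cv_hk_eq hF hFc ht, cv_hk_eq hF hFc h2t]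
    have hb : ∀ k, ‖(((Pe t (prt k F) z).toReal - (Pe (2 * t) (prt k F) x).toReal : ℝ) : ℂ)‖ₑ ≤
      (Pe t (prt k F) z - Pe (2 * t) (prt k F) x) + (Pe (2 * t) (prt k F) x - Pe t (prt k F) z) := by
      intro k
      rw [← ofReal_norm, Complex.norm_real, ofReal_norm]
      exact enorm_sub_toReal_le (hfin k t ht z) (hfin k _ h2t x)
    set D : Fin 4 → ℂ := fun k =>
      (((Pe t (prt k F) z).toReal - (Pe (2 * t) (prt k F) x).toReal : ℝ) : ℂ) with hD
    calc _ = ‖(D 0 - D 1) + (D 2 - D 3) * I‖ₑ := by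
          congr 1; simp only [hD]; push_cast; ring
      _ ≤ ‖D 0 - D 1‖ₑ + ‖(D 2 - D 3) * I‖ₑ := enorm_add_le _ _
      _ ≤ (‖D 0‖ₑ + ‖D 1‖ₑ) + (‖D 2‖ₑ + ‖D 3‖ₑ) := by
          rw [enorm_mul, show ‖I‖ₑ = 1 by simp [← ofReal_norm], mul_one]
          exact add_le_add enorm_sub_le enorm_sub_le
      _ = ∑ k : Fin 4, ‖D k‖ₑ := by rw [Fin.sum_univ_four]; ring
      _ ≤ _ := Finset.sum_le_sum fun k _ => hb k
  refine (Pe_mono hpt x).trans ?_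
  unfold Pe dl4
  simp_rw [Finset.mul_sum]
  rw [lintegral_finsetSum]
  · refine Finset.sum_le_sum fun k _ => ?_
    exact (lintegral_abs_osc_eq (measurable_prt k hF) ENNReal.ofReal_ne_top (hle k) ht x).le
  · intro k _
    have := measurable_Pe (measurable_prt k hF) t
    change Measurable fun z => hkE t (x - z) * ((Pe t (prt k F) z - Pe (2 * t) (prt k F) x) +
      (Pe (2 * t) (prt k F) x - Pe t (prt k F) z))
    fun_prop

lemma lintegral_sum_sqfun_le {α : Type*} [MeasurableSpace α] {μ : Measure α} {ι : Type*}
    [Fintype ι] {A : ι → α → ℝ≥0∞} (hA : ∀ k, Measurable (A k)) {r : ℝ} (hr : 0 < r)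
    {C I : ℝ≥0∞} (h : ∀ k, ∫⁻ x, A k x ^ r ∂μ ≤ C * I) :
    ∫⁻ x, (∑ k, A k x) ^ r ∂μ ≤ ((Fintype.card ι : ℝ≥0∞) ^ r * (Fintype.card ι * C)) * I := by
  calc _ ≤ ∫⁻ x, (Fintype.card ι : ℝ≥0∞) ^ r * ∑ k, A k x ^ r ∂μ :=
        lintegral_mono fun x => sum_rpow_le Finset.univ (fun k => A k x) hr
    _ = (Fintype.card ι : ℝ≥0∞) ^ r * ∑ k, ∫⁻ x, A k x ^ r ∂μ := by
        rw [lintegral_const_mul' _ _ (ENNReal.rpow_ne_top_of_nonneg hr.le (by simp)),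
          lintegral_finsetSum _ fun k _ => (hA k).pow_const r]
    _ ≤ (Fintype.card ι : ℝ≥0∞) ^ r * ∑ _k : ι, C * I := by
        gcongr with k
        exact h k
    _ = _ := by simp only [Finset.sum_const, Finset.card_univ, nsmul_eq_mul]; ring

lemma sq_dl4_le (F : Ed d → ℂ) (t : ℝ) (x : Ed d) :
    dl4 F t x ^ 2 ≤ 16 * ∑ k : Fin 4, dlt (prt k F) t x ^ 2 := by
  have := sum_rpow_le Finset.univ (fun k : Fin 4 => dlt (prt k F) t x) (r := 2) (by norm_num)
  simp only [ENNReal.rpow_ofNat, Finset.card_univ, Fintype.card_fin] at this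
  refine this.trans_eq ?_
  norm_num

/-- Littlewood-Paley estimate for cancelling kernels dominated by heat kernels. -/
lemma lp_kernel (hd : 1 ≤ d) {p : ℝ} (hp : 1 < p) {M : ℝ≥0∞} (hM : M ≠ ⊤) {K : ℝ → Ed d → ℝ}
    (hKm : ∀ t, 0 < t → Measurable (K t)) (hK0 : ∀ t, 0 < t → ∫ z, K t z = 0)
    (hKM : ∀ t, 0 < t → ∀ z, ‖K t z‖ₑ ≤ M * hkE (2 * t / 3) z) :
    ∃ C : ℝ≥0∞, C ≠ ⊤ ∧ ∀ F : Ed d → ℂ, Measurable F → (∃ c : ℝ, ∀ x, ‖F x‖ ≤ c) →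
      ∫⁻ x, (∫⁻ t, ‖cv (hk (t / 3)) (cv (K t) (cv (hk t) F)) x‖ₑ ^ 2 ∂mu0) ^ (p / 2)
        ≤ C * ∫⁻ x, ‖F x‖ₑ ^ p := by
  have hin : ∀ {t : ℝ}, 0 < t → ∀ {F : Ed d → ℂ}, Measurable F → ∀ {c : ℝ}, (∀ x, ‖F x‖ ≤ c) →
      ∀ (b : ℂ) (y : Ed d), ‖cv (K t) (cv (hk t) F) y‖ₑ ≤
        M * Pe (2 * t / 3) (fun z => ‖cv (hk t) F z - b‖ₑ) y := by
    intro t ht F hF c hFc b y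
    have hi := integrable_of_le_hkE (hKm t ht) hM (by positivity) (hKM t ht)
    rw [← cv_sub_const hi (hK0 t ht) (measurable_cv (continuous_hk t).measurable hF)
      (fun z => norm_cv_hk_le hFc ht z) b y]
    exact enorm_cv_le _ hM (hKM t ht) y
  have hprtint : ∀ (k : Fin 4) (F : Ed d → ℂ), ∫⁻ x, prt k F x ^ p ≤ ∫⁻ x, ‖F x‖ₑ ^ p := fun k F =>
    lintegral_mono fun x => ENNReal.rpow_le_rpow (prt_le k F x) (by linarith)
  have hprtb : ∀ (k : Fin 4) {F : Ed d → ℂ} {c : ℝ}, (∀ x, ‖F x‖ ≤ c) →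
      ∃ c' : ℝ≥0∞, c' ≠ ⊤ ∧ ∀ x, prt k F x ≤ c' := fun k F c hFc =>
    ⟨ENNReal.ofReal c, ENNReal.ofReal_ne_top, fun z => (prt_le k F z).trans (by
      rw [← ofReal_norm]; exact ENNReal.ofReal_le_ofReal (hFc z))⟩
  rcases le_or_gt p 2 with hp2 | hp2
  · obtain ⟨C, hC, hCb⟩ := lintegral_dlt_sqfun_le hd hp hp2
    refine ⟨((M * 2) ^ 2 * 16) ^ (p / 2) * ((4 : ℝ≥0∞) ^ (p / 2) * (4 * C)), ?_, ?_⟩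
    · have : ∀ y : ℝ≥0∞, y ≠ ⊤ → y ^ (p / 2) ≠ ⊤ := fun y hy =>
        ENNReal.rpow_ne_top_of_nonneg (by linarith) hy
      refine ENNReal.mul_ne_top (this _ ?_) (ENNReal.mul_ne_top (this _ (by simp)) ?_)
      · exact ENNReal.mul_ne_top (ENNReal.pow_ne_top (ENNReal.mul_ne_top hM (by simp))) (by simp)
      · exact ENNReal.mul_ne_top (by simp) hC
    rintro F hF ⟨c, hFc⟩
    have hdm : ∀ k x, Measurable fun t => dlt (prt k F) t x ^ 2 := fun k x =>
      (measurable_section_left (measurable_dlt_uncurry (measurable_prt k hF)) x).pow_const 2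
    have hpt : ∀ t, 0 < t → ∀ x, ‖cv (hk (t / 3)) (cv (K t) (cv (hk t) F)) x‖ₑ ≤
        M * 2 * dl4 F t x := by
      intro t ht x
      have hum : Measurable (cv (hk t) F) := measurable_cv (continuous_hk t).measurable hF
      have humb : Measurable fun z => ‖cv (hk t) F z - cv (hk (2 * t)) F x‖ₑ := by fun_prop
      refine (enorm_cv_hk_le _ (by positivity) x).trans ?_
      refine (Pe_mono (fun y => hin ht hF hFc (cv (hk (2 * t)) F x) y) x).trans ?_
      rw [Pe_const_mul (measurable_Pe humb _),
        Pe_Pe (by positivity) (by positivity) humb, show t / 3 + 2 * t / 3 = t by ring, mul_assoc]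
      gcongr
      exact Pe_osc_le hF hFc ht x
    have hx : ∀ x, ∫⁻ t, ‖cv (hk (t / 3)) (cv (K t) (cv (hk t) F)) x‖ₑ ^ 2 ∂mu0 ≤
        ((M * 2) ^ 2 * 16) * ∑ k : Fin 4, ∫⁻ t, dlt (prt k F) t x ^ 2 ∂mu0 := by
      intro x
      rw [← lintegral_finsetSum _ fun k _ => hdm k x,
        ← lintegral_const_mul _ (Finset.measurable_sum _ fun k _ => hdm k x)]
      refine lintegral_mu0_mono fun t ht => ?_
      calc _ ≤ (M * 2 * dl4 F t x) ^ 2 := by gcongr; exact hpt t ht x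
        _ = (M * 2) ^ 2 * dl4 F t x ^ 2 := by ring
        _ ≤ (M * 2) ^ 2 * (16 * ∑ k : Fin 4, dlt (prt k F) t x ^ 2) := by
          gcongr; exact sq_dl4_le F t x
        _ = _ := by ring
    calc _ ≤ ∫⁻ x, ((M * 2) ^ 2 * 16) ^ (p / 2) *
          (∑ k : Fin 4, ∫⁻ t, dlt (prt k F) t x ^ 2 ∂mu0) ^ (p / 2) := lintegral_mono fun x => by
          rw [← ENNReal.mul_rpow_of_nonneg _ _ (by linarith)]
          exact ENNReal.rpow_le_rpow (hx x) (by linarith)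
      _ = ((M * 2) ^ 2 * 16) ^ (p / 2) * ∫⁻ x,
          (∑ k : Fin 4, ∫⁻ t, dlt (prt k F) t x ^ 2 ∂mu0) ^ (p / 2) :=
          lintegral_const_mul' _ _ (ENNReal.rpow_ne_top_of_nonneg (by linarith)
            (ENNReal.mul_ne_top (ENNReal.pow_ne_top (ENNReal.mul_ne_top hM (by simp))) (by simp)))
      _ ≤ ((M * 2) ^ 2 * 16) ^ (p / 2) * (((4 : ℝ≥0∞) ^ (p / 2) * (4 * C)) *
          ∫⁻ x, ‖F x‖ₑ ^ p) := by
          gcongr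
          have := lintegral_sum_sqfun_le (μ := (volume : Measure (Ed d)))
            (A := fun (k : Fin 4) x => ∫⁻ t, dlt (prt k F) t x ^ 2 ∂mu0) (r := p / 2) (C := C)
            (I := ∫⁻ x, ‖F x‖ₑ ^ p) (fun k => Measurable.lintegral_prod_left'
              (f := fun q : ℝ × Ed d => dlt (prt k F) q.1 q.2 ^ 2)
              ((measurable_dlt_uncurry (measurable_prt k hF)).pow_const 2)) (by linarith)
            (fun k => (hCb _ (measurable_prt k hF) (hprtb k hFc)).trans
              (mul_le_mul' le_rfl (hprtint k F)))
          simpa using this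
      _ = _ := by ring
  · obtain ⟨C, hC, hCb⟩ := lintegral_Pe_dlt_sqfun_le hd (r := p / 2) (by linarith)
    set N : ℝ≥0∞ := M * (ENNReal.ofReal ((3 / 2) ^ ((d : ℝ) / 2)) * 2) with hN
    have hNt : N ≠ ⊤ := ENNReal.mul_ne_top hM (ENNReal.mul_ne_top ENNReal.ofReal_ne_top (by simp))
    have hNt2 : N ^ 2 * 16 ≠ ⊤ := ENNReal.mul_ne_top (ENNReal.pow_ne_top hNt) (by simp)
    refine ⟨(N ^ 2 * 16) ^ (p / 2) * ((4 : ℝ≥0∞) ^ (p / 2) * (4 * C)), ?_, ?_⟩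
    · have : ∀ y : ℝ≥0∞, y ≠ ⊤ → y ^ (p / 2) ≠ ⊤ := fun y hy =>
        ENNReal.rpow_ne_top_of_nonneg (by linarith) hy
      exact ENNReal.mul_ne_top (this _ hNt2)
        (ENNReal.mul_ne_top (this _ (by simp)) (ENNReal.mul_ne_top (by simp) hC))
    rintro F hF ⟨c, hFc⟩
    have hdk : ∀ k t, Measurable fun x => dlt (prt k F) t x ^ 2 := fun k t =>
      (measurable_dlt_pair (measurable_prt k hF) measurable_const measurable_id).pow_const 2
    have hdl : ∀ t, Measurable fun x => dl4 F t x := fun t =>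
      measurable_section_right (measurable_dl4 hF) t
    have hPm : ∀ k, Measurable fun q : ℝ × Ed d =>
        Pe (q.1 / 3) (fun z => dlt (prt k F) q.1 z ^ 2) q.2 := fun k =>
      measurable_Pe_comp (φ := fun (a : ℝ × Ed d) z => dlt (prt k F) a.1 z ^ 2)
        ((measurable_dlt_pair (measurable_prt k hF) (by fun_prop) (by fun_prop)).pow_const 2)
        (by fun_prop) (by fun_prop)
    have hpt : ∀ t, 0 < t → ∀ x, ‖cv (hk (t / 3)) (cv (K t) (cv (hk t) F)) x‖ₑ ^ 2 ≤
        N ^ 2 * 16 * ∑ k : Fin 4, Pe (t / 3) (fun z => dlt (prt k F) t z ^ 2) x := by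
      intro t ht x
      have h1 : ∀ y, ‖cv (K t) (cv (hk t) F) y‖ₑ ≤ N * dl4 F t y := by
        intro y
        have hum : Measurable (cv (hk t) F) := measurable_cv (continuous_hk t).measurable hF
        have humb : Measurable fun z => ‖cv (hk t) F z - cv (hk (2 * t)) F y‖ₑ := by fun_prop
        refine (hin ht hF hFc (cv (hk (2 * t)) F y) y).trans ?_
        rw [hN, mul_assoc, mul_assoc]
        gcongr
        refine (Pe_le_Pe (by positivity) (by linarith : 2 * t / 3 ≤ t) humb y).trans ?_
        rw [show t / (2 * t / 3) = 3 / 2 by field_simp]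
        gcongr
        exact Pe_osc_le hF hFc ht y
      have h2 : ‖cv (hk (t / 3)) (cv (K t) (cv (hk t) F)) x‖ₑ ≤ N * Pe (t / 3) (dl4 F t) x := by
        refine (enorm_cv_hk_le _ (by positivity) x).trans ((Pe_mono h1 x).trans ?_)
        rw [Pe_const_mul (hdl t)]
      calc _ ≤ (N * Pe (t / 3) (dl4 F t) x) ^ 2 := by gcongr
        _ = N ^ 2 * Pe (t / 3) (dl4 F t) x ^ 2 := by ring
        _ ≤ N ^ 2 * Pe (t / 3) (fun z => dl4 F t z ^ 2) x := by
          gcongr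
          simpa only [ENNReal.rpow_ofNat] using
            Pe_rpow_le (by positivity : 0 < t / 3) (p := 2) (by norm_num) (hdl t) x
        _ ≤ N ^ 2 * Pe (t / 3) (fun z => 16 * ∑ k : Fin 4, dlt (prt k F) t z ^ 2) x := by
          gcongr
          exact Pe_mono (fun z => sq_dl4_le F t z) x
        _ = _ := by
          rw [Pe_const_mul (Finset.measurable_sum _ fun k _ => hdk k t), mul_assoc]
          congr 2
          unfold Pe
          simp_rw [Finset.mul_sum]
          rw [lintegral_finsetSum]
          intro k _
          have := hdk k t
          fun_prop
    have hx : ∀ x, ∫⁻ t, ‖cv (hk (t / 3)) (cv (K t) (cv (hk t) F)) x‖ₑ ^ 2 ∂mu0 ≤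
        (N ^ 2 * 16) * ∑ k : Fin 4, ∫⁻ t, Pe (t / 3) (fun z => dlt (prt k F) t z ^ 2) x ∂mu0 := by
      intro x
      have hm : ∀ k, Measurable fun t => Pe (t / 3) (fun z => dlt (prt k F) t z ^ 2) x := fun k =>
        measurable_section_left (f := fun t x => Pe (t / 3) (fun z => dlt (prt k F) t z ^ 2) x)
          (hPm k) x
      rw [← lintegral_finsetSum _ fun k _ => hm k,
        ← lintegral_const_mul _ (Finset.measurable_sum _ fun k _ => hm k)]
      exact lintegral_mu0_mono fun t ht => hpt t ht x
    calc _ ≤ ∫⁻ x, (N ^ 2 * 16) ^ (p / 2) *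
          (∑ k : Fin 4, ∫⁻ t, Pe (t / 3) (fun z => dlt (prt k F) t z ^ 2) x ∂mu0) ^ (p / 2) :=
          lintegral_mono fun x => by
          rw [← ENNReal.mul_rpow_of_nonneg _ _ (by linarith)]
          exact ENNReal.rpow_le_rpow (hx x) (by linarith)
      _ = (N ^ 2 * 16) ^ (p / 2) * ∫⁻ x,
          (∑ k : Fin 4, ∫⁻ t, Pe (t / 3) (fun z => dlt (prt k F) t z ^ 2) x ∂mu0) ^ (p / 2) :=
          lintegral_const_mul' _ _ (ENNReal.rpow_ne_top_of_nonneg (by linarith) hNt2)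
      _ ≤ (N ^ 2 * 16) ^ (p / 2) * (((4 : ℝ≥0∞) ^ (p / 2) * (4 * C)) *
          ∫⁻ x, ‖F x‖ₑ ^ p) := by
          gcongr
          have := lintegral_sum_sqfun_le (μ := (volume : Measure (Ed d)))
            (A := fun (k : Fin 4) x => ∫⁻ t, Pe (t / 3) (fun z => dlt (prt k F) t z ^ 2) x ∂mu0)
            (r := p / 2) (C := C)
            (I := ∫⁻ x, ‖F x‖ₑ ^ p) (fun k => Measurable.lintegral_prod_left'
              (f := fun q : ℝ × Ed d => Pe (q.1 / 3) (fun z => dlt (prt k F) q.1 z ^ 2) q.2)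
              (hPm k)) (by linarith)
            (fun k => (hCb _ (measurable_prt k hF) (hprtb k hFc)).trans
              (mul_le_mul' le_rfl (by rw [mul_div_cancel₀ p two_ne_zero]; exact hprtint k F)))
          simpa using this
      _ = _ := by ring

/-- The character `exp (i x · ξ)`. -/
def ch (x ξ : Ed d) : ℂ := cexp (I * ((⟪x, ξ⟫ : ℝ) : ℂ))

lemma norm_ch (x ξ : Ed d) : ‖ch x ξ‖ = 1 := by
  unfold ch; rw [mul_comm]; exact Complex.norm_exp_ofReal_mul_I _

@[fun_prop]
lemma measurable_ch_comp {α : Type*} [MeasurableSpace α] {f g : α → Ed d} (hf : Measurable f)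
    (hg : Measurable g) : Measurable fun a => ch (f a) (g a) := by
  unfold ch; fun_prop

lemma ch_add_left (x y ξ : Ed d) : ch (x + y) ξ = ch x ξ * ch y ξ := by
  unfold ch; rw [← Complex.exp_add, inner_add_left]; push_cast; ring_nf

lemma ch_add_right (x ξ η : Ed d) : ch x (ξ + η) = ch x ξ * ch x η := by
  unfold ch; rw [← Complex.exp_add, inner_add_right]; push_cast; ring_nf

lemma ch_zero_right (x : Ed d) : ch x 0 = 1 := by simp [ch]

lemma FT_eq (f : Ed d → ℂ) (ξ : Ed d) : FT f ξ = ∫ x, ch (-x) ξ * f x := by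
  unfold FT ch
  simp [inner_neg_left]

/-- The trigonometric integral `∫ exp (i x · ξ) ψ ξ dξ`. -/
def em (ψ : Ed d → ℂ) (x : Ed d) : ℂ := ∫ ξ, ch x ξ * ψ ξ

lemma integrable_ch_mul {ψ : Ed d → ℂ} (hψ : Integrable ψ) (x : Ed d) :
    Integrable fun ξ => ch x ξ * ψ ξ :=
  hψ.bdd_mul (c := 1) (Measurable.aestronglyMeasurable (by fun_prop))
    (Eventually.of_forall fun ξ => (norm_ch x ξ).le)

lemma norm_em_le (ψ : Ed d → ℂ) (x : Ed d) : ‖em ψ x‖ ≤ ∫ ξ, ‖ψ ξ‖ := by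
  refine (norm_integral_le_integral_norm _).trans_eq ?_
  simp [norm_ch]

lemma continuous_em {ψ : Ed d → ℂ} (hψ : Integrable ψ) : Continuous (em ψ) := by
  unfold em
  refine continuous_of_dominated (bound := fun ξ => ‖ψ ξ‖)
    (fun x => (integrable_ch_mul hψ x).aestronglyMeasurable) (fun x => ?_) hψ.norm ?_
  · exact Eventually.of_forall fun ξ => by simp [norm_ch]
  · refine Eventually.of_forall fun ξ => ?_
    have : Continuous fun x : Ed d => ch x ξ := by unfold ch; fun_prop
    exact this.mul continuous_const

lemma measurable_em {ψ : Ed d → ℂ} (hψ : Integrable ψ) : Measurable (em ψ) :=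
  (continuous_em hψ).measurable

lemma em_sub {φ ψ : Ed d → ℂ} (hφ : Integrable φ) (hψ : Integrable ψ) (x : Ed d) :
    em (fun ξ => φ ξ - ψ ξ) x = em φ x - em ψ x := by
  unfold em
  rw [← integral_sub (integrable_ch_mul hφ x) (integrable_ch_mul hψ x)]
  simp_rw [mul_sub]

lemma em_const_mul (a : ℂ) (ψ : Ed d → ℂ) (x : Ed d) :
    em (fun ξ => a * ψ ξ) x = a * em ψ x := by
  unfold em
  rw [← integral_const_mul]
  congr 1; ext ξ; ring

lemma em_finset_sum {ι : Type*} (S : Finset ι) {ψ : ι → Ed d → ℂ} (hψ : ∀ i ∈ S, Integrable (ψ i))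
    (x : Ed d) : em (fun ξ => ∑ i ∈ S, ψ i ξ) x = ∑ i ∈ S, em (ψ i) x := by
  unfold em
  rw [← integral_finsetSum S fun i hi => integrable_ch_mul (hψ i hi) x]
  simp_rw [Finset.mul_sum]

lemma FT_convolution {k l : Ed d → ℝ} (hk : Integrable k) (hl : Integrable l) (ξ : Ed d) :
    FT (fun x => ((∫ z, k (x - z) * l z : ℝ) : ℂ)) ξ
      = FT (fun x => (k x : ℂ)) ξ * FT (fun x => (l x : ℂ)) ξ := by
  have hF : Integrable fun x => ch (-x) ξ * (k x : ℂ) :=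
    hk.ofReal.bdd_mul (c := 1) (Measurable.aestronglyMeasurable (by fun_prop))
    (Eventually.of_forall fun x => (norm_ch _ ξ).le)
  have hG : Integrable fun x => ch (-x) ξ * (l x : ℂ) :=
    hl.ofReal.bdd_mul (c := 1) (Measurable.aestronglyMeasurable (by fun_prop))
    (Eventually.of_forall fun x => (norm_ch _ ξ).le)
  have h := integral_convolution (L := ContinuousLinearMap.mul ℝ ℂ) hG hF
  simp only [ContinuousLinearMap.mul_apply'] at h
  rw [FT_eq, FT_eq, FT_eq, mul_comm, ← h]
  refine integral_congr_ae (Eventually.of_forall fun x => ?_)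
  simp only [convolution, ContinuousLinearMap.mul_apply']
  rw [← integral_complex_ofReal, ← integral_const_mul]
  refine integral_congr_ae (Eventually.of_forall fun z => ?_)
  simp only
  have : ch (-x) ξ = ch (-z) ξ * ch (-(x - z)) ξ := by rw [← ch_add_left]; congr 1; abel
  rw [this]; push_cast; ring

lemma cv_em {k : Ed d → ℝ} (hk : Integrable k) {ψ : Ed d → ℂ} (hψ : Integrable ψ) (x : Ed d) :
    cv k (em ψ) x = em (fun ξ => FT (fun z => (k z : ℂ)) ξ * ψ ξ) x := by
  unfold cv em
  have h1 : Integrable fun q : Ed d × Ed d => ((k (x - q.1) : ℝ) : ℂ) * (ch q.1 q.2 * ψ q.2) := by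
    have := (((hk.comp_sub_left x).ofReal (𝕜 := ℂ)).mul_prod hψ).bdd_mul (c := 1)
      (f := fun q : Ed d × Ed d => ch q.1 q.2)
      (Measurable.aestronglyMeasurable (by fun_prop)) (Eventually.of_forall fun q => (norm_ch _ _).le)
    refine this.congr (Eventually.of_forall fun q => ?_)
    simp only; exact mul_left_comm _ _ _
  simp_rw [← integral_const_mul]
  rw [integral_integral_swap h1]
  refine integral_congr_ae (Eventually.of_forall fun ξ => ?_)
  simp only
  rw [FT_eq, ← integral_sub_left_eq_self _ _ x, ← mul_assoc, ← integral_const_mul,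
    ← integral_mul_const]
  refine integral_congr_ae (Eventually.of_forall fun z => ?_)
  simp only
  have : ch (x - z) ξ = ch x ξ * ch (-z) ξ := by rw [← ch_add_left, sub_eq_add_neg]
  rw [this, sub_sub_cancel]; ring

lemma FT_hk {t : ℝ} (ht : 0 < t) (ξ : Ed d) :
    FT (fun z => (hk t z : ℂ)) ξ = cexp (-((t * ‖ξ‖ ^ 2 : ℝ) : ℂ)) := by
  have h := GaussianFourier.integral_cexp_neg_mul_sq_norm_add (V := Ed d)
    (b := ((1 / (4 * t) : ℝ) : ℂ)) (by rw [Complex.ofReal_re]; positivity) (-I) ξ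
  have hpos : (0:ℝ) < 4 * Real.pi * t := by positivity
  unfold FT
  have e1 : ∀ z : Ed d, cexp (-I * ((⟪z, ξ⟫ : ℝ) : ℂ)) * (hk t z : ℂ) =
      (((4 * Real.pi * t) ^ (-(d:ℝ) / 2) : ℝ) : ℂ) *
        cexp (-((1 / (4 * t) : ℝ) : ℂ) * ‖z‖ ^ 2 + -I * ⟪ξ, z⟫) := fun z => by
    unfold hk
    rw [Complex.exp_add, real_inner_comm]
    push_cast
    rw [show -(‖z‖:ℂ) ^ 2 / (4 * (t:ℂ)) = -(1 / (4 * (t:ℂ))) * (‖z‖:ℂ) ^ 2 by ring]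
    ring
  simp_rw [e1]
  rw [integral_const_mul, h]
  have e2 : ((Real.pi : ℂ) / ((1 / (4 * t) : ℝ) : ℂ)) = ((4 * Real.pi * t : ℝ) : ℂ) := by
    push_cast; field_simp
  have e3 : (((4 * Real.pi * t : ℝ) : ℂ)) ^ ((Module.finrank ℝ (Ed d) : ℂ) / 2)
      = (((4 * Real.pi * t) ^ ((d:ℝ) / 2) : ℝ) : ℂ) := by
    rw [Complex.ofReal_cpow hpos.le]; simp
  rw [e2, e3, ← mul_assoc, ← Complex.ofReal_mul, ← Real.rpow_add hpos]
  have : -(d:ℝ) / 2 + d / 2 = 0 := by ring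
  rw [this, Real.rpow_zero]
  simp only [Complex.ofReal_one, one_mul]
  congr 1
  push_cast
  have ht' : (t:ℂ) ≠ 0 := by exact_mod_cast ht.ne'
  field_simp
  rw [I_sq]; ring

/-- The partial derivative of the heat kernel. -/
def gk (j : Fin d) (c : ℝ) (z : Ed d) : ℝ := -(z j / (2 * c)) * hk c z

lemma measurable_gk (j : Fin d) (c : ℝ) : Measurable (gk j c) := by
  unfold gk
  have : Continuous fun z : Ed d => z j := by fun_prop
  have := this.measurable
  fun_prop

lemma half_le_exp_sq (y : ℝ) : y / 2 ≤ Real.exp (y ^ 2 / 8) := by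
  have := Real.add_one_le_exp (y ^ 2 / 8)
  nlinarith [sq_nonneg (y - 2)]

/-- The constant comparing `gk j c` with the heat kernel at time `2 * c`. -/
def gkc (d : ℕ) (c : ℝ) : ℝ := 2 ^ ((d : ℝ) / 2) * c ^ (-(1 / 2) : ℝ)

lemma gkc_nonneg {c : ℝ} (hc : 0 < c) : 0 ≤ gkc d c := by unfold gkc; positivity

lemma abs_gk_le (j : Fin d) {c : ℝ} (hc : 0 < c) (z : Ed d) :
    |gk j c z| ≤ gkc d c * hk (2 * c) z := by
  have hz : |z j| ≤ ‖z‖ := by simpa using PiLp.norm_apply_le z j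
  have hs : 0 < Real.sqrt c := Real.sqrt_pos.2 hc
  have hss : Real.sqrt c * Real.sqrt c = c := Real.mul_self_sqrt hc.le
  have hcr : c ^ (-(1 / 2) : ℝ) = (Real.sqrt c)⁻¹ := by
    rw [Real.rpow_neg hc.le, Real.sqrt_eq_rpow]
  have h1 : (4 * Real.pi * c) ^ (-(d:ℝ) / 2) = 2 ^ ((d:ℝ) / 2) * (4 * Real.pi * (2 * c)) ^ (-(d:ℝ) / 2) := by
    rw [show 4 * Real.pi * (2 * c) = 2 * (4 * Real.pi * c) by ring,
      Real.mul_rpow (x := 2) (by norm_num) (by positivity), ← mul_assoc,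
      ← Real.rpow_add (by norm_num)]
    rw [show (d:ℝ) / 2 + -(d:ℝ) / 2 = 0 by ring]; simp
  have h2 : ‖z‖ / (2 * c) * Real.exp (-‖z‖ ^ 2 / (4 * c)) ≤
      (Real.sqrt c)⁻¹ * Real.exp (-‖z‖ ^ 2 / (4 * (2 * c))) := by
    have h := half_le_exp_sq (‖z‖ / Real.sqrt c)
    have e1 : (‖z‖ / Real.sqrt c) ^ 2 / 8 = ‖z‖ ^ 2 / (8 * c) := by
      rw [div_pow, Real.sq_sqrt hc.le]; field_simp
    have e2 : ‖z‖ / (2 * c) = (Real.sqrt c)⁻¹ * (‖z‖ / Real.sqrt c / 2) := by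
      rw [← hss]; field_simp; rw [Real.sqrt_sq hs.le]
    rw [e2, mul_assoc]
    refine mul_le_mul_of_nonneg_left ?_ (by positivity)
    calc _ ≤ Real.exp (‖z‖ ^ 2 / (8 * c)) * Real.exp (-‖z‖ ^ 2 / (4 * c)) := by
          rw [← e1]; gcongr
      _ = _ := by rw [← Real.exp_add]; congr 1; field_simp; ring
  have hA : (0:ℝ) < (4 * Real.pi * (2 * c)) ^ (-(d:ℝ) / 2) := by positivity
  unfold gk gkc
  rw [abs_mul, abs_neg, abs_div, abs_of_pos (by positivity : (0:ℝ) < 2 * c),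
    abs_of_pos (hk_pos hc z), hcr]
  unfold hk
  rw [h1]
  calc _ ≤ ‖z‖ / (2 * c) * (2 ^ ((d:ℝ) / 2) * (4 * Real.pi * (2 * c)) ^ (-(d:ℝ) / 2) *
        Real.exp (-‖z‖ ^ 2 / (4 * c))) := by gcongr
    _ = (2 ^ ((d:ℝ) / 2) * (4 * Real.pi * (2 * c)) ^ (-(d:ℝ) / 2)) *
        (‖z‖ / (2 * c) * Real.exp (-‖z‖ ^ 2 / (4 * c))) := by ring
    _ ≤ (2 ^ ((d:ℝ) / 2) * (4 * Real.pi * (2 * c)) ^ (-(d:ℝ) / 2)) *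
        ((Real.sqrt c)⁻¹ * Real.exp (-‖z‖ ^ 2 / (4 * (2 * c)))) := by gcongr
    _ = _ := by ring

lemma enorm_gk_le (j : Fin d) {c : ℝ} (hc : 0 < c) (z : Ed d) :
    ‖gk j c z‖ₑ ≤ ENNReal.ofReal (gkc d c) * hkE (2 * c) z := by
  rw [Real.enorm_eq_ofReal_abs, hkE, ← ENNReal.ofReal_mul (gkc_nonneg hc)]
  exact ENNReal.ofReal_le_ofReal (abs_gk_le j hc z)

lemma integrable_gk (j : Fin d) {c : ℝ} (hc : 0 < c) : Integrable (gk j c) :=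
  integrable_of_le_hkE (measurable_gk j c) ENNReal.ofReal_ne_top (by positivity) (enorm_gk_le j hc)

lemma hasLineDerivAt_hk (j : Fin d) {c : ℝ} (hc : 0 < c) (x : Ed d) :
    HasLineDerivAt ℝ (fun z => (hk c z : ℂ)) (gk j c x : ℂ) x (EuclideanSpace.single j 1) := by
  unfold HasLineDerivAt
  have hn : ∀ u : ℝ, ‖x + u • EuclideanSpace.single j (1:ℝ)‖ ^ 2
      = ‖x‖ ^ 2 + 2 * u * x j + u ^ 2 := fun u => by
    rw [norm_add_sq_real, inner_smul_right, norm_smul,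
      EuclideanSpace.inner_single_right]
    simp
    ring
  have h : HasDerivAt (fun u : ℝ => hk c (x + u • EuclideanSpace.single j 1)) (gk j c x) 0 := by
    unfold hk gk
    simp_rw [hn]
    have h1 : HasDerivAt (fun u : ℝ => -(‖x‖ ^ 2 + 2 * u * x j + u ^ 2) / (4 * c))
        (-(x j / (2 * c))) 0 := by
      have := (((((hasDerivAt_id' (0:ℝ)).const_mul 2).mul_const (x j)).const_add (‖x‖ ^ 2)).fun_add
        ((hasDerivAt_id' (0:ℝ)).fun_pow 2)).fun_neg.div_const (4 * c)
      refine this.congr_deriv ?_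
      simp; field_simp; ring
    refine (h1.exp.const_mul _).congr_deriv ?_
    simp [hk]; ring
  exact h.ofReal_comp

lemma hasLineDerivAt_ch (j : Fin d) (x ξ : Ed d) :
    HasLineDerivAt ℝ (fun z => ch (-z) ξ) (-(I * (ξ j : ℂ)) * ch (-x) ξ) x
      (EuclideanSpace.single j 1) := by
  unfold HasLineDerivAt ch
  have hi : ∀ u : ℝ, I * ((⟪-(x + u • EuclideanSpace.single j (1:ℝ)), ξ⟫ : ℝ) : ℂ)
      = I * ((⟪-x, ξ⟫ : ℝ) : ℂ) + -(I * (ξ j : ℂ)) * (u : ℂ) := fun u => by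
    rw [neg_add, inner_add_left, inner_neg_left (u • _), inner_smul_left,
      EuclideanSpace.inner_single_left]
    simp; ring
  simp_rw [hi]
  have h1 : HasDerivAt (fun u : ℝ => I * ((⟪-x, ξ⟫ : ℝ) : ℂ) + -(I * (ξ j : ℂ)) * (u : ℂ))
      (-(I * (ξ j : ℂ))) 0 := by
    refine (((hasDerivAt_id' (0:ℝ)).ofReal_comp.const_mul (-(I * (ξ j : ℂ)))).const_add _).congr_deriv ?_
    simp
  refine h1.cexp.congr_deriv ?_
  simp; ring

lemma FT_gk (j : Fin d) {c : ℝ} (hc : 0 < c) (ξ : Ed d) :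
    FT (fun z => (gk j c z : ℂ)) ξ = I * (ξ j : ℂ) * cexp (-((c * ‖ξ‖ ^ 2 : ℝ) : ℂ)) := by
  have hb : ∀ {k : Ed d → ℝ}, Integrable k → Integrable fun z => (k z : ℂ) * ch (-z) ξ := fun hk =>
    hk.ofReal.mul_bdd (c := 1) (Measurable.aestronglyMeasurable (by fun_prop))
    (Eventually.of_forall fun x => (norm_ch _ ξ).le)
  have h := integral_bilinear_hasLineDerivAt_right_eq_neg_left_of_integrable
    (μ := (volume : Measure (Ed d))) (B := ContinuousLinearMap.mul ℝ ℂ)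
    (f := fun z => (hk c z : ℂ)) (f' := fun z => (gk j c z : ℂ)) (g := fun z => ch (-z) ξ)
    (g' := fun z => -(I * (ξ j : ℂ)) * ch (-z) ξ) (v := EuclideanSpace.single j 1)
    (by simpa using hb (integrable_gk j hc))
    (by
      simp only [ContinuousLinearMap.mul_apply']
      refine ((hb (integrable_hk hc)).const_mul (-(I * (ξ j : ℂ)))).congr
        (Eventually.of_forall fun z => ?_)
      simp only; ring)
    (by simpa using hb (integrable_hk hc))
    (fun x _ => hasLineDerivAt_hk j hc x) (fun x _ => hasLineDerivAt_ch j x ξ)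
  simp only [ContinuousLinearMap.mul_apply'] at h
  rw [← FT_hk hc, FT_eq, FT_eq, ← integral_const_mul]
  simp_rw [mul_comm (ch _ ξ) (gk j c _ : ℂ)]
  rw [← neg_inj, ← h, ← integral_neg]
  refine integral_congr_ae (Eventually.of_forall fun z => ?_)
  simp only; ring

/-- Iterated derivatives of the heat kernel, as iterated convolutions. -/
def kk : List (Fin d) → ℝ → Ed d → ℝ
  | [], c => hk c
  | j :: l, c => fun x => ∫ z, gk j c (x - z) * kk l c z

/-- The symbol of the differential operator attached to a list of coordinates. -/
def sym (l : List (Fin d)) (ξ : Ed d) : ℂ := (l.map fun j => I * (ξ j : ℂ)).prod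

@[simp] lemma sym_nil (ξ : Ed d) : sym [] ξ = 1 := by simp [sym]
@[simp] lemma sym_cons (j : Fin d) (l : List (Fin d)) (ξ : Ed d) :
    sym (j :: l) ξ = I * (ξ j : ℂ) * sym l ξ := by simp [sym]

lemma measurable_kk (l : List (Fin d)) (c : ℝ) : Measurable (kk l c) := by
  induction l with
  | nil => exact (continuous_hk c).measurable
  | cons j l ih =>
    unfold kk
    refine (StronglyMeasurable.integral_prod_right (f := fun x z => gk j c (x - z) * kk l c z)
      (Measurable.stronglyMeasurable ?_)).measurable
    simp only [Function.uncurry_def]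
    have := measurable_gk j c
    fun_prop

lemma enorm_kk_le (l : List (Fin d)) {c : ℝ} (hc : 0 < c) (x : Ed d) :
    ‖kk l c x‖ₑ ≤ ENNReal.ofReal (gkc d c) ^ l.length * hkE ((2 * l.length + 1) * c) x := by
  induction l generalizing x with
  | nil => simp [kk, enorm_hk hc]
  | cons j l ih =>
    have hne : ENNReal.ofReal (gkc d c) ^ (l.length + 1) ≠ ⊤ := ENNReal.pow_ne_top ENNReal.ofReal_ne_top
    have h2 := lintegral_hkE_mul_hkE (d := d) (s := 2 * c) (t := (2 * l.length + 1) * c)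
      (by positivity) (by positivity) x 0
    simp only [sub_zero] at h2
    rw [show 2 * c + (2 * l.length + 1) * c = (2 * ((j :: l).length : ℕ) + 1) * c by
      simp; ring] at h2
    rw [← h2, List.length_cons, ← lintegral_const_mul' _ _ hne]
    unfold kk
    refine (enorm_integral_le_lintegral_enorm _).trans (lintegral_mono fun z => ?_)
    rw [enorm_mul, pow_succ']
    calc _ ≤ (ENNReal.ofReal (gkc d c) * hkE (2 * c) (x - z)) *
          (ENNReal.ofReal (gkc d c) ^ l.length * hkE ((2 * l.length + 1) * c) z) :=
          mul_le_mul' (enorm_gk_le j hc _) (ih z)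
      _ = _ := by ring

lemma integrable_kk (l : List (Fin d)) {c : ℝ} (hc : 0 < c) : Integrable (kk l c) :=
  integrable_of_le_hkE (measurable_kk l c) (ENNReal.pow_ne_top ENNReal.ofReal_ne_top)
    (by positivity) (enorm_kk_le l hc)

lemma FT_kk (l : List (Fin d)) {c : ℝ} (hc : 0 < c) (ξ : Ed d) :
    FT (fun z => (kk l c z : ℂ)) ξ = sym l ξ * cexp (-(((l.length + 1) * c * ‖ξ‖ ^ 2 : ℝ) : ℂ)) := by
  induction l with
  | nil => simp [kk, FT_hk hc]
  | cons j l ih =>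
    simp only [kk]
    rw [FT_convolution (integrable_gk j hc) (integrable_kk l hc), ih, FT_gk j hc, sym_cons,
      mul_mul_mul_comm, ← Complex.exp_add]
    congr 2
    push_cast; simp; ring

lemma integral_kk {l : List (Fin d)} (hl : l ≠ []) {c : ℝ} (hc : 0 < c) : ∫ z, kk l c z = 0 := by
  have h := FT_kk l hc 0
  rw [FT_eq] at h
  simp only [ch_zero_right, one_mul] at h
  rw [integral_complex_ofReal] at h
  obtain ⟨j, l, rfl⟩ := List.exists_cons_of_ne_nil hl
  simpa using h

lemma enorm_complex_ofReal {r : ℝ} (hr : 0 ≤ r) : ‖(r : ℂ)‖ₑ = ENNReal.ofReal r := by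
  rw [← ofReal_norm, Complex.norm_real, Real.norm_of_nonneg hr]

lemma cv_const_mul_left (a : ℝ) (k : Ed d → ℝ) (F : Ed d → ℂ) (x : Ed d) :
    cv (fun z => a * k z) F x = (a : ℂ) * cv k F x := by
  unfold cv
  rw [← integral_const_mul]
  congr 1; ext z; push_cast; ring

lemma cv_const_mul_right (a : ℂ) (k : Ed d → ℝ) (F : Ed d → ℂ) (x : Ed d) :
    cv k (fun z => a * F z) x = a * cv k F x := by
  unfold cv
  rw [← integral_const_mul]
  congr 1; ext z; ring

/-- The time parameter of the derivative kernel in `bd`. -/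
def tc (l : List (Fin d)) (t : ℝ) : ℝ := 2 * t / 3 / (2 * l.length + 1)

lemma tc_pos (l : List (Fin d)) {t : ℝ} (ht : 0 < t) : 0 < tc l t := by unfold tc; positivity

/-- A derivative of the heat extension written as a triple convolution. -/
def bd (l : List (Fin d)) (t : ℝ) (h : Ed d → ℂ) : Ed d → ℂ :=
  cv (hk (t / 3)) (cv (kk l (tc l t)) (cv (hk t) h))

lemma lp_bd (hd : 1 ≤ d) {p : ℝ} (hp : 1 < p) {l : List (Fin d)} (hl : l ≠ []) :
    ∃ C : ℝ≥0∞, C ≠ ⊤ ∧ ∀ h : Ed d → ℂ, Measurable h → (∃ c : ℝ, ∀ x, ‖h x‖ ≤ c) →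
      ∫⁻ x, (∫⁻ t, (ENNReal.ofReal (t ^ ((l.length : ℝ) / 2)) * ‖bd l t h x‖ₑ) ^ 2 ∂mu0) ^ (p / 2)
        ≤ C * ∫⁻ x, ‖h x‖ₑ ^ p := by
  set m : ℕ := l.length with hm
  set b : ℝ := (2 ^ ((d : ℝ) / 2) * (3 * (2 * m + 1) / 2) ^ ((1:ℝ) / 2)) ^ m with hb
  have hb0 : 0 ≤ b := by positivity
  obtain ⟨C, hC, H⟩ := lp_kernel hd hp (M := ENNReal.ofReal b) ENNReal.ofReal_ne_top
    (K := fun t z => t ^ ((m : ℝ) / 2) * kk l (tc l t) z)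
    (fun t ht => (measurable_kk l _).const_mul _)
    (fun t ht => by rw [integral_const_mul, integral_kk hl (tc_pos l ht), mul_zero])
    (fun t ht z => by
      have hc := tc_pos l ht
      have h1 : t ^ ((m : ℝ) / 2) * gkc d (tc l t) ^ m = b := by
        rw [hb, show ((m : ℝ) / 2) = (1 / 2) * m by ring, Real.rpow_mul ht.le, Real.rpow_natCast,
          ← mul_pow]
        congr 1
        unfold gkc
        rw [Real.rpow_neg hc.le, ← Real.inv_rpow hc.le, mul_left_comm, ← Real.mul_rpow ht.le
          (by positivity)]
        congr 2
        unfold tc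
        rw [← hm]
        field_simp
      have h2 := enorm_kk_le l hc z
      rw [show (2 * (l.length : ℝ) + 1) * tc l t = 2 * t / 3 by unfold tc; field_simp] at h2
      rw [enorm_mul, Real.enorm_eq_ofReal (by positivity), ← h1,
        ENNReal.ofReal_mul (by positivity), ENNReal.ofReal_pow (gkc_nonneg hc), mul_assoc]
      exact mul_le_mul' le_rfl h2)
  refine ⟨C, hC, fun h hh hbd => ?_⟩
  refine le_trans (le_of_eq ?_) (H h hh hbd)
  refine lintegral_congr fun x => ?_
  congr 1
  refine lintegral_congr_ae ?_
  filter_upwards [ae_mu0_pos] with t ht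
  unfold bd
  rw [funext fun y => cv_const_mul_left (t ^ ((m : ℝ) / 2)) (kk l (tc l t)) (cv (hk t) h) y,
    cv_const_mul_right, enorm_mul, enorm_complex_ofReal (by positivity)]

lemma norm_FT_le (k : Ed d → ℂ) (ξ : Ed d) : ‖FT k ξ‖ ≤ ∫ z, ‖k z‖ := by
  rw [FT_eq]
  refine (norm_integral_le_integral_norm _).trans_eq ?_
  simp [norm_ch]

lemma measurable_FT {k : Ed d → ℂ} (hk : Measurable k) : Measurable (FT k) := by
  have : FT k = fun ξ => ∫ x, ch (-x) ξ * k x := funext (FT_eq k)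
  rw [this]
  refine (StronglyMeasurable.integral_prod_right (f := fun ξ x => ch (-x) ξ * k x)
    (Measurable.stronglyMeasurable ?_)).measurable
  simp only [Function.uncurry_def]
  fun_prop

lemma integrable_FT_mul {k : Ed d → ℂ} (hk : Measurable k) {ψ : Ed d → ℂ} (hψ : Integrable ψ) :
    Integrable fun ξ => FT k ξ * ψ ξ :=
  hψ.bdd_mul (c := ∫ z, ‖k z‖) (measurable_FT hk).aestronglyMeasurable
    (Eventually.of_forall (norm_FT_le k))

/-- The Gaussian factor `exp (-w |ξ|²)`. -/
def ga (w : ℝ) (ξ : Ed d) : ℂ := cexp (-((w * ‖ξ‖ ^ 2 : ℝ) : ℂ))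

lemma ga_eq_ofReal (w : ℝ) (ξ : Ed d) : ga w ξ = ((Real.exp (-(w * ‖ξ‖ ^ 2)) : ℝ) : ℂ) := by
  unfold ga; push_cast; rfl

lemma norm_ga (w : ℝ) (ξ : Ed d) : ‖ga w ξ‖ = Real.exp (-(w * ‖ξ‖ ^ 2)) := by
  rw [ga_eq_ofReal, Complex.norm_real, Real.norm_of_nonneg (Real.exp_pos _).le]

lemma norm_ga_le {w : ℝ} (hw : 0 ≤ w) (ξ : Ed d) : ‖ga w ξ‖ ≤ 1 := by
  rw [norm_ga, Real.exp_le_one_iff]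
  have : 0 ≤ w * ‖ξ‖ ^ 2 := by positivity
  linarith

lemma ga_add (v w : ℝ) (ξ : Ed d) : ga (v + w) ξ = ga v ξ * ga w ξ := by
  unfold ga; rw [← Complex.exp_add]; congr 1; push_cast; ring

@[simp] lemma ga_zero (ξ : Ed d) : ga 0 ξ = 1 := by simp [ga]

@[fun_prop]
lemma measurable_ga_comp {α : Type*} [MeasurableSpace α] {f : α → ℝ} {g : α → Ed d}
    (hf : Measurable f) (hg : Measurable g) : Measurable fun a => ga (f a) (g a) := by
  unfold ga; fun_prop

@[fun_prop]
lemma measurable_sym_comp {α : Type*} [MeasurableSpace α] (l : List (Fin d)) {g : α → Ed d}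
    (hg : Measurable g) : Measurable fun a => sym l (g a) := by
  induction l with
  | nil => simp
  | cons j l ih =>
    simp only [sym_cons]
    have h : Continuous fun z : Ed d => z j := by fun_prop
    have : Measurable fun a => g a j := h.measurable.comp hg
    fun_prop

/-- The derivative `∂^l exp (w Δ)` of the function with frequency density `ψ`. -/
def dP (l : List (Fin d)) (w : ℝ) (ψ : Ed d → ℂ) (x : Ed d) : ℂ :=
  em (fun ξ => sym l ξ * ga w ξ * ψ ξ) x

@[fun_prop]
lemma measurable_dP_comp {α : Type*} [MeasurableSpace α] (l : List (Fin d)) {ψ : Ed d → ℂ}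
    (hψ : Measurable ψ) {f : α → ℝ} {g : α → Ed d}
    (hf : Measurable f) (hg : Measurable g) : Measurable fun a => dP l (f a) ψ (g a) := by
  unfold dP em
  refine (StronglyMeasurable.integral_prod_right (f := fun (a : α) ξ =>
    ch (g a) ξ * (sym l ξ * ga (f a) ξ * ψ ξ)) (Measurable.stronglyMeasurable ?_)).measurable
  simp only [Function.uncurry_def]
  fun_prop

lemma integrable_sym_ga_mul (l : List (Fin d)) {w : ℝ} (hw : 0 < w) {ψ : Ed d → ℂ}
    (hψ : Integrable ψ) : Integrable fun ξ => sym l ξ * ga w ξ * ψ ξ := by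
  have hc : 0 < w / (l.length + 1) := by positivity
  have h := integrable_FT_mul (k := fun z => (kk l (w / (l.length + 1)) z : ℂ))
    ((measurable_kk l _).complex_ofReal) hψ
  refine h.congr (Eventually.of_forall fun ξ => ?_)
  simp only
  rw [FT_kk l hc, ga]
  congr 4
  field_simp

/-- The total time of `bd l t` divided by `t`. -/
def rho (l : List (Fin d)) : ℝ := 4 / 3 + (l.length + 1) * (2 / 3 / (2 * l.length + 1))

lemma rho_pos (l : List (Fin d)) : 0 < rho l := by unfold rho; positivity

lemma bd_em (l : List (Fin d)) {t : ℝ} (ht : 0 < t) {ψ : Ed d → ℂ} (hψ : Integrable ψ) (x : Ed d) :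
    bd l t (em ψ) x = dP l (rho l * t) ψ x := by
  have hc := tc_pos l ht
  have h1 := integrable_FT_mul (k := fun z => (hk t z : ℂ))
    ((continuous_hk t).measurable.complex_ofReal) hψ
  have h2 := integrable_FT_mul (k := fun z => (kk l (tc l t) z : ℂ))
    ((measurable_kk l _).complex_ofReal) h1
  unfold bd
  rw [funext (cv_em (integrable_hk ht) hψ), funext (cv_em (integrable_kk l hc) h1),
    cv_em (integrable_hk (by positivity)) h2]
  unfold dP
  congr 1
  ext ξ
  rw [FT_hk ht, FT_hk (by positivity), FT_kk l hc]
  have : ga (rho l * t) ξ = ga (t / 3) ξ * (ga ((l.length + 1) * tc l t) ξ * ga t ξ) := by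
    rw [← ga_add, ← ga_add]; congr 1; unfold rho tc; ring
  rw [this]
  unfold ga
  ring

lemma lp_em (hd : 1 ≤ d) {p : ℝ} (hp : 1 < p) {l : List (Fin d)} (hl : l ≠ []) :
    ∃ C : ℝ≥0∞, C ≠ ⊤ ∧ ∀ ψ : Ed d → ℂ, Measurable ψ → Integrable ψ →
      ∫⁻ x, (∫⁻ w, (ENNReal.ofReal (w ^ ((l.length : ℝ) / 2)) * ‖dP l w ψ x‖ₑ) ^ 2 ∂mu0) ^ (p / 2)
        ≤ C * ∫⁻ x, ‖em ψ x‖ₑ ^ p := by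
  obtain ⟨C, hC, H⟩ := lp_bd hd hp hl
  set b : ℝ≥0∞ := ENNReal.ofReal (rho l ^ ((l.length : ℝ) / 2)) ^ 2 with hb
  have hbt : b ≠ ⊤ := ENNReal.pow_ne_top ENNReal.ofReal_ne_top
  refine ⟨b ^ (p / 2) * C, ENNReal.mul_ne_top
    (ENNReal.rpow_ne_top_of_nonneg (by linarith) hbt) hC, fun ψ hψm hψ => ?_⟩
  have H' := H (em ψ) (measurable_em hψ) ⟨_, norm_em_le ψ⟩
  rw [mul_assoc]
  refine le_trans ?_ (mul_le_mul' le_rfl H')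
  rw [← lintegral_const_mul' _ _ (ENNReal.rpow_ne_top_of_nonneg (by linarith) hbt)]
  refine lintegral_mono fun x => ?_
  rw [← ENNReal.mul_rpow_of_nonneg _ _ (by linarith : 0 ≤ p / 2), ← lintegral_const_mul' _ _ hbt]
  refine ENNReal.rpow_le_rpow ?_ (by linarith)
  rw [← lintegral_mu0_comp_mul (rho_pos l) (f := fun w =>
    (ENNReal.ofReal (w ^ ((l.length : ℝ) / 2)) * ‖dP l w ψ x‖ₑ) ^ 2) (by fun_prop)]
  refine lintegral_mu0_mono fun t ht => ?_
  rw [bd_em l ht hψ, hb, Real.mul_rpow (rho_pos l).le ht.le,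
    ENNReal.ofReal_mul (Real.rpow_nonneg (rho_pos l).le _)]
  apply le_of_eq
  ring

lemma integral_em {α : Type*} [MeasurableSpace α] {ν : Measure α} [SFinite ν]
    {Ψ : α → Ed d → ℂ} (h : Integrable (fun q : α × Ed d => Ψ q.1 q.2) (ν.prod volume)) (x : Ed d) :
    ∫ v, em (Ψ v) x ∂ν = em (fun ξ => ∫ v, Ψ v ξ ∂ν) x := by
  unfold em
  have h1 : Integrable (fun q : α × Ed d => ch x q.2 * Ψ q.1 q.2) (ν.prod volume) :=
    h.bdd_mul (c := 1) (Measurable.aestronglyMeasurable (by fun_prop))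
      (Eventually.of_forall fun q => (norm_ch _ _).le)
  rw [integral_integral_swap h1]
  simp_rw [integral_const_mul]

lemma lintegral_Ioi_add (r : ℝ) {h : ℝ → ℝ≥0∞} :
    ∫⁻ v in Ioi 0, h (r + v) = ∫⁻ w in Ioi r, h w := by
  rw [← lintegral_indicator measurableSet_Ioi, ← lintegral_indicator measurableSet_Ioi,
    ← lintegral_add_left_eq_self ((Ioi r).indicator h) r]
  refine lintegral_congr fun v => ?_
  simp [Set.indicator]

lemma lintegral_Ioi_eq_mu0 {r : ℝ} (hr : 0 ≤ r) {h : ℝ → ℝ≥0∞} (hh : Measurable h) :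
    ∫⁻ w in Ioi r, h w = ∫⁻ w, (if r < w then ENNReal.ofReal w * h w else 0) ∂mu0 := by
  have hm : Measurable fun w => if r < w then ENNReal.ofReal w * h w else 0 :=
    Measurable.ite measurableSet_Ioi (by fun_prop) measurable_const
  rw [lintegral_mu0 hm, ← lintegral_indicator measurableSet_Ioi,
    ← lintegral_indicator measurableSet_Ioi]
  refine lintegral_congr fun w => ?_
  simp only [Set.indicator, mem_Ioi]
  by_cases h1 : r < w
  · have h0 : 0 < w := hr.trans_lt h1
    rw [if_pos h1, if_pos h0, if_pos h1, ← mul_assoc, ← ENNReal.ofReal_mul (by positivity),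
      inv_mul_cancel₀ h0.ne']
    simp
  · simp [h1]

lemma sum_sym (l : List (Fin d)) (ξ : Ed d) :
    ∑ i, sym (i :: i :: l) ξ = -((‖ξ‖ ^ 2 : ℝ) : ℂ) * sym l ξ := by
  have : ‖ξ‖ ^ 2 = ∑ i, ξ i ^ 2 := by
    rw [EuclideanSpace.norm_sq_eq]; simp
  rw [this]
  push_cast
  rw [← Finset.sum_neg_distrib, Finset.sum_mul]
  refine Finset.sum_congr rfl fun i _ => ?_
  rw [sym_cons, sym_cons]
  have := I_sq
  linear_combination (ξ i : ℂ) ^ 2 * sym l ξ * this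

lemma abs_coord_le (ξ : Ed d) (i : Fin d) : |ξ i| ≤ ‖ξ‖ := by simpa using PiLp.norm_apply_le ξ i

lemma norm_sym_cons_le (i : Fin d) (l : List (Fin d)) (ξ : Ed d) :
    ‖sym (i :: l) ξ‖ ≤ ‖ξ‖ * ‖sym l ξ‖ := by
  rw [sym_cons, norm_mul, norm_mul, norm_I, one_mul, Complex.norm_real]
  gcongr
  exact abs_coord_le ξ i

lemma integrableOn_gamma {b a : ℝ} (hb : 0 ≤ b) (ha : 0 < a) :
    IntegrableOn (fun v : ℝ => v ^ b * Real.exp (-(v * a))) (Ioi 0) := by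
  have := integrableOn_rpow_mul_exp_neg_mul_rpow (p := 1) (s := b) (b := a) (by linarith) (by norm_num) ha
  refine this.congr_fun (fun v _ => ?_) measurableSet_Ioi
  simp [mul_comm]

lemma integral_gamma {b a : ℝ} (hb : 0 ≤ b) (ha : 0 < a) :
    ∫ v in Ioi (0:ℝ), v ^ b * Real.exp (-(v * a)) = a ^ (-(b + 1)) * Real.Gamma (b + 1) := by
  have := Real.integral_rpow_mul_exp_neg_mul_Ioi (a := b + 1) (r := a) (by linarith) ha
  rw [add_sub_cancel_right] at this
  simp_rw [mul_comm a] at this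
  rw [this, one_div, Real.inv_rpow ha.le, Real.rpow_neg ha.le]

/-- The frequency density of the fractional derivative. -/
def fr (σ : ℝ) (φ : Ed d → ℂ) (ξ : Ed d) : ℂ := ((‖ξ‖ ^ σ : ℝ) : ℂ) * φ ξ

@[fun_prop]
lemma measurable_fr (σ : ℝ) {φ : Ed d → ℂ} (hφ : Measurable φ) : Measurable (fr σ φ) := by
  unfold fr; fun_prop

lemma gamma_density_bound {σ : ℝ} (hσ : 0 ≤ σ) {l : List (Fin d)} (hl : l ≠ [])
    {r : ℝ} {φ : Ed d → ℂ} (i : Fin d) (ξ : Ed d) :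
    (∫ v in Ioi (0:ℝ), ‖((v ^ (σ / 2) : ℝ) : ℂ) * (sym (i :: i :: l) ξ * ga (r + v) ξ * fr σ φ ξ)‖) ≤
      Real.Gamma (σ / 2 + 1) * ‖sym l ξ * ga r ξ * φ ξ‖ ∧
    Integrable (fun v : ℝ => ((v ^ (σ / 2) : ℝ) : ℂ) *
      (sym (i :: i :: l) ξ * ga (r + v) ξ * fr σ φ ξ)) (volume.restrict (Ioi 0)) ∧
    (∫ v in Ioi (0:ℝ), ∑ i, ((v ^ (σ / 2) : ℝ) : ℂ) *
      (sym (i :: i :: l) ξ * ga (r + v) ξ * fr σ φ ξ)) =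
      -(Real.Gamma (σ / 2 + 1) : ℂ) * (sym l ξ * ga r ξ * φ ξ) := by
  have hG : 0 < Real.Gamma (σ / 2 + 1) := Real.Gamma_pos_of_pos (by linarith)
  rcases eq_or_ne ξ 0 with rfl | hξ
  · obtain ⟨j, l, rfl⟩ := List.exists_cons_of_ne_nil hl
    simp
  have hn : 0 < ‖ξ‖ := norm_pos_iff.2 hξ
  have ha : 0 < ‖ξ‖ ^ 2 := by positivity
  have hI := integrableOn_gamma (b := σ / 2) (by linarith) ha
  have hV := integral_gamma (b := σ / 2) (by linarith) ha
  have hp : (‖ξ‖ ^ 2) ^ (-(σ / 2 + 1)) * (‖ξ‖ ^ 2 * ‖ξ‖ ^ σ) = 1 := by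
    rw [← Real.rpow_natCast, ← Real.rpow_mul hn.le, ← Real.rpow_add hn, ← Real.rpow_add hn,
      show ((2:ℕ):ℝ) * -(σ / 2 + 1) + (((2:ℕ):ℝ) + σ) = 0 by push_cast; ring, Real.rpow_zero]
  have e : ∀ (i : Fin d) (v : ℝ), ((v ^ (σ / 2) : ℝ) : ℂ) *
      (sym (i :: i :: l) ξ * ga (r + v) ξ * fr σ φ ξ) =
      ((v ^ (σ / 2) * Real.exp (-(v * ‖ξ‖ ^ 2)) : ℝ) : ℂ) *
        (sym (i :: i :: l) ξ * ga r ξ * fr σ φ ξ) := fun i v => by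
    rw [ga_add, ga_eq_ofReal v]; push_cast; ring
  have hI' : ∀ i, Integrable (fun v : ℝ => ((v ^ (σ / 2) : ℝ) : ℂ) *
      (sym (i :: i :: l) ξ * ga (r + v) ξ * fr σ φ ξ)) (volume.restrict (Ioi 0)) := fun i => by
    simp_rw [e]
    exact hI.ofReal.mul_const _
  refine ⟨?_, hI' i, ?_⟩
  · have e2 : ∀ v ∈ Ioi (0:ℝ), ‖((v ^ (σ / 2) : ℝ) : ℂ) *
      (sym (i :: i :: l) ξ * ga (r + v) ξ * fr σ φ ξ)‖ =
      (v ^ (σ / 2) * Real.exp (-(v * ‖ξ‖ ^ 2))) *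
        ‖sym (i :: i :: l) ξ * ga r ξ * fr σ φ ξ‖ := fun v hv => by
      have hv : (0:ℝ) < v := hv
      rw [e, norm_mul, Complex.norm_real, Real.norm_of_nonneg (by positivity)]
    rw [setIntegral_congr_fun measurableSet_Ioi e2, integral_mul_const, hV]
    have h1 : ‖sym (i :: i :: l) ξ * ga r ξ * fr σ φ ξ‖ ≤
        (‖ξ‖ ^ 2 * ‖ξ‖ ^ σ) * ‖sym l ξ * ga r ξ * φ ξ‖ := by
      have := (norm_sym_cons_le i (i :: l) ξ).trans
        (mul_le_mul_of_nonneg_left (norm_sym_cons_le i l ξ) hn.le)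
      unfold fr
      simp only [norm_mul, Complex.norm_real]
      rw [Real.norm_of_nonneg (by positivity : 0 ≤ ‖ξ‖ ^ σ)]
      calc _ ≤ (‖ξ‖ * (‖ξ‖ * ‖sym l ξ‖)) * ‖ga r ξ‖ * (‖ξ‖ ^ σ * ‖φ ξ‖) := by gcongr
        _ = _ := by ring
    calc _ ≤ (‖ξ‖ ^ 2) ^ (-(σ / 2 + 1)) * Real.Gamma (σ / 2 + 1) *
          ((‖ξ‖ ^ 2 * ‖ξ‖ ^ σ) * ‖sym l ξ * ga r ξ * φ ξ‖) := by gcongr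
      _ = ((‖ξ‖ ^ 2) ^ (-(σ / 2 + 1)) * (‖ξ‖ ^ 2 * ‖ξ‖ ^ σ)) *
          (Real.Gamma (σ / 2 + 1) * ‖sym l ξ * ga r ξ * φ ξ‖) := by ring
      _ = _ := by rw [hp, one_mul]
  · rw [integral_finsetSum _ fun i _ => hI' i]
    simp_rw [e]
    simp_rw [integral_mul_const]
    rw [integral_complex_ofReal, hV, ← Finset.mul_sum, ← Finset.sum_mul, ← Finset.sum_mul, sum_sym]
    unfold fr
    have hp' := congrArg (Complex.ofReal) hp
    push_cast at hp' ⊢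
    linear_combination (-(Real.Gamma (σ / 2 + 1) : ℂ) * (sym l ξ * ga r ξ * φ ξ)) * hp'

lemma dP_fractional {σ : ℝ} (hσ : 0 ≤ σ) {l : List (Fin d)} (hl : l ≠ []) {r : ℝ} (hr : 0 < r)
    {φ : Ed d → ℂ} (hφm : Measurable φ) (hφ : Integrable φ) (x : Ed d) :
    (Real.Gamma (σ / 2 + 1) : ℂ) * dP l r φ x =
      -∑ i, ∫ v in Ioi (0:ℝ), ((v ^ (σ / 2) : ℝ) : ℂ) * dP (i :: i :: l) (r + v) (fr σ φ) x := by
  have hInt : ∀ i : Fin d, Integrable (fun q : ℝ × Ed d => ((q.1 ^ (σ / 2) : ℝ) : ℂ) *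
      (sym (i :: i :: l) q.2 * ga (r + q.1) q.2 * fr σ φ q.2))
      ((volume.restrict (Ioi 0)).prod volume) := fun i => by
    have hm : Measurable (fun q : ℝ × Ed d => ((q.1 ^ (σ / 2) : ℝ) : ℂ) *
      (sym (i :: i :: l) q.2 * ga (r + q.1) q.2 * fr σ φ q.2)) := by
      have := measurable_fr σ hφm
      fun_prop
    rw [integrable_prod_iff' hm.aestronglyMeasurable]
    refine ⟨Eventually.of_forall fun ξ => (gamma_density_bound hσ hl i ξ).2.1, ?_⟩
    refine ((integrable_sym_ga_mul l hr hφ).norm.const_mul (Real.Gamma (σ / 2 + 1))).mono'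
      ?_ (Eventually.of_forall fun ξ => ?_)
    · refine (StronglyMeasurable.integral_prod_left (f := fun (v : ℝ) (ξ : Ed d) =>
        ‖((v ^ (σ / 2) : ℝ) : ℂ) * (sym (i :: i :: l) ξ * ga (r + v) ξ * fr σ φ ξ)‖)
        (Measurable.stronglyMeasurable ?_)).aestronglyMeasurable
      exact hm.norm
    · rw [Real.norm_of_nonneg (integral_nonneg fun _ => norm_nonneg _)]
      exact (gamma_density_bound hσ hl i ξ).1
  have e1 : ∀ i : Fin d, ∫ v in Ioi (0:ℝ), ((v ^ (σ / 2) : ℝ) : ℂ) *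
      dP (i :: i :: l) (r + v) (fr σ φ) x = em (fun ξ => ∫ v in Ioi (0:ℝ), ((v ^ (σ / 2) : ℝ) : ℂ) *
      (sym (i :: i :: l) ξ * ga (r + v) ξ * fr σ φ ξ)) x := fun i => by
    rw [← integral_em (hInt i)]
    unfold dP
    simp_rw [em_const_mul]
  simp_rw [e1]
  rw [← em_finset_sum _ fun i _ => (hInt i).integral_prod_right]
  unfold dP
  rw [← em_const_mul, ← neg_one_mul, ← em_const_mul]
  congr 1
  ext ξ
  by_cases hd : Nonempty (Fin d)
  · obtain ⟨i⟩ := hd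
    have h := (gamma_density_bound (φ := φ) (r := r) hσ hl i ξ).2.2
    rw [integral_finsetSum _ fun i _ => (gamma_density_bound hσ hl i ξ).2.1] at h
    rw [h]; ring
  · obtain ⟨j, l, rfl⟩ := List.exists_cons_of_ne_nil hl
    exact absurd ⟨j⟩ hd

/-- The vertical square function of order `l` and smoothness `σ`. -/
def sqf (l : List (Fin d)) (σ : ℝ) (φ : Ed d → ℂ) (x : Ed d) : ℝ≥0∞ :=
  (∫⁻ r, (ENNReal.ofReal (r ^ ((l.length - σ) / 2)) * ‖dP l r φ x‖ₑ) ^ 2 ∂mu0) ^ (1 / 2 : ℝ)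

lemma measurable_sqf (l : List (Fin d)) (σ : ℝ) {φ : Ed d → ℂ} (hφ : Measurable φ) :
    Measurable (sqf l σ φ) := by
  unfold sqf
  refine Measurable.pow_const ?_ _
  refine Measurable.lintegral_prod_right' (f := fun q : Ed d × ℝ =>
    (ENNReal.ofReal (q.2 ^ ((l.length - σ) / 2)) * ‖dP l q.2 φ q.1‖ₑ) ^ 2) ?_
  fun_prop

lemma enorm_dP_le {σ : ℝ} (hσ : 0 ≤ σ) {l : List (Fin d)} (hl : l ≠ []) {r : ℝ} (hr : 0 < r)
    {φ : Ed d → ℂ} (hφm : Measurable φ) (hφ : Integrable φ) (x : Ed d) :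
    ENNReal.ofReal (r ^ ((l.length - σ) / 2)) * ‖dP l r φ x‖ₑ ≤
      ENNReal.ofReal (Real.Gamma (σ / 2 + 1))⁻¹ * ∑ i, ∫⁻ w, pk ((l.length - σ) / 2) r w *
        (ENNReal.ofReal (w ^ (((i :: i :: l).length : ℝ) / 2)) *
          ‖dP (i :: i :: l) w (fr σ φ) x‖ₑ) ∂mu0 := by
  have hG : 0 < Real.Gamma (σ / 2 + 1) := Real.Gamma_pos_of_pos (by linarith)
  have hfm := measurable_fr σ hφm
  have h1 : ∀ i : Fin d, ‖∫ v in Ioi (0:ℝ), ((v ^ (σ / 2) : ℝ) : ℂ) *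
      dP (i :: i :: l) (r + v) (fr σ φ) x‖ₑ ≤
      ∫⁻ w, (if r < w then ENNReal.ofReal w * (ENNReal.ofReal (w ^ (σ / 2)) *
        ‖dP (i :: i :: l) w (fr σ φ) x‖ₑ) else 0) ∂mu0 := fun i => by
    rw [← lintegral_Ioi_eq_mu0 hr.le (h := fun w => ENNReal.ofReal (w ^ (σ / 2)) *
        ‖dP (i :: i :: l) w (fr σ φ) x‖ₑ) (by fun_prop), ← lintegral_Ioi_add]
    refine (enorm_integral_le_lintegral_enorm _).trans ?_
    refine setLIntegral_mono_ae' measurableSet_Ioi (Eventually.of_forall fun v hv => ?_)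
    have hv : (0:ℝ) < v := hv
    rw [enorm_mul, enorm_complex_ofReal (by positivity)]
    gcongr
    linarith
  have h2 : ‖dP l r φ x‖ₑ ≤ ENNReal.ofReal (Real.Gamma (σ / 2 + 1))⁻¹ * ∑ i,
      ∫⁻ w, (if r < w then ENNReal.ofReal w * (ENNReal.ofReal (w ^ (σ / 2)) *
        ‖dP (i :: i :: l) w (fr σ φ) x‖ₑ) else 0) ∂mu0 := by
    have h := dP_fractional hσ hl hr hφm hφ x
    have h' : dP l r φ x = (((Real.Gamma (σ / 2 + 1))⁻¹ : ℝ) : ℂ) * ((Real.Gamma (σ / 2 + 1) : ℂ) * dP l r φ x) := by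
      rw [← mul_assoc, ← Complex.ofReal_mul, inv_mul_cancel₀ hG.ne']; simp
    rw [h', h, enorm_mul, enorm_complex_ofReal (by positivity), enorm_neg]
    gcongr
    exact (enorm_sum_le _ _).trans (Finset.sum_le_sum fun i _ => h1 i)
  refine (mul_le_mul' le_rfl h2).trans_eq ?_
  rw [mul_left_comm, Finset.mul_sum]
  congr 1
  refine Finset.sum_congr rfl fun i _ => ?_
  rw [← lintegral_const_mul' _ _ ENNReal.ofReal_ne_top]
  refine lintegral_congr fun w => ?_
  unfold pk
  split_ifs with hw
  · have hw0 : 0 < w := hr.trans hw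
    rw [← mul_assoc, ← mul_assoc, ← mul_assoc, ← ENNReal.ofReal_mul (by positivity),
      ← ENNReal.ofReal_mul (by positivity), ← ENNReal.ofReal_mul (by positivity)]
    congr 2
    rw [Real.div_rpow hr.le hw0.le, div_mul_eq_mul_div, mul_div_assoc, ← Real.rpow_sub hw0, mul_assoc]
    congr 1
    have : w * w ^ (σ / 2) = w ^ (1 + σ / 2) := by rw [Real.rpow_add hw0, Real.rpow_one]
    rw [this]
    congr 1
    push_cast [List.length_cons]
    ring
  · simp

lemma sqf_le_sum {σ : ℝ} (hσ : 0 ≤ σ) {l : List (Fin d)} (hlσ : σ < l.length)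
    {φ : Ed d → ℂ} (hφm : Measurable φ) (hφ : Integrable φ) (x : Ed d) :
    ∃ C : ℝ≥0∞, C = (ENNReal.ofReal (Real.Gamma (σ / 2 + 1))⁻¹) ^ 2 * (d ^ (2:ℝ) *
        ENNReal.ofReal (1 / ((l.length - σ) / 2)) ^ 2) ∧
      ∫⁻ r, (ENNReal.ofReal (r ^ ((l.length - σ) / 2)) * ‖dP l r φ x‖ₑ) ^ 2 ∂mu0 ≤
      C * ∑ i : Fin d, ∫⁻ w, (ENNReal.ofReal (w ^ (((i :: i :: l).length : ℝ) / 2)) *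
          ‖dP (i :: i :: l) w (fr σ φ) x‖ₑ) ^ 2 ∂mu0 := by
  have hl : l ≠ [] := by rintro rfl; simp at hlσ; linarith
  have hα : 0 < (l.length - σ) / 2 := by linarith
  have hfm := measurable_fr σ hφm
  refine ⟨_, rfl, ?_⟩
  set G := ENNReal.ofReal (Real.Gamma (σ / 2 + 1))⁻¹ with hG
  set a : Fin d → ℝ → ℝ≥0∞ := fun i w => ENNReal.ofReal (w ^ (((i :: i :: l).length : ℝ) / 2)) *
          ‖dP (i :: i :: l) w (fr σ φ) x‖ₑ with ha
  have ham : ∀ i, Measurable (a i) := fun i => by simp only [ha]; fun_prop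
  have hGm : G ^ 2 ≠ ⊤ := ENNReal.pow_ne_top ENNReal.ofReal_ne_top
  have hdm : ((d:ℝ≥0∞) ^ (2:ℝ)) ≠ ⊤ := ENNReal.rpow_ne_top_of_nonneg (by norm_num) (by simp)
  have hpm : ∀ i, Measurable fun r => (∫⁻ w, pk ((l.length - σ) / 2) r w * a i w ∂mu0) ^ 2 := fun i => by
    refine Measurable.pow_const ?_ 2
    refine Measurable.lintegral_prod_right' (f := fun q : ℝ × ℝ =>
      pk ((l.length - σ) / 2) q.1 q.2 * a i q.2) ?_
    have := measurable_pk ((l.length - σ) / 2)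
    exact this.mul ((ham i).comp measurable_snd)
  calc _ ≤ ∫⁻ r, G ^ 2 * (d ^ (2:ℝ) * ∑ i, (∫⁻ w, pk ((l.length - σ) / 2) r w * a i w ∂mu0) ^ 2) ∂mu0 := by
        refine lintegral_mu0_mono fun r hr => ?_
        have h := enorm_dP_le hσ hl hr hφm hφ x
        refine (pow_le_pow_left' h 2).trans ?_
        rw [mul_pow]
        gcongr
        have := sum_rpow_le (Finset.univ : Finset (Fin d))
          (fun i => ∫⁻ w, pk ((l.length - σ) / 2) r w * a i w ∂mu0) (r := 2) (by norm_num)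
        rw [Finset.card_univ, Fintype.card_fin] at this
        simp_rw [ENNReal.rpow_two] at this ⊢
        exact this
    _ = G ^ 2 * (d ^ (2:ℝ) * ∑ i, ∫⁻ r, (∫⁻ w, pk ((l.length - σ) / 2) r w * a i w ∂mu0) ^ 2 ∂mu0) := by
        rw [lintegral_const_mul' _ _ hGm, lintegral_const_mul' _ _ hdm,
          lintegral_finsetSum _ fun i _ => hpm i]
    _ ≤ G ^ 2 * (d ^ (2:ℝ) * ∑ i, ENNReal.ofReal (1 / ((l.length - σ) / 2)) ^ 2 * ∫⁻ w, a i w ^ 2 ∂mu0) := by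
        gcongr with i
        exact hardy_up hα (ham i)
    _ = _ := by rw [← Finset.mul_sum]; ring

/-- Square functions are controlled by fractional derivatives. -/
lemma lp_sqf (hd : 1 ≤ d) {p : ℝ} (hp : 1 < p) {σ : ℝ} (hσ : 0 ≤ σ) {l : List (Fin d)}
    (hlσ : σ < l.length) :
    ∃ C : ℝ≥0∞, C ≠ ⊤ ∧ ∀ φ : Ed d → ℂ, Measurable φ → Integrable φ → Integrable (fr σ φ) →
      ∫⁻ x, sqf l σ φ x ^ p ≤ C * ∫⁻ x, ‖em (fr σ φ) x‖ₑ ^ p := by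
  choose C hC H using fun i : Fin d => lp_em hd hp (l := i :: i :: l) (by simp)
  set K : ℝ≥0∞ := (ENNReal.ofReal (Real.Gamma (σ / 2 + 1))⁻¹) ^ 2 * (d ^ (2:ℝ) *
        ENNReal.ofReal (1 / ((l.length - σ) / 2)) ^ 2) with hK
  have hKt : K ≠ ⊤ := ENNReal.mul_ne_top (ENNReal.pow_ne_top ENNReal.ofReal_ne_top)
    (ENNReal.mul_ne_top (ENNReal.rpow_ne_top_of_nonneg (by norm_num) (by simp))
      (ENNReal.pow_ne_top ENNReal.ofReal_ne_top))
  have hKt' : K ^ (p / 2) ≠ ⊤ := ENNReal.rpow_ne_top_of_nonneg (by linarith) hKt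
  have hst : ∑ i, C i ≠ ⊤ := by simpa using fun i => hC i
  refine ⟨K ^ (p / 2) * ((Fintype.card (Fin d) : ℝ≥0∞) ^ (p / 2) * (Fintype.card (Fin d) * ∑ i, C i)),
    ENNReal.mul_ne_top hKt' (ENNReal.mul_ne_top
      (ENNReal.rpow_ne_top_of_nonneg (by linarith) (by simp)) (ENNReal.mul_ne_top (by simp) hst)),
    fun φ hφm hφ hφσ => ?_⟩
  have hfm := measurable_fr σ hφm
  set A : Fin d → Ed d → ℝ≥0∞ := fun i x => ∫⁻ w, (ENNReal.ofReal
    (w ^ (((i :: i :: l).length : ℝ) / 2)) * ‖dP (i :: i :: l) w (fr σ φ) x‖ₑ) ^ 2 ∂mu0 with hA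
  have hAm : ∀ i, Measurable (A i) := fun i => by
    simp only [hA]
    refine Measurable.lintegral_prod_right' (f := fun q : Ed d × ℝ =>
      (ENNReal.ofReal (q.2 ^ (((i :: i :: l).length : ℝ) / 2)) *
        ‖dP (i :: i :: l) q.2 (fr σ φ) q.1‖ₑ) ^ 2) ?_
    fun_prop
  have h1 := lintegral_sum_sqfun_le hAm (r := p / 2) (by linarith) (C := ∑ i, C i)
    (I := ∫⁻ x, ‖em (fr σ φ) x‖ₑ ^ p) (μ := volume) (fun i => (H i _ hfm hφσ).trans (by
      gcongr
      exact Finset.single_le_sum (f := C) (fun _ _ => zero_le) (Finset.mem_univ i)))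
  rw [mul_assoc]
  refine le_trans ?_ (mul_le_mul' le_rfl h1)
  rw [← lintegral_const_mul' _ _ hKt']
  refine lintegral_mono fun x => ?_
  obtain ⟨_, rfl, h2⟩ := sqf_le_sum hσ hlσ hφm hφ x
  unfold sqf
  rw [← ENNReal.rpow_mul, ← ENNReal.mul_rpow_of_nonneg _ _ (by linarith : 0 ≤ p / 2),
    show 1 / 2 * p = p / 2 by ring]
  exact ENNReal.rpow_le_rpow h2 (by linarith)

/-- Bilinear trigonometric integral. -/
def em2 (Φ : Ed d × Ed d → ℂ) (x : Ed d) : ℂ := ∫ q : Ed d × Ed d, ch x (q.1 + q.2) * Φ q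

lemma integrable_ch_mul2 {Φ : Ed d × Ed d → ℂ} (hΦ : Integrable Φ) (x : Ed d) :
    Integrable fun q : Ed d × Ed d => ch x (q.1 + q.2) * Φ q :=
  hΦ.bdd_mul (c := 1) (Measurable.aestronglyMeasurable (by fun_prop))
    (Eventually.of_forall fun _ => (norm_ch _ _).le)

lemma em_mul_em2 (a b : Ed d → ℂ) (x : Ed d) :
    em a x * em b x = em2 (fun q => a q.1 * b q.2) x := by
  unfold em em2
  rw [← integral_prod_mul]
  refine integral_congr_ae (Eventually.of_forall fun q => ?_)
  simp only [ch_add_right]; ring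

lemma em2_add {Φ Ψ : Ed d × Ed d → ℂ} (hΦ : Integrable Φ) (hΨ : Integrable Ψ) (x : Ed d) :
    em2 (fun q => Φ q + Ψ q) x = em2 Φ x + em2 Ψ x := by
  unfold em2
  rw [← integral_add (integrable_ch_mul2 hΦ x) (integrable_ch_mul2 hΨ x)]
  simp_rw [mul_add]

lemma em2_sub {Φ Ψ : Ed d × Ed d → ℂ} (hΦ : Integrable Φ) (hΨ : Integrable Ψ) (x : Ed d) :
    em2 (fun q => Φ q - Ψ q) x = em2 Φ x - em2 Ψ x := by
  unfold em2
  rw [← integral_sub (integrable_ch_mul2 hΦ x) (integrable_ch_mul2 hΨ x)]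
  simp_rw [mul_sub]

lemma em2_const_mul (a : ℂ) (Φ : Ed d × Ed d → ℂ) (x : Ed d) :
    em2 (fun q => a * Φ q) x = a * em2 Φ x := by
  unfold em2
  rw [← integral_const_mul]
  congr 1; ext ξ; ring

lemma em2_finset_sum {ι : Type*} (S : Finset ι) {Ψ : ι → Ed d × Ed d → ℂ}
    (hΨ : ∀ i ∈ S, Integrable (Ψ i)) (x : Ed d) :
    em2 (fun q => ∑ i ∈ S, Ψ i q) x = ∑ i ∈ S, em2 (Ψ i) x := by
  unfold em2
  rw [← integral_finsetSum S fun i hi => integrable_ch_mul2 (hΨ i hi) x]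
  simp_rw [Finset.mul_sum]

lemma cv_em2 {k : Ed d → ℝ} (hk : Integrable k) {Φ : Ed d × Ed d → ℂ} (hΦ : Integrable Φ)
    (x : Ed d) :
    cv k (em2 Φ) x = em2 (fun q => FT (fun z => (k z : ℂ)) (q.1 + q.2) * Φ q) x := by
  unfold cv em2
  have h1 : Integrable fun p : Ed d × (Ed d × Ed d) =>
      ((k (x - p.1) : ℝ) : ℂ) * (ch p.1 (p.2.1 + p.2.2) * Φ p.2) := by
    have := (((hk.comp_sub_left x).ofReal (𝕜 := ℂ)).mul_prod hΦ).bdd_mul (c := 1)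
      (f := fun p : Ed d × (Ed d × Ed d) => ch p.1 (p.2.1 + p.2.2))
      (Measurable.aestronglyMeasurable (by fun_prop)) (Eventually.of_forall fun q => (norm_ch _ _).le)
    refine this.congr (Eventually.of_forall fun q => ?_)
    simp only; exact mul_left_comm _ _ _
  simp_rw [← integral_const_mul]
  rw [integral_integral_swap h1]
  refine integral_congr_ae (Eventually.of_forall fun q => ?_)
  simp only
  rw [FT_eq, ← integral_sub_left_eq_self _ _ x, ← mul_assoc, ← integral_const_mul,
    ← integral_mul_const]
  refine integral_congr_ae (Eventually.of_forall fun z => ?_)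
  simp only
  have : ch (x - z) (q.1 + q.2) = ch x (q.1 + q.2) * ch (-z) (q.1 + q.2) := by
    rw [← ch_add_left, sub_eq_add_neg]
  rw [this, sub_sub_cancel]; ring

lemma integrable_FT_mul2 {k : Ed d → ℂ} (hk : Measurable k) {Φ : Ed d × Ed d → ℂ}
    (hΦ : Integrable Φ) : Integrable fun q : Ed d × Ed d => FT k (q.1 + q.2) * Φ q :=
  hΦ.bdd_mul (c := ∫ z, ‖k z‖)
    ((measurable_FT hk).comp (measurable_fst.add measurable_snd)).aestronglyMeasurable
    (Eventually.of_forall fun _ => norm_FT_le k _)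

lemma integral_em2 {α : Type*} [MeasurableSpace α] {ν : Measure α} [SFinite ν]
    {Ψ : α → Ed d × Ed d → ℂ}
    (h : Integrable (fun q : α × (Ed d × Ed d) => Ψ q.1 q.2) (ν.prod volume)) (x : Ed d) :
    ∫ v, em2 (Ψ v) x ∂ν = em2 (fun ξ => ∫ v, Ψ v ξ ∂ν) x := by
  unfold em2
  have h1 : Integrable (fun q : α × (Ed d × Ed d) => ch x (q.2.1 + q.2.2) * Ψ q.1 q.2)
      (ν.prod volume) :=
    h.bdd_mul (c := 1) (Measurable.aestronglyMeasurable (by fun_prop))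
      (Eventually.of_forall fun q => (norm_ch _ _).le)
  rw [integral_integral_swap h1]
  simp_rw [integral_const_mul]

lemma sum_sym_mul_sym (ξ η : Ed d) :
    ∑ j, sym [j] ξ * sym [j] η = -((⟪ξ, η⟫ : ℝ) : ℂ) := by
  have : (⟪ξ, η⟫ : ℝ) = ∑ j, ξ j * η j := by
    rw [PiLp.inner_apply]; simp [mul_comm]
  rw [this]
  push_cast
  rw [← Finset.sum_neg_distrib]
  refine Finset.sum_congr rfl fun i _ => ?_
  simp only [sym_cons, sym_nil]
  linear_combination (ξ i : ℂ) * η i * I_sq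

lemma integral_ga_interval (ξ η : Ed d) {τ : ℝ} (hτ : 0 < τ) :
    ∫ r in Ioo 0 τ, 2 * ∑ j, ga (τ - r) (ξ + η) * (sym [j] ξ * ga r ξ) * (sym [j] η * ga r η)
      = ga τ (ξ + η) - ga τ ξ * ga τ η := by
  have hE : ∀ r : ℝ, HasDerivAt (fun r : ℝ => -(ga (τ - r) (ξ + η) * ga r ξ * ga r η))
      (2 * ∑ j, ga (τ - r) (ξ + η) * (sym [j] ξ * ga r ξ) * (sym [j] η * ga r η)) r := fun r => by
    have e1 : ∀ r : ℝ, -(ga (τ - r) (ξ + η) * ga r ξ * ga r η) =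
        -cexp (-((τ * ‖ξ + η‖ ^ 2 : ℝ) : ℂ) + ((2 * ⟪ξ, η⟫ : ℝ) : ℂ) * (r : ℂ)) := fun r => by
      unfold ga
      rw [← Complex.exp_add, ← Complex.exp_add]
      congr 2
      have h := norm_add_sq_real ξ η
      have h' : (2 * ⟪ξ, η⟫ : ℝ) = ‖ξ + η‖ ^ 2 - ‖ξ‖ ^ 2 - ‖η‖ ^ 2 := by linarith
      rw [h']; push_cast; ring
    have e2 : 2 * ∑ j, ga (τ - r) (ξ + η) * (sym [j] ξ * ga r ξ) * (sym [j] η * ga r η) =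
        -(ga (τ - r) (ξ + η) * ga r ξ * ga r η) * ((2 * ⟪ξ, η⟫ : ℝ) : ℂ) := by
      have : ∀ j : Fin d, ga (τ - r) (ξ + η) * (sym [j] ξ * ga r ξ) * (sym [j] η * ga r η) =
        (ga (τ - r) (ξ + η) * ga r ξ * ga r η) * (sym [j] ξ * sym [j] η) := fun j => by ring
      simp_rw [this]
      rw [← Finset.mul_sum, sum_sym_mul_sym]; push_cast; ring
    rw [e2, e1]
    simp_rw [e1]
    have h1 : HasDerivAt (fun r : ℝ => -((τ * ‖ξ + η‖ ^ 2 : ℝ) : ℂ) + ((2 * ⟪ξ, η⟫ : ℝ) : ℂ) * (r : ℂ))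
        ((2 * ⟪ξ, η⟫ : ℝ) : ℂ) r :=
      (((hasDerivAt_id' r).ofReal_comp.const_mul _).const_add _).congr_deriv (by simp)
    exact h1.cexp.fun_neg.congr_deriv (by ring)
  have hc : Continuous fun r : ℝ =>
      2 * ∑ j, ga (τ - r) (ξ + η) * (sym [j] ξ * ga r ξ) * (sym [j] η * ga r η) := by
    unfold ga; fun_prop
  rw [← integral_Ioc_eq_integral_Ioo, ← intervalIntegral.integral_of_le hτ.le,
    intervalIntegral.integral_eq_sub_of_hasDerivAt (fun r _ => hE r) (hc.intervalIntegrable _ _)]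
  simp only [sub_self, sub_zero, ga_zero]; ring

/-- Moment condition on a frequency density. -/
structure Mom1 (a : Ed d → ℂ) : Prop where
  meas : Measurable a
  int : Integrable a
  int1 : ∀ j : Fin d, Integrable fun ξ => sym [j] ξ * a ξ

lemma integrable_ga_mul {w : ℝ} (hw : 0 ≤ w) {a : Ed d → ℂ} (ha : Integrable a) :
    Integrable fun ξ => ga w ξ * a ξ :=
  ha.bdd_mul (c := 1) (Measurable.aestronglyMeasurable (by fun_prop))
    (Eventually.of_forall fun ξ => norm_ga_le hw ξ)

lemma cv_hk_em {t : ℝ} (ht : 0 < t) {a : Ed d → ℂ} (ha : Integrable a) (x : Ed d) :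
    cv (hk t) (em a) x = em (fun ξ => ga t ξ * a ξ) x := by
  rw [cv_em (integrable_hk ht) ha]
  simp_rw [FT_hk ht]; rfl

lemma cv_hk_mul {t : ℝ} (ht : 0 < t) {a b : Ed d → ℂ} (ha : Integrable a) (hb : Integrable b)
    (x : Ed d) : cv (hk t) (fun y => em a y * em b y) x =
      em2 (fun q => ga t (q.1 + q.2) * (a q.1 * b q.2)) x := by
  have : (fun y => em a y * em b y) = em2 (fun q => a q.1 * b q.2) := funext (em_mul_em2 a b)
  rw [this, cv_em2 (integrable_hk ht) (ha.mul_prod hb)]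
  simp_rw [FT_hk ht]; rfl

lemma heat_product_defect {a b : Ed d → ℂ} (ha : Mom1 a) (hb : Mom1 b) {τ : ℝ} (hτ : 0 < τ)
    (x : Ed d) :
    cv (hk τ) (fun y => em a y * em b y) x - dP [] τ a x * dP [] τ b x =
      ∫ r in Ioo 0 τ, 2 * ∑ j, cv (hk (τ - r)) (fun y => dP [j] r a y * dP [j] r b y) x := by
  have ha' := ha.meas
  have hb' := hb.meas
  set Ψ : Fin d → ℝ → Ed d × Ed d → ℂ := fun j r q =>
    ga (τ - r) (q.1 + q.2) * ((sym [j] q.1 * ga r q.1 * a q.1) * (sym [j] q.2 * ga r q.2 * b q.2)) with hΨ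
  have hsg : ∀ (j : Fin d) {r : ℝ}, 0 ≤ r → ∀ {u : Ed d → ℂ}, Mom1 u →
      Integrable fun ξ => sym [j] ξ * ga r ξ * u ξ := fun j r hr u hu =>
    (integrable_ga_mul hr (hu.int1 j)).congr (Eventually.of_forall fun ξ => by simp only; ring)
  have hΨi : ∀ j, ∀ r ∈ Ioo 0 τ, Integrable (Ψ j r) := fun j r hr => by
    refine ((hsg j hr.1.le ha).mul_prod (hsg j hr.1.le hb)).bdd_mul (c := 1)
      (Measurable.aestronglyMeasurable (by fun_prop))
      (Eventually.of_forall fun q => norm_ga_le (sub_nonneg.2 hr.2.le) _)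
  have hΨI : ∀ j, Integrable (fun q : ℝ × (Ed d × Ed d) => Ψ j q.1 q.2)
      ((volume.restrict (Ioo 0 τ)).prod volume) := fun j => by
    have h0 : Integrable (fun _ : ℝ => (1:ℂ)) (volume.restrict (Ioo 0 τ)) := by
      refine integrable_const _
    have h1 := h0.mul_prod ((ha.int1 j).mul_prod (hb.int1 j))
    refine h1.mono (Measurable.aestronglyMeasurable ?_) ?_
    · simp only [hΨ]; fun_prop
    · have hae : ∀ᵐ q ∂((volume.restrict (Ioo 0 τ)).prod (volume : Measure (Ed d × Ed d))),
          q.1 ∈ Ioo 0 τ :=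
        Measure.quasiMeasurePreserving_fst.ae (ae_restrict_mem measurableSet_Ioo)
      filter_upwards [hae] with q hq
      simp only [hΨ, one_mul, norm_mul]
      have g1 := norm_ga_le (sub_nonneg.2 hq.2.le) (q.2.1 + q.2.2)
      have g2 := norm_ga_le hq.1.le q.2.1
      have g3 := norm_ga_le hq.1.le q.2.2
      calc _ ≤ 1 * ((‖sym [j] q.2.1‖ * 1 * ‖a q.2.1‖) * (‖sym [j] q.2.2‖ * 1 * ‖b q.2.2‖)) := by
            gcongr
        _ = _ := by ring
  have e1 : ∫ r in Ioo 0 τ, 2 * ∑ j, cv (hk (τ - r)) (fun y => dP [j] r a y * dP [j] r b y) x =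
      ∫ r in Ioo 0 τ, em2 (fun q => 2 * ∑ j, Ψ j r q) x := by
    refine setIntegral_congr_fun measurableSet_Ioo fun r hr => ?_
    rw [em2_const_mul, em2_finset_sum _ fun j _ => hΨi j r hr]
    congr 1
    refine Finset.sum_congr rfl fun j _ => ?_
    unfold dP
    rw [cv_hk_mul (sub_pos.2 hr.2) (hsg j hr.1.le ha) (hsg j hr.1.le hb)]
  have hI2 : Integrable (fun q : ℝ × (Ed d × Ed d) => 2 * ∑ j, Ψ j q.1 q.2)
      ((volume.restrict (Ioo 0 τ)).prod volume) :=
    (integrable_finsetSum _ fun j _ => hΨI j).const_mul 2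
  have hInt : Integrable fun q : Ed d × Ed d => ga τ (q.1 + q.2) * (a q.1 * b q.2) :=
    (ha.int.mul_prod hb.int).bdd_mul (c := 1) (Measurable.aestronglyMeasurable (by fun_prop))
      (Eventually.of_forall fun q => norm_ga_le hτ.le _)
  have hint2 : Integrable fun q : Ed d × Ed d => (ga τ q.1 * a q.1) * (ga τ q.2 * b q.2) :=
    (integrable_ga_mul hτ.le ha.int).mul_prod (integrable_ga_mul hτ.le hb.int)
  rw [e1, integral_em2 (Ψ := fun r q => 2 * ∑ j, Ψ j r q) hI2, cv_hk_mul hτ ha.int hb.int]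
  unfold dP
  simp only [sym_nil, one_mul]
  rw [em_mul_em2, ← em2_sub hInt hint2]
  congr 1
  ext q
  have h := integral_ga_interval q.1 q.2 hτ
  have e3 : ∀ r : ℝ, 2 * ∑ j, Ψ j r q = (2 * ∑ j, ga (τ - r) (q.1 + q.2) *
      (sym [j] q.1 * ga r q.1) * (sym [j] q.2 * ga r q.2)) * (a q.1 * b q.2) := fun r => by
    rw [mul_assoc, Finset.sum_mul]
    congr 1
    refine Finset.sum_congr rfl fun j _ => ?_
    simp only [hΨ]; ring
  simp_rw [e3]
  rw [integral_mul_const, h]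
  ring

lemma enorm_heat_product_defect_le {a b : Ed d → ℂ} (ha : Mom1 a) (hb : Mom1 b) {τ : ℝ}
    (hτ : 0 < τ) (x : Ed d) :
    ‖cv (hk τ) (fun y => em a y * em b y) x - dP [] τ a x * dP [] τ b x‖ₑ ≤
      2 * ∑ j, ∫⁻ r in Ioo 0 τ, Pe (τ - r) (fun y => ‖dP [j] r a y‖ₑ * ‖dP [j] r b y‖ₑ) x := by
  have ha' := ha.meas
  have hb' := hb.meas
  rw [heat_product_defect ha hb hτ]
  refine (enorm_integral_le_lintegral_enorm _).trans ?_
  have hm : ∀ j, Measurable fun r => Pe (τ - r) (fun y => ‖dP [j] r a y‖ₑ * ‖dP [j] r b y‖ₑ) x := by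
    intro j
    unfold Pe
    refine Measurable.lintegral_prod_right' (f := fun q : ℝ × Ed d =>
      hkE (τ - q.1) (x - q.2) * (‖dP [j] q.1 a q.2‖ₑ * ‖dP [j] q.1 b q.2‖ₑ)) ?_
    fun_prop
  rw [← lintegral_finsetSum _ fun j _ => hm j, ← lintegral_const_mul' _ _ (by simp)]
  refine setLIntegral_mono_ae' measurableSet_Ioo (Eventually.of_forall fun r hr => ?_)
  rw [enorm_mul]
  have h2 : ‖(2:ℂ)‖ₑ = 2 := by
    have := enorm_complex_ofReal (r := 2) (by norm_num)
    simpa using this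
  rw [h2]
  gcongr
  refine (enorm_sum_le _ _).trans (Finset.sum_le_sum fun j _ => ?_)
  refine (enorm_cv_hk_le _ (sub_pos.2 hr.2) x).trans_eq ?_
  simp_rw [enorm_mul]

/-- Normalising constant of the heat representation of the fractional Laplacian. -/
def kap (s : ℝ) : ℝ := ∫ t in Ioi (0:ℝ), t ^ (-(s / 2) - 1) * (1 - Real.exp (-t))

lemma integrableOn_heat_gap {s : ℝ} (hs0 : 0 < s) (hs1 : s < 2) :
    IntegrableOn (fun t : ℝ => t ^ (-(s / 2) - 1) * (1 - Real.exp (-t))) (Ioi 0) := by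
  have hm : Measurable fun t : ℝ => t ^ (-(s / 2) - 1) * (1 - Real.exp (-t)) := by fun_prop
  rw [← Ioc_union_Ioi_eq_Ioi zero_le_one]
  refine IntegrableOn.union ?_ ?_
  · have h : IntegrableOn (fun t : ℝ => t ^ (-(s / 2))) (Ioc 0 1) :=
      (intervalIntegrable_iff_integrableOn_Ioc_of_le zero_le_one).1
        (intervalIntegral.intervalIntegrable_rpow' (by linarith))
    refine Integrable.mono' h hm.aestronglyMeasurable ?_
    refine (ae_restrict_iff' measurableSet_Ioc).2 (Eventually.of_forall fun t ht => ?_)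
    have h1 : 1 - Real.exp (-t) ≤ t := by have := Real.add_one_le_exp (-t); linarith
    have h0 : 0 ≤ 1 - Real.exp (-t) := by
      have : Real.exp (-t) ≤ 1 := Real.exp_le_one_iff.2 (by linarith [ht.1])
      linarith
    have hp : (0:ℝ) ≤ t ^ (-(s / 2) - 1) := Real.rpow_nonneg ht.1.le _
    rw [Real.norm_of_nonneg (mul_nonneg hp h0)]
    calc t ^ (-(s / 2) - 1) * (1 - Real.exp (-t)) ≤ t ^ (-(s / 2) - 1) * t := by gcongr
      _ = t ^ (-(s / 2)) := by
        nth_rw 2 [← Real.rpow_one t]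
        rw [← Real.rpow_add ht.1]; congr 1; ring
  · have h : IntegrableOn (fun t : ℝ => t ^ (-(s / 2) - 1)) (Ioi 1) :=
      integrableOn_Ioi_rpow_of_lt (by linarith) zero_lt_one
    refine Integrable.mono' h hm.aestronglyMeasurable ?_
    refine (ae_restrict_iff' measurableSet_Ioi).2 (Eventually.of_forall fun t ht => ?_)
    have ht0 : (0:ℝ) < t := lt_trans zero_lt_one ht
    have h1 : 1 - Real.exp (-t) ≤ 1 := by have := Real.exp_pos (-t); linarith
    have h0 : 0 ≤ 1 - Real.exp (-t) := by
      have : Real.exp (-t) ≤ 1 := Real.exp_le_one_iff.2 (by linarith)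
      linarith
    have hp : (0:ℝ) ≤ t ^ (-(s / 2) - 1) := Real.rpow_nonneg ht0.le _
    rw [Real.norm_of_nonneg (mul_nonneg hp h0)]
    exact mul_le_of_le_one_right hp h1

lemma kap_pos {s : ℝ} (hs0 : 0 < s) (hs1 : s < 2) : 0 < kap s := by
  have hpos : ∀ t ∈ Ioi (0:ℝ), 0 < t ^ (-(s / 2) - 1) * (1 - Real.exp (-t)) := fun t ht => by
    have : Real.exp (-t) < 1 := Real.exp_lt_one_iff.2 (by linarith [mem_Ioi.1 ht])
    exact mul_pos (Real.rpow_pos_of_pos ht _) (by linarith)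
  unfold kap
  rw [setIntegral_pos_iff_support_of_nonneg_ae
    ((ae_restrict_iff' measurableSet_Ioi).2 (Eventually.of_forall fun t ht => (hpos t ht).le))
    (integrableOn_heat_gap hs0 hs1)]
  have : Ioi (0:ℝ) ⊆ Function.support (fun t : ℝ => t ^ (-(s / 2) - 1) * (1 - Real.exp (-t))) ∩
      Ioi 0 := fun t ht => ⟨(hpos t ht).ne', ht⟩
  exact lt_of_lt_of_le (by simp) (measure_mono this)

lemma heat_gap {s : ℝ} (hs0 : 0 < s) (hs1 : s < 2) {a : ℝ} (ha : 0 ≤ a) :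
    IntegrableOn (fun t : ℝ => t ^ (-(s / 2) - 1) * (1 - Real.exp (-(t * a)))) (Ioi 0) ∧
    ∫ t in Ioi (0:ℝ), t ^ (-(s / 2) - 1) * (1 - Real.exp (-(t * a))) = kap s * a ^ (s / 2) := by
  rcases ha.eq_or_lt with rfl | ha
  · simp [Real.zero_rpow (by positivity : s / 2 ≠ 0)]
  have key : ∀ t ∈ Ioi (0:ℝ), t ^ (-(s / 2) - 1) * (1 - Real.exp (-(t * a))) =
      a ^ (s / 2 + 1) * ((a * t) ^ (-(s / 2) - 1) * (1 - Real.exp (-(a * t)))) := fun t ht => by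
    rw [Real.mul_rpow ha.le (mem_Ioi.1 ht).le, mul_comm t a]
    have : a ^ (s / 2 + 1) * a ^ (-(s / 2) - 1) = 1 := by
      rw [← Real.rpow_add ha]; ring_nf; simp
    linear_combination (-(t ^ (-(s / 2) - 1) * (1 - Real.exp (-(a * t))))) * this
  constructor
  · rw [integrableOn_congr_fun key measurableSet_Ioi]
    have h := (integrableOn_Ioi_comp_mul_left_iff
      (fun t : ℝ => t ^ (-(s / 2) - 1) * (1 - Real.exp (-t))) 0 ha).2
      (by simpa using integrableOn_heat_gap hs0 hs1)
    exact h.const_mul _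
  · rw [setIntegral_congr_fun measurableSet_Ioi key, integral_const_mul]
    have h := integral_comp_mul_left_Ioi
      (fun t : ℝ => t ^ (-(s / 2) - 1) * (1 - Real.exp (-t))) 0 ha
    rw [h, mul_zero, Real.rpow_add ha, Real.rpow_one, kap, smul_eq_mul]
    field_simp

lemma integrable_integral_em {α : Type*} [MeasurableSpace α] {ν : Measure α} [SFinite ν]
    {Ψ : α → Ed d → ℂ} (h : Integrable (fun q : α × Ed d => Ψ q.1 q.2) (ν.prod volume))
    (x : Ed d) : Integrable (fun v => em (Ψ v) x) ν := by
  have h1 : Integrable (fun q : α × Ed d => ch x q.2 * Ψ q.1 q.2) (ν.prod volume) :=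
    h.bdd_mul (c := 1) (Measurable.aestronglyMeasurable (by fun_prop))
      (Eventually.of_forall fun q => (norm_ch _ _).le)
  exact h1.integral_prod_left

lemma integrable_heat_density {s : ℝ} (hs0 : 0 < s) (hs1 : s < 2) {u : Ed d → ℂ}
    (hum : Measurable u) (hus : Integrable (fr s u)) :
    Integrable (fun q : ℝ × Ed d =>
      ((q.1 ^ (-(s / 2) - 1) : ℝ) : ℂ) * ((1 - ga q.1 q.2) * u q.2))
      ((volume.restrict (Ioi 0)).prod volume) := by
  have hnorm : ∀ t ∈ Ioi (0:ℝ), ∀ ξ : Ed d,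
      ‖((t ^ (-(s / 2) - 1) : ℝ) : ℂ) * ((1 - ga t ξ) * u ξ)‖ =
      (t ^ (-(s / 2) - 1) * (1 - Real.exp (-(t * ‖ξ‖ ^ 2)))) * ‖u ξ‖ := fun t ht ξ => by
    have h0 : 0 ≤ 1 - Real.exp (-(t * ‖ξ‖ ^ 2)) := by
      have : Real.exp (-(t * ‖ξ‖ ^ 2)) ≤ 1 := Real.exp_le_one_iff.2 (by
        have := mul_nonneg (mem_Ioi.1 ht).le (sq_nonneg ‖ξ‖); linarith)
      linarith
    rw [norm_mul, norm_mul, ga_eq_ofReal, ← ofReal_one, ← ofReal_sub, norm_real, norm_real,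
      Real.norm_of_nonneg h0, Real.norm_of_nonneg (Real.rpow_nonneg (mem_Ioi.1 ht).le _)]
    ring
  refine (integrable_prod_iff' (Measurable.aestronglyMeasurable (by fun_prop))).2 ⟨?_, ?_⟩
  · refine Eventually.of_forall fun ξ => ?_
    have h := ((heat_gap hs0 hs1 (sq_nonneg ‖ξ‖)).1).mul_const ‖u ξ‖
    refine Integrable.mono' h (Measurable.aestronglyMeasurable (by fun_prop)) ?_
    exact (ae_restrict_iff' measurableSet_Ioi).2 (Eventually.of_forall fun t ht =>
      (hnorm t ht ξ).le)
  · have h2 : ∀ ξ : Ed d, ∫ t in Ioi (0:ℝ),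
        ‖((t ^ (-(s / 2) - 1) : ℝ) : ℂ) * ((1 - ga t ξ) * u ξ)‖ = kap s * ‖fr s u ξ‖ := fun ξ => by
      rw [setIntegral_congr_fun measurableSet_Ioi fun t ht => hnorm t ht ξ, integral_mul_const,
        (heat_gap hs0 hs1 (sq_nonneg ‖ξ‖)).2, fr, norm_mul, norm_real,
        Real.norm_of_nonneg (Real.rpow_nonneg (norm_nonneg _) _), ← Real.rpow_natCast,
        ← Real.rpow_mul (norm_nonneg _)]
      rw [mul_assoc]
      congr 4
      push_cast; ring
    simp_rw [h2]
    exact hus.norm.const_mul _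

lemma em_heat_gap {t : ℝ} (ht : 0 ≤ t) (s : ℝ) {u : Ed d → ℂ} (hu : Integrable u) (x : Ed d) :
    em (fun ξ => ((t ^ (-(s / 2) - 1) : ℝ) : ℂ) * ((1 - ga t ξ) * u ξ)) x =
      ((t ^ (-(s / 2) - 1) : ℝ) : ℂ) * (em u x - dP [] t u x) := by
  rw [em_const_mul, dP, ← em_sub hu]
  · congr 2; ext ξ; simp; ring
  · simpa using integrable_ga_mul ht hu

lemma integrable_heat {s : ℝ} (hs0 : 0 < s) (hs1 : s < 2) {u : Ed d → ℂ}
    (hum : Measurable u) (hu : Integrable u) (hus : Integrable (fr s u)) (x : Ed d) :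
    IntegrableOn (fun t : ℝ => ((t ^ (-(s / 2) - 1) : ℝ) : ℂ) * (em u x - dP [] t u x))
      (Ioi 0) := by
  have h := integrable_integral_em
    (Ψ := fun t ξ => ((t ^ (-(s / 2) - 1) : ℝ) : ℂ) * ((1 - ga t ξ) * u ξ))
    (integrable_heat_density hs0 hs1 hum hus) x
  exact (integrableOn_congr_fun (fun t ht => em_heat_gap (mem_Ioi.1 ht).le s hu x)
    measurableSet_Ioi).1 h

lemma heat_representation {s : ℝ} (hs0 : 0 < s) (hs1 : s < 2) {u : Ed d → ℂ}
    (hum : Measurable u) (hu : Integrable u) (hus : Integrable (fr s u)) (x : Ed d) :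
    ∫ t in Ioi (0:ℝ), ((t ^ (-(s / 2) - 1) : ℝ) : ℂ) * (em u x - dP [] t u x) =
      (kap s : ℂ) * em (fr s u) x := by
  rw [← setIntegral_congr_fun measurableSet_Ioi
    (fun t ht => em_heat_gap (mem_Ioi.1 ht).le s hu x),
    integral_em (Ψ := fun t ξ => ((t ^ (-(s / 2) - 1) : ℝ) : ℂ) * ((1 - ga t ξ) * u ξ))
      (integrable_heat_density hs0 hs1 hum hus), ← em_const_mul]
  congr 1
  ext ξ
  have h : ∀ t : ℝ, ((t ^ (-(s / 2) - 1) : ℝ) : ℂ) * ((1 - ga t ξ) * u ξ) =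
      ((t ^ (-(s / 2) - 1) * (1 - Real.exp (-(t * ‖ξ‖ ^ 2))) : ℝ) : ℂ) * u ξ := fun t => by
    rw [ga_eq_ofReal]; push_cast; ring
  simp_rw [h]
  rw [integral_mul_const, integral_complex_ofReal, (heat_gap hs0 hs1 (sq_nonneg ‖ξ‖)).2, fr,
    ← Real.rpow_natCast, ← Real.rpow_mul (norm_nonneg _)]
  push_cast
  rw [show (2:ℝ) * (s / 2) = s by ring]
  ring

/-- Defect of multiplicativity of the heat semigroup. -/
def dft (φ ψ : Ed d → ℂ) (t : ℝ) (x : Ed d) : ℂ :=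
  cv (hk t) (fun y => em φ y * em ψ y) x - dP [] t φ x * dP [] t ψ x

/-- The fractional Leibniz defect. -/
def leib (s : ℝ) (φ ψ χ : Ed d → ℂ) (x : Ed d) : ℂ :=
  em (fr s χ) x - em φ x * em (fr s ψ) x - em ψ x * em (fr s φ) x

/-- Densities for which the heat representation is available. -/
structure HDens (s : ℝ) (u : Ed d → ℂ) : Prop where
  meas : Measurable u
  int : Integrable u
  intS : Integrable (fr s u)

lemma dft_eq {φ ψ χ : Ed d → ℂ} (hχ : Integrable χ)
    (h : ∀ x, em χ x = em φ x * em ψ x) {t : ℝ} (ht : 0 < t) (x : Ed d) :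
    dft φ ψ t x = dP [] t χ x - dP [] t φ x * dP [] t ψ x := by
  rw [dft, ← funext h, cv_hk_em ht hχ]
  congr 1
  simp [dP]

lemma leib_eq {s : ℝ} (hs0 : 0 < s) (hs1 : s < 2) {φ ψ χ : Ed d → ℂ} (hφ : HDens s φ)
    (hψ : HDens s ψ) (hχ : HDens s χ) (h : ∀ x, em χ x = em φ x * em ψ x) (x : Ed d) :
    IntegrableOn (fun t : ℝ => ((t ^ (-(s / 2) - 1) : ℝ) : ℂ) * (dft φ ψ t x +
      (em φ x - dP [] t φ x) * (em ψ x - dP [] t ψ x))) (Ioi 0) ∧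
    ∫ t in Ioi (0:ℝ), ((t ^ (-(s / 2) - 1) : ℝ) : ℂ) * (dft φ ψ t x +
      (em φ x - dP [] t φ x) * (em ψ x - dP [] t ψ x)) = -((kap s : ℂ) * leib s φ ψ χ x) := by
  have iφ := integrable_heat hs0 hs1 hφ.meas hφ.int hφ.intS x
  have iψ := integrable_heat hs0 hs1 hψ.meas hψ.int hψ.intS x
  have iχ := integrable_heat hs0 hs1 hχ.meas hχ.int hχ.intS x
  have key : ∀ t ∈ Ioi (0:ℝ), ((t ^ (-(s / 2) - 1) : ℝ) : ℂ) * (dft φ ψ t x +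
      (em φ x - dP [] t φ x) * (em ψ x - dP [] t ψ x)) =
      (em φ x * (((t ^ (-(s / 2) - 1) : ℝ) : ℂ) * (em ψ x - dP [] t ψ x)) +
      em ψ x * (((t ^ (-(s / 2) - 1) : ℝ) : ℂ) * (em φ x - dP [] t φ x))) -
      ((t ^ (-(s / 2) - 1) : ℝ) : ℂ) * (em χ x - dP [] t χ x) := fun t ht => by
    rw [dft_eq hχ.int h ht, h x]; ring
  have i1 := iψ.const_mul (em φ x)
  have i2 := iφ.const_mul (em ψ x)
  constructor
  · rw [integrableOn_congr_fun key measurableSet_Ioi]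
    exact (i1.add i2).sub iχ
  · rw [setIntegral_congr_fun measurableSet_Ioi key, integral_sub (i1.fun_add i2) iχ,
      integral_add i1 i2, integral_const_mul, integral_const_mul,
      heat_representation hs0 hs1 hφ.meas hφ.int hφ.intS,
      heat_representation hs0 hs1 hψ.meas hψ.int hψ.intS,
      heat_representation hs0 hs1 hχ.meas hχ.int hχ.intS, leib]
    ring

/-- The weighted derivative whose square function is `sqf`. -/
def wd (l : List (Fin d)) (σ : ℝ) (φ : Ed d → ℂ) (x : Ed d) (r : ℝ) : ℝ≥0∞ :=
  ENNReal.ofReal (r ^ ((l.length - σ) / 2)) * ‖dP l r φ x‖ₑ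

@[fun_prop]
lemma measurable_wd (l : List (Fin d)) (σ : ℝ) {φ : Ed d → ℂ} (hφ : Measurable φ) (x : Ed d) :
    Measurable (wd l σ φ x) := by
  unfold wd; fun_prop

lemma sqf_eq (l : List (Fin d)) (σ : ℝ) (φ : Ed d → ℂ) (x : Ed d) :
    sqf l σ φ x = (∫⁻ r, wd l σ φ x r ^ 2 ∂mu0) ^ (1 / 2 : ℝ) := rfl

lemma ofReal_rpow_mul_rpow {r : ℝ} (hr : 0 < r) (a b : ℝ) :
    ENNReal.ofReal (r ^ a) * ENNReal.ofReal (r ^ b) = ENNReal.ofReal (r ^ (a + b)) := by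
  rw [← ENNReal.ofReal_mul (by positivity), Real.rpow_add hr]

lemma ofReal_mul_ofReal_rpow {r : ℝ} (hr : 0 < r) (b : ℝ) :
    ENNReal.ofReal r * ENNReal.ofReal (r ^ b) = ENNReal.ofReal (r ^ (1 + b)) := by
  rw [← ofReal_rpow_mul_rpow hr, Real.rpow_one]

lemma enorm_dP_eq_wd (l : List (Fin d)) (σ : ℝ) (φ : Ed d → ℂ) (x : Ed d) {r : ℝ} (hr : 0 < r) :
    ‖dP l r φ x‖ₑ = ENNReal.ofReal (r ^ (-((l.length - σ) / 2))) * wd l σ φ x r := by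
  rw [wd, ← mul_assoc, ofReal_rpow_mul_rpow hr]
  simp

lemma lintegral_Ioi_zero_eq_mu0 {h : ℝ → ℝ≥0∞} (hh : Measurable h) :
    ∫⁻ w in Ioi 0, h w = ∫⁻ w, ENNReal.ofReal w * h w ∂mu0 := by
  rw [lintegral_Ioi_eq_mu0 le_rfl hh]
  refine lintegral_congr fun w => ?_
  split_ifs with hw
  · rfl
  · simp [ENNReal.ofReal_of_nonpos (not_lt.1 hw)]

lemma lintegral_Ioo_eq_Ioi {t : ℝ} (h : ℝ → ℝ≥0∞) :
    ∫⁻ r in Ioo 0 t, h r = ∫⁻ r in Ioi 0, if r < t then h r else 0 := by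
  rw [← lintegral_indicator measurableSet_Ioo, ← lintegral_indicator measurableSet_Ioi]
  refine lintegral_congr fun r => ?_
  by_cases h0 : 0 < r <;> by_cases h1 : r < t <;> simp [indicator, h0, h1]

lemma lintegral_wd_mul_le (l m : List (Fin d)) (σ τ : ℝ) {φ ψ : Ed d → ℂ} (hφ : Measurable φ)
    (hψ : Measurable ψ) (x : Ed d) :
    ∫⁻ r, wd l σ φ x r * wd m τ ψ x r ∂mu0 ≤ sqf l σ φ x * sqf m τ ψ x :=
  lintegral_mul_le_sqrt _ (measurable_wd l σ hφ x).aemeasurable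
    (measurable_wd m τ hψ x).aemeasurable

lemma measurable_family {α β γ : Type*} [MeasurableSpace α] [MeasurableSpace β]
    [MeasurableSpace γ] {F : α → β → ℝ≥0∞} (hF : Measurable (Function.uncurry F)) {a : γ → α}
    {x : γ → β} (ha : Measurable a) (hx : Measurable x) : Measurable fun c => F (a c) (x c) :=
  hF.comp (ha.prodMk hx)

lemma measurable_Pe_family {α β : Type*} [MeasurableSpace α] [MeasurableSpace β] {τ : α → ℝ}
    (hτ : Measurable τ) {F : α → Ed d → ℝ≥0∞} (hF : Measurable (Function.uncurry F)) {a : β → α}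
    {x : β → Ed d} (ha : Measurable a) (hx : Measurable x) :
    Measurable fun b => Pe (τ (a b)) (F (a b)) (x b) :=
  measurable_Pe_comp (φ := fun b => F (a b))
    (measurable_family hF (ha.comp measurable_fst) measurable_snd) (hτ.comp ha) hx

lemma lintegral_Pe_family {α : Type*} [MeasurableSpace α] (ν : Measure α) [SFinite ν]
    {W : α → ℝ≥0∞} (hW : Measurable W) {τ : α → ℝ} (hτ : Measurable τ)
    {F : α → Ed d → ℝ≥0∞} (hF : Measurable (Function.uncurry F))
    (hpos : ∀ᵐ a ∂ν, W a ≠ 0 → 0 < τ a) {η : Ed d → ℝ≥0∞} (hη : Measurable η) :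
    ∫⁻ x, (∫⁻ a, W a * Pe (τ a) (F a) x ∂ν) * η x ≤
      ∫⁻ x, maxFun η x * ∫⁻ a, W a * F a x ∂ν := by
  have hFa : ∀ a, Measurable (F a) := fun a =>
    measurable_family hF (measurable_const (a := a)) measurable_id
  have hM := measurable_maxFun η
  calc ∫⁻ x, (∫⁻ a, W a * Pe (τ a) (F a) x ∂ν) * η x
      = ∫⁻ x, ∫⁻ a, W a * Pe (τ a) (F a) x * η x ∂ν := by
        refine lintegral_congr fun x => ?_
        rw [lintegral_mul_const]
        exact hW.fun_mul (measurable_Pe_family hτ hF measurable_id measurable_const)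
    _ = ∫⁻ a, (∫⁻ x, W a * Pe (τ a) (F a) x * η x) ∂ν := by
        refine lintegral_lintegral_swap (Measurable.aemeasurable ?_)
        exact ((hW.comp measurable_snd).fun_mul
          (measurable_Pe_family hτ hF measurable_snd measurable_fst)).fun_mul (hη.comp measurable_fst)
    _ ≤ ∫⁻ a, (∫⁻ x, maxFun η x * (W a * F a x)) ∂ν := by
        refine lintegral_mono_ae ?_
        filter_upwards [hpos] with a ha
        by_cases hWa : W a = 0
        · simp [hWa]
        simp_rw [mul_assoc, mul_left_comm _ (W a)]
        rw [lintegral_const_mul _ ((measurable_Pe (hFa a) _).fun_mul hη),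
          lintegral_const_mul _ (hM.fun_mul (hFa a)), lintegral_Pe_mul (hFa a) hη]
        refine mul_le_mul' le_rfl (lintegral_mono fun x => ?_)
        rw [mul_comm]
        exact mul_le_mul' (Pe_le_maxFun (ha hWa) hη x) le_rfl
    _ = ∫⁻ x, ∫⁻ a, maxFun η x * (W a * F a x) ∂ν := by
        refine lintegral_lintegral_swap (Measurable.aemeasurable ?_)
        exact (hM.comp measurable_snd).fun_mul ((hW.comp measurable_fst).fun_mul hF)
    _ = _ := by
        refine lintegral_congr fun x => ?_
        rw [lintegral_const_mul]
        exact hW.fun_mul (measurable_family hF measurable_id measurable_const)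

lemma measurable_dft {φ ψ : Ed d → ℂ} (hφ : Measurable φ) (hψ : Measurable ψ)
    (hφi : Integrable φ) (hψi : Integrable ψ) :
    Measurable fun q : ℝ × Ed d => dft φ ψ q.1 q.2 := by
  unfold dft cv
  refine Measurable.sub (StronglyMeasurable.measurable ?_) (by fun_prop)
  refine StronglyMeasurable.integral_prod_right (f := fun (q : ℝ × Ed d) z =>
    ((hk q.1 (q.2 - z) : ℝ) : ℂ) * (em φ z * em ψ z)) (Measurable.stronglyMeasurable ?_)
  have h1 := measurable_em hφi
  have h2 := measurable_em hψi
  simp only [Function.uncurry_def]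
  fun_prop

lemma dft_pair_le {s s1 s2 : ℝ} (hs0 : 0 < s) (hs : s = s1 + s2) {φ ψ : Ed d → ℂ}
    (hφ : Measurable φ) (hψ : Measurable ψ) (j : Fin d) (x : Ed d) :
    ∫⁻ a : ℝ × ℝ, ENNReal.ofReal (a.1 ^ (-(s / 2) - 1)) * (if a.2 < a.1 then 1 else 0) *
        (‖dP [j] a.2 φ x‖ₑ * ‖dP [j] a.2 ψ x‖ₑ)
        ∂((volume.restrict (Ioi 0)).prod (volume.restrict (Ioi 0))) ≤
      ENNReal.ofReal (2 / s) * (sqf [j] s1 φ x * sqf [j] s2 ψ x) := by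
  have hmi : Measurable fun a : ℝ × ℝ => if a.2 < a.1 then (1:ℝ≥0∞) else 0 :=
    Measurable.ite (measurableSet_lt measurable_snd measurable_fst) measurable_const
      measurable_const
  rw [lintegral_prod_symm _ (Measurable.aemeasurable (by fun_prop))]
  calc _ ≤ ∫⁻ r in Ioi (0:ℝ), ENNReal.ofReal (2 / s) *
        (ENNReal.ofReal (r ^ (-(s / 2))) * (‖dP [j] r φ x‖ₑ * ‖dP [j] r ψ x‖ₑ)) := by
        refine setLIntegral_mono_ae' measurableSet_Ioi (Eventually.of_forall fun r hr => ?_)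
        have hr : 0 < r := hr
        dsimp only
        rw [lintegral_mul_const _ (by
          have := hmi.comp (measurable_prodMk_right (y := r)); fun_prop)]
        rw [← mul_assoc (ENNReal.ofReal (2 / s))]
        refine mul_le_mul' ?_ le_rfl
        have h := lintegral_Ioi_rpow (half_pos hs0) hr
        rw [← ENNReal.ofReal_mul (by positivity),
          show 2 / s * r ^ (-(s / 2)) = r ^ (-(s / 2)) / (s / 2) by field_simp, ← h,
          ← lintegral_indicator measurableSet_Ioi, ← lintegral_indicator measurableSet_Ioi]
        refine lintegral_mono fun t => ?_
        by_cases h1 : r < t <;> by_cases h2 : 0 < t <;> simp [indicator, h1, h2]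
    _ = ENNReal.ofReal (2 / s) * ∫⁻ r, wd [j] s1 φ x r * wd [j] s2 ψ x r ∂mu0 := by
        rw [lintegral_const_mul' _ _ ENNReal.ofReal_ne_top,
          lintegral_Ioi_zero_eq_mu0 (by fun_prop)]
        congr 1
        refine lintegral_congr_ae ?_
        filter_upwards [ae_mu0_pos] with r hr
        rw [← mul_assoc, ofReal_mul_ofReal_rpow hr]
        unfold wd
        simp only [List.length_singleton, Nat.cast_one]
        rw [show 1 + -(s / 2) = (1 - s1) / 2 + (1 - s2) / 2 by rw [hs]; ring,
          ← ofReal_rpow_mul_rpow hr]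
        ring
    _ ≤ _ := by gcongr; exact lintegral_wd_mul_le _ _ _ _ hφ hψ x

/-- Weight on the region `r < t`. -/
def tw (s : ℝ) (a : ℝ × ℝ) : ℝ≥0∞ :=
  ENNReal.ofReal (a.1 ^ (-(s / 2) - 1)) * (if a.2 < a.1 then 1 else 0)

lemma measurable_tw (s : ℝ) : Measurable (tw s) := by
  have hmi : Measurable fun a : ℝ × ℝ => if a.2 < a.1 then (1:ℝ≥0∞) else 0 :=
    Measurable.ite (measurableSet_lt measurable_snd measurable_fst) measurable_const
      measurable_const
  unfold tw; fun_prop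

/-- Product of heat gradients. -/
def gp (j : Fin d) (φ ψ : Ed d → ℂ) (a : ℝ × ℝ) (x : Ed d) : ℝ≥0∞ :=
  ‖dP [j] a.2 φ x‖ₑ * ‖dP [j] a.2 ψ x‖ₑ

lemma measurable_gp (j : Fin d) {φ ψ : Ed d → ℂ} (hφ : Measurable φ) (hψ : Measurable ψ) :
    Measurable (Function.uncurry (gp j φ ψ)) := by
  simp only [Function.uncurry_def, gp]; fun_prop

lemma measurable_Pe_gp {β : Type*} [MeasurableSpace β] (j : Fin d) {φ ψ : Ed d → ℂ}
    (hφ : Measurable φ) (hψ : Measurable ψ) {a : β → ℝ × ℝ} {x : β → Ed d} (ha : Measurable a)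
    (hx : Measurable x) : Measurable fun b => Pe ((a b).1 - (a b).2) (gp j φ ψ (a b)) (x b) := by
  unfold Pe gp
  refine Measurable.lintegral_prod_right' (f := fun q : β × Ed d =>
    hkE ((a q.1).1 - (a q.1).2) (x q.1 - q.2) *
      (‖dP [j] (a q.1).2 φ q.2‖ₑ * ‖dP [j] (a q.1).2 ψ q.2‖ₑ)) ?_
  fun_prop

lemma lintegral_enorm_dft_le (s : ℝ) {φ ψ : Ed d → ℂ} (hφ : Mom1 φ) (hψ : Mom1 ψ) (x : Ed d) :
    ∫⁻ t in Ioi (0:ℝ), ENNReal.ofReal (t ^ (-(s / 2) - 1)) * ‖dft φ ψ t x‖ₑ ≤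
      ∑ j, 2 * ∫⁻ a, tw s a * Pe (a.1 - a.2) (gp j φ ψ a) x
        ∂((volume.restrict (Ioi 0)).prod (volume.restrict (Ioi 0))) := by
  have hPx : ∀ j, Measurable fun a : ℝ × ℝ => tw s a * Pe (a.1 - a.2) (gp j φ ψ a) x := fun j =>
    (measurable_tw s).fun_mul
      (measurable_Pe_gp j hφ.meas hψ.meas measurable_id measurable_const)
  rw [← Finset.mul_sum, ← lintegral_finsetSum _ fun j _ => hPx j,
    lintegral_prod _ (Finset.measurable_fun_sum _ fun j _ => hPx j).aemeasurable,
    ← lintegral_const_mul' _ _ (by simp)]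
  refine setLIntegral_mono_ae' measurableSet_Ioi (Eventually.of_forall fun t ht => ?_)
  refine (mul_le_mul' le_rfl (enorm_heat_product_defect_le hφ hψ ht x)).trans_eq ?_
  have hPt : ∀ j, Measurable fun r : ℝ => tw s (t, r) * Pe (t - r) (gp j φ ψ (t, r)) x :=
    fun j => (hPx j).comp measurable_prodMk_left
  rw [mul_left_comm, Finset.mul_sum, lintegral_finsetSum _ fun j _ => hPt j]
  congr 1
  refine Finset.sum_congr rfl fun j _ => ?_
  rw [lintegral_Ioo_eq_Ioi, ← lintegral_const_mul' _ _ ENNReal.ofReal_ne_top]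
  refine lintegral_congr fun r => ?_
  simp only [tw]
  split_ifs
  · rw [mul_one]; rfl
  · simp

lemma lintegral_dft_le {s s1 s2 : ℝ} (hs0 : 0 < s) (hs : s = s1 + s2) {φ ψ : Ed d → ℂ}
    (hφ : Mom1 φ) (hψ : Mom1 ψ) {η : Ed d → ℝ≥0∞} (hη : Measurable η) :
    ∫⁻ x, (∫⁻ t in Ioi (0:ℝ), ENNReal.ofReal (t ^ (-(s / 2) - 1)) * ‖dft φ ψ t x‖ₑ) * η x ≤
      ∑ j, ∫⁻ x, 2 * ENNReal.ofReal (2 / s) *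
        (maxFun η x * (sqf [j] s1 φ x * sqf [j] s2 ψ x)) := by
  calc _ ≤ ∫⁻ x, ∑ j, (2 * ∫⁻ a, tw s a * Pe (a.1 - a.2) (gp j φ ψ a) x
        ∂((volume.restrict (Ioi 0)).prod (volume.restrict (Ioi 0)))) * η x := by
        refine lintegral_mono fun x => ?_
        dsimp only
        rw [← Finset.sum_mul]
        exact mul_le_mul' (lintegral_enorm_dft_le s hφ hψ x) le_rfl
    _ = ∑ j, 2 * ∫⁻ x, (∫⁻ a, tw s a * Pe (a.1 - a.2) (gp j φ ψ a) x
        ∂((volume.restrict (Ioi 0)).prod (volume.restrict (Ioi 0)))) * η x := by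
        have hm : ∀ j, Measurable fun x => ∫⁻ a, tw s a * Pe (a.1 - a.2) (gp j φ ψ a) x
            ∂((volume.restrict (Ioi 0)).prod (volume.restrict (Ioi 0))) := fun j =>
          Measurable.lintegral_prod_right' (f := fun q : Ed d × (ℝ × ℝ) =>
            tw s q.2 * Pe (q.2.1 - q.2.2) (gp j φ ψ q.2) q.1)
            (((measurable_tw s).comp measurable_snd).fun_mul
              (measurable_Pe_gp j hφ.meas hψ.meas measurable_snd measurable_fst))
        rw [lintegral_finsetSum _ fun j _ => ((hm j).const_mul 2).fun_mul hη]
        refine Finset.sum_congr rfl fun j _ => ?_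
        simp_rw [mul_assoc]
        rw [lintegral_const_mul' _ _ (by simp)]
    _ ≤ _ := by
        refine Finset.sum_le_sum fun j _ => ?_
        have h := lintegral_Pe_family ((volume.restrict (Ioi 0)).prod (volume.restrict (Ioi 0)))
          (measurable_tw s) (τ := fun a => a.1 - a.2) (by fun_prop)
          (measurable_gp j hφ.meas hψ.meas)
          (Eventually.of_forall fun a ha => by
            by_contra hc
            exact ha (by simp [tw, not_lt.2 (by linarith : a.1 ≤ a.2)])) hη
        simp_rw [mul_assoc]
        rw [lintegral_const_mul' _ _ (by simp)]
        refine mul_le_mul' le_rfl (h.trans ?_)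
        refine lintegral_mono fun x => ?_
        rw [mul_left_comm]
        exact mul_le_mul' le_rfl (dft_pair_le hs0 hs hφ.meas hψ.meas j x)

/-- Second-order moment condition on a frequency density. -/
structure Mom2 (a : Ed d → ℂ) : Prop extends Mom1 a where
  int2 : ∀ i : Fin d, Integrable fun ξ => sym [i, i] ξ * a ξ

lemma integral_ga_increment (ξ : Ed d) {t : ℝ} (ht : 0 < t) :
    ∫ r in Ioo 0 t, ∑ i, sym [i, i] ξ * ga r ξ = -(1 - ga t ξ) := by
  have hE : ∀ r : ℝ, HasDerivAt (fun r : ℝ => ga r ξ) (∑ i, sym [i, i] ξ * ga r ξ) r := fun r => by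
    rw [← Finset.sum_mul, sum_sym [] ξ]
    unfold ga
    have h1 : HasDerivAt (fun r : ℝ => -((r * ‖ξ‖ ^ 2 : ℝ) : ℂ)) (-((‖ξ‖ ^ 2 : ℝ) : ℂ)) r := by
      have := (((hasDerivAt_id' r).mul_const (‖ξ‖ ^ 2)).ofReal_comp).fun_neg
      simpa using this
    exact h1.cexp.congr_deriv (by simp; ring)
  have hc : Continuous fun r : ℝ => ∑ i, sym [i, i] ξ * ga r ξ := by unfold ga; fun_prop
  rw [← integral_Ioc_eq_integral_Ioo, ← intervalIntegral.integral_of_le ht.le,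
    intervalIntegral.integral_eq_sub_of_hasDerivAt (fun r _ => hE r) (hc.intervalIntegrable _ _)]
  simp only [ga_zero]; ring

lemma integrable_increment_density {φ : Ed d → ℂ} (hφ : Mom2 φ) (t : ℝ) (i : Fin d) :
    Integrable (fun q : ℝ × Ed d => sym [i, i] q.2 * ga q.1 q.2 * φ q.2)
      ((volume.restrict (Ioo 0 t)).prod volume) := by
  have hφm := hφ.meas
  have h0 : Integrable (fun _ : ℝ => (1:ℂ)) (volume.restrict (Ioo 0 t)) := by simp
  refine (h0.mul_prod (hφ.int2 i)).mono (Measurable.aestronglyMeasurable (by fun_prop)) ?_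
  have hae : ∀ᵐ q ∂((volume.restrict (Ioo 0 t)).prod (volume : Measure (Ed d))),
      q.1 ∈ Ioo 0 t :=
    Measure.quasiMeasurePreserving_fst.ae (ae_restrict_mem measurableSet_Ioo)
  filter_upwards [hae] with q hq
  rw [one_mul, norm_mul, norm_mul, norm_mul]
  have := norm_ga_le hq.1.le q.2
  gcongr
  exact mul_le_of_le_one_right (norm_nonneg _) this

lemma heat_increment {φ : Ed d → ℂ} (hφ : Mom2 φ) {t : ℝ} (ht : 0 < t) (x : Ed d) :
    em φ x - dP [] t φ x = -∑ i, ∫ r in Ioo 0 t, dP [i, i] r φ x := by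
  have hI := integrable_increment_density hφ t
  have h1 : ∀ i, ∫ r in Ioo 0 t, dP [i, i] r φ x =
      em (fun ξ => ∫ r in Ioo 0 t, sym [i, i] ξ * ga r ξ * φ ξ) x := fun i =>
    integral_em (Ψ := fun r ξ => sym [i, i] ξ * ga r ξ * φ ξ) (hI i) x
  simp_rw [h1]
  rw [← em_finset_sum _ fun i _ => (hI i).integral_prod_right]
  rw [dP, ← em_sub hφ.int (by simpa using integrable_ga_mul ht.le hφ.int), ← neg_one_mul,
    ← em_const_mul]
  congr 1
  ext ξ
  have hc : ∀ i : Fin d, Integrable (fun r : ℝ => sym [i, i] ξ * ga r ξ)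
      (volume.restrict (Ioo 0 t)) := fun i => by
    have : Continuous fun r : ℝ => sym [i, i] ξ * ga r ξ := by unfold ga; fun_prop
    exact (this.integrableOn_Icc (a := 0) (b := t)).mono_set Ioo_subset_Icc_self
  simp_rw [integral_mul_const]
  rw [← Finset.sum_mul, ← integral_finsetSum _ fun i _ => hc i, integral_ga_increment ξ ht]
  simp; ring

lemma enorm_heat_increment_le {φ : Ed d → ℂ} (hφ : Mom2 φ) {t : ℝ} (ht : 0 < t) (x : Ed d)
    (σ : ℝ) : ‖em φ x - dP [] t φ x‖ₑ ≤ ENNReal.ofReal (t ^ (σ / 2)) *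
      ∑ i, ∫⁻ r, pk (σ / 2) r t * wd [i, i] σ φ x r ∂mu0 := by
  have hφm := hφ.meas
  rw [heat_increment hφ ht, enorm_neg, Finset.mul_sum]
  refine (enorm_sum_le _ _).trans (Finset.sum_le_sum fun i _ => ?_)
  refine (enorm_integral_le_lintegral_enorm _).trans_eq ?_
  rw [lintegral_Ioo_eq_Ioi, lintegral_Ioi_zero_eq_mu0, ← lintegral_const_mul' _ _
    ENNReal.ofReal_ne_top]
  · refine lintegral_congr_ae ?_
    filter_upwards [ae_mu0_pos] with r hr
    unfold pk
    split_ifs with h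
    · rw [enorm_dP_eq_wd [i, i] σ φ x hr, ← mul_assoc, ofReal_mul_ofReal_rpow hr, ← mul_assoc,
        ← ENNReal.ofReal_mul (by positivity), Real.div_rpow hr.le ht.le,
        mul_div_cancel₀ _ (Real.rpow_pos_of_pos ht _).ne']
      congr 3
      simp; ring
    · simp
  · exact Measurable.ite measurableSet_Iio (by fun_prop) measurable_const

lemma sqrt_hardy_down {α : ℝ} (hα : 0 < α) {a : ℝ → ℝ≥0∞} (ha : Measurable a) :
    (∫⁻ t, (∫⁻ r, pk α r t * a r ∂mu0) ^ 2 ∂mu0) ^ (1 / 2 : ℝ) ≤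
      ENNReal.ofReal (1 / α) * (∫⁻ w, a w ^ 2 ∂mu0) ^ (1 / 2 : ℝ) := by
  refine (ENNReal.rpow_le_rpow (hardy_down hα ha) (by norm_num)).trans_eq ?_
  rw [ENNReal.mul_rpow_of_nonneg _ _ (by norm_num), ← ENNReal.rpow_natCast, ← ENNReal.rpow_mul]
  norm_num

lemma measurable_hardy_down (α : ℝ) {a : ℝ → ℝ≥0∞} (ha : Measurable a) :
    Measurable fun t => ∫⁻ r, pk α r t * a r ∂mu0 := by
  refine Measurable.lintegral_prod_right' (f := fun q : ℝ × ℝ => pk α q.2 q.1 * a q.2) ?_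
  exact ((measurable_pk α).comp (measurable_snd.prodMk measurable_fst)).fun_mul
    (ha.comp measurable_snd)

lemma lintegral_increment_product_le {s s1 s2 : ℝ} (h1 : 0 < s1) (h2 : 0 < s2)
    (hs : s = s1 + s2) {φ ψ : Ed d → ℂ} (hφ : Mom2 φ) (hψ : Mom2 ψ) (x : Ed d) :
    ∫⁻ t in Ioi (0:ℝ), ENNReal.ofReal (t ^ (-(s / 2) - 1)) *
      ‖(em φ x - dP [] t φ x) * (em ψ x - dP [] t ψ x)‖ₑ ≤
    ∑ i, ∑ k, (ENNReal.ofReal (1 / (s1 / 2)) * ENNReal.ofReal (1 / (s2 / 2))) *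
      (sqf [i, i] s1 φ x * sqf [k, k] s2 ψ x) := by
  have hφm := hφ.meas
  have hψm := hψ.meas
  rw [lintegral_Ioi_zero_eq_mu0 (by fun_prop)]
  have hmA : ∀ i : Fin d, Measurable fun t => ∫⁻ r, pk (s1 / 2) r t * wd [i, i] s1 φ x r ∂mu0 :=
    fun i => measurable_hardy_down _ (by fun_prop)
  have hmB : ∀ i : Fin d, Measurable fun t => ∫⁻ r, pk (s2 / 2) r t * wd [i, i] s2 ψ x r ∂mu0 :=
    fun i => measurable_hardy_down _ (by fun_prop)
  calc _ ≤ ∫⁻ t, ∑ i, ∑ k, (∫⁻ r, pk (s1 / 2) r t * wd [i, i] s1 φ x r ∂mu0) *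
        (∫⁻ r, pk (s2 / 2) r t * wd [k, k] s2 ψ x r ∂mu0) ∂mu0 := by
        refine lintegral_mu0_mono fun t ht => ?_
        rw [enorm_mul, ← Finset.sum_mul_sum]
        refine (mul_le_mul' le_rfl (mul_le_mul' le_rfl (mul_le_mul'
          (enorm_heat_increment_le hφ ht x s1) (enorm_heat_increment_le hψ ht x s2)))).trans_eq ?_
        set A := ∑ i, ∫⁻ r, pk (s1 / 2) r t * wd [i, i] s1 φ x r ∂mu0
        set B := ∑ i, ∫⁻ r, pk (s2 / 2) r t * wd [i, i] s2 ψ x r ∂mu0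
        have e : ENNReal.ofReal t * ENNReal.ofReal (t ^ (-(s / 2) - 1)) *
            (ENNReal.ofReal (t ^ (s1 / 2)) * ENNReal.ofReal (t ^ (s2 / 2))) = 1 := by
          rw [ofReal_mul_ofReal_rpow ht, ofReal_rpow_mul_rpow ht, ofReal_rpow_mul_rpow ht, hs]
          ring_nf; simp
        calc _ = (ENNReal.ofReal t * ENNReal.ofReal (t ^ (-(s / 2) - 1)) *
            (ENNReal.ofReal (t ^ (s1 / 2)) * ENNReal.ofReal (t ^ (s2 / 2)))) * (A * B) := by ring
          _ = A * B := by rw [e, one_mul]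
    _ = ∑ i, ∑ k, ∫⁻ t, (∫⁻ r, pk (s1 / 2) r t * wd [i, i] s1 φ x r ∂mu0) *
        (∫⁻ r, pk (s2 / 2) r t * wd [k, k] s2 ψ x r ∂mu0) ∂mu0 := by
        rw [lintegral_finsetSum _ fun i _ =>
          Finset.measurable_fun_sum _ fun k _ => (hmA i).fun_mul (hmB k)]
        refine Finset.sum_congr rfl fun i _ => ?_
        rw [lintegral_finsetSum _ fun k _ => (hmA i).fun_mul (hmB k)]
    _ ≤ _ := by
        refine Finset.sum_le_sum fun i _ => Finset.sum_le_sum fun k _ => ?_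
        refine (lintegral_mul_le_sqrt _ (hmA i).aemeasurable (hmB k).aemeasurable).trans ?_
        refine (mul_le_mul' (sqrt_hardy_down (half_pos h1) (by fun_prop))
          (sqrt_hardy_down (half_pos h2) (by fun_prop))).trans_eq ?_
        rw [sqf_eq, sqf_eq]
        ring

/-- Weight on the region `0 < w < v`. -/
def vw (s : ℝ) (a : ℝ × ℝ) : ℝ≥0∞ :=
  if 0 < a.1 ∧ a.1 < a.2 then ENNReal.ofReal (a.2 ^ (-(s / 2) - 1)) else 0

@[fun_prop]
lemma measurable_vw (s : ℝ) : Measurable (vw s) := by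
  unfold vw
  refine Measurable.ite ?_ (by fun_prop) measurable_const
  exact (measurableSet_lt measurable_const measurable_fst).inter
    (measurableSet_lt measurable_fst measurable_snd)

lemma lintegral_vw (s : ℝ) {G : ℝ × ℝ → ℝ≥0∞} (hG : Measurable G) :
    ∫⁻ a, vw s a * G a =
      ∫⁻ w in Ioi (0:ℝ), ∫⁻ v in Ioi w, ENNReal.ofReal (v ^ (-(s / 2) - 1)) * G (w, v) := by
  rw [Measure.volume_eq_prod, lintegral_prod _ (by fun_prop),
    ← lintegral_indicator measurableSet_Ioi]
  refine lintegral_congr fun w => ?_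
  by_cases hw : 0 < w
  · rw [indicator_of_mem (mem_Ioi.2 hw), ← lintegral_indicator measurableSet_Ioi]
    refine lintegral_congr fun v => ?_
    by_cases hv : w < v <;> simp [vw, hw, hv]
  · rw [indicator_of_notMem (by simpa using hw)]
    simp [vw, hw]

lemma lintegral_vw_symm (s : ℝ) {G : ℝ × ℝ → ℝ≥0∞} (hG : Measurable G) :
    ∫⁻ a, vw s a * G a =
      ∫⁻ v in Ioi (0:ℝ), ∫⁻ w in Ioo 0 v, ENNReal.ofReal (v ^ (-(s / 2) - 1)) * G (w, v) := by
  rw [Measure.volume_eq_prod, lintegral_prod_symm _ (by fun_prop),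
    ← lintegral_indicator measurableSet_Ioi]
  refine lintegral_congr fun v => ?_
  by_cases hv : 0 < v
  · rw [indicator_of_mem (mem_Ioi.2 hv), ← lintegral_indicator measurableSet_Ioo]
    refine lintegral_congr fun w => ?_
    by_cases hw : 0 < w <;> by_cases hwv : w < v <;> simp [vw, hw, hwv]
  · rw [indicator_of_notMem (by simpa using hv)]
    have : ∀ w, vw s (w, v) = 0 := fun w => if_neg fun h => hv (h.1.trans h.2)
    simp [this]

lemma lintegral_vw_left {s : ℝ} (hs0 : 0 < s) {A B : ℝ → ℝ≥0∞} (hA : Measurable A)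
    (hB : Measurable B) :
    ∫⁻ a, vw s a * (A a.1 * B a.1) = ENNReal.ofReal (2 / s) *
      ∫⁻ w, (ENNReal.ofReal (w ^ ((1 - s) / 2)) * A w) *
        (ENNReal.ofReal (w ^ ((1:ℝ) / 2)) * B w) ∂mu0 := by
  rw [lintegral_vw s (by fun_prop)]
  calc _ = ∫⁻ w in Ioi (0:ℝ), ENNReal.ofReal (2 / s) *
        (ENNReal.ofReal (w ^ (-(s / 2))) * (A w * B w)) := by
        refine setLIntegral_congr_fun measurableSet_Ioi fun w hw => ?_
        have hw : 0 < w := hw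
        dsimp only
        rw [lintegral_mul_const _ (by fun_prop), lintegral_Ioi_rpow (half_pos hs0) hw,
          ← mul_assoc (ENNReal.ofReal (2 / s)), ← ENNReal.ofReal_mul (by positivity)]
        congr 2
        field_simp
    _ = _ := by
        rw [lintegral_const_mul' _ _ ENNReal.ofReal_ne_top,
          lintegral_Ioi_zero_eq_mu0 (by fun_prop)]
        congr 1
        refine lintegral_congr_ae ?_
        filter_upwards [ae_mu0_pos] with w hw
        rw [← mul_assoc, ofReal_mul_ofReal_rpow hw,
          show 1 + -(s / 2) = (1 - s) / 2 + 1 / 2 by ring, ← ofReal_rpow_mul_rpow hw]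
        ring

lemma lintegral_vw_pair_le {s : ℝ} (hs0 : 0 < s) (l : List (Fin d)) (j : Fin d) {φ ψ : Ed d → ℂ}
    (hφ : Measurable φ) (hψ : Measurable ψ) (x : Ed d) :
    ∫⁻ a, vw s a * (ENNReal.ofReal (a.1 ^ (((l.length : ℝ) - 1) / 2)) * ‖dP l a.1 φ x‖ₑ *
      ‖dP [j] a.2 ψ x‖ₑ) ≤
    ENNReal.ofReal (1 / ((1 + s) / 2)) * (sqf l s φ x * sqf [j] 0 ψ x) := by
  rw [lintegral_vw_symm s (by fun_prop)]
  have hm := measurable_hardy_down ((1 + s) / 2) (measurable_wd l s hφ x)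
  calc _ = ∫⁻ v in Ioi (0:ℝ), ENNReal.ofReal (v ^ (-1:ℝ)) * (wd [j] 0 ψ x v *
        ∫⁻ w, pk ((1 + s) / 2) w v * wd l s φ x w ∂mu0) := by
        refine setLIntegral_congr_fun measurableSet_Ioi fun v hv => ?_
        have hv : 0 < v := hv
        dsimp only
        have hpk : Measurable fun w => pk ((1 + s) / 2) w v * wd l s φ x w :=
          ((measurable_pk ((1 + s) / 2)).comp
            (measurable_id.prodMk measurable_const)).mul (measurable_wd l s hφ x)
        rw [lintegral_Ioo_eq_Ioi, lintegral_Ioi_zero_eq_mu0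
          (Measurable.ite measurableSet_Iio (by fun_prop) measurable_const), ← mul_assoc,
          ← lintegral_const_mul _ hpk]
        refine lintegral_congr_ae ?_
        filter_upwards [ae_mu0_pos] with w hw
        simp only [pk]
        split_ifs with h
        · rw [enorm_dP_eq_wd l s φ x hw, enorm_dP_eq_wd [j] 0 ψ x hv,
            Real.div_rpow hw.le hv.le, div_eq_mul_inv (w ^ ((1 + s) / 2)), ← Real.rpow_neg hv.le,
            ENNReal.ofReal_mul (by positivity)]
          have e1 : ENNReal.ofReal w * (ENNReal.ofReal (w ^ (((l.length : ℝ) - 1) / 2)) *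
              ENNReal.ofReal (w ^ (-((l.length - s) / 2)))) = ENNReal.ofReal (w ^ ((1 + s) / 2)) := by
            rw [ofReal_rpow_mul_rpow hw, ofReal_mul_ofReal_rpow hw]; congr 2; ring
          have e2 : ENNReal.ofReal (v ^ (-(s / 2) - 1)) *
              ENNReal.ofReal (v ^ (-((([j] : List (Fin d)).length - 0) / 2) : ℝ)) =
              ENNReal.ofReal (v ^ (-1:ℝ)) * ENNReal.ofReal (v ^ (-((1 + s) / 2))) := by
            rw [ofReal_rpow_mul_rpow hv, ofReal_rpow_mul_rpow hv]; congr 2; simp; ring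
          rw [← e1]
          calc _ = ENNReal.ofReal w * (ENNReal.ofReal (w ^ (((l.length : ℝ) - 1) / 2)) *
              ENNReal.ofReal (w ^ (-((l.length - s) / 2)))) * (ENNReal.ofReal (v ^ (-(s / 2) - 1)) *
              ENNReal.ofReal (v ^ (-((([j] : List (Fin d)).length - 0) / 2) : ℝ))) *
              (wd l s φ x w * wd [j] 0 ψ x v) := by ring
            _ = _ := by rw [e2]; ring
        · simp
    _ = ∫⁻ v, wd [j] 0 ψ x v * (∫⁻ w, pk ((1 + s) / 2) w v * wd l s φ x w ∂mu0) ∂mu0 := by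
        rw [lintegral_Ioi_zero_eq_mu0 (by fun_prop)]
        refine lintegral_congr_ae ?_
        filter_upwards [ae_mu0_pos] with v hv
        rw [← mul_assoc, ofReal_mul_ofReal_rpow hv]
        simp
    _ ≤ _ := by
        refine (lintegral_mul_le_sqrt _ (measurable_wd [j] 0 hψ x).aemeasurable
          hm.aemeasurable).trans ?_
        refine (mul_le_mul' le_rfl (sqrt_hardy_down (by positivity)
          (measurable_wd l s hφ x))).trans_eq ?_
        rw [sqf_eq, sqf_eq]
        ring

lemma lintegral_vw_shift_le {s : ℝ} (hs0 : 0 < s) (hs1 : s < 1) {A B : ℝ → ℝ≥0∞}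
    (hA : Measurable A) (hB : Measurable B) :
    ∫⁻ a, vw s a * (∫⁻ r in Ioo 0 a.1, A (a.1 + r) * B (a.2 + r)) ≤
      4 * ∫⁻ a, vw s a * (ENNReal.ofReal a.1 * A a.1 * B a.2) := by
  set k : ℝ → ℝ × ℝ → ℝ≥0∞ := fun r a =>
    vw s a * (if 0 < r ∧ r < a.1 then 1 else 0) * (A a.1 * B a.2) with hk
  have hI : Measurable fun q : ℝ × (ℝ × ℝ) => if 0 < q.1 ∧ q.1 < q.2.1 then (1:ℝ≥0∞) else 0 := by
    refine Measurable.ite ?_ measurable_const measurable_const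
    exact (measurableSet_lt measurable_const measurable_fst).inter
      (measurableSet_lt measurable_fst (measurable_fst.comp measurable_snd))
  have hkm : Measurable (Function.uncurry k) := by
    simp only [hk, Function.uncurry_def]
    fun_prop
  have hkr : ∀ r, Measurable (k r) := fun r => hkm.comp measurable_prodMk_left
  have hkr' : Measurable fun q : (ℝ × ℝ) × ℝ => k q.2 (q.1 + (q.2, q.2)) :=
    hkm.comp (measurable_snd.prodMk (measurable_fst.add (measurable_snd.prodMk measurable_snd)))
  calc _ ≤ ∫⁻ a : ℝ × ℝ, ∫⁻ r, 4 * k r (a + (r, r)) := by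
        refine lintegral_mono fun a => ?_
        dsimp only
        by_cases ha : 0 < a.1 ∧ a.1 < a.2
        · rw [← lintegral_indicator measurableSet_Ioo,
            ← lintegral_const_mul' _ _ (by rw [vw, if_pos ha]; exact ENNReal.ofReal_ne_top)]
          refine lintegral_mono fun r => ?_
          by_cases hr : r ∈ Ioo 0 a.1
          · rw [indicator_of_mem hr]
            have h1 : 0 < a.1 + r ∧ a.1 + r < a.2 + r := ⟨by linarith [hr.1], by linarith⟩
            have h2 : 0 < r ∧ r < a.1 + r := ⟨hr.1, by linarith⟩
            simp only [hk, vw, Prod.fst_add, Prod.snd_add, if_pos ha, if_pos h1, if_pos h2, mul_one]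
            rw [← mul_assoc (4:ℝ≥0∞)]
            refine mul_le_mul' ?_ le_rfl
            have h4 : (4:ℝ≥0∞) = ENNReal.ofReal 4 := by simp
            rw [h4, ← ENNReal.ofReal_mul (by norm_num)]
            refine ENNReal.ofReal_le_ofReal ?_
            have hv : 0 < a.2 := ha.1.trans ha.2
            have hle : a.2 + r ≤ 2 * a.2 := by linarith [hr.2, ha.2]
            have e1 : (2 * a.2) ^ (-(s / 2) - 1) ≤ (a.2 + r) ^ (-(s / 2) - 1) :=
              Real.rpow_le_rpow_of_nonpos (by linarith [hr.1]) hle (by linarith)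
            rw [Real.mul_rpow (by norm_num) hv.le] at e1
            have e2 : (1:ℝ) / 4 ≤ 2 ^ (-(s / 2) - 1) := by
              have : (2:ℝ) ^ (-2:ℝ) ≤ 2 ^ (-(s / 2) - 1) :=
                Real.rpow_le_rpow_of_exponent_le (by norm_num) (by linarith)
              refine le_trans (le_of_eq ?_) this
              rw [Real.rpow_neg (by norm_num)]; norm_num
            have e3 : 0 ≤ a.2 ^ (-(s / 2) - 1) := Real.rpow_nonneg hv.le _
            nlinarith
          · rw [indicator_of_notMem hr]; simp
        · simp [vw, if_neg ha]
    _ = ∫⁻ r, ∫⁻ a : ℝ × ℝ, 4 * k r (a + (r, r)) :=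
        lintegral_lintegral_swap (hkr'.const_mul 4).aemeasurable
    _ = ∫⁻ r, ∫⁻ a : ℝ × ℝ, 4 * k r a := by
        refine lintegral_congr fun r => ?_
        exact lintegral_add_right_eq_self (μ := (volume : Measure (ℝ × ℝ)))
          (fun a => 4 * k r a) (r, r)
    _ = ∫⁻ a : ℝ × ℝ, ∫⁻ r, 4 * k r a :=
        lintegral_lintegral_swap (hkm.const_mul 4).aemeasurable
    _ ≤ ∫⁻ a : ℝ × ℝ, 4 * (vw s a * (ENNReal.ofReal a.1 * A a.1 * B a.2)) := by
        refine lintegral_mono fun a => ?_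
        dsimp only
        rw [lintegral_const_mul' _ _ (by simp)]
        refine mul_le_mul' le_rfl (le_of_eq ?_)
        simp only [hk]
        have hIr : Measurable fun r : ℝ => if 0 < r ∧ r < a.1 then (1:ℝ≥0∞) else 0 :=
          Measurable.ite measurableSet_Ioo measurable_const measurable_const
        rw [lintegral_mul_const _ (hIr.const_mul _), lintegral_const_mul _ hIr]
        have : ∫⁻ r : ℝ, (if 0 < r ∧ r < a.1 then (1:ℝ≥0∞) else 0) = ENNReal.ofReal a.1 := by
          have e : (fun r : ℝ => if 0 < r ∧ r < a.1 then (1:ℝ≥0∞) else 0) =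
              (Ioo 0 a.1).indicator 1 := by
            ext r; by_cases h : r ∈ Ioo 0 a.1 <;> simp_all [indicator]
          rw [e, lintegral_indicator_one measurableSet_Ioo]
          simp
        rw [this]
        ring
    _ = _ := lintegral_const_mul' _ _ (by simp)

lemma norm_cv_le {k : Ed d → ℝ} (hk : Integrable k) {F : Ed d → ℂ} (hF : Measurable F) {c : ℝ}
    (hFc : ∀ z, ‖F z‖ ≤ c) (x : Ed d) : ‖cv k F x‖ ≤ (∫ z, ‖k z‖) * c := by
  unfold cv
  refine (norm_integral_le_integral_norm _).trans ?_
  rw [← integral_sub_left_eq_self (fun z => ‖k z‖) volume x, ← integral_mul_const]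
  refine integral_mono (integrable_cv hk hF hFc x).norm
    ((hk.comp_sub_left x).norm.mul_const c) fun z => ?_
  dsimp only
  rw [norm_mul, Complex.norm_real]
  exact mul_le_mul_of_nonneg_left (hFc z) (norm_nonneg _)

lemma integrable_kernel_mul {k : Ed d → ℝ} (hk : Integrable k) {h : Ed d → ℂ} (hh : Integrable h) :
    Integrable fun q : Ed d × Ed d => ((k (q.1 - q.2) : ℝ) : ℂ) * h q.2 := by
  have := Integrable.convolution_integrand (ContinuousLinearMap.mul ℝ ℂ) hh
    (hk.ofReal (𝕜 := ℂ)) (μ := volume) (ν := volume)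
  refine this.congr (Eventually.of_forall fun q => ?_)
  simp [mul_comm]

lemma integrable_cv_of_integrable {k : Ed d → ℝ} (hk : Integrable k) {h : Ed d → ℂ}
    (hh : Integrable h) : Integrable (cv k h) :=
  (integrable_kernel_mul hk hh).integral_prod_left

lemma integral_cv_mul {k : Ed d → ℝ} (hk : Integrable k) {F h : Ed d → ℂ}
    (hF : Measurable F) {c : ℝ} (hFc : ∀ z, ‖F z‖ ≤ c) (hh : Integrable h) :
    ∫ x, cv k F x * h x = ∫ z, F z * cv (fun y => k (-y)) h z := by
  have h1 : Integrable fun q : Ed d × Ed d => F q.1 * (((k (-(q.1 - q.2)) : ℝ) : ℂ) * h q.2) :=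
    (integrable_kernel_mul hk.comp_neg hh).bdd_mul (c := c)
      (hF.comp measurable_fst).aestronglyMeasurable (Eventually.of_forall fun q => hFc _)
  unfold cv
  simp_rw [← integral_const_mul, ← integral_mul_const]
  refine Eq.trans ?_ (integral_integral_swap h1).symm
  refine integral_congr_ae (Eventually.of_forall fun x => ?_)
  refine integral_congr_ae (Eventually.of_forall fun z => ?_)
  simp only [neg_sub]
  ring

lemma integral_cv_hk_mul {t : ℝ} (ht : 0 < t) {F h : Ed d → ℂ}
    (hF : Measurable F) {c : ℝ} (hFc : ∀ z, ‖F z‖ ≤ c) (hh : Integrable h) :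
    ∫ x, cv (hk t) F x * h x = ∫ z, F z * cv (hk t) h z := by
  rw [integral_cv_mul (integrable_hk ht) hF hFc hh]
  simp only [hk_neg]

lemma gk_neg (i : Fin d) (c : ℝ) (z : Ed d) : gk i c (-z) = -gk i c z := by
  simp [gk, hk_neg]; ring

lemma kk_singleton_neg (i : Fin d) (c : ℝ) (x : Ed d) : kk [i] c (-x) = -kk [i] c x := by
  simp only [kk]
  rw [← integral_neg_eq_self, ← integral_neg]
  refine integral_congr_ae (Eventually.of_forall fun z => ?_)
  simp only [hk_neg]
  rw [show -x - -z = -(x - z) by abel, gk_neg]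
  ring

lemma integral_cv_kk_mul (i : Fin d) {c : ℝ} (hc : 0 < c) {F h : Ed d → ℂ}
    (hF : Measurable F) {b : ℝ} (hFc : ∀ z, ‖F z‖ ≤ b) (hh : Integrable h) :
    ∫ x, cv (kk [i] c) F x * h x = -∫ z, F z * cv (kk [i] c) h z := by
  rw [integral_cv_mul (integrable_kk _ hc) hF hFc hh, ← integral_neg]
  refine integral_congr_ae (Eventually.of_forall fun z => ?_)
  simp only [cv, kk_singleton_neg]
  push_cast
  simp only [neg_mul, integral_neg, mul_neg]

/-- Transpose of `bd [i] t` up to sign. -/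
def bdT (i : Fin d) (t : ℝ) (F : Ed d → ℂ) : Ed d → ℂ :=
  cv (hk t) (cv (kk [i] (tc [i] t)) (cv (hk (t / 3)) F))

lemma integral_bdT_mul (i : Fin d) {t : ℝ} (ht : 0 < t) {F h : Ed d → ℂ}
    (hF : Measurable F) {b : ℝ} (hFc : ∀ z, ‖F z‖ ≤ b) (hh : Integrable h) :
    ∫ x, bdT i t F x * h x = -∫ z, F z * bd [i] t h z := by
  have hc := tc_pos [i] ht
  have ht3 : 0 < t / 3 := by positivity
  have m1 := measurable_cv (continuous_hk (t / 3)).measurable hF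
  have b1 := norm_cv_le (integrable_hk ht3) hF hFc
  have m2 := measurable_cv (measurable_kk [i] (tc [i] t)) m1
  have b2 := norm_cv_le (integrable_kk [i] hc) m1 b1
  have i1 := integrable_cv_of_integrable (integrable_hk ht) hh
  have i2 := integrable_cv_of_integrable (integrable_kk [i] hc) i1
  unfold bdT bd
  rw [integral_cv_hk_mul ht m2 b2 hh, integral_cv_kk_mul i hc m1 b1 i1,
    integral_cv_hk_mul ht3 hF hFc i2]

lemma norm_bdT_le (i : Fin d) {t : ℝ} (ht : 0 < t) {F : Ed d → ℂ}
    (hF : Measurable F) {b : ℝ} (hFc : ∀ z, ‖F z‖ ≤ b) : ∃ c : ℝ, ∀ x, ‖bdT i t F x‖ ≤ c := by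
  have hc := tc_pos [i] ht
  have ht3 : 0 < t / 3 := by positivity
  have m1 := measurable_cv (continuous_hk (t / 3)).measurable hF
  have b1 := norm_cv_le (integrable_hk ht3) hF hFc
  have m2 := measurable_cv (measurable_kk [i] (tc [i] t)) m1
  have b2 := norm_cv_le (integrable_kk [i] hc) m1 b1
  exact ⟨_, norm_cv_le (integrable_hk ht) m2 b2⟩

lemma measurable_bdT (i : Fin d) (t : ℝ) {F : Ed d → ℂ} (hF : Measurable F) :
    Measurable (bdT i t F) :=
  measurable_cv (continuous_hk _).measurable (measurable_cv (measurable_kk _ _)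
    (measurable_cv (continuous_hk _).measurable hF))

lemma bdT_em2 (i : Fin d) {t : ℝ} (ht : 0 < t) {Φ : Ed d × Ed d → ℂ} (hΦ : Integrable Φ)
    (x : Ed d) : bdT i t (em2 Φ) x =
      em2 (fun q => sym [i] (q.1 + q.2) * ga (rho [i] * t) (q.1 + q.2) * Φ q) x := by
  have hc := tc_pos [i] ht
  have ht3 : 0 < t / 3 := by positivity
  have h1 := integrable_FT_mul2 (k := fun z => (hk (t / 3) z : ℂ))
    ((continuous_hk _).measurable.complex_ofReal) hΦ
  have h2 := integrable_FT_mul2 (k := fun z => (kk [i] (tc [i] t) z : ℂ))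
    ((measurable_kk [i] _).complex_ofReal) h1
  unfold bdT
  rw [funext (cv_em2 (integrable_hk ht3) hΦ), funext (cv_em2 (integrable_kk [i] hc) h1),
    cv_em2 (integrable_hk ht) h2]
  congr 1
  ext q
  rw [FT_hk ht, FT_hk ht3, FT_kk [i] hc]
  have : ga (rho [i] * t) (q.1 + q.2) = ga (t / 3) (q.1 + q.2) *
      (ga ((([i] : List (Fin d)).length + 1) * tc [i] t) (q.1 + q.2) * ga t (q.1 + q.2)) := by
    rw [← ga_add, ← ga_add]; congr 1; unfold rho tc; ring
  rw [this]
  unfold ga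
  ring

lemma bdT_dP (i : Fin d) {w v : ℝ} (hw : 0 < w) (hv : 0 < v) {φ ψ : Ed d → ℂ}
    (hφ : Integrable φ) (hψ : Integrable ψ) (x : Ed d) :
    bdT i (w / rho [i]) (fun y => dP [i] w φ y * dP [] v ψ y) x =
      cv (hk w) (fun y => dP [i, i] w φ y * dP [] v ψ y) x +
      cv (hk w) (fun y => dP [i] w φ y * dP [i] v ψ y) x := by
  have i1 := integrable_sym_ga_mul [i] hw hφ
  have i2 := integrable_sym_ga_mul [i, i] hw hφ
  have j1 := integrable_sym_ga_mul [] hv hψ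
  have j2 := integrable_sym_ga_mul [i] hv hψ
  have hr := rho_pos [i]
  have hrw : rho [i] * (w / rho [i]) = w := by field_simp
  have g1 : ∀ {Φ : Ed d × Ed d → ℂ}, Integrable Φ →
      Integrable fun q : Ed d × Ed d => ga w (q.1 + q.2) * Φ q := fun h =>
    h.bdd_mul (c := 1) (Measurable.aestronglyMeasurable (by fun_prop))
      (Eventually.of_forall fun q => norm_ga_le hw.le _)
  have e : (fun y => dP [i] w φ y * dP [] v ψ y) = em2 (fun q =>
      (sym [i] q.1 * ga w q.1 * φ q.1) * (sym [] q.2 * ga v q.2 * ψ q.2)) :=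
    funext fun y => em_mul_em2 _ _ y
  rw [e, bdT_em2 i (by positivity) (i1.mul_prod j1), hrw]
  unfold dP
  rw [cv_hk_mul hw i2 j1, cv_hk_mul hw i1 j2,
    ← em2_add (g1 (i2.mul_prod j1)) (g1 (i1.mul_prod j2))]
  congr 1
  ext q
  simp only [sym_cons, sym_nil, PiLp.add_apply]
  push_cast
  ring

lemma dP_dP (l m : List (Fin d)) (r w : ℝ) (φ : Ed d → ℂ) (x : Ed d) :
    dP l r (fun ξ => sym m ξ * ga w ξ * φ ξ) x = dP (l ++ m) (w + r) φ x := by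
  unfold dP
  congr 1
  ext ξ
  rw [ga_add]
  simp only [sym, List.map_append, List.prod_append]
  ring

lemma mom1_sym_ga {φ : Ed d → ℂ} (hm : Measurable φ) (hφ : Integrable φ) (l : List (Fin d)) {w : ℝ}
    (hw : 0 < w) : Mom1 (fun ξ => sym l ξ * ga w ξ * φ ξ) where
  meas := by fun_prop
  int := integrable_sym_ga_mul l hw hφ
  int1 j := by
    refine (integrable_sym_ga_mul (j :: l) hw hφ).congr (Eventually.of_forall fun ξ => ?_)
    simp only [sym_cons, sym_nil]
    ring

lemma enorm_dP_nil_le {ψ : Ed d → ℂ} (hψ : Integrable ψ) {v : ℝ} (hv : 0 < v) (x : Ed d) :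
    ‖dP [] v ψ x‖ₑ ≤ maxFun (fun y => ‖em ψ y‖ₑ) x := by
  have : dP [] v ψ x = cv (hk v) (em ψ) x := by
    rw [cv_hk_em hv hψ]; simp [dP]
  rw [this]
  exact (enorm_cv_hk_le _ hv x).trans (Pe_le_maxFun hv (measurable_em hψ).enorm x)

lemma lintegral_cv_hk_mul_le {t : ℝ} (ht : 0 < t) {F : Ed d → ℂ} (hF : Measurable F)
    {η : Ed d → ℝ≥0∞} (hη : Measurable η) :
    ∫⁻ x, ‖cv (hk t) F x‖ₑ * η x ≤ ∫⁻ x, maxFun η x * ‖F x‖ₑ := by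
  refine (lintegral_mono fun x => mul_le_mul' (enorm_cv_hk_le F ht x) le_rfl).trans ?_
  rw [lintegral_Pe_mul hF.enorm hη]
  exact lintegral_mono fun x => (mul_comm _ _).trans_le (mul_le_mul' (Pe_le_maxFun ht hη x) le_rfl)

lemma norm_dP_le (l : List (Fin d)) (w : ℝ) (φ : Ed d → ℂ) (x : Ed d) :
    ‖dP l w φ x‖ ≤ ∫ ξ, ‖sym l ξ * ga w ξ * φ ξ‖ := norm_em_le _ x

lemma lintegral_defect_mul_le (i : Fin d) {w v : ℝ} (hw : 0 < w) (hv : 0 < v) {φ ψ : Ed d → ℂ}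
    (hφm : Measurable φ) (hφ : Integrable φ) (hψm : Measurable ψ) (hψ : Integrable ψ)
    {η : Ed d → ℝ≥0∞} (hη : Measurable η) :
    ∫⁻ x, ‖cv (hk w) (fun y => dP [i, i] w φ y * dP [] v ψ y) x -
      dP [i, i] (2 * w) φ x * dP [] (v + w) ψ x‖ₑ * η x ≤
    2 * ∑ j, ∫⁻ x, maxFun η x * ∫⁻ r in Ioo 0 w,
      ‖dP [j, i, i] (w + r) φ x‖ₑ * ‖dP [j] (v + r) ψ x‖ₑ := by
  have key : ∀ x, ‖cv (hk w) (fun y => dP [i, i] w φ y * dP [] v ψ y) x -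
      dP [i, i] (2 * w) φ x * dP [] (v + w) ψ x‖ₑ ≤ 2 * ∑ j, ∫⁻ r in Ioo 0 w, Pe (w - r)
        (fun y => ‖dP [j, i, i] (w + r) φ y‖ₑ * ‖dP [j] (v + r) ψ y‖ₑ) x := fun x => by
    have h := enorm_heat_product_defect_le (mom1_sym_ga hφm hφ [i, i] hw)
      (mom1_sym_ga hψm hψ [] hv) hw x
    simp only [dP_dP, List.nil_append, List.append_nil, List.cons_append] at h
    rw [two_mul w]
    exact h
  have hm : ∀ j, Measurable fun x => ∫⁻ r in Ioo 0 w, Pe (w - r)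
        (fun y => ‖dP [j, i, i] (w + r) φ y‖ₑ * ‖dP [j] (v + r) ψ y‖ₑ) x := fun j => by
    unfold Pe
    refine Measurable.lintegral_prod_right' (f := fun q : Ed d × ℝ => ∫⁻ z, hkE (w - q.2) (q.1 - z) *
      (‖dP [j, i, i] (w + q.2) φ z‖ₑ * ‖dP [j] (v + q.2) ψ z‖ₑ)) ?_
    refine Measurable.lintegral_prod_right' (f := fun q : (Ed d × ℝ) × Ed d =>
      hkE (w - q.1.2) (q.1.1 - q.2) *
      (‖dP [j, i, i] (w + q.1.2) φ q.2‖ₑ * ‖dP [j] (v + q.1.2) ψ q.2‖ₑ)) ?_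
    fun_prop
  refine (lintegral_mono fun x => mul_le_mul' (key x) le_rfl).trans ?_
  simp_rw [mul_assoc, Finset.sum_mul]
  rw [lintegral_const_mul' _ _ (by simp), lintegral_finsetSum _ fun j _ => (hm j).fun_mul hη]
  refine mul_le_mul' le_rfl (Finset.sum_le_sum fun j _ => ?_)
  have := lintegral_Pe_family (volume.restrict (Ioo 0 w)) (W := fun _ => 1) measurable_const
    (τ := fun r => w - r) (by fun_prop)
    (F := fun r y => ‖dP [j, i, i] (w + r) φ y‖ₑ * ‖dP [j] (v + r) ψ y‖ₑ)
    (by simp only [Function.uncurry_def]; fun_prop)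
    ((ae_restrict_mem measurableSet_Ioo).mono fun r hr _ => sub_pos.2 hr.2) hη
  simpa only [one_mul] using this

lemma enorm_integral_pair_le (i : Fin d) {w v : ℝ} (hw : 0 < w) (hv : 0 < v) {φ ψ : Ed d → ℂ}
    (hφm : Measurable φ) (hφ : Integrable φ) (hψm : Measurable ψ) (hψ : Integrable ψ)
    {h : Ed d → ℂ} (hm : Measurable h) (hh : Integrable h) :
    ‖∫ x, dP [i, i] (2 * w) φ x * dP [] (v + w) ψ x * h x‖ₑ ≤
    (∫⁻ x, maxFun (fun y => ‖em ψ y‖ₑ) x * (‖dP [i] w φ x‖ₑ * ‖bd [i] (w / rho [i]) h x‖ₑ)) +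
    (∫⁻ x, maxFun (fun y => ‖h y‖ₑ) x * (‖dP [i] w φ x‖ₑ * ‖dP [i] v ψ x‖ₑ)) +
    2 * ∑ j, ∫⁻ x, maxFun (fun y => ‖h y‖ₑ) x * ∫⁻ r in Ioo 0 w,
      ‖dP [j, i, i] (w + r) φ x‖ₑ * ‖dP [j] (v + r) ψ x‖ₑ := by
  have hw' : 0 < w / rho [i] := div_pos hw (rho_pos _)
  have bW : ∀ (l m : List (Fin d)) (a b : ℝ) x, ‖dP l a φ x * dP m b ψ x‖ ≤
      (∫ ξ, ‖sym l ξ * ga a ξ * φ ξ‖) * ∫ ξ, ‖sym m ξ * ga b ξ * ψ ξ‖ := fun l m a b x => by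
    rw [norm_mul]
    exact mul_le_mul (norm_dP_le _ _ _ _) (norm_dP_le _ _ _ _) (norm_nonneg _)
      (integral_nonneg fun _ => norm_nonneg _)
  have mW : ∀ (l m : List (Fin d)) (a b : ℝ), Measurable fun x => dP l a φ x * dP m b ψ x :=
    fun l m a b => by fun_prop
  have int_of : ∀ {G : Ed d → ℂ}, Measurable G → (∃ c, ∀ x, ‖G x‖ ≤ c) →
      Integrable fun x => G x * h x := fun {G} hG ⟨c, hc⟩ =>
    hh.bdd_mul (c := c) hG.aestronglyMeasurable (Eventually.of_forall hc)
  have mcv : ∀ (l m : List (Fin d)), Measurable (cv (hk w) fun x => dP l w φ x * dP m v ψ x) :=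
    fun l m => measurable_cv (continuous_hk w).measurable (mW l m w v)
  have i1 := int_of (measurable_bdT i (w / rho [i]) (mW [i] [] w v))
    (norm_bdT_le i hw' (mW [i] [] w v) (bW [i] [] w v))
  have i2 := int_of (mcv [i] [i]) ⟨_, norm_cv_le (integrable_hk hw) (mW [i] [i] w v) (bW _ _ _ _)⟩
  have i3 := int_of (mcv [i, i] []) ⟨_, norm_cv_le (integrable_hk hw) (mW _ _ w v) (bW _ _ _ _)⟩
  have i4 := int_of (mW [i, i] [] (2 * w) (v + w)) ⟨_, bW _ _ _ _⟩
  have e : ∫ x, dP [i, i] (2 * w) φ x * dP [] (v + w) ψ x * h x =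
      ((∫ x, bdT i (w / rho [i]) (fun y => dP [i] w φ y * dP [] v ψ y) x * h x) -
      ∫ x, cv (hk w) (fun y => dP [i] w φ y * dP [i] v ψ y) x * h x) -
      ∫ x, (cv (hk w) (fun y => dP [i, i] w φ y * dP [] v ψ y) x -
        dP [i, i] (2 * w) φ x * dP [] (v + w) ψ x) * h x := by
    have i5 : Integrable fun x => (cv (hk w) (fun y => dP [i, i] w φ y * dP [] v ψ y) x -
        dP [i, i] (2 * w) φ x * dP [] (v + w) ψ x) * h x := by
      exact (i3.sub i4).congr (Eventually.of_forall fun x => (sub_mul _ _ _).symm)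
    have i6 : Integrable fun x => bdT i (w / rho [i]) (fun y => dP [i] w φ y * dP [] v ψ y) x * h x -
        cv (hk w) (fun y => dP [i] w φ y * dP [i] v ψ y) x * h x := i1.sub i2
    rw [← integral_sub i1 i2, ← integral_sub i6 i5]
    refine integral_congr_ae (Eventually.of_forall fun x => ?_)
    dsimp only
    rw [bdT_dP i hw hv hφ hψ]
    ring
  rw [e]
  refine (enorm_sub_le.trans (add_le_add enorm_sub_le le_rfl)).trans
    (add_le_add (add_le_add ?_ ?_) ?_)
  · rw [integral_bdT_mul i hw' (mW [i] [] w v) (bW _ _ _ _) hh, enorm_neg]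
    refine (enorm_integral_le_lintegral_enorm _).trans (lintegral_mono fun x => ?_)
    rw [enorm_mul, enorm_mul]
    calc _ = ‖dP [] v ψ x‖ₑ * (‖dP [i] w φ x‖ₑ * ‖bd [i] (w / rho [i]) h x‖ₑ) := by ring
      _ ≤ _ := mul_le_mul' (enorm_dP_nil_le hψ hv x) le_rfl
  · refine (enorm_integral_le_lintegral_enorm _).trans ?_
    simp_rw [enorm_mul]
    refine (lintegral_cv_hk_mul_le hw (mW [i] [i] w v) hm.enorm).trans_eq ?_
    simp_rw [enorm_mul]
  · refine (enorm_integral_le_lintegral_enorm _).trans ?_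
    simp_rw [enorm_mul]
    exact lintegral_defect_mul_le i hw hv hφm hφ hψm hψ hm.enorm

lemma measurable_cv_family {α : Type*} [MeasurableSpace α] {K : α → Ed d → ℝ}
    (hK : Measurable (Function.uncurry K)) {F : α → Ed d → ℂ}
    (hF : Measurable (Function.uncurry F)) :
    Measurable fun q : α × Ed d => cv (K q.1) (F q.1) q.2 := by
  unfold cv
  refine (StronglyMeasurable.integral_prod_right
    (f := fun (q : α × Ed d) z => ((K q.1 (q.2 - z) : ℝ) : ℂ) * F q.1 z)
    (Measurable.stronglyMeasurable ?_)).measurable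
  simp only [Function.uncurry_def]
  refine Measurable.mul (Measurable.complex_ofReal ?_) ?_
  · exact hK.comp ((measurable_fst.comp measurable_fst).prodMk
      ((measurable_snd.comp measurable_fst).sub measurable_snd))
  · exact hF.comp ((measurable_fst.comp measurable_fst).prodMk measurable_snd)

lemma measurable_kk_singleton (i : Fin d) :
    Measurable fun q : ℝ × Ed d => kk [i] (tc [i] q.1) q.2 := by
  simp only [kk]
  refine (StronglyMeasurable.integral_prod_right
    (f := fun (q : ℝ × Ed d) z => gk i (tc [i] q.1) (q.2 - z) * hk (tc [i] q.1) z)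
    (Measurable.stronglyMeasurable ?_)).measurable
  simp only [Function.uncurry_def]
  unfold gk tc
  have : Measurable fun z : Ed d => z i := by
    have : Continuous fun z : Ed d => z i := by fun_prop
    exact this.measurable
  have h2 : Measurable fun q : (ℝ × Ed d) × Ed d => (q.1.2 - q.2) i :=
    this.comp (by fun_prop)
  fun_prop

lemma measurable_bd (i : Fin d) {h : Ed d → ℂ} (hm : Measurable h) :
    Measurable fun q : ℝ × Ed d => bd [i] q.1 h q.2 := by
  have h1 : Measurable fun q : ℝ × Ed d => cv (hk q.1) h q.2 :=
    measurable_cv_family (K := fun t => hk t) (F := fun _ => h)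
      (by simp only [Function.uncurry_def]; fun_prop) (hm.comp measurable_snd)
  have h2 : Measurable fun q : ℝ × Ed d => cv (kk [i] (tc [i] q.1)) (cv (hk q.1) h) q.2 :=
    measurable_cv_family (K := fun t => kk [i] (tc [i] t)) (F := fun t => cv (hk t) h)
      (measurable_kk_singleton i) h1
  exact measurable_cv_family (K := fun t => hk (t / 3))
    (F := fun t => cv (kk [i] (tc [i] t)) (cv (hk t) h))
      (by simp only [Function.uncurry_def]; fun_prop) h2

lemma measurable_family_complex {α β γ : Type*} [MeasurableSpace α] [MeasurableSpace β]
    [MeasurableSpace γ] {F : α → β → ℂ} (hF : Measurable fun q : α × β => F q.1 q.2) {a : γ → α}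
    {x : γ → β} (ha : Measurable a) (hx : Measurable x) : Measurable fun c => F (a c) (x c) :=
  hF.comp (ha.prodMk hx)

@[fun_prop]
lemma measurable_bd_comp {γ : Type*} [MeasurableSpace γ] (i : Fin d) {h : Ed d → ℂ}
    (hm : Measurable h) {t : γ → ℝ} {x : γ → Ed d} (ht : Measurable t) (hx : Measurable x) :
    Measurable fun c => bd [i] (t c) h (x c) :=
  measurable_family_complex (F := fun t x => bd [i] t h x) (measurable_bd i hm) ht hx

/-- Rescaled square function associated with `bd [i]`. -/
def sqb (i : Fin d) (h : Ed d → ℂ) (x : Ed d) : ℝ≥0∞ :=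
  (∫⁻ w, (ENNReal.ofReal (w ^ ((1:ℝ) / 2)) * ‖bd [i] (w / rho [i]) h x‖ₑ) ^ 2 ∂mu0) ^ (1 / 2 : ℝ)

lemma measurable_bd_left (i : Fin d) {h : Ed d → ℂ} (hm : Measurable h) (x : Ed d) :
    Measurable fun w : ℝ => ‖bd [i] (w / rho [i]) h x‖ₑ :=
  (measurable_bd_comp i hm (measurable_id.div_const (rho [i])) measurable_const).enorm

lemma measurable_sqb (i : Fin d) {h : Ed d → ℂ} (hm : Measurable h) : Measurable (sqb i h) := by
  unfold sqb
  refine Measurable.pow_const ?_ _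
  refine Measurable.lintegral_prod_right' (f := fun q : Ed d × ℝ =>
    (ENNReal.ofReal (q.2 ^ ((1:ℝ) / 2)) * ‖bd [i] (q.2 / rho [i]) h q.1‖ₑ) ^ 2) ?_
  have : Measurable fun q : Ed d × ℝ => bd [i] (q.2 / rho [i]) h q.1 :=
    measurable_bd_comp i hm (measurable_snd.div_const (rho [i])) measurable_fst
  fun_prop

lemma vw_ne_top (s : ℝ) (a : ℝ × ℝ) : vw s a ≠ ⊤ := by
  unfold vw; split_ifs <;> simp

lemma lintegral_vw_lintegral (s : ℝ) {M : Ed d → ℝ≥0∞} (hM : Measurable M)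
    {G : ℝ × ℝ → Ed d → ℝ≥0∞} (hG : Measurable (Function.uncurry G)) :
    ∫⁻ a, vw s a * ∫⁻ x, M x * G a x = ∫⁻ x, M x * ∫⁻ a, vw s a * G a x := by
  have hGa : ∀ x, Measurable fun a => G a x := fun x => hG.comp measurable_prodMk_right
  rw [lintegral_congr fun a =>
    (lintegral_const_mul' (vw s a) (fun x => M x * G a x) (vw_ne_top s a)).symm,
    lintegral_lintegral_swap]
  · refine lintegral_congr fun x => ?_
    rw [← lintegral_const_mul _ ((measurable_vw s).fun_mul (hGa x))]
    exact lintegral_congr fun a => mul_left_comm _ _ _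
  · have h1 : Measurable fun q : (ℝ × ℝ) × Ed d => G q.1 q.2 := hG
    simp only [Function.uncurry_def]
    fun_prop

lemma lintegral_vw_bd_le {s : ℝ} (hs0 : 0 < s) (i : Fin d) {φ h : Ed d → ℂ} (hφ : Measurable φ)
    (hm : Measurable h) (x : Ed d) :
    ∫⁻ a, vw s a * (‖dP [i] a.1 φ x‖ₑ * ‖bd [i] (a.1 / rho [i]) h x‖ₑ) ≤
      ENNReal.ofReal (2 / s) * (sqf [i] s φ x * sqb i h x) := by
  have hb := measurable_bd_left i hm x
  rw [lintegral_vw_left hs0 (A := fun w => ‖dP [i] w φ x‖ₑ)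
    (B := fun w => ‖bd [i] (w / rho [i]) h x‖ₑ) (by fun_prop) hb]
  refine mul_le_mul' le_rfl ?_
  refine (lintegral_mul_le_sqrt _ (by fun_prop) (by fun_prop)).trans_eq ?_
  rw [sqf_eq, sqb]
  simp [wd]

lemma lintegral_vw_same_le {s : ℝ} (hs0 : 0 < s) (i : Fin d) {φ ψ : Ed d → ℂ} (hφ : Measurable φ)
    (hψ : Measurable ψ) (x : Ed d) :
    ∫⁻ a, vw s a * (‖dP [i] a.1 φ x‖ₑ * ‖dP [i] a.2 ψ x‖ₑ) ≤
      ENNReal.ofReal (1 / ((1 + s) / 2)) * (sqf [i] s φ x * sqf [i] 0 ψ x) := by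
  refine le_of_eq_of_le ?_ (lintegral_vw_pair_le hs0 [i] i hφ hψ x)
  simp

lemma lintegral_vw_triple_le {s : ℝ} (hs0 : 0 < s) (hs1 : s < 1) (i j : Fin d) {φ ψ : Ed d → ℂ}
    (hφ : Measurable φ) (hψ : Measurable ψ) (x : Ed d) :
    ∫⁻ a, vw s a * (∫⁻ r in Ioo 0 a.1,
      ‖dP [j, i, i] (a.1 + r) φ x‖ₑ * ‖dP [j] (a.2 + r) ψ x‖ₑ) ≤
      4 * (ENNReal.ofReal (1 / ((1 + s) / 2)) * (sqf [j, i, i] s φ x * sqf [j] 0 ψ x)) := by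
  refine (lintegral_vw_shift_le hs0 hs1 (A := fun w => ‖dP [j, i, i] w φ x‖ₑ)
    (B := fun w => ‖dP [j] w ψ x‖ₑ) (by fun_prop) (by fun_prop)).trans
    (mul_le_mul' le_rfl ?_)
  refine le_of_eq_of_le ?_ (lintegral_vw_pair_le hs0 [j, i, i] j hφ hψ x)
  norm_num

/-- Trilinear pairing of a heat-flow derivative, a heat flow and a test function. -/
def tri (i : Fin d) (φ ψ h : Ed d → ℂ) (r t : ℝ) : ℂ :=
  ∫ x, dP [i, i] r φ x * dP [] t ψ x * h x

lemma lintegral_vw_tri_le {s : ℝ} (hs0 : 0 < s) (hs1 : s < 1) (i : Fin d) {φ ψ : Ed d → ℂ}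
    (hφm : Measurable φ) (hφ : Integrable φ) (hψm : Measurable ψ) (hψ : Integrable ψ)
    {h : Ed d → ℂ} (hm : Measurable h) (hh : Integrable h) :
    ∫⁻ a, vw s a * ‖tri i φ ψ h (2 * a.1) (a.2 + a.1)‖ₑ ≤
    (∫⁻ x, maxFun (fun y => ‖em ψ y‖ₑ) x *
      (ENNReal.ofReal (2 / s) * (sqf [i] s φ x * sqb i h x))) +
    (∫⁻ x, maxFun (fun y => ‖h y‖ₑ) x *
      (ENNReal.ofReal (1 / ((1 + s) / 2)) * (sqf [i] s φ x * sqf [i] 0 ψ x))) +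
    2 * ∑ j, ∫⁻ x, maxFun (fun y => ‖h y‖ₑ) x *
      (4 * (ENNReal.ofReal (1 / ((1 + s) / 2)) * (sqf [j, i, i] s φ x * sqf [j] 0 ψ x))) := by
  have m1 := measurable_maxFun fun y => ‖em ψ y‖ₑ
  have m2 := measurable_maxFun fun y => ‖h y‖ₑ
  have g1 : Measurable (Function.uncurry fun (a : ℝ × ℝ) x =>
      ‖dP [i] a.1 φ x‖ₑ * ‖bd [i] (a.1 / rho [i]) h x‖ₑ) := by
    have : Measurable fun q : (ℝ × ℝ) × Ed d => bd [i] (q.1.1 / rho [i]) h q.2 :=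
      measurable_bd_comp i hm ((measurable_fst.comp measurable_fst).div_const (rho [i]))
        measurable_snd
    simp only [Function.uncurry_def]
    fun_prop
  have g2 : Measurable (Function.uncurry fun (a : ℝ × ℝ) x =>
      ‖dP [i] a.1 φ x‖ₑ * ‖dP [i] a.2 ψ x‖ₑ) := by
    simp only [Function.uncurry_def]
    fun_prop
  have g3 : ∀ j, Measurable (Function.uncurry fun (a : ℝ × ℝ) x => ∫⁻ r in Ioo 0 a.1,
      ‖dP [j, i, i] (a.1 + r) φ x‖ₑ * ‖dP [j] (a.2 + r) ψ x‖ₑ) := fun j => by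
    simp only [Function.uncurry_def, lintegral_Ioo_eq_Ioi]
    refine Measurable.lintegral_prod_right' (f := fun q : ((ℝ × ℝ) × Ed d) × ℝ =>
      if q.2 < q.1.1.1 then
      ‖dP [j, i, i] (q.1.1.1 + q.2) φ q.1.2‖ₑ * ‖dP [j] (q.1.1.2 + q.2) ψ q.1.2‖ₑ else 0) ?_
    exact Measurable.ite (measurableSet_lt (by fun_prop) (by fun_prop)) (by fun_prop)
      measurable_const
  have M : ∀ {N : Ed d → ℝ≥0∞} {G : ℝ × ℝ → Ed d → ℝ≥0∞}, Measurable N →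
      Measurable (Function.uncurry G) → Measurable fun a => vw s a * ∫⁻ x, N x * G a x :=
    fun {N G} hN hG => (measurable_vw s).mul (Measurable.lintegral_prod_right'
      (f := fun q : (ℝ × ℝ) × Ed d => N q.2 * G q.1 q.2) ((hN.comp measurable_snd).mul hG))
  calc _ ≤ ∫⁻ a, ((vw s a * ∫⁻ x, maxFun (fun y => ‖em ψ y‖ₑ) x *
        (‖dP [i] a.1 φ x‖ₑ * ‖bd [i] (a.1 / rho [i]) h x‖ₑ)) +
        (vw s a * ∫⁻ x, maxFun (fun y => ‖h y‖ₑ) x * (‖dP [i] a.1 φ x‖ₑ * ‖dP [i] a.2 ψ x‖ₑ))) +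
        2 * ∑ j, vw s a * ∫⁻ x, maxFun (fun y => ‖h y‖ₑ) x * ∫⁻ r in Ioo 0 a.1,
          ‖dP [j, i, i] (a.1 + r) φ x‖ₑ * ‖dP [j] (a.2 + r) ψ x‖ₑ := by
        refine lintegral_mono fun a => ?_
        by_cases ha : 0 < a.1 ∧ a.1 < a.2
        · refine (mul_le_mul' le_rfl (enorm_integral_pair_le i ha.1 (ha.1.trans ha.2) hφm hφ hψm hψ
            hm hh)).trans_eq ?_
          rw [mul_add, mul_add, ← Finset.mul_sum]
          ring
        · simp [vw, ha]
    _ ≤ _ := by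
        rw [lintegral_add_left ((M m1 g1).fun_add (M m2 g2)), lintegral_add_left (M m1 g1),
          lintegral_const_mul' _ _ (by simp), lintegral_finsetSum _ fun j _ => M m2 (g3 j),
          lintegral_vw_lintegral s m1 g1, lintegral_vw_lintegral s m2 g2]
        refine add_le_add (add_le_add ?_ ?_) (mul_le_mul' le_rfl (Finset.sum_le_sum fun j _ => ?_))
        · exact lintegral_mono fun x => mul_le_mul' le_rfl (lintegral_vw_bd_le hs0 i hφm hm x)
        · exact lintegral_mono fun x => mul_le_mul' le_rfl (lintegral_vw_same_le hs0 i hφm hψm x)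
        · rw [lintegral_vw_lintegral s m2 (g3 j)]
          exact lintegral_mono fun x =>
            mul_le_mul' le_rfl (lintegral_vw_triple_le hs0 hs1 i j hφm hψm x)

/-- Density of the paraproduct-type term. -/
def jd (s : ℝ) (φ ψ : Ed d → ℂ) (t : ℝ) (x : Ed d) : ℂ :=
  ((t ^ (-(s / 2) - 1) : ℝ) : ℂ) * (em φ x - dP [] t φ x) * dP [] t ψ x

/-- The paraproduct-type term. -/
def jJ (s : ℝ) (φ ψ : Ed d → ℂ) (x : Ed d) : ℂ := ∫ t in Ioi (0:ℝ), jd s φ ψ t x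

lemma measurable_jd_uncurry (s : ℝ) {φ ψ : Ed d → ℂ} (hφm : Measurable φ) (hφ : Integrable φ)
    (hψm : Measurable ψ) : Measurable fun q : ℝ × Ed d => jd s φ ψ q.1 q.2 := by
  have := measurable_em hφ
  unfold jd
  fun_prop

lemma measurable_jJ (s : ℝ) {φ ψ : Ed d → ℂ} (hφm : Measurable φ) (hφ : Integrable φ)
    (hψm : Measurable ψ) : Measurable (jJ s φ ψ) := by
  unfold jJ
  refine (StronglyMeasurable.integral_prod_right (f := fun x t => jd s φ ψ t x)
    (Measurable.stronglyMeasurable ?_)).measurable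
  have := measurable_em hφ
  simp only [Function.uncurry_def, jd]
  fun_prop

lemma norm_dP_nil_le {ψ : Ed d → ℂ} (hψ : Integrable ψ) {t : ℝ} (ht : 0 ≤ t) (x : Ed d) :
    ‖dP [] t ψ x‖ ≤ ∫ ξ, ‖ψ ξ‖ := by
  refine (norm_dP_le _ _ _ _).trans (integral_mono ?_ hψ.norm fun ξ => ?_)
  · simpa using (integrable_ga_mul ht hψ).norm
  · simp only [sym_nil, one_mul, norm_mul]
    exact mul_le_of_le_one_left (norm_nonneg _) (norm_ga_le ht ξ)

lemma norm_jd_le (s : ℝ) {φ ψ : Ed d → ℂ} (hφ : Integrable φ) (hψ : Integrable ψ) {t : ℝ}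
    (ht : 0 ≤ t) (x : Ed d) : ‖jd s φ ψ t x‖ ≤
      (∫ ξ, ‖((t ^ (-(s / 2) - 1) : ℝ) : ℂ) * ((1 - ga t ξ) * φ ξ)‖) * ∫ ξ, ‖ψ ξ‖ := by
  unfold jd
  rw [norm_mul, ← em_heat_gap ht s hφ]
  exact mul_le_mul (norm_em_le _ x) (norm_dP_nil_le hψ ht x) (norm_nonneg _)
    (integral_nonneg fun _ => norm_nonneg _)

lemma norm_jJ_le {s : ℝ} (hs0 : 0 < s) (hs1 : s < 2) {φ ψ : Ed d → ℂ} (hφ : HDens s φ)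
    (hψ : Integrable ψ) : ∃ c : ℝ, ∀ x, ‖jJ s φ ψ x‖ ≤ c := by
  have hD := (integrable_heat_density hs0 hs1 hφ.meas hφ.intS).integral_norm_prod_left
  refine ⟨_, fun x => norm_integral_le_of_norm_le (hD.mul_const (∫ ξ, ‖ψ ξ‖)) ?_⟩
  exact (ae_restrict_mem measurableSet_Ioi).mono fun t ht =>
    norm_jd_le s hφ.int hψ (mem_Ioi.1 ht).le x

lemma integrable_jd_mul {s : ℝ} (hs0 : 0 < s) (hs1 : s < 2) {φ ψ : Ed d → ℂ} (hφ : HDens s φ)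
    (hψm : Measurable ψ) (hψ : Integrable ψ) {h : Ed d → ℂ} (hm : Measurable h)
    (hh : Integrable h) : Integrable (fun q : ℝ × Ed d => jd s φ ψ q.1 q.2 * h q.2)
      ((volume.restrict (Ioi 0)).prod volume) := by
  have hD := (integrable_heat_density hs0 hs1 hφ.meas hφ.intS).integral_norm_prod_left
  refine ((hD.mul_const (∫ ξ, ‖ψ ξ‖)).mul_prod hh.norm).mono'
    ((measurable_jd_uncurry s hφ.meas hφ.int hψm).mul
      (hm.comp measurable_snd)).aestronglyMeasurable ?_
  filter_upwards [Measure.quasiMeasurePreserving_fst.ae (ae_restrict_mem measurableSet_Ioi)]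
    with q hq
  rw [norm_mul]
  exact mul_le_mul_of_nonneg_right (norm_jd_le s hφ.int hψ (mem_Ioi.1 hq).le _) (norm_nonneg _)

lemma norm_dP_diag_le {φ : Ed d → ℂ} (hφ : Mom2 φ) (i : Fin d) {r : ℝ} (hr : 0 ≤ r) (x : Ed d) :
    ‖dP [i, i] r φ x‖ ≤ ∫ ξ, ‖sym [i, i] ξ * φ ξ‖ := by
  refine (norm_dP_le _ _ _ _).trans (integral_mono ?_ (hφ.int2 i).norm fun ξ => ?_)
  · refine (integrable_ga_mul hr (hφ.int2 i)).norm.congr (Eventually.of_forall fun ξ => ?_)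
    simp only [norm_mul]; ring
  · simp only [norm_mul]
    refine mul_le_mul_of_nonneg_right ?_ (norm_nonneg _)
    exact mul_le_of_le_one_right (by positivity) (norm_ga_le hr ξ)

lemma integrable_tri_density {φ ψ : Ed d → ℂ} (hφ : Mom2 φ) (hψm : Measurable ψ)
    (hψ : Integrable ψ) {h : Ed d → ℂ} (hm : Measurable h) (hh : Integrable h) (i : Fin d) {t : ℝ}
    (ht : 0 < t) : Integrable (fun q : ℝ × Ed d => dP [i, i] q.1 φ q.2 * dP [] t ψ q.2 * h q.2)
      ((volume.restrict (Ioo 0 t)).prod volume) := by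
  have hc : Integrable (fun _ : ℝ => (∫ ξ, ‖sym [i, i] ξ * φ ξ‖) * ∫ ξ, ‖ψ ξ‖)
    (volume.restrict (Ioo 0 t)) := integrable_const _
  have := hφ.meas
  refine (hc.mul_prod hh.norm).mono' (Measurable.aestronglyMeasurable (by fun_prop)) ?_
  filter_upwards [Measure.quasiMeasurePreserving_fst.ae (ae_restrict_mem measurableSet_Ioo)]
    with q hq
  rw [norm_mul, norm_mul]
  refine mul_le_mul_of_nonneg_right ?_ (norm_nonneg _)
  exact mul_le_mul (norm_dP_diag_le hφ i hq.1.le _) (norm_dP_nil_le hψ ht.le _) (norm_nonneg _)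
    (integral_nonneg fun _ => norm_nonneg _)

lemma integral_increment_mul {φ ψ : Ed d → ℂ} (hφ : Mom2 φ) (hψm : Measurable ψ)
    (hψ : Integrable ψ) {h : Ed d → ℂ} (hm : Measurable h) (hh : Integrable h) {t : ℝ}
    (ht : 0 < t) : ∫ x, (em φ x - dP [] t φ x) * dP [] t ψ x * h x =
      -∑ i, ∫ r in Ioo 0 t, tri i φ ψ h r t := by
  have hI := integrable_tri_density hφ hψm hψ hm hh (t := t)
  unfold tri
  have e : ∀ i, ∫ r in Ioo 0 t, ∫ x, dP [i, i] r φ x * dP [] t ψ x * h x =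
      ∫ x, ∫ r in Ioo 0 t, dP [i, i] r φ x * dP [] t ψ x * h x := fun i =>
    integral_integral_swap (hI i ht)
  simp_rw [e]
  rw [← integral_finsetSum _ fun i _ => (hI i ht).integral_prod_right, ← integral_neg]
  refine integral_congr_ae (Eventually.of_forall fun x => ?_)
  dsimp only
  rw [heat_increment hφ ht]
  simp_rw [integral_mul_const]
  rw [← Finset.sum_mul, ← Finset.sum_mul]
  ring

lemma measurable_tri (i : Fin d) {φ ψ h : Ed d → ℂ} (hφ : Measurable φ) (hψ : Measurable ψ)
    (hm : Measurable h) : Measurable fun a : ℝ × ℝ => tri i φ ψ h a.1 a.2 := by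
  unfold tri
  refine (StronglyMeasurable.integral_prod_right
    (f := fun (a : ℝ × ℝ) x => dP [i, i] a.1 φ x * dP [] a.2 ψ x * h x)
    (Measurable.stronglyMeasurable ?_)).measurable
  simp only [Function.uncurry_def]
  fun_prop

lemma enorm_integral_jJ_mul_le {s : ℝ} (hs0 : 0 < s) (hs1 : s < 2) {φ ψ : Ed d → ℂ}
    (hφ : HDens s φ) (hφ2 : Mom2 φ) (hψm : Measurable ψ) (hψ : Integrable ψ) {h : Ed d → ℂ}
    (hm : Measurable h) (hh : Integrable h) :
    ‖∫ x, jJ s φ ψ x * h x‖ₑ ≤ ∑ i, ∫⁻ a, vw s a * ‖tri i φ ψ h a.1 a.2‖ₑ := by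
  have e : ∫ x, jJ s φ ψ x * h x = ∫ t in Ioi (0:ℝ), ∫ x, jd s φ ψ t x * h x := by
    rw [integral_integral_swap (integrable_jd_mul hs0 hs1 hφ hψm hψ hm hh)]
    simp_rw [integral_mul_const]
    rfl
  have hT := fun i => measurable_tri i hφ.meas hψm hm
  rw [e]
  refine (enorm_integral_le_lintegral_enorm _).trans ?_
  simp_rw [fun i => lintegral_vw_symm s (hT i).enorm]
  rw [← lintegral_finsetSum]
  · refine setLIntegral_mono_ae' measurableSet_Ioi (Eventually.of_forall fun t ht => ?_)
    have ht : 0 < t := ht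
    have e2 : ∫ x, jd s φ ψ t x * h x = ((t ^ (-(s / 2) - 1) : ℝ) : ℂ) *
        ∫ x, (em φ x - dP [] t φ x) * dP [] t ψ x * h x := by
      rw [← integral_const_mul]
      refine integral_congr_ae (Eventually.of_forall fun x => ?_)
      simp only [jd]; ring
    rw [e2, integral_increment_mul hφ2 hψm hψ hm hh ht, enorm_mul, enorm_neg,
      enorm_complex_ofReal (by positivity)]
    refine (mul_le_mul' le_rfl (enorm_sum_le _ _)).trans ?_
    rw [Finset.mul_sum]
    refine Finset.sum_le_sum fun i _ => ?_
    rw [lintegral_const_mul' _ _ ENNReal.ofReal_ne_top]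
    exact mul_le_mul' le_rfl (enorm_integral_le_lintegral_enorm _)
  · intro i _
    simp only [lintegral_Ioo_eq_Ioi]
    refine Measurable.lintegral_prod_right' (f := fun q : ℝ × ℝ => if q.2 < q.1 then
      ENNReal.ofReal (q.1 ^ (-(s / 2) - 1)) * ‖tri i φ ψ h q.2 q.1‖ₑ else 0) ?_
    have : Measurable fun q : ℝ × ℝ => tri i φ ψ h q.2 q.1 := measurable_family_complex (F := fun r t => tri i φ ψ h r t) (hT i) measurable_snd measurable_fst
    exact Measurable.ite (measurableSet_lt (by fun_prop) (by fun_prop)) (by fun_prop)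
      measurable_const

lemma lintegral_comp_two_mul {g : ℝ → ℝ≥0∞} (hg : Measurable g) :
    ∫⁻ t, g t = 2 * ∫⁻ t, g (2 * t) := by
  rw [← lintegral_map hg (measurable_const_mul 2), Real.map_volume_mul_left two_ne_zero,
    lintegral_smul_measure, smul_eq_mul, ← mul_assoc]
  have : (2:ℝ≥0∞) * ENNReal.ofReal |(2:ℝ)⁻¹| = 1 := by
    rw [show (2:ℝ≥0∞) = ENNReal.ofReal 2 by simp, ← ENNReal.ofReal_mul (by norm_num)]
    norm_num
  rw [this, one_mul]

lemma lintegral_vw_change {s : ℝ} (hs0 : 0 < s) {T : ℝ × ℝ → ℝ≥0∞} (hT : Measurable T) :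
    ∫⁻ a, vw s a * T a ≤ 2 * ∫⁻ a, vw s a * T (2 * a.1, a.2 + a.1) := by
  have m1 : Measurable fun a => vw s a * T a := by fun_prop
  have m2 : Measurable fun a : ℝ × ℝ => vw s a * T (2 * a.1, a.2 + a.1) := by fun_prop
  rw [Measure.volume_eq_prod, lintegral_prod _ m1.aemeasurable, lintegral_prod _ m2.aemeasurable,
    lintegral_comp_two_mul m1.lintegral_prod_right']
  refine mul_le_mul' le_rfl (lintegral_mono fun w => ?_)
  dsimp only
  rw [← lintegral_add_right_eq_self _ w]
  refine lintegral_mono fun v => mul_le_mul' ?_ le_rfl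
  unfold vw
  by_cases h : 0 < w ∧ w < v
  · rw [if_pos h, if_pos ⟨by linarith, by linarith⟩]
    exact ENNReal.ofReal_le_ofReal (Real.rpow_le_rpow_of_nonpos (h.1.trans h.2)
      (by dsimp only; linarith) (by linarith))
  · rw [if_neg]
    · simp
    · rintro ⟨h1, h2⟩
      exact h ⟨by linarith, by linarith⟩

lemma exists_dual_function {J : Ed d → ℂ} (hJ : Measurable J) {c : ℝ} (hJc : ∀ x, ‖J x‖ ≤ c)
    {η : Ed d → ℝ≥0∞} (hη : Measurable η) {b : ℝ≥0∞} (hb : b ≠ ⊤) (hηb : ∀ x, η x ≤ b)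
    (hηi : ∫⁻ x, η x ≠ ⊤) : ∃ h : Ed d → ℂ, Measurable h ∧ Integrable h ∧ (∀ x, ‖h x‖ₑ = η x) ∧
      ∫⁻ x, ‖J x‖ₑ * η x = ‖∫ x, J x * h x‖ₑ := by
  have hηt : ∀ x, η x ≠ ⊤ := fun x => ne_top_of_le_ne_top hb (hηb x)
  set u : Ed d → ℂ := fun x => if J x = 0 then 1 else (starRingEnd ℂ) (J x) / (‖J x‖ : ℂ) with hu
  have hum : Measurable u := by
    refine Measurable.ite (hJ (measurableSet_singleton 0)) measurable_const ?_
    exact (Complex.continuous_conj.measurable.comp hJ).div hJ.norm.complex_ofReal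
  have hun : ∀ x, ‖u x‖ = 1 := fun x => by
    simp only [hu]
    split_ifs with h
    · simp
    · rw [norm_div, RCLike.norm_conj, Complex.norm_real, norm_norm, div_self (norm_ne_zero_iff.2 h)]
  have hJu : ∀ x, J x * u x = (‖J x‖ : ℂ) := fun x => by
    simp only [hu]
    split_ifs with h
    · simp [h]
    · have : (‖J x‖ : ℂ) ≠ 0 := by simpa using h
      rw [mul_div_assoc', Complex.mul_conj, Complex.normSq_eq_norm_sq, div_eq_iff this]
      push_cast; ring
  set h : Ed d → ℂ := fun x => u x * ((η x).toReal : ℂ) with hh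
  have hhm : Measurable h := hum.mul hη.ennreal_toReal.complex_ofReal
  have hhn : ∀ x, ‖h x‖ₑ = η x := fun x => by
    rw [hh]
    dsimp only
    rw [enorm_mul, enorm_complex_ofReal ENNReal.toReal_nonneg, ENNReal.ofReal_toReal (hηt x),
      ← ofReal_norm, hun]
    simp
  have hhi : Integrable h := ⟨hhm.aestronglyMeasurable, by
    rw [HasFiniteIntegral]; simp_rw [hhn]; exact hηi.lt_top⟩
  refine ⟨h, hhm, hhi, hhn, ?_⟩
  have i1 : Integrable fun x => J x * h x :=
    hhi.bdd_mul (c := c) hJ.aestronglyMeasurable (Eventually.of_forall hJc)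
  have e1 : ∀ x, J x * h x = ((‖J x * h x‖ : ℝ) : ℂ) := fun x => by
    have : J x * h x = ((‖J x‖ * (η x).toReal : ℝ) : ℂ) := by
      simp only [hh]; rw [← mul_assoc, hJu]; push_cast; rfl
    rw [this, Complex.norm_real, Real.norm_of_nonneg (by positivity)]
  rw [integral_congr_ae (Eventually.of_forall e1), integral_complex_ofReal,
    enorm_complex_ofReal (integral_nonneg fun _ => norm_nonneg _),
    ofReal_integral_norm_eq_lintegral_enorm i1]
  simp_rw [enorm_mul, hhn]

lemma lintegral_jJ_mul_le {s : ℝ} (hs0 : 0 < s) (hs1 : s < 1) {φ ψ : Ed d → ℂ}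
    (hφ : HDens s φ) (hφ2 : Mom2 φ) (hψm : Measurable ψ) (hψ : Integrable ψ)
    {η : Ed d → ℝ≥0∞} (hη : Measurable η) {b : ℝ≥0∞} (hb : b ≠ ⊤) (hηb : ∀ x, η x ≤ b)
    (hηi : ∫⁻ x, η x ≠ ⊤) : ∃ h : Ed d → ℂ, Measurable h ∧ (∀ x, ‖h x‖ₑ = η x) ∧
      ∫⁻ x, ‖jJ s φ ψ x‖ₑ * η x ≤ ∑ i, 2 *
    ((∫⁻ x, maxFun (fun y => ‖em ψ y‖ₑ) x *
      (ENNReal.ofReal (2 / s) * (sqf [i] s φ x * sqb i h x))) +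
    (∫⁻ x, maxFun η x *
      (ENNReal.ofReal (1 / ((1 + s) / 2)) * (sqf [i] s φ x * sqf [i] 0 ψ x))) +
    2 * ∑ j, ∫⁻ x, maxFun η x *
      (4 * (ENNReal.ofReal (1 / ((1 + s) / 2)) * (sqf [j, i, i] s φ x * sqf [j] 0 ψ x)))) := by
  obtain ⟨c, hc⟩ := norm_jJ_le hs0 (by linarith) hφ hψ
  obtain ⟨h, hm, hi, hn, e⟩ := exists_dual_function (measurable_jJ s hφ.meas hφ.int hψm) hc hη hb
    hηb hηi
  refine ⟨h, hm, hn, ?_⟩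
  rw [e]
  refine (enorm_integral_jJ_mul_le hs0 (by linarith) hφ hφ2 hψm hψ hm hi).trans
    (Finset.sum_le_sum fun i _ => ?_)
  refine (lintegral_vw_change hs0 (measurable_tri i hφ.meas hψm hm).enorm).trans
    (mul_le_mul' le_rfl ?_)
  have := lintegral_vw_tri_le hs0 hs1 i hφ.meas hφ.int hψm hψ hm hi
  simpa only [hn] using this

/-- The `L^p` norm of a nonnegative function. -/
def nL (p : ℝ) (F : Ed d → ℝ≥0∞) : ℝ≥0∞ := (∫⁻ x, F x ^ p) ^ (1 / p)

lemma nL_le_of_lintegral_le {p : ℝ} (hp : 0 < p) {F G : Ed d → ℝ≥0∞} {C : ℝ≥0∞}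
    (h : ∫⁻ x, F x ^ p ≤ C * ∫⁻ x, G x ^ p) : nL p F ≤ C ^ (1 / p) * nL p G := by
  unfold nL
  rw [← ENNReal.mul_rpow_of_nonneg _ _ (by positivity)]
  exact ENNReal.rpow_le_rpow h (by positivity)

lemma nL_mono {p : ℝ} (hp : 0 < p) {F G : Ed d → ℝ≥0∞} (h : ∀ x, F x ≤ G x) :
    nL p F ≤ nL p G :=
  ENNReal.rpow_le_rpow (lintegral_mono fun x => ENNReal.rpow_le_rpow (h x) hp.le) (by positivity)

lemma nL_const_mul {p : ℝ} (hp : 0 < p) {c : ℝ≥0∞} (hc : c ≠ ⊤) (F : Ed d → ℝ≥0∞) :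
    nL p (fun x => c * F x) = c * nL p F := by
  unfold nL
  simp_rw [ENNReal.mul_rpow_of_nonneg _ _ hp.le]
  rw [lintegral_const_mul' _ _ (ENNReal.rpow_ne_top_of_nonneg hp.le hc),
    ENNReal.mul_rpow_of_nonneg _ _ (by positivity), ← ENNReal.rpow_mul, mul_one_div_cancel hp.ne',
    ENNReal.rpow_one]

lemma nL_add_le {p : ℝ} (hp : 1 ≤ p) {F G : Ed d → ℝ≥0∞} (hF : Measurable F)
    (hG : Measurable G) : nL p (fun x => F x + G x) ≤ nL p F + nL p G :=
  ENNReal.lintegral_Lp_add_le hF.aemeasurable hG.aemeasurable hp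

lemma nL_mul_le {p p1 p2 : ℝ} (hp : 0 < p) (hp1 : 0 < p1) (hp2 : 0 < p2)
    (hpe : 1 / p = 1 / p1 + 1 / p2) {F G : Ed d → ℝ≥0∞} (hF : Measurable F)
    (hG : Measurable G) : nL p (fun x => F x * G x) ≤ nL p1 F * nL p2 G := by
  refine ENNReal.lintegral_Lp_mul_le_Lq_mul_Lr hp ?_ hpe volume hF.aemeasurable hG.aemeasurable
  have : 0 < 1 / p2 := by positivity
  exact (one_div_lt_one_div hp1 hp).1 (by linarith)

lemma nL_sum_le {ι : Type*} (S : Finset ι) {p : ℝ} (hp : 1 ≤ p) {F : ι → Ed d → ℝ≥0∞}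
    (hF : ∀ i, Measurable (F i)) : nL p (fun x => ∑ i ∈ S, F i x) ≤ ∑ i ∈ S, nL p (F i) := by
  classical
  have hp0 : 0 < p := by linarith
  induction S using Finset.induction_on with
  | empty => simp [nL, hp0]
  | insert a S ha ih =>
    simp_rw [Finset.sum_insert ha]
    exact (nL_add_le hp (hF a) (Finset.measurable_fun_sum _ fun i _ => hF i)).trans
      (add_le_add le_rfl ih)

lemma lintegral_mul_mul_le {p p1 p2 q : ℝ} (hpq : p.HolderConjugate q) (hp1 : 0 < p1)
    (hp2 : 0 < p2) (hpe : 1 / p = 1 / p1 + 1 / p2) {E F G : Ed d → ℝ≥0∞} (hE : Measurable E)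
    (hF : Measurable F) (hG : Measurable G) :
    ∫⁻ x, E x * (F x * G x) ≤ nL q E * (nL p1 F * nL p2 G) := by
  refine (ENNReal.lintegral_mul_le_Lp_mul_Lq volume hpq.symm hE.aemeasurable
    (hF.mul hG).aemeasurable).trans ?_
  exact mul_le_mul' le_rfl (nL_mul_le hpq.pos hp1 hp2 hpe hF hG)

lemma nL_le_of_duality {p q : ℝ} (hpq : p.HolderConjugate q) {R : Ed d → ℝ≥0∞}
    (hR : Measurable R) {K : ℝ≥0∞} (h : ∀ η : Ed d → ℝ≥0∞, Measurable η →
      (∃ c, c ≠ ⊤ ∧ ∀ x, η x ≤ c) → ∫⁻ x, η x ≠ ⊤ → ∫⁻ x, R x * η x ≤ K * nL q η) :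
    nL p R ≤ K :=
  lintegral_rpow_le_of_duality hR hpq fun η h1 h2 _ h3 => h η h1 h2 h3

lemma nL_maxFun_le (hd : 1 ≤ d) {q : ℝ} (hq : 1 < q) :
    ∃ C : ℝ≥0∞, C ≠ ⊤ ∧ ∀ φ : Ed d → ℝ≥0∞, Measurable φ → nL q (maxFun φ) ≤ C * nL q φ := by
  obtain ⟨C, -, h⟩ := lintegral_maxFun_rpow_le hd hq
  exact ⟨_, ENNReal.rpow_ne_top_of_nonneg (by positivity) ENNReal.ofReal_ne_top,
    fun φ hφ => nL_le_of_lintegral_le (by linarith) (h φ hφ)⟩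

lemma nL_sqf_le (hd : 1 ≤ d) {p : ℝ} (hp : 1 < p) {σ : ℝ} (hσ : 0 ≤ σ) {l : List (Fin d)}
    (hl : σ < l.length) : ∃ C : ℝ≥0∞, C ≠ ⊤ ∧ ∀ φ : Ed d → ℂ, HDens σ φ →
      nL p (sqf l σ φ) ≤ C * nL p fun x => ‖em (fr σ φ) x‖ₑ := by
  obtain ⟨C, hC, h⟩ := lp_sqf hd hp hσ hl
  exact ⟨_, ENNReal.rpow_ne_top_of_nonneg (by positivity) hC,
    fun φ hφ => nL_le_of_lintegral_le (by linarith) (h φ hφ.meas hφ.int hφ.intS)⟩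

lemma nL_sqb_le (hd : 1 ≤ d) {q : ℝ} (hq : 1 < q) (i : Fin d) :
    ∃ C : ℝ≥0∞, C ≠ ⊤ ∧ ∀ h : Ed d → ℂ, Measurable h → (∃ c, ∀ x, ‖h x‖ ≤ c) →
      nL q (sqb i h) ≤ C * nL q fun x => ‖h x‖ₑ := by
  obtain ⟨C, hC, hb⟩ := lp_bd hd hq (l := [i]) (by simp)
  have hr := rho_pos [i]
  have hq0 : 0 < q := by linarith
  set c : ℝ≥0∞ := ENNReal.ofReal (rho [i] ^ ((1:ℝ) / 2)) ^ 2 with hc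
  have hct : c ≠ ⊤ := by finiteness
  refine ⟨(c ^ (q / 2) * C) ^ (1 / q), ENNReal.rpow_ne_top_of_nonneg (by positivity)
    (ENNReal.mul_ne_top (ENNReal.rpow_ne_top_of_nonneg (by positivity) hct) hC),
    fun h hm hh => nL_le_of_lintegral_le hq0 ?_⟩
  rw [mul_assoc]
  refine le_trans ?_ (mul_le_mul' le_rfl (hb h hm hh))
  rw [← lintegral_const_mul' _ _ (ENNReal.rpow_ne_top_of_nonneg (by positivity) hct)]
  refine lintegral_mono fun x => ?_
  dsimp only
  have hbm := measurable_bd_left i hm x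
  have e : ∫⁻ w, (ENNReal.ofReal (w ^ ((1:ℝ) / 2)) * ‖bd [i] (w / rho [i]) h x‖ₑ) ^ 2 ∂mu0 ≤
      c * ∫⁻ t, (ENNReal.ofReal (t ^ ((([i] : List (Fin d)).length : ℝ) / 2)) *
        ‖bd [i] t h x‖ₑ) ^ 2 ∂mu0 := by
    rw [← lintegral_mu0_comp_mul hr (by fun_prop), ← lintegral_const_mul' _ _ hct]
    refine lintegral_mu0_mono fun t ht => le_of_eq ?_
    rw [Real.mul_rpow hr.le ht.le, ENNReal.ofReal_mul (by positivity),
      mul_div_cancel_left₀ _ hr.ne']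
    simp only [List.length_singleton, Nat.cast_one, hc]
    ring
  unfold sqb
  rw [← ENNReal.rpow_mul, ← ENNReal.mul_rpow_of_nonneg _ _ (by positivity)]
  rw [show 1 / 2 * q = q / 2 by ring]
  exact ENNReal.rpow_le_rpow e (by positivity)

/-- The remainder integral built from the heat defect. -/
def dD (s : ℝ) (φ ψ : Ed d → ℂ) (x : Ed d) : ℝ≥0∞ :=
  ∫⁻ t in Ioi (0:ℝ), ENNReal.ofReal (t ^ (-(s / 2) - 1)) * ‖dft φ ψ t x‖ₑ

lemma measurable_dD (s : ℝ) {φ ψ : Ed d → ℂ} (hφ : Mom1 φ) (hψ : Mom1 ψ) :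
    Measurable (dD s φ ψ) := by
  have h : Measurable fun a : Ed d × ℝ => dft φ ψ a.2 a.1 :=
    measurable_family_complex (F := fun t x => dft φ ψ t x)
      (measurable_dft hφ.meas hψ.meas hφ.int hψ.int) measurable_snd measurable_fst
  exact Measurable.lintegral_prod_right' (f := fun a : Ed d × ℝ =>
    ENNReal.ofReal (a.2 ^ (-(s / 2) - 1)) * ‖dft φ ψ a.2 a.1‖ₑ) (by fun_prop)

lemma nL_dD_le (hd : 1 ≤ d) {s s1 s2 p p1 p2 : ℝ} (hs0 : 0 < s) (hs : s = s1 + s2)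
    (hs1 : 0 ≤ s1) (hs1' : s1 < 1) (hs2 : 0 ≤ s2) (hs2' : s2 < 1) (hp : 1 < p) (hp1 : 1 < p1)
    (hp2 : 1 < p2) (hpe : 1 / p = 1 / p1 + 1 / p2) :
    ∃ C : ℝ≥0∞, C ≠ ⊤ ∧ ∀ φ ψ : Ed d → ℂ, Mom1 φ → Mom1 ψ → HDens s1 φ → HDens s2 ψ →
      nL p (dD s φ ψ) ≤
        C * (nL p1 (fun x => ‖em (fr s1 φ) x‖ₑ) * nL p2 fun x => ‖em (fr s2 ψ) x‖ₑ) := by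
  have hpq := Real.HolderConjugate.conjExponent hp
  obtain ⟨M, hM, hMb⟩ := nL_maxFun_le hd hpq.symm.lt
  choose A hA hAb using fun j : Fin d => nL_sqf_le hd hp1 hs1 (l := [j]) (by simpa using hs1')
  choose B hB hBb using fun j : Fin d => nL_sqf_le hd hp2 hs2 (l := [j]) (by simpa using hs2')
  have hc : 2 * ENNReal.ofReal (2 / s) ≠ ⊤ := by finiteness
  refine ⟨∑ j, 2 * ENNReal.ofReal (2 / s) * (M * (A j * B j)), ENNReal.sum_ne_top.2 fun j _ => ?_,
    fun φ ψ hφ hψ hφ1 hψ2 => nL_le_of_duality hpq (measurable_dD s hφ hψ) fun η hη _ _ => ?_⟩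
  · exact ENNReal.mul_ne_top hc (ENNReal.mul_ne_top hM (ENNReal.mul_ne_top (hA j) (hB j)))
  refine (lintegral_dft_le hs0 hs hφ hψ hη).trans ?_
  rw [Finset.sum_mul, Finset.sum_mul]
  refine Finset.sum_le_sum fun j _ => ?_
  rw [lintegral_const_mul' _ _ hc]
  calc _ ≤ 2 * ENNReal.ofReal (2 / s) *
        (nL p.conjExponent (maxFun η) * (nL p1 (sqf [j] s1 φ) * nL p2 (sqf [j] s2 ψ))) :=
        mul_le_mul' le_rfl (lintegral_mul_mul_le hpq (by linarith) (by linarith) hpe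
          (measurable_maxFun η) (measurable_sqf _ _ hφ.meas) (measurable_sqf _ _ hψ.meas))
    _ ≤ 2 * ENNReal.ofReal (2 / s) * ((M * nL p.conjExponent η) *
        ((A j * nL p1 fun x => ‖em (fr s1 φ) x‖ₑ) * (B j * nL p2 fun x => ‖em (fr s2 ψ) x‖ₑ))) :=
        mul_le_mul' le_rfl (mul_le_mul' (hMb η hη) (mul_le_mul' (hAb j φ hφ1) (hBb j ψ hψ2)))
    _ = _ := by ring

lemma fr_zero (ψ : Ed d → ℂ) : fr 0 ψ = ψ := by
  ext ξ; simp [fr]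

lemma nL_jJ_le (hd : 1 ≤ d) {s p p1 p2 : ℝ} (hs0 : 0 < s) (hs1 : s < 1) (hp : 1 < p)
    (hp1 : 1 < p1) (hp2 : 1 < p2) (hpe : 1 / p = 1 / p1 + 1 / p2) :
    ∃ C : ℝ≥0∞, C ≠ ⊤ ∧ ∀ φ ψ : Ed d → ℂ, Mom2 φ → HDens s φ → HDens 0 ψ →
      nL p (fun x => ‖jJ s φ ψ x‖ₑ) ≤
        C * (nL p1 (fun x => ‖em (fr s φ) x‖ₑ) * nL p2 fun x => ‖em (fr 0 ψ) x‖ₑ) := by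
  have hpq := Real.HolderConjugate.conjExponent hp
  obtain ⟨M, hM, hMb⟩ := nL_maxFun_le hd hpq.symm.lt
  obtain ⟨N, hN, hNb⟩ := nL_maxFun_le hd hp2
  choose A hA hAb using fun j : Fin d => nL_sqf_le hd hp1 hs0.le (l := [j]) (by simpa using hs1)
  choose B hB hBb using fun j : Fin d => nL_sqf_le hd hp2 le_rfl (l := [j]) (by simp)
  choose D hD hDb using fun (i j : Fin d) => nL_sqf_le hd hp1 hs0.le (l := [j, i, i])
    (by simp; linarith)
  choose E hE hEb using fun i : Fin d => nL_sqb_le hd hpq.symm.lt i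
  have hc1 : ENNReal.ofReal (2 / s) ≠ ⊤ := ENNReal.ofReal_ne_top
  have hc2 : ENNReal.ofReal (1 / ((1 + s) / 2)) ≠ ⊤ := ENNReal.ofReal_ne_top
  have hp10 : 0 < p1 := by linarith
  have hp20 : 0 < p2 := by linarith
  refine ⟨∑ i, 2 * (ENNReal.ofReal (2 / s) * (N * (A i * E i)) +
    ENNReal.ofReal (1 / ((1 + s) / 2)) * (M * (A i * B i)) +
    2 * ∑ j, 4 * ENNReal.ofReal (1 / ((1 + s) / 2)) * (M * (D i j * B j))),
    ENNReal.sum_ne_top.2 fun i _ => ?_,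
    fun φ ψ hφ hφs hψ => nL_le_of_duality hpq
      (measurable_jJ s hφ.meas hφ.int hψ.meas).enorm fun η hη hb hi => ?_⟩
  · have h1 := hA i
    have h2 := hB i
    have h3 := hE i
    have h4 : ∑ j, 4 * ENNReal.ofReal (1 / ((1 + s) / 2)) * (M * (D i j * B j)) ≠ ⊤ :=
      ENNReal.sum_ne_top.2 fun j _ => by
        have h5 := hD i j
        have h6 := hB j
        finiteness
    finiteness
  obtain ⟨b, hbt, hηb⟩ := hb
  obtain ⟨h, hm, hh, hle⟩ := lintegral_jJ_mul_le hs0 hs1 hφs hφ hψ.meas hψ.int hη hbt hηb hi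
  refine hle.trans ?_
  have hnh : (nL p.conjExponent fun x => ‖h x‖ₑ) = nL p.conjExponent η := by
    simp only [nL, hh]
  have hhb : ∃ c, ∀ x, ‖h x‖ ≤ c := ⟨b.toReal, fun x => by
    have := (hh x).trans_le (hηb x)
    rw [← toReal_enorm]
    exact ENNReal.toReal_mono hbt this⟩
  have hψe : (fun x => ‖em ψ x‖ₑ) = fun x => ‖em (fr 0 ψ) x‖ₑ := by rw [fr_zero]
  have hme := (measurable_em hψ.int).enorm
  rw [Finset.sum_mul, Finset.sum_mul]
  refine Finset.sum_le_sum fun i _ => ?_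
  rw [mul_assoc, mul_assoc]
  refine mul_le_mul' le_rfl ?_
  rw [add_mul, add_mul, mul_assoc 2, Finset.sum_mul]
  refine add_le_add (add_le_add ?_ ?_) (mul_le_mul' le_rfl (Finset.sum_le_sum fun j _ => ?_))
  · calc _ = ENNReal.ofReal (2 / s) *
          ∫⁻ x, sqb i h x * (sqf [i] s φ x * maxFun (fun y => ‖em ψ y‖ₑ) x) := by
          rw [← lintegral_const_mul' _ _ hc1]
          exact lintegral_congr fun x => by ring
      _ ≤ ENNReal.ofReal (2 / s) * (nL p.conjExponent (sqb i h) *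
          (nL p1 (sqf [i] s φ) * nL p2 (maxFun fun y => ‖em ψ y‖ₑ))) :=
          mul_le_mul' le_rfl (lintegral_mul_mul_le hpq hp10 hp20 hpe (measurable_sqb i hm)
            (measurable_sqf _ _ hφ.meas) (measurable_maxFun _))
      _ ≤ ENNReal.ofReal (2 / s) * ((E i * nL p.conjExponent η) *
          ((A i * nL p1 fun x => ‖em (fr s φ) x‖ₑ) *
            (N * nL p2 fun x => ‖em (fr 0 ψ) x‖ₑ))) := by
          refine mul_le_mul' le_rfl (mul_le_mul' (hnh ▸ hEb i h hm hhb)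
            (mul_le_mul' (hAb i φ hφs) ?_))
          rw [← hψe]
          exact hNb _ hme
      _ = _ := by ring
  · calc _ = ENNReal.ofReal (1 / ((1 + s) / 2)) *
          ∫⁻ x, maxFun η x * (sqf [i] s φ x * sqf [i] 0 ψ x) := by
          rw [← lintegral_const_mul' _ _ hc2]
          exact lintegral_congr fun x => by ring
      _ ≤ ENNReal.ofReal (1 / ((1 + s) / 2)) * (nL p.conjExponent (maxFun η) *
          (nL p1 (sqf [i] s φ) * nL p2 (sqf [i] 0 ψ))) :=
          mul_le_mul' le_rfl (lintegral_mul_mul_le hpq hp10 hp20 hpe (measurable_maxFun η)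
            (measurable_sqf _ _ hφ.meas) (measurable_sqf _ _ hψ.meas))
      _ ≤ ENNReal.ofReal (1 / ((1 + s) / 2)) * ((M * nL p.conjExponent η) *
          ((A i * nL p1 fun x => ‖em (fr s φ) x‖ₑ) *
            (B i * nL p2 fun x => ‖em (fr 0 ψ) x‖ₑ))) :=
          mul_le_mul' le_rfl (mul_le_mul' (hMb η hη) (mul_le_mul' (hAb i φ hφs) (hBb i ψ hψ)))
      _ = _ := by ring
  · calc _ = 4 * ENNReal.ofReal (1 / ((1 + s) / 2)) *
          ∫⁻ x, maxFun η x * (sqf [j, i, i] s φ x * sqf [j] 0 ψ x) := by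
          rw [← lintegral_const_mul' _ _ (ENNReal.mul_ne_top (by simp) hc2)]
          exact lintegral_congr fun x => by ring
      _ ≤ 4 * ENNReal.ofReal (1 / ((1 + s) / 2)) * (nL p.conjExponent (maxFun η) *
          (nL p1 (sqf [j, i, i] s φ) * nL p2 (sqf [j] 0 ψ))) :=
          mul_le_mul' le_rfl (lintegral_mul_mul_le hpq hp10 hp20 hpe (measurable_maxFun η)
            (measurable_sqf _ _ hφ.meas) (measurable_sqf _ _ hψ.meas))
      _ ≤ 4 * ENNReal.ofReal (1 / ((1 + s) / 2)) * ((M * nL p.conjExponent η) *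
          ((D i j * nL p1 fun x => ‖em (fr s φ) x‖ₑ) *
            (B j * nL p2 fun x => ‖em (fr 0 ψ) x‖ₑ))) :=
          mul_le_mul' le_rfl (mul_le_mul' (hMb η hη) (mul_le_mul' (hDb i j φ hφs) (hBb j ψ hψ)))
      _ = _ := by ring

lemma integrable_jd {s : ℝ} (hs0 : 0 < s) (hs1 : s < 2) {φ ψ : Ed d → ℂ} (hφ : HDens s φ)
    (hψm : Measurable ψ) (hψ : Integrable ψ) (x : Ed d) :
    IntegrableOn (fun t => jd s φ ψ t x) (Ioi 0) := by
  have hD := (integrable_heat_density hs0 hs1 hφ.meas hφ.intS).integral_norm_prod_left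
  have hm : Measurable fun t : ℝ => jd s φ ψ t x :=
    measurable_family_complex (F := fun t x => jd s φ ψ t x)
      (measurable_jd_uncurry s hφ.meas hφ.int hψm) measurable_id measurable_const
  refine (hD.mul_const (∫ ξ, ‖ψ ξ‖)).mono' hm.aestronglyMeasurable ?_
  exact (ae_restrict_mem measurableSet_Ioi).mono fun t ht =>
    norm_jd_le s hφ.int hψ (mem_Ioi.1 ht).le x

lemma enorm_ofReal_mul_integral_le {s : ℝ} (F : ℝ → ℂ) :
    ‖∫ t in Ioi (0:ℝ), ((t ^ (-(s / 2) - 1) : ℝ) : ℂ) * F t‖ₑ ≤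
      ∫⁻ t in Ioi (0:ℝ), ENNReal.ofReal (t ^ (-(s / 2) - 1)) * ‖F t‖ₑ := by
  refine (enorm_integral_le_lintegral_enorm _).trans
    (setLIntegral_mono_ae' measurableSet_Ioi (Eventually.of_forall fun t ht => le_of_eq ?_))
  rw [enorm_mul, enorm_complex_ofReal (Real.rpow_nonneg (mem_Ioi.1 ht).le _)]

lemma enorm_leib_le {s s1 s2 : ℝ} (hs0 : 0 < s) (hs : s < 2) (hs1 : 0 < s1) (hs2 : 0 < s2)
    (hsum : s = s1 + s2) {φ ψ χ : Ed d → ℂ} (hφ : HDens s φ) (hψ : HDens s ψ) (hχ : HDens s χ)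
    (hφ2 : Mom2 φ) (hψ2 : Mom2 ψ) (h : ∀ x, em χ x = em φ x * em ψ x) (x : Ed d) :
    ENNReal.ofReal (kap s) * ‖leib s φ ψ χ x‖ₑ ≤ dD s φ ψ x +
      ∑ i, ∑ k, (ENNReal.ofReal (1 / (s1 / 2)) * ENNReal.ofReal (1 / (s2 / 2))) *
        (sqf [i, i] s1 φ x * sqf [k, k] s2 ψ x) := by
  have e := (leib_eq hs0 hs hφ hψ hχ h x).2
  rw [← enorm_complex_ofReal (kap_pos hs0 hs).le, ← enorm_mul, ← enorm_neg, ← e]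
  refine (enorm_ofReal_mul_integral_le _).trans ?_
  refine le_trans ?_ (add_le_add le_rfl (lintegral_increment_product_le hs1 hs2 hsum hφ2 hψ2 x))
  have hm : Measurable fun t : ℝ => dft φ ψ t x :=
    measurable_family_complex (F := fun t x => dft φ ψ t x)
      (measurable_dft hφ.meas hψ.meas hφ.int hψ.int) measurable_id measurable_const
  unfold dD
  rw [← lintegral_add_left (by fun_prop)]
  refine lintegral_mono fun t => ?_
  dsimp only
  rw [← mul_add]
  exact mul_le_mul' le_rfl (enorm_add_le _ _)

lemma enorm_leib_le_endpoint {s : ℝ} (hs0 : 0 < s) (hs : s < 2) {φ ψ χ : Ed d → ℂ}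
    (hφ : HDens s φ) (hψ : HDens s ψ) (hχ : HDens s χ)
    (h : ∀ x, em χ x = em φ x * em ψ x) (x : Ed d) :
    ENNReal.ofReal (kap s) * ‖leib s φ ψ χ x‖ₑ ≤ dD s φ ψ x + (‖jJ s φ ψ x‖ₑ +
      ENNReal.ofReal (kap s) * (‖em (fr s φ) x‖ₑ * ‖em ψ x‖ₑ)) := by
  obtain ⟨hi, e⟩ := leib_eq hs0 hs hφ hψ hχ h x
  have i2 : IntegrableOn (fun t : ℝ => ((t ^ (-(s / 2) - 1) : ℝ) : ℂ) *
      (em φ x - dP [] t φ x) * em ψ x) (Ioi 0) :=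
    (integrable_heat hs0 hs hφ.meas hφ.int hφ.intS x).mul_const (em ψ x)
  have i3 := integrable_jd hs0 hs hφ hψ.meas hψ.int x
  have e2 : ∫ t in Ioi (0:ℝ), ((t ^ (-(s / 2) - 1) : ℝ) : ℂ) * dft φ ψ t x =
      -(kap s * leib s φ ψ χ x) - kap s * em (fr s φ) x * em ψ x + jJ s φ ψ x := by
    rw [← e, ← heat_representation hs0 hs hφ.meas hφ.int hφ.intS x, jJ, ← integral_mul_const]
    rw [← integral_sub hi i2]
    have i4 : IntegrableOn (fun t : ℝ => ((t ^ (-(s / 2) - 1) : ℝ) : ℂ) *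
        (dft φ ψ t x + (em φ x - dP [] t φ x) * (em ψ x - dP [] t ψ x)) -
        ((t ^ (-(s / 2) - 1) : ℝ) : ℂ) * (em φ x - dP [] t φ x) * em ψ x) (Ioi 0) := hi.sub i2
    rw [← integral_add i4 i3]
    refine integral_congr_ae (Eventually.of_forall fun t => ?_)
    simp only [jd]
    ring
  have e3 : (kap s : ℂ) * leib s φ ψ χ x =
      -(∫ t in Ioi (0:ℝ), ((t ^ (-(s / 2) - 1) : ℝ) : ℂ) * dft φ ψ t x) +
        (jJ s φ ψ x + -(kap s * (em (fr s φ) x * em ψ x))) := by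
    rw [e2]; ring
  rw [← enorm_complex_ofReal (kap_pos hs0 hs).le, ← enorm_mul, e3]
  refine (enorm_add_le _ _).trans (add_le_add ?_ ((enorm_add_le _ _).trans (add_le_add le_rfl ?_)))
  · rw [enorm_neg]
    exact enorm_ofReal_mul_integral_le _
  · rw [enorm_neg, enorm_mul, enorm_mul]

lemma le_inv_mul_of_mul_le {k a b : ℝ≥0∞} (hk : k ≠ 0) (hk' : k ≠ ⊤) (h : k * a ≤ b) :
    a ≤ k⁻¹ * b :=
  calc a = k⁻¹ * (k * a) := by rw [← mul_assoc, ENNReal.inv_mul_cancel hk hk', one_mul]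
    _ ≤ k⁻¹ * b := mul_le_mul' le_rfl h

lemma nL_leib_le_of_pos (hd : 1 ≤ d) {s s1 s2 p p1 p2 : ℝ} (hs1 : s < 1) (hs : s = s1 + s2)
    (hs10 : 0 < s1) (hs20 : 0 < s2) (hp : 1 < p) (hp1 : 1 < p1) (hp2 : 1 < p2)
    (hpe : 1 / p = 1 / p1 + 1 / p2) :
    ∃ C : ℝ≥0∞, C ≠ ⊤ ∧ ∀ φ ψ χ : Ed d → ℂ, Mom2 φ → Mom2 ψ → (∀ σ, 0 ≤ σ → HDens σ φ) →
      (∀ σ, 0 ≤ σ → HDens σ ψ) → HDens s χ → (∀ x, em χ x = em φ x * em ψ x) →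
      nL p (fun x => ‖leib s φ ψ χ x‖ₑ) ≤
        C * (nL p1 (fun x => ‖em (fr s1 φ) x‖ₑ) * nL p2 fun x => ‖em (fr s2 ψ) x‖ₑ) := by
  have hs0 : 0 < s := by linarith
  have hp0 : 0 < p := by linarith
  obtain ⟨K, hK, hKb⟩ := nL_dD_le hd hs0 hs hs10.le (by linarith) hs20.le (by linarith) hp hp1
    hp2 hpe
  choose A hA hAb using fun j : Fin d => nL_sqf_le hd hp1 hs10.le (l := [j, j])
    (by simp; linarith)
  choose B hB hBb using fun j : Fin d => nL_sqf_le hd hp2 hs20.le (l := [j, j])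
    (by simp; linarith)
  have hk : ENNReal.ofReal (kap s) ≠ 0 := by
    simpa using kap_pos hs0 (by linarith)
  have hc : ENNReal.ofReal (1 / (s1 / 2)) * ENNReal.ofReal (1 / (s2 / 2)) ≠ ⊤ := by finiteness
  refine ⟨(ENNReal.ofReal (kap s))⁻¹ * (K + ∑ i, ∑ k, ENNReal.ofReal (1 / (s1 / 2)) *
    ENNReal.ofReal (1 / (s2 / 2)) * (A i * B k)), ?_, fun φ ψ χ hφ2 hψ2 hφ hψ hχ h => ?_⟩
  · refine ENNReal.mul_ne_top (ENNReal.inv_ne_top.2 hk) (ENNReal.add_ne_top.2 ⟨hK,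
      ENNReal.sum_ne_top.2 fun i _ => ENNReal.sum_ne_top.2 fun k _ =>
      ENNReal.mul_ne_top hc (ENNReal.mul_ne_top (hA i) (hB k))⟩)
  rw [mul_assoc]
  refine le_inv_mul_of_mul_le hk ENNReal.ofReal_ne_top ?_
  rw [← nL_const_mul hp0 ENNReal.ofReal_ne_top]
  refine (nL_mono hp0 (enorm_leib_le hs0 (by linarith) hs10 hs20 hs (hφ s hs0.le) (hψ s hs0.le)
    hχ hφ2 hψ2 h)).trans ?_
  have hm : ∀ i k : Fin d, Measurable fun x => ENNReal.ofReal (1 / (s1 / 2)) *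
      ENNReal.ofReal (1 / (s2 / 2)) * (sqf [i, i] s1 φ x * sqf [k, k] s2 ψ x) := fun i k =>
    ((measurable_sqf _ _ hφ2.meas).mul (measurable_sqf _ _ hψ2.meas)).const_mul _
  refine (nL_add_le hp.le (measurable_dD s hφ2.toMom1 hψ2.toMom1)
    (Finset.measurable_fun_sum _ fun i _ => Finset.measurable_fun_sum _ fun k _ => hm i k)).trans ?_
  rw [add_mul, Finset.sum_mul]
  refine add_le_add (hKb φ ψ hφ2.toMom1 hψ2.toMom1 (hφ s1 hs10.le) (hψ s2 hs20.le)) ?_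
  refine (nL_sum_le _ hp.le fun i => Finset.measurable_fun_sum _ fun k _ => hm i k).trans
    (Finset.sum_le_sum fun i _ => ?_)
  rw [Finset.sum_mul]
  refine (nL_sum_le _ hp.le fun k => hm i k).trans (Finset.sum_le_sum fun k _ => ?_)
  rw [nL_const_mul hp0 hc, mul_assoc _ (A i * B k)]
  refine mul_le_mul' le_rfl ?_
  refine (nL_mul_le hp0 (by linarith) (by linarith) hpe (measurable_sqf _ _ hφ2.meas)
    (measurable_sqf _ _ hψ2.meas)).trans ?_
  refine (mul_le_mul' (hAb i φ (hφ s1 hs10.le)) (hBb k ψ (hψ s2 hs20.le))).trans (le_of_eq ?_)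
  ring

lemma nL_leib_le_endpoint (hd : 1 ≤ d) {s p p1 p2 : ℝ} (hs0 : 0 < s) (hs1 : s < 1)
    (hp : 1 < p) (hp1 : 1 < p1) (hp2 : 1 < p2) (hpe : 1 / p = 1 / p1 + 1 / p2) :
    ∃ C : ℝ≥0∞, C ≠ ⊤ ∧ ∀ φ ψ χ : Ed d → ℂ, Mom2 φ → Mom2 ψ → (∀ σ, 0 ≤ σ → HDens σ φ) →
      (∀ σ, 0 ≤ σ → HDens σ ψ) → HDens s χ → (∀ x, em χ x = em φ x * em ψ x) →
      nL p (fun x => ‖leib s φ ψ χ x‖ₑ) ≤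
        C * (nL p1 (fun x => ‖em (fr s φ) x‖ₑ) * nL p2 fun x => ‖em (fr 0 ψ) x‖ₑ) := by
  have hp0 : 0 < p := by linarith
  obtain ⟨K, hK, hKb⟩ := nL_dD_le hd hs0 (add_zero s).symm hs0.le hs1 le_rfl one_pos hp hp1
    hp2 hpe
  obtain ⟨J, hJ, hJb⟩ := nL_jJ_le hd hs0 hs1 hp hp1 hp2 hpe
  have hk : ENNReal.ofReal (kap s) ≠ 0 := by
    simpa using kap_pos hs0 (by linarith)
  refine ⟨(ENNReal.ofReal (kap s))⁻¹ * (K + (J + ENNReal.ofReal (kap s))), ?_,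
    fun φ ψ χ hφ2 hψ2 hφ hψ hχ h => ?_⟩
  · exact ENNReal.mul_ne_top (ENNReal.inv_ne_top.2 hk) (by finiteness)
  have hm1 := (measurable_em (hφ s hs0.le).intS).enorm
  have hm2 := (measurable_em hψ2.int).enorm
  have hm3 := (measurable_jJ s hφ2.meas hφ2.int hψ2.meas).enorm
  have hm4 := (hm1.mul hm2).const_mul (ENNReal.ofReal (kap s))
  rw [mul_assoc]
  refine le_inv_mul_of_mul_le hk ENNReal.ofReal_ne_top ?_
  rw [← nL_const_mul hp0 ENNReal.ofReal_ne_top]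
  refine (nL_mono hp0 (enorm_leib_le_endpoint hs0 (by linarith) (hφ s hs0.le) (hψ s hs0.le)
    hχ h)).trans ?_
  refine (nL_add_le hp.le (measurable_dD s hφ2.toMom1 hψ2.toMom1) (hm3.add hm4)).trans ?_
  rw [add_mul, add_mul]
  refine add_le_add (hKb φ ψ hφ2.toMom1 hψ2.toMom1 (hφ s hs0.le) (hψ 0 le_rfl))
    ((nL_add_le hp.le hm3 hm4).trans
      (add_le_add (hJb φ ψ hφ2 (hφ s hs0.le) (hψ 0 le_rfl)) ?_))
  rw [nL_const_mul hp0 ENNReal.ofReal_ne_top, fr_zero]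
  exact mul_le_mul' le_rfl (nL_mul_le hp0 (by linarith) (by linarith) hpe hm1 hm2)

lemma leib_comm (s : ℝ) (φ ψ χ : Ed d → ℂ) (x : Ed d) : leib s φ ψ χ x = leib s ψ φ χ x := by
  unfold leib; ring

/-- The fractional Leibniz estimate for functions given by their Fourier densities. -/
lemma nL_leib_le (hd : 1 ≤ d) {s s1 s2 p p1 p2 : ℝ} (hs0 : 0 < s) (hs1 : s < 1)
    (hs : s = s1 + s2) (hs10 : 0 ≤ s1) (hs20 : 0 ≤ s2) (hp : 1 < p) (hp1 : 1 < p1) (hp2 : 1 < p2)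
    (hpe : 1 / p = 1 / p1 + 1 / p2) :
    ∃ C : ℝ≥0∞, C ≠ ⊤ ∧ ∀ φ ψ χ : Ed d → ℂ, Mom2 φ → Mom2 ψ → (∀ σ, 0 ≤ σ → HDens σ φ) →
      (∀ σ, 0 ≤ σ → HDens σ ψ) → HDens s χ → (∀ x, em χ x = em φ x * em ψ x) →
      nL p (fun x => ‖leib s φ ψ χ x‖ₑ) ≤
        C * (nL p1 (fun x => ‖em (fr s1 φ) x‖ₑ) * nL p2 fun x => ‖em (fr s2 ψ) x‖ₑ) := by
  rcases hs10.eq_or_lt with rfl | h1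
  · rw [zero_add] at hs
    subst hs
    obtain ⟨C, hC, h⟩ := nL_leib_le_endpoint hd hs0 hs1 hp hp2 hp1 (by rw [hpe, add_comm])
    refine ⟨C, hC, fun φ ψ χ hφ2 hψ2 hφ hψ hχ he => ?_⟩
    simp_rw [leib_comm s φ ψ χ]
    rw [mul_comm (nL p1 _)]
    exact h ψ φ χ hψ2 hφ2 hψ hφ hχ fun x => by rw [he, mul_comm]
  rcases hs20.eq_or_lt with rfl | h2
  · rw [add_zero] at hs
    subst hs
    exact nL_leib_le_endpoint hd hs0 hs1 hp hp1 hp2 hpe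
  exact nL_leib_le_of_pos hd hs1 hs h1 h2 hp hp1 hp2 hpe

open scoped FourierTransform SchwartzMap

lemma integrable_schwartz_of_norm_le (u : 𝓢(Ed d, ℂ)) {F : Ed d → ℂ} (hF : Measurable F) (k : ℕ)
    (h : ∀ ξ, ‖F ξ‖ ≤ ‖u ξ‖ + ‖ξ‖ ^ k * ‖u ξ‖) : Integrable F :=
  (u.integrable.norm.add (u.integrable_pow_mul volume k)).mono' hF.aestronglyMeasurable
    (Eventually.of_forall h)

lemma norm_sym_le (l : List (Fin d)) (ξ : Ed d) : ‖sym l ξ‖ ≤ ‖ξ‖ ^ l.length := by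
  induction l with
  | nil => simp
  | cons i l ih =>
    refine (norm_sym_cons_le i l ξ).trans ?_
    rw [List.length_cons, pow_succ']
    exact mul_le_mul_of_nonneg_left ih (norm_nonneg _)

lemma integrable_sym_mul_schwartz (u : 𝓢(Ed d, ℂ)) (l : List (Fin d)) :
    Integrable fun ξ => sym l ξ * u ξ := by
  have := u.continuous.measurable
  refine integrable_schwartz_of_norm_le u (by fun_prop) l.length fun ξ => ?_
  rw [norm_mul]
  exact (mul_le_mul_of_nonneg_right (norm_sym_le l ξ) (norm_nonneg _)).trans
    (le_add_of_nonneg_left (norm_nonneg _))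

lemma mom2_schwartz (u : 𝓢(Ed d, ℂ)) : Mom2 (u : Ed d → ℂ) where
  meas := u.continuous.measurable
  int := u.integrable
  int1 j := integrable_sym_mul_schwartz u [j]
  int2 i := integrable_sym_mul_schwartz u [i, i]

lemma hDens_schwartz (u : 𝓢(Ed d, ℂ)) {σ : ℝ} (hσ : 0 ≤ σ) : HDens σ (u : Ed d → ℂ) where
  meas := u.continuous.measurable
  int := u.integrable
  intS := by
    refine integrable_schwartz_of_norm_le u (measurable_fr σ u.continuous.measurable) ⌈σ⌉₊
      fun ξ => ?_
    rw [fr, norm_mul, norm_real, Real.norm_of_nonneg (by positivity), ← one_add_mul]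
    refine mul_le_mul_of_nonneg_right ?_ (norm_nonneg _)
    rcases le_total ‖ξ‖ 1 with h | h
    · have := Real.rpow_le_one (norm_nonneg ξ) h hσ
      have : 0 ≤ ‖ξ‖ ^ ⌈σ⌉₊ := by positivity
      linarith
    · have := Real.rpow_le_rpow_of_exponent_le h (Nat.le_ceil σ)
      rw [Real.rpow_natCast] at this
      linarith

/-- The normalized Fourier density of a Schwartz function. -/
def fDens (f : 𝓢(Ed d, ℂ)) : 𝓢(Ed d, ℂ) :=
  (((2 * Real.pi) ^ (-(d : ℝ)) : ℝ) : ℂ) •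
    SchwartzMap.compCLMOfContinuousLinearEquiv ℂ (ContinuousLinearEquiv.smulLeft
      (Units.mk0 (2 * Real.pi)⁻¹ (by positivity))) (𝓕 f)

lemma fDens_apply_fourier (f : 𝓢(Ed d, ℂ)) (ξ : Ed d) : fDens f ξ =
    (((2 * Real.pi) ^ (-(d : ℝ)) : ℝ) : ℂ) * 𝓕 (f : Ed d → ℂ) ((2 * Real.pi)⁻¹ • ξ) := rfl

lemma FT_eq_fourier (f : Ed d → ℂ) (ξ : Ed d) : FT f ξ = 𝓕 f ((2 * Real.pi)⁻¹ • ξ) := by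
  rw [Real.fourier_eq', FT]
  refine integral_congr_ae (Eventually.of_forall fun x => ?_)
  simp only [smul_eq_mul, inner_smul_right]
  congr 2
  have : (Real.pi : ℂ) ≠ 0 := by exact_mod_cast Real.pi_ne_zero
  push_cast
  field_simp

lemma fDens_apply (f : 𝓢(Ed d, ℂ)) (ξ : Ed d) :
    fDens f ξ = (((2 * Real.pi) ^ (-(d : ℝ)) : ℝ) : ℂ) * FT f ξ := by
  rw [fDens_apply_fourier, FT_eq_fourier]

lemma em_fDens (f : 𝓢(Ed d, ℂ)) (x : Ed d) : em (fDens f) x = f x := by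
  have hinv : 𝓕⁻ (𝓕 f) = f := FourierTransform.fourierInv_fourier_eq f
  have h2 : 𝓕⁻ (𝓕 (f : Ed d → ℂ)) x = f x := by
    rw [← SchwartzMap.fourier_coe, ← SchwartzMap.fourierInv_coe, hinv]
  rw [← h2, Real.fourierInv_eq', em]
  have e := Measure.integral_comp_inv_smul_of_nonneg (volume : Measure (Ed d))
    (fun v : Ed d => cexp (↑(2 * Real.pi * ⟪v, x⟫) * I) • 𝓕 (f : Ed d → ℂ) v)
    (R := 2 * Real.pi) (by positivity)
  have hpi : 0 < 2 * Real.pi := by positivity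
  have hpc : (Real.pi : ℂ) ≠ 0 := by exact_mod_cast Real.pi_ne_zero
  have e2 : ∀ ξ : Ed d, ch x ξ * fDens f ξ = (((2 * Real.pi) ^ (-(d : ℝ)) : ℝ) : ℂ) *
      (cexp (↑(2 * Real.pi * ⟪(2 * Real.pi)⁻¹ • ξ, x⟫) * I) •
        𝓕 (f : Ed d → ℂ) ((2 * Real.pi)⁻¹ • ξ)) := fun ξ => by
    rw [fDens_apply_fourier, ch, inner_smul_left, real_inner_comm x ξ, smul_eq_mul]
    have : I * ((⟪x, ξ⟫ : ℝ) : ℂ) =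
        ((2 * Real.pi * ((starRingEnd ℝ) (2 * Real.pi)⁻¹ * ⟪x, ξ⟫) : ℝ) : ℂ) * I := by
      simp only [conj_trivial]
      push_cast
      field_simp
    rw [this]
    ring
  simp_rw [e2]
  rw [integral_const_mul, e, finrank_euclideanSpace_fin, Real.rpow_neg hpi.le,
    Real.rpow_natCast, real_smul, ← mul_assoc, ← ofReal_mul,
    inv_mul_cancel₀ (pow_ne_zero _ hpi.ne'), ofReal_one, one_mul]

lemma fracD_eq_em (σ : ℝ) (f : 𝓢(Ed d, ℂ)) (x : Ed d) :
    fracD σ f x = em (fr σ (fDens f)) x := by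
  rw [fracD, FTinv, em, ← integral_const_mul]
  refine integral_congr_ae (Eventually.of_forall fun ξ => ?_)
  simp only [fr, fDens_apply, ch]
  ring

/-- The product of two Schwartz functions. -/
def schwartzMul (f g : 𝓢(Ed d, ℂ)) : 𝓢(Ed d, ℂ) :=
  SchwartzMap.bilinLeftCLM (ContinuousLinearMap.mul ℂ ℂ) g.hasTemperateGrowth f

lemma schwartzMul_apply (f g : 𝓢(Ed d, ℂ)) (x : Ed d) : schwartzMul f g x = f x * g x := rfl

lemma eLpNorm_eq_nL {p : ℝ} (hp : 0 < p) (F : Ed d → ℂ) :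
    eLpNorm F (ENNReal.ofReal p) volume = nL p fun x => ‖F x‖ₑ := by
  rw [eLpNorm_eq_lintegral_rpow_enorm_toReal (by simpa using hp) ENNReal.ofReal_ne_top,
    ENNReal.toReal_ofReal hp.le, nL]

lemma leib_fDens (s : ℝ) (f g : 𝓢(Ed d, ℂ)) (x : Ed d) :
    fracD s (fun y => f y * g y) x - f x * fracD s g x - g x * fracD s f x =
      leib s (fDens f) (fDens g) (fDens (schwartzMul f g)) x := by
  have h : (fun y => f y * g y) = (schwartzMul f g : Ed d → ℂ) := rfl
  rw [h, fracD_eq_em, fracD_eq_em, fracD_eq_em, leib, em_fDens, em_fDens]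

end KatoPonce

theorem stmt1 (d : ℕ) (hd : 1 ≤ d) (s s1 s2 : ℝ) (hs0 : 0 < s) (hs1 : s < 1)
    (hs10 : 0 ≤ s1) (hs1s : s1 ≤ s) (hs20 : 0 ≤ s2) (hs2s : s2 ≤ s) (hsum : s = s1 + s2)
    (p p1 p2 : ℝ) (hp : 1 < p) (hp1 : 1 < p1) (hp2 : 1 < p2)
    (hpe : 1 / p = 1 / p1 + 1 / p2) :
    ∃ C : ℝ, 0 < C ∧ ∀ f g : SchwartzMap (Ed d) ℂ,
      eLpNorm (fun x : Ed d =>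
          fracD s (fun y => f y * g y) x - f x * fracD s (⇑g) x - g x * fracD s (⇑f) x)
        (ENNReal.ofReal p) volume
      ≤ ENNReal.ofReal C * eLpNorm (fracD s1 (⇑f)) (ENNReal.ofReal p1) volume
          * eLpNorm (fracD s2 (⇑g)) (ENNReal.ofReal p2) volume := by
  obtain ⟨K, hK, h⟩ := KatoPonce.nL_leib_le hd hs0 hs1 hsum hs10 hs20 hp hp1 hp2 hpe
  refine ⟨K.toReal + 1, by positivity, fun f g => ?_⟩
  simp_rw [KatoPonce.leib_fDens]
  rw [KatoPonce.eLpNorm_eq_nL (by linarith), KatoPonce.eLpNorm_eq_nL (by linarith),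
    KatoPonce.eLpNorm_eq_nL (by linarith), mul_assoc]
  simp_rw [KatoPonce.fracD_eq_em]
  refine (h _ _ _ (KatoPonce.mom2_schwartz _) (KatoPonce.mom2_schwartz _)
    (fun σ hσ => KatoPonce.hDens_schwartz _ hσ) (fun σ hσ => KatoPonce.hDens_schwartz _ hσ)
    (KatoPonce.hDens_schwartz _ hs0.le) fun x => ?_).trans (mul_le_mul' ?_ le_rfl)
  · simp_rw [KatoPonce.em_fDens, KatoPonce.schwartzMul_apply]
  · rw [← ENNReal.ofReal_toReal hK]
    exact ENNReal.ofReal_le_ofReal (by simp)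

end
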